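/- Let π ∈ ℤ[ρ] be a primary prime with p = π·π̄. Then there exists a rational integer a_π such that the coefficient α_π of the elliptic Gauss sum satisfies: α_π = χ_π(3)·a_π with a_π ≡ 1 (mod 3) if p ≡ 7 (mod 18); α_π = χ̄_π(3)·a_π with a_π ≡ −1 (mod 3) if p ≡ 13 (mod 18); and α_π = χ_π(3)·a_π·√−3 if p ≡ 1 (mod 18). -/

import Mathlib

open Complex BigOperators

noncomputable section

/-- `ρ = e^{2πi/3}`, a primitive cube root of unity. -/
def ρ3 : ℂ := Complex.exp (2 * Real.pi * Complex.I / 3)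

/-- The ring of Eisenstein integers `ℤ[ρ]`, realized as a subring of `ℂ`. -/
def O3 : Subring ℂ := Subring.closure {ρ3}

/-- `√−3 = i·√3`. -/
def sqrtm3 : ℂ := Complex.I * (Real.sqrt 3 : ℝ)

/-- The congruence `a ≡ b (mod c)` in `ℤ[ρ]`. -/
def ECong (a b c : ℂ) : Prop := ∃ d ∈ O3, a - b = c * d

/-- `a` and `b` are coprime in `ℤ[ρ]`. -/
def ECoprime (a b : ℂ) : Prop := ∃ u ∈ O3, ∃ v ∈ O3, u * a + v * b = 1

/-- The real period `ϖ₁ = ∫₀¹ (1−x³)^{−2/3} dx`. -/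
def varpi1 : ℝ := ∫ x in (0:ℝ)..(1:ℝ), (1 - x ^ 3) ^ (-(2:ℝ)/3)

/-- The points of the period lattice `ϖ₁·ℤ[ρ]`. -/
def ω3 (m : ℤ × ℤ) : ℂ := (varpi1 : ℂ) * ((m.1 : ℂ) + (m.2 : ℂ) * ρ3)

/-- The Weierstrass `℘`-function of the period lattice `ϖ₁·ℤ[ρ]`
(so that `℘′² = 4℘³ − 27`). -/
def wp3 (u : ℂ) : ℂ :=
  (u ^ 2)⁻¹ + ∑' m : ℤ × ℤ, if m = 0 then 0 else (((u - ω3 m) ^ 2)⁻¹ - ((ω3 m) ^ 2)⁻¹)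

/-- The derivative `℘′` of the Weierstrass `℘`-function of `ϖ₁·ℤ[ρ]`. -/
def wp3' (u : ℂ) : ℂ := ∑' m : ℤ × ℤ, (-2) * ((u - ω3 m) ^ 3)⁻¹

/-- The Weierstrass `ζ`-function of the period lattice `ϖ₁·ℤ[ρ]`. -/
def wzeta3 (u : ℂ) : ℂ :=
  u⁻¹ + ∑' m : ℤ × ℤ, if m = 0 then 0 else ((u - ω3 m)⁻¹ + (ω3 m)⁻¹ + u * ((ω3 m) ^ 2)⁻¹)

/-- The non-analytic doubly periodic function `Z(u) = ζ(ϖ₁u) − (2π/(√3·ϖ₁))·ū`. -/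
def Z3 (u : ℂ) : ℂ :=
  wzeta3 ((varpi1 : ℂ) * u) -
    ((2 * Real.pi / (Real.sqrt 3 * varpi1) : ℝ) : ℂ) * (starRingEnd ℂ) u

/-- The elliptic function `φ(u) = 6℘(ϖ₁u)/(9+℘′(ϖ₁u))` of period lattice `ℤ[ρ]`. -/
def phi3 (u : ℂ) : ℂ := 6 * wp3 ((varpi1 : ℂ) * u) / (9 + wp3' ((varpi1 : ℂ) * u))

/-- The elliptic function `ψ(u) = (9−℘′(ϖ₁u))/(9+℘′(ϖ₁u))` of period lattice `ℤ[ρ]`. -/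
def psi3 (u : ℂ) : ℂ := (9 - wp3' ((varpi1 : ℂ) * u)) / (9 + wp3' ((varpi1 : ℂ) * u))

/-- A residue class character modulo `β` on `ℤ[ρ]`. -/
structure IsResChar3 (β : ℂ) (χ : ℂ → ℂ) : Prop where
  periodic : ∀ a ∈ O3, ∀ b ∈ O3, ECong a b β → χ a = χ b
  map_mul : ∀ a ∈ O3, ∀ b ∈ O3, χ (a * b) = χ a * χ b
  map_one : χ 1 = 1
  vanish : ∀ a ∈ O3, ¬ ECoprime a β → χ a = 0

/-- The cubic residue character `χ_π = (·/π)₃` modulo a prime `π` with `p = π·π̄`: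
`χ_π(ν)³ = 1` and `χ_π(ν) ≡ ν^{(p−1)/3} (mod π)`. -/
structure IsCubicChar (π : ℂ) (p : ℕ) (χ : ℂ → ℂ) : Prop where
  resChar : IsResChar3 π χ
  cube : ∀ ν ∈ O3, ECoprime ν π → χ ν ^ 3 = 1
  euler : ∀ ν ∈ O3, ECoprime ν π → ECong (χ ν) (ν ^ ((p - 1) / 3)) π

/-- The elliptic Gauss sum `G_π(χ, f) = (1/3)·Σ_{ν ∈ (ℤ[ρ]/(π))^×} χ(ν)·f(ν/π)`,
computed via the integer representatives `1, …, p−1` of `(ℤ[ρ]/(π))^× ≅ (ℤ/p)^×`. -/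
def EGS3 (p : ℕ) (χ f : ℂ → ℂ) (π : ℂ) : ℂ :=
  (1/3 : ℂ) * ∑ r ∈ Finset.Icc 1 (p - 1), χ (r : ℂ) * f ((r : ℂ) / π)

/-- `S` is a third set of `(ℤ[ρ]/(π))^×`, i.e. `(ℤ[ρ]/(π))^× = S ∪ ρS ∪ ρ̄S`. -/
def IsThirdSet (π : ℂ) (S : Finset ℂ) : Prop :=
  (∀ ν ∈ S, ν ∈ O3 ∧ ECoprime ν π) ∧
  (∀ a ∈ O3, ECoprime a π →
    ∃ ν ∈ S, ∃ ε ∈ ({1, ρ3, ρ3 ^ 2} : Set ℂ), ECong a (ε * ν) π) ∧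
  (∀ ν ∈ S, ∀ μ ∈ S, ∀ ε ∈ ({1, ρ3, ρ3 ^ 2} : Set ℂ), ∀ ε' ∈ ({1, ρ3, ρ3 ^ 2} : Set ℂ),
    ECong (ε * ν) (ε' * μ) π → ν = μ ∧ ε = ε')

/-- `γ(S)` is the cube root of unity with `γ(S) ≡ −∏_{ν∈S} ν (mod π)`. -/
def IsGamma3 (π : ℂ) (S : Finset ℂ) (γ : ℂ) : Prop :=
  γ ^ 3 = 1 ∧ ECong γ (-(∏ ν ∈ S, ν)) π

/-- `L` is the value at `s = 1` of the analytic continuation of the Hecke `L`-series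
`L(s, χ̃) = Σ_𝔞 χ̃(𝔞)·N𝔞^{−s} = (1/6)·Σ_{ν ∈ ℤ[ρ]} χ₁(ν)·ν̄·|ν|^{−2s}` attached to the
weight-one Hecke character `χ̃((ν)) = χ₁(ν)·ν̄` of `ℚ(ρ)`. -/
def IsLValue3 (χ₁ : ℂ → ℂ) (L : ℂ) : Prop :=
  ∃ F : ℂ → ℂ, DifferentiableOn ℂ F {s : ℂ | 0 < s.re} ∧
    (∀ s : ℂ, 3/2 < s.re →
      F s = (1/6 : ℂ) *
        ∑' ν : O3, χ₁ (ν : ℂ) * (starRingEnd ℂ) (ν : ℂ) *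
          ((Complex.normSq (ν : ℂ) : ℂ) ^ (-s))) ∧
    F 1 = L

/-- `T` is a complete residue system modulo `β` in `ℤ[ρ]`. -/
def IsCRS3 (β : ℂ) (T : Finset ℂ) : Prop :=
  (∀ a ∈ T, a ∈ O3) ∧ (∀ a ∈ T, ∀ b ∈ T, ECong a b β → a = b) ∧
  (∀ z ∈ O3, ∃ a ∈ T, ECong z a β)

/-- `e^{2πi·S(z)}` where `S(a + b·ρ̄) = a`, i.e. `2πi·S(z) = (2π/√3)·(zρ − z̄ρ̄)`. -/
def eS3 (z : ℂ) : ℂ :=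
  Complex.exp (((2 * Real.pi / Real.sqrt 3 : ℝ) : ℂ) *
    (z * ρ3 - (starRingEnd ℂ) z * (starRingEnd ℂ) ρ3))

/-- `χ₀`: the character mod `3` giving the natural isomorphism `(ℤ[ρ]/(3))^× ≅ W`,
i.e. `χ₀(ν) = ε` for `ν ≡ ε (mod 3)`, `ε ∈ W = {±1, ±ρ, ±ρ̄}`. -/
def IsChi0₃ (χ₀ : ℂ → ℂ) : Prop :=
  IsResChar3 3 χ₀ ∧ ∀ ε ∈ ({1, -1, ρ3, -ρ3, ρ3 ^ 2, -ρ3 ^ 2} : Set ℂ), χ₀ ε = ε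

/-- `χ₀′`: the character mod `√−3` giving `(ℤ[ρ]/(√−3))^× ≅ {±1}`,
i.e. `χ₀′(ν) = δ` for `ν ≡ δ (mod √−3)`, `δ ∈ {±1}`. -/
def IsChi0'₃ (χ₀' : ℂ → ℂ) : Prop :=
  IsResChar3 sqrtm3 χ₀' ∧ χ₀' (-1) = -1

/-- The classical cubic (Kummer) Gauss sum `G₃(π) = Σ_{r=1}^{p−1} (r/π)₃·e^{2πir/p}`. -/
def G3sum (p : ℕ) (χ : ℂ → ℂ) : ℂ :=
  ∑ r ∈ Finset.Icc 1 (p - 1), χ (r : ℂ) * Complex.exp (2 * Real.pi * Complex.I * (r : ℂ) / (p : ℂ))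

namespace FermatCurve

open Topology Filter
open scoped PeriodPair

section Param

variable (L : PeriodPair) (h a : ℂ)

/-- The function `a℘/(h + ℘′)`, the first coordinate of a parametrization of the Fermat cubic. -/
def fx (u : ℂ) : ℂ := a * ℘[L] u / (h + ℘'[L] u)

open Classical in
/-- The function `(℘′ - h)/(℘′ + h)`, the second coordinate, with the correct value on the
lattice. -/
def fy (u : ℂ) : ℂ := if u ∈ L.lattice then 1 else (℘'[L] u - h) / (℘'[L] u + h)

/-- The set where the parametrization is holomorphic. -/
def fN : Set ℂ := {u | u ∈ L.lattice ∨ h + ℘'[L] u ≠ 0}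

/-- The data for which `a℘/(h + ℘′)`, `(℘′ - h)/(℘′ + h)` lie on the Fermat cubic. -/
structure IsFermatData : Prop where
  g2 : L.g₂ = 0
  g3 : L.g₃ = h ^ 2 / 3
  a3 : a ^ 3 = 24 * h
  h0 : h ≠ 0

variable {L h a}

lemma fx_add_coe (u l : ℂ) (hl : l ∈ L.lattice) : fx L h a (u + l) = fx L h a u := by
  have h1 := L.weierstrassP_add_coe u ⟨l, hl⟩
  have h2 := L.derivWeierstrassP_add_coe u ⟨l, hl⟩
  simp only at h1 h2
  simp [fx, h1, h2]

lemma add_mem_lattice_iff (u l : ℂ) (hl : l ∈ L.lattice) : u + l ∈ L.lattice ↔ u ∈ L.lattice :=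
  ⟨fun hh => by simpa using L.lattice.sub_mem hh hl, fun hh => L.lattice.add_mem hh hl⟩

lemma fy_add_coe (u l : ℂ) (hl : l ∈ L.lattice) : fy L h (u + l) = fy L h u := by
  have h2 := L.derivWeierstrassP_add_coe u ⟨l, hl⟩
  simp only at h2
  have h1 := add_mem_lattice_iff u l hl
  by_cases hu : u ∈ L.lattice
  · simp [fy, hu, h1.mpr hu]
  · simp [fy, hu, h2, mt h1.mp hu]

lemma add_mem_fN_iff (u l : ℂ) (hl : l ∈ L.lattice) : u + l ∈ fN L h ↔ u ∈ fN L h := by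
  have h2 := L.derivWeierstrassP_add_coe u ⟨l, hl⟩
  simp only at h2
  simp [fN, h2, add_mem_lattice_iff u l hl]

lemma fx_coe {l : ℂ} (hl : l ∈ L.lattice) : fx L h a l = 0 := by
  have h1 := L.weierstrassP_coe ⟨l, hl⟩
  simp only at h1
  simp [fx, h1]

lemma fy_coe {l : ℂ} (hl : l ∈ L.lattice) : fy L h l = 1 := by simp [fy, hl]

lemma mem_fN_of_mem {l : ℂ} (hl : l ∈ L.lattice) : l ∈ fN L h := Or.inl hl

lemma zero_mem_fN : (0 : ℂ) ∈ fN L h := mem_fN_of_mem (zero_mem _)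

lemma eventually_notMem_lattice (L : PeriodPair) : ∀ᶠ z in 𝓝[≠] (0:ℂ), z ∉ L.lattice := by
  filter_upwards [self_mem_nhdsWithin,
    mem_nhdsWithin_of_mem_nhds (L.compl_lattice_sdiff_singleton_mem_nhds 0)] with z hz hz2 hz3
  exact hz2 ⟨hz3, hz⟩

lemma tendsto_weierstrassP_cobounded (L : PeriodPair) :
    Tendsto (fun z => ‖℘[L] z‖) (𝓝[≠] (0:ℂ)) atTop := by
  rw [tendsto_norm_atTop_iff_cobounded, tendsto_cobounded_iff_meromorphicOrderAt_neg
    (L.meromorphic_weierstrassP 0), L.order_weierstrassP 0 (zero_mem _)]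
  decide

lemma sq_of_g2 (h2 : L.g₂ = 0) (u : ℂ) (hu : u ∉ L.lattice) :
    ℘'[L] u ^ 2 = 4 * ℘[L] u ^ 3 - L.g₃ := by
  rw [L.derivWeierstrassP_sq u hu, h2]; ring

/-- `℘″ = 6℘²`. -/
lemma deriv_derivWeierstrassP_of_g2 (h2 : L.g₂ = 0) (u : ℂ) (hu : u ∉ L.lattice) : deriv ℘'[L] u = 6 * ℘[L] u ^ 2 := by
  have hP := L.analyticOnNhd_weierstrassP
  have hP' := L.analyticOnNhd_derivWeierstrassP
  have hpre : IsPreconnected (L.latticeᶜ : Set ℂ) := by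
    have hc : (L.lattice : Set ℂ).Countable := Set.countable_coe_iff.mp
      (inferInstanceAs (Countable L.lattice))
    exact (hc.isPathConnected_compl_of_one_lt_rank (by simp)).isConnected.isPreconnected
  have hf : AnalyticOnNhd ℂ (fun u => deriv ℘'[L] u - 6 * ℘[L] u ^ 2) L.latticeᶜ := by
    intro v hv
    have h1 := (hP'.deriv v hv)
    have h2 := hP v hv
    fun_prop
  have hopen : IsOpen (L.latticeᶜ : Set ℂ) := L.isClosed_lattice.isOpen_compl
  have hmul : ∀ v ∈ (L.latticeᶜ : Set ℂ), ℘'[L] v * (deriv ℘'[L] v - 6 * ℘[L] v ^ 2) = 0 := by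
    intro v hv
    have e : (fun u => ℘'[L] u ^ 2) =ᶠ[𝓝 v] fun u => 4 * ℘[L] u ^ 3 - L.g₃ := by
      filter_upwards [hopen.mem_nhds hv] with w hw using sq_of_g2 h2 w hw
    have e2 := e.deriv_eq
    have d1 : HasDerivAt ℘'[L] (deriv ℘'[L] v) v := (hP' v hv).differentiableAt.hasDerivAt
    have d2 : HasDerivAt ℘[L] (℘'[L] v) v := by
      have := (hP v hv).differentiableAt.hasDerivAt
      rwa [L.deriv_weierstrassP] at this
    have d3 : HasDerivAt (fun u => ℘'[L] u ^ 2) _ v := d1.pow 2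
    have d4 : HasDerivAt (fun u => 4 * ℘[L] u ^ 3 - L.g₃) _ v :=
      ((d2.pow 3).const_mul 4).sub_const _
    rw [d3.deriv, d4.deriv] at e2
    norm_num at e2
    linear_combination e2 / 2
  rcases AnalyticOnNhd.eq_zero_or_eq_zero_of_mul_eq_zero hP' hf hmul hpre with h0 | h0
  · exfalso
    have h1 := tendsto_weierstrassP_cobounded L
    have h22 : ∀ᶠ z in 𝓝[≠] (0:ℂ), ℘[L] z ^ 3 = L.g₃ / 4 := by
      filter_upwards [eventually_notMem_lattice L] with z hz
      have h3 : ℘'[L] z = 0 := h0 z hz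
      have := sq_of_g2 h2 z hz
      rw [h3] at this
      linear_combination -this / 4
    have h3 : Tendsto (fun z => ‖℘[L] z ^ 3‖) (𝓝[≠] (0:ℂ)) atTop := by
      simp only [norm_pow]
      exact (tendsto_pow_atTop (by norm_num)).comp h1
    have h4 : Tendsto (fun z => ‖℘[L] z ^ 3‖) (𝓝[≠] (0:ℂ)) (𝓝 ‖L.g₃ / 4‖) :=
      tendsto_const_nhds.congr' (h22.mono fun z hz => by simp only [hz])
    exact not_tendsto_nhds_of_tendsto_atTop h3 _ h4
  · have := h0 u hu
    linear_combination this

namespace IsFermatData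

variable (H : IsFermatData L h a)
include H

lemma sq (u : ℂ) (hu : u ∉ L.lattice) : ℘'[L] u ^ 2 = 4 * ℘[L] u ^ 3 - h ^ 2 / 3 := by
  rw [L.derivWeierstrassP_sq u hu, H.g2, H.g3]; ring

lemma a0 : a ≠ 0 := by
  intro h0
  have := H.a3
  rw [h0] at this
  apply H.h0
  simpa using this.symm

lemma curve (u : ℂ) (hu : u ∈ fN L h) : fx L h a u ^ 3 + fy L h u ^ 3 = 1 := by
  by_cases hL : u ∈ L.lattice
  · simp [fx_coe hL, fy_coe hL]
  · have h1 : h + ℘'[L] u ≠ 0 := by simpa [fN, hL] using hu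
    have h2 : ℘'[L] u + h ≠ 0 := by rwa [add_comm]
    have h3 := H.sq u hL
    simp only [fx, fy, hL, if_false]
    rw [add_comm h]
    field_simp
    linear_combination ℘[L] u ^ 3 * H.a3 - 6 * h * h3

lemma eq_one_iff (u : ℂ) (hu : u ∈ fN L h) : fy L h u = 1 ↔ u ∈ L.lattice := by
  constructor
  · intro h1
    by_contra hL
    have h2 : h + ℘'[L] u ≠ 0 := by simpa [fN, hL] using hu
    have h3 : ℘'[L] u + h ≠ 0 := by rwa [add_comm]
    simp only [fy, hL, if_false] at h1
    rw [div_eq_one_iff_eq h3] at h1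
    apply H.h0
    linear_combination -h1/2
  · exact fy_coe

omit H in
lemma neg_mem_iff (u : ℂ) (hu : u ∈ fN L h) : -u ∈ fN L h ↔ fy L h u ≠ 0 := by
  by_cases hL : u ∈ L.lattice
  · simp [fy_coe hL, fN, hL]
  · have hL' : -u ∉ L.lattice := by simpa using hL
    have h2 : h + ℘'[L] u ≠ 0 := by simpa [fN, hL] using hu
    have h3 : ℘'[L] u + h ≠ 0 := by rwa [add_comm]
    simp only [fN, hL', fy, hL, Set.mem_ofPred_eq, false_or, L.derivWeierstrassP_neg, if_false, ne_eq,
      div_eq_zero_iff, h3, or_false]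
    rw [← sub_eq_add_neg, sub_eq_zero, sub_eq_zero, eq_comm]


omit H in
lemma eventually_eq_zero : ∀ᶠ z in 𝓝 (0:ℂ), z ∈ fN L h ∧
    fx L h a z = a * (z + z ^ 3 * L.weierstrassPExcept 0 z) / (-2 + z ^ 3 * (L.derivWeierstrassPExcept 0 z + h)) ∧
    fy L h z = (-2 + z ^ 3 * (L.derivWeierstrassPExcept 0 z - h)) / (-2 + z ^ 3 * (L.derivWeierstrassPExcept 0 z + h)) := by
  have c : ContinuousAt (fun z : ℂ => -2 + z ^ 3 * (L.derivWeierstrassPExcept 0 z + h)) 0 := by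
    have := (L.analyticAt_derivWeierstrassPExcept 0).continuousAt
    fun_prop
  have c0 := c.eventually_ne (show _ ≠ (0:ℂ) by simp)
  filter_upwards [c0, L.compl_lattice_sdiff_singleton_mem_nhds 0] with z hD hz
  by_cases z0 : z = 0
  · subst z0
    refine ⟨zero_mem_fN, ?_, ?_⟩
    · simp [fx_coe (zero_mem L.lattice)]
    · simp [fy_coe (zero_mem L.lattice)]
  have hL : z ∉ L.lattice := fun hh => hz ⟨hh, z0⟩
  have e1 := L.weierstrassPExcept_add ⟨0, zero_mem _⟩ z
  have e2 := L.derivWeierstrassPExcept_sub ⟨0, zero_mem _⟩ z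
  simp only [sub_zero, ne_eq, OfNat.ofNat_ne_zero, not_false_eq_true, zero_pow, div_zero] at e1 e2
  have e3 : h + ℘'[L] z = (-2 + z ^ 3 * (L.derivWeierstrassPExcept 0 z + h)) / z ^ 3 := by
    rw [← e2]; field_simp; ring
  have e4 : ℘'[L] z + h = (-2 + z ^ 3 * (L.derivWeierstrassPExcept 0 z + h)) / z ^ 3 := by
    rw [← e2]; field_simp; ring
  have hz3 : z ^ 3 ≠ 0 := pow_ne_zero _ z0
  refine ⟨Or.inr ?_, ?_, ?_⟩
  · rw [e3]
    exact div_ne_zero hD hz3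
  · rw [fx, e3, ← e1]
    field_simp
    ring
  · simp only [fy, hL, if_false]
    rw [e4, ← e2]
    field_simp
    ring

omit H in
lemma analyticAt_zero : AnalyticAt ℂ (fx L h a) 0 ∧ AnalyticAt ℂ (fy L h) 0 := by
  have h1 := L.analyticAt_derivWeierstrassPExcept 0
  have h2 := L.analyticAt_weierstrassPExcept 0
  constructor
  · have : AnalyticAt ℂ (fun z => a * (z + z ^ 3 * L.weierstrassPExcept 0 z) /
      (-2 + z ^ 3 * (L.derivWeierstrassPExcept 0 z + h))) 0 := by
      apply AnalyticAt.div (by fun_prop) (by fun_prop) (by simp)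
    exact this.congr ((eventually_eq_zero (h := h) (a := a)).mono fun z hz => hz.2.1.symm)
  · have : AnalyticAt ℂ (fun z => (-2 + z ^ 3 * (L.derivWeierstrassPExcept 0 z - h)) /
      (-2 + z ^ 3 * (L.derivWeierstrassPExcept 0 z + h))) 0 := by
      apply AnalyticAt.div (by fun_prop) (by fun_prop) (by simp)
    exact this.congr ((eventually_eq_zero (h := h) (a := a)).mono fun z hz => hz.2.2.symm)

omit H in
lemma eventually_mem_fN_coe {l : ℂ} (hl : l ∈ L.lattice) : ∀ᶠ z in 𝓝 l, z ∈ fN L h := by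
  have h1 : ∀ᶠ z in 𝓝 (0:ℂ), z ∈ fN L h :=
    (eventually_eq_zero (L := L) (h := h) (a := 1)).mono fun z hz => hz.1
  have h2 : Tendsto (fun z => z + -l) (𝓝 l) (𝓝 0) := by
    have : ContinuousAt (fun z => z + -l) l := by fun_prop
    simpa [ContinuousAt] using this
  filter_upwards [h2.eventually h1] with z hz
  exact (add_mem_fN_iff z (-l) (L.lattice.neg_mem hl)).mp hz

omit H in
lemma isOpen_fN : IsOpen (fN L h) := by
  rw [isOpen_iff_eventually]
  intro z hz
  by_cases hL : z ∈ L.lattice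
  · exact eventually_mem_fN_coe hL
  · have h1 : h + ℘'[L] z ≠ 0 := by simpa [fN, hL] using hz
    have h2 := (L.analyticOnNhd_derivWeierstrassP z hL).continuousAt
    have h3 : ContinuousAt (fun z => h + ℘'[L] z) z := by fun_prop
    filter_upwards [h3.eventually_ne h1] with w hw using Or.inr hw

omit H in
lemma eventually_notMem {z : ℂ} (hz : z ∉ L.lattice) : ∀ᶠ w in 𝓝 z, w ∉ L.lattice :=
  L.isClosed_lattice.isOpen_compl.mem_nhds hz

lemma hasDerivAt_of_notMem {z : ℂ} (hz : z ∈ fN L h) (hL : z ∉ L.lattice) :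
    HasDerivAt (fx L h a) (-a / 2 * fy L h z ^ 2) z ∧
    HasDerivAt (fy L h) (a / 2 * fx L h a z ^ 2) z := by
  have h1 : h + ℘'[L] z ≠ 0 := by simpa [fN, hL] using hz
  have h1' : ℘'[L] z + h ≠ 0 := by rwa [add_comm]
  have d1 : HasDerivAt ℘'[L] (6 * ℘[L] z ^ 2) z := by
    rw [← deriv_derivWeierstrassP_of_g2 H.g2 z hL]
    exact (L.analyticOnNhd_derivWeierstrassP z hL).differentiableAt.hasDerivAt
  have d2 : HasDerivAt ℘[L] (℘'[L] z) z := by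
    have := (L.analyticOnNhd_weierstrassP z hL).differentiableAt.hasDerivAt
    rwa [L.deriv_weierstrassP] at this
  have hs := H.sq z hL
  constructor
  · have := (d2.const_mul a).div (d1.const_add h) h1
    refine this.congr_deriv ?_
    simp only [fy, hL, if_false]
    rw [add_comm h] at *
    field_simp
    linear_combination 3 * a * hs
  · have := (d1.sub_const h).div (d1.add_const h) h1'
    have e : fy L h =ᶠ[𝓝 z] fun z => (℘'[L] z - h) / (℘'[L] z + h) := by
      filter_upwards [eventually_notMem hL] with w hw
      simp [fy, hw]
    refine (this.congr_deriv ?_).congr_of_eventuallyEq e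
    simp only [fx]
    rw [add_comm h] at *
    field_simp
    linear_combination - ℘[L] z ^ 2 * H.a3

lemma hasDerivAt_zero :
    HasDerivAt (fx L h a) (-a / 2 * fy L h 0 ^ 2) 0 ∧
    HasDerivAt (fy L h) (a / 2 * fx L h a 0 ^ 2) 0 := by
  obtain ⟨hx, hy⟩ := analyticAt_zero (L := L) (h := h) (a := a)
  have ev : ∀ᶠ z in 𝓝[≠] (0:ℂ), z ∈ fN L h ∧ z ∉ L.lattice :=
    (Filter.Eventually.filter_mono nhdsWithin_le_nhds (eventually_mem_fN_coe (zero_mem _))).and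
      (eventually_notMem_lattice L)
  have key : ∀ (f g : ℂ → ℂ), AnalyticAt ℂ f 0 → ContinuousAt g 0 →
      (∀ᶠ z in 𝓝[≠] (0:ℂ), deriv f z = g z) → HasDerivAt f (g 0) 0 := by
    intro f g hf hg hfg
    have h1 : Tendsto (deriv f) (𝓝[≠] 0) (𝓝 (deriv f 0)) :=
      hf.deriv.continuousAt.tendsto.mono_left nhdsWithin_le_nhds
    have h2 : Tendsto g (𝓝[≠] 0) (𝓝 (g 0)) := hg.tendsto.mono_left nhdsWithin_le_nhds
    rw [← tendsto_nhds_unique (h1.congr' hfg) h2]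
    exact hf.differentiableAt.hasDerivAt
  have hxc := hx.continuousAt
  have hyc := hy.continuousAt
  constructor
  · exact key _ (fun z => -a / 2 * fy L h z ^ 2) hx (by fun_prop)
      (ev.mono fun z hz => (H.hasDerivAt_of_notMem hz.1 hz.2).1.deriv)
  · exact key _ (fun z => a / 2 * fx L h a z ^ 2) hy (by fun_prop)
      (ev.mono fun z hz => (H.hasDerivAt_of_notMem hz.1 hz.2).2.deriv)

lemma hasDerivAt {z : ℂ} (hz : z ∈ fN L h) :
    HasDerivAt (fx L h a) (-a / 2 * fy L h z ^ 2) z ∧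
    HasDerivAt (fy L h) (a / 2 * fx L h a z ^ 2) z := by
  by_cases hL : z ∈ L.lattice
  · obtain ⟨h1, h2⟩ := H.hasDerivAt_zero
    have hn : -z ∈ L.lattice := L.lattice.neg_mem hL
    have e1 : (fun w => fx L h a (w + -z)) = fx L h a := funext fun w => fx_add_coe w _ hn
    have e2 : (fun w => fy L h (w + -z)) = fy L h := funext fun w => fy_add_coe w _ hn
    have hz0 : z + -z = 0 := by ring
    rw [← hz0] at h1 h2
    have h1' := h1.comp_add_const z (-z)
    have h2' := h2.comp_add_const z (-z)
    rw [e1] at h1'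
    rw [e2] at h2'
    rw [fy_add_coe z _ hn] at h1'
    rw [fx_add_coe z _ hn] at h2'
    exact ⟨h1', h2'⟩
  · exact H.hasDerivAt_of_notMem hz hL

lemma eventually_mem_fN_of_notMem {z : ℂ} (hz : z ∉ fN L h) :
    ∀ᶠ w in 𝓝[≠] z, h + ℘'[L] w ≠ 0 := by
  have hL : z ∉ L.lattice := fun hh => hz (Or.inl hh)
  have h1 : h + ℘'[L] z = 0 := by simpa [fN, hL] using hz
  have hs := H.sq z hL
  have hP : ℘[L] z ≠ 0 := by
    intro h0
    rw [h0, show ℘'[L] z = -h by linear_combination h1] at hs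
    have : h ^ 2 = 0 := by linear_combination 3 / 4 * hs
    exact H.h0 (pow_eq_zero_iff (two_ne_zero) |>.mp this)
  have d1 : HasDerivAt ℘'[L] (6 * ℘[L] z ^ 2) z := by
    rw [← deriv_derivWeierstrassP_of_g2 H.g2 z hL]
    exact (L.analyticOnNhd_derivWeierstrassP z hL).differentiableAt.hasDerivAt
  exact (d1.const_add h).eventually_ne (by simpa using hP)

lemma countable_compl_fN : (fN L h)ᶜ.Countable := by
  have : DiscreteTopology ((fN L h)ᶜ : Set ℂ) := by
    rw [discreteTopology_subtype_iff]
    intro z hz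
    rw [inf_principal_eq_bot]
    filter_upwards [H.eventually_mem_fN_of_notMem hz] with w hw hw2
    exact hw2 (Or.inr hw)
  exact Set.countable_coe_iff.mp (countable_of_Lindelof_of_discrete)

lemma tendsto_norm_of_notMem {z : ℂ} (hz : z ∉ fN L h) :
    Tendsto (fun w => ‖fx L h a w‖) (𝓝[≠] z) atTop := by
  have hL : z ∉ L.lattice := fun hh => hz (Or.inl hh)
  have h1 : h + ℘'[L] z = 0 := by simpa [fN, hL] using hz
  have hs := H.sq z hL
  have hP : ℘[L] z ≠ 0 := by
    intro h0
    rw [h0, show ℘'[L] z = -h by linear_combination h1] at hs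
    have : h ^ 2 = 0 := by linear_combination 3 / 4 * hs
    exact H.h0 (pow_eq_zero_iff (two_ne_zero) |>.mp this)
  have c1 := (L.analyticOnNhd_weierstrassP z hL).continuousAt
  have c2 := (L.analyticOnNhd_derivWeierstrassP z hL).continuousAt
  have t1 : Tendsto (fun w => ‖a * ℘[L] w‖) (𝓝[≠] z) (𝓝 ‖a * ℘[L] z‖) := by
    have : ContinuousAt (fun w => ‖a * ℘[L] w‖) z := by fun_prop
    exact this.tendsto.mono_left nhdsWithin_le_nhds
  have t2 : Tendsto (fun w => h + ℘'[L] w) (𝓝[≠] z) (𝓝[≠] 0) := by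
    rw [tendsto_nhdsWithin_iff]
    refine ⟨?_, H.eventually_mem_fN_of_notMem hz⟩
    have : ContinuousAt (fun w => h + ℘'[L] w) z := by fun_prop
    rw [← h1]
    exact this.tendsto.mono_left nhdsWithin_le_nhds
  have t3 := tendsto_norm_inv_nhdsNE_zero_atTop.comp t2
  have := t1.pos_mul_atTop (norm_pos_iff.mpr (mul_ne_zero H.a0 hP)) t3
  refine this.congr fun w => ?_
  simp [fx, div_eq_mul_inv]

end IsFermatData
end Param
end FermatCurve

namespace FermatCurve

open Topology Filter

/-- A holomorphic solution of `x′ = ky²`, `y′ = -kx²` on the Fermat cubic through `(0, 1)`, defined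
off a countable closed set of poles. -/
structure IsFermatFlow (k : ℂ) (x y : ℂ → ℂ) (N : Set ℂ) : Prop where
  isOpen : IsOpen N
  countable : Nᶜ.Countable
  zero_mem : (0 : ℂ) ∈ N
  x0 : x 0 = 0
  y0 : y 0 = 1
  curve : ∀ u ∈ N, x u ^ 3 + y u ^ 3 = 1
  dx : ∀ u ∈ N, HasDerivAt x (k * y u ^ 2) u
  dy : ∀ u ∈ N, HasDerivAt y (-k * x u ^ 2) u
  isolated : ∀ u, u ∉ N → ∀ᶠ w in 𝓝[≠] u, w ∈ N
  pole : ∀ u, u ∉ N → Tendsto (fun w => ‖x w‖) (𝓝[≠] u) atTop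

namespace IsFermatFlow

variable {k : ℂ} {x y : ℂ → ℂ} {N : Set ℂ} (F : IsFermatFlow k x y N)
include F

lemma analyticOnNhd : AnalyticOnNhd ℂ x N ∧ AnalyticOnNhd ℂ y N := by
  constructor
  · exact DifferentiableOn.analyticOnNhd
      (fun u hu => (F.dx u hu).differentiableAt.differentiableWithinAt) F.isOpen
  · exact DifferentiableOn.analyticOnNhd
      (fun u hu => (F.dy u hu).differentiableAt.differentiableWithinAt) F.isOpen

/-- The points `b` such that `b` and `c - b` are not poles. -/
lemma isPreconnected_inter (c : ℂ) : IsOpen {b | b ∈ N ∧ c - b ∈ N} ∧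
    IsPreconnected {b | b ∈ N ∧ c - b ∈ N} := by
  constructor
  · exact F.isOpen.inter (F.isOpen.preimage (by fun_prop : Continuous fun b => c - b))
  · have hc : ({b | b ∈ N ∧ c - b ∈ N}ᶜ : Set ℂ).Countable := by
      have : ({b | b ∈ N ∧ c - b ∈ N}ᶜ : Set ℂ) ⊆ Nᶜ ∪ (fun b => c - b) ⁻¹' Nᶜ := by
        intro b hb
        simp only [Set.mem_compl_iff, Set.mem_ofPred_eq, not_and_or] at hb
        simpa using hb
      refine Set.Countable.mono this (F.countable.union (F.countable.preimage ?_))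
      exact sub_right_injective
    have := (hc.isPathConnected_compl_of_one_lt_rank (by simp)).isConnected.isPreconnected
    simpa using this

lemma near_zero (c : ℂ) (hc : c ∈ N) : ∀ᶠ b in 𝓝 (0:ℂ), 
    x c * (y b + x b ^ 2 * x (c - b) * y (c - b)) = x (c - b) + y (c - b) ^ 2 * x b * y b ∧
    y c * (y b + x b ^ 2 * x (c - b) * y (c - b)) = y b ^ 2 * y (c - b) - x (c - b) ^ 2 * x b ∧
    y b + x b ^ 2 * x (c - b) * y (c - b) ≠ 0 := by
  have h0 : (0:ℂ) ∈ {b | b ∈ N ∧ c - b ∈ N} := ⟨F.zero_mem, by simpa using hc⟩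
  have hU := F.isPreconnected_inter c
  have d1 : ∀ b ∈ {b | b ∈ N ∧ c - b ∈ N}, HasDerivAt x (k * y b ^ 2) b := fun b hb => F.dx b hb.1
  have d2 : ∀ b ∈ {b | b ∈ N ∧ c - b ∈ N}, HasDerivAt y (-k * x b ^ 2) b := fun b hb => F.dy b hb.1
  have d3 : ∀ b ∈ {b | b ∈ N ∧ c - b ∈ N},
      HasDerivAt (fun b => x (c - b)) (-k * y (c - b) ^ 2) b := fun b hb => by
    have := (F.dx (c - b) hb.2).comp_const_sub c b
    exact this.congr_deriv (by ring)
  have d4 : ∀ b ∈ {b | b ∈ N ∧ c - b ∈ N},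
      HasDerivAt (fun b => y (c - b)) (k * x (c - b) ^ 2) b := fun b hb => by
    have := (F.dy (c - b) hb.2).comp_const_sub c b
    exact this.congr_deriv (by ring)
  have dD : ∀ b ∈ {b | b ∈ N ∧ c - b ∈ N},
      HasDerivAt (fun b => y b + x b ^ 2 * x (c - b) * y (c - b))
        (k * (2 * x b * y (c - b) * (y b ^ 2 * x (c - b) - x b * y (c - b) ^ 2))) b := by
    intro b hb
    have := (d2 b hb).add ((((d1 b hb).pow 2).mul (d3 b hb)).mul (d4 b hb))
    refine this.congr_deriv ?_
    simp only [Pi.pow_apply, Pi.mul_apply]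
    push_cast
    have e := F.curve _ hb.2
    linear_combination (k * x b ^ 2) * e
  have hD0 : ∀ᶠ b in 𝓝 (0:ℂ), y b + x b ^ 2 * x (c - b) * y (c - b) ≠ 0 := by
    have := (dD 0 h0).continuousAt
    exact this.eventually_ne (by simp [F.x0, F.y0])
  obtain ⟨ε, hε, hball⟩ := Metric.eventually_nhds_iff_ball.mp
    (hD0.and (hU.1.mem_nhds h0))
  have const : ∀ f f' : ℂ → ℂ, (∀ b ∈ Metric.ball (0:ℂ) ε, HasDerivAt f (f' b) b) →
      (∀ b ∈ Metric.ball (0:ℂ) ε, f' b = 0) → ∀ b ∈ Metric.ball (0:ℂ) ε, f b = f 0 := by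
    intro f f' hf hf' b hb
    have := (convex_ball (0:ℂ) ε).is_const_of_fderivWithin_eq_zero (𝕜 := ℂ) (f := f)
      (fun b hb => (hf b hb).differentiableAt.differentiableWithinAt) ?_ hb
      (Metric.mem_ball_self hε)
    · exact this
    · intro b hb
      rw [fderivWithin_of_isOpen Metric.isOpen_ball hb, (hf b hb).hasFDerivAt.fderiv, hf' b hb]
      ext
      simp
  filter_upwards [Metric.ball_mem_nhds (0:ℂ) hε] with b hb
  have hDb := (hball b hb).1
  have e1 := const (fun b => (x (c - b) + y (c - b) ^ 2 * x b * y b) /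
    (y b + x b ^ 2 * x (c - b) * y (c - b))) _ (fun b hb => by
      have hbU := (hball b hb).2
      have := (((d3 b hbU).add ((((d4 b hbU).pow 2).mul (d1 b hbU)).mul (d2 b hbU)))).div (dD b hbU)
        (hball b hb).1
      exact this) (fun b hb => by
      have hbU := (hball b hb).2
      simp only [Pi.pow_apply, Pi.mul_apply, Pi.add_apply]
      rw [div_eq_zero_iff]
      left
      push_cast
      have e := F.curve _ hbU.1
      have e' := F.curve _ hbU.2
      linear_combination (k * (y (c - b) ^ 2 * (y b + x b ^ 2 * x (c - b) * y (c - b)) -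
        2 * x b * y (c - b) * (x (c - b) * x b * y (c - b) ^ 2))) * e +
        (k * 2 * x b * y (c - b) * (x b ^ 2 * y (c - b) * y b)) * e') b hb
  have e2 := const (fun b => (y b ^ 2 * y (c - b) - x (c - b) ^ 2 * x b) /
    (y b + x b ^ 2 * x (c - b) * y (c - b))) _ (fun b hb => by
      have hbU := (hball b hb).2
      have := ((((d2 b hbU).pow 2).mul (d4 b hbU)).sub (((d3 b hbU).pow 2).mul (d1 b hbU))).div
        (dD b hbU) (hball b hb).1
      exact this) (fun b hb => by
      have hbU := (hball b hb).2
      simp only [Pi.pow_apply, Pi.mul_apply, Pi.sub_apply]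
      rw [div_eq_zero_iff]
      left
      push_cast
      have e := F.curve _ hbU.1
      have e' := F.curve _ hbU.2
      linear_combination (-k * 2 * x b * (x (c - b) * y (c - b) ^ 2 * y b)) * e +
        (k * 2 * x b * (y b ^ 2 * x b * y (c - b))) * e') b hb
  refine ⟨?_, ?_, hDb⟩
  · rw [div_eq_iff hDb] at e1
    rw [e1]
    simp [F.x0, F.y0]
  · rw [div_eq_iff hDb] at e2
    rw [e2]
    simp [F.x0, F.y0]

lemma identities (c b : ℂ) (hc : c ∈ N) (hb : b ∈ N) (hcb : c - b ∈ N) :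
    x (c - b) * x b * x c = y (c - b) * y b - y c ∧
    x b * y (c - b) * y c = x c * y b - x (c - b) := by
  have hU := F.isPreconnected_inter c
  obtain ⟨ax, ay⟩ := F.analyticOnNhd
  have h0 : (0:ℂ) ∈ {b | b ∈ N ∧ c - b ∈ N} := ⟨F.zero_mem, by simpa using hc⟩
  have ax' : AnalyticOnNhd ℂ (fun b => x (c - b)) {b | b ∈ N ∧ c - b ∈ N} := fun b hb =>
    (ax (c - b) hb.2).fun_comp (f := fun b => c - b) (by fun_prop)
  have ay' : AnalyticOnNhd ℂ (fun b => y (c - b)) {b | b ∈ N ∧ c - b ∈ N} := fun b hb =>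
    (ay (c - b) hb.2).fun_comp (f := fun b => c - b) (by fun_prop)
  constructor
  · refine AnalyticOnNhd.eqOn_of_preconnected_of_eventuallyEq (𝕜 := ℂ)
      (f := fun b => x (c - b) * x b * x c) (g := fun b => y (c - b) * y b - y c) ?_ ?_
      hU.2 h0 ?_ ⟨hb, hcb⟩
    · intro b hb
      have h1 := ax b hb.1
      have h3 := ax' b hb
      exact (h3.mul h1).mul analyticAt_const
    · intro b hb
      have h1 := ay b hb.1
      have h3 := ay' b hb
      exact (h3.mul h1).sub analyticAt_const
    · filter_upwards [F.near_zero c hc] with b ⟨e1, e2, e3⟩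
      apply mul_right_cancel₀ e3
      linear_combination (x (c - b) * x b) * e1 + e2
  · refine AnalyticOnNhd.eqOn_of_preconnected_of_eventuallyEq (𝕜 := ℂ)
      (f := fun b => x b * y (c - b) * y c) (g := fun b => x c * y b - x (c - b)) ?_ ?_
      hU.2 h0 ?_ ⟨hb, hcb⟩
    · intro b hb
      have h1 := ax b hb.1
      have h3 := ay' b hb
      exact (h1.mul h3).mul analyticAt_const
    · intro b hb
      have h1 := ay b hb.1
      have h3 := ax' b hb
      exact (analyticAt_const.mul h1).sub h3
    · filter_upwards [F.near_zero c hc] with b ⟨e1, e2, e3⟩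
      apply mul_right_cancel₀ e3
      linear_combination (x b * y (c - b)) * e2 - y b * e1

lemma I1 {a b : ℂ} (ha : a ∈ N) (hb : b ∈ N) (hab : a + b ∈ N) :
    x a * x b * x (a + b) = y a * y b - y (a + b) := by
  have := (F.identities (a + b) b hab hb (by simpa using ha)).1
  simpa using this

lemma I2 {a b : ℂ} (ha : a ∈ N) (hb : b ∈ N) (hab : a + b ∈ N) :
    x b * y a * y (a + b) = x (a + b) * y b - x a := by
  have := (F.identities (a + b) b hab hb (by simpa using ha)).2
  simpa using this

lemma add_x {a b : ℂ} (ha : a ∈ N) (hb : b ∈ N) (hab : a + b ∈ N) :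
    x (a + b) * (y b + x b ^ 2 * x a * y a) = x a + y a ^ 2 * x b * y b := by
  linear_combination (x b * y a) * F.I1 ha hb hab - F.I2 ha hb hab

lemma add_y {a b : ℂ} (ha : a ∈ N) (hb : b ∈ N) (hab : a + b ∈ N) :
    y (a + b) * (y b + x b ^ 2 * x a * y a) = y b ^ 2 * y a - x a ^ 2 * x b := by
  linear_combination (y b) * F.I1 ha hb hab + (x a * x b) * F.I2 ha hb hab

lemma add_mem {a b : ℂ} (ha : a ∈ N) (hb : b ∈ N) (hD : y b + x b ^ 2 * x a * y a ≠ 0) :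
    a + b ∈ N := by
  by_contra hab
  have t1 := F.pole _ hab
  have hsub : Tendsto (fun w => w - b) (𝓝[≠] (a + b)) (𝓝 a) := by
    have : ContinuousAt (fun w => w - b) (a + b) := by fun_prop
    have h := this.tendsto
    rw [add_sub_cancel_right] at h
    exact h.mono_left nhdsWithin_le_nhds
  have cx : Tendsto (fun w => x (w - b)) (𝓝[≠] (a + b)) (𝓝 (x a)) :=
    ((F.dx a ha).continuousAt.tendsto).comp hsub
  have cy : Tendsto (fun w => y (w - b)) (𝓝[≠] (a + b)) (𝓝 (y a)) :=
    ((F.dy a ha).continuousAt.tendsto).comp hsub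
  have t2 : Tendsto (fun w => ‖y b + x b ^ 2 * x (w - b) * y (w - b)‖) (𝓝[≠] (a + b))
      (𝓝 ‖y b + x b ^ 2 * x a * y a‖) :=
    (tendsto_const_nhds.add ((tendsto_const_nhds.mul cx).mul cy)).norm
  have t3 : Tendsto (fun w => ‖x (w - b) + y (w - b) ^ 2 * x b * y b‖) (𝓝[≠] (a + b))
      (𝓝 ‖x a + y a ^ 2 * x b * y b‖) :=
    (cx.add (((cy.pow 2).mul_const _).mul_const _)).norm
  have t4 := t1.atTop_mul_pos (norm_pos_iff.mpr hD) t2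
  refine not_tendsto_nhds_of_tendsto_atTop t4 _ (t3.congr' ?_)
  have ev1 : ∀ᶠ w in 𝓝[≠] (a + b), w - b ∈ N := hsub.eventually (F.isOpen.mem_nhds ha)
  have ev2 : ∀ᶠ w in 𝓝[≠] (a + b), w ∈ N := F.isolated _ hab
  filter_upwards [ev1, ev2] with w h1 h2
  have := F.add_x h1 hb (by simpa using h2)
  rw [sub_add_cancel] at this
  rw [← norm_mul, this]

end IsFermatFlow

end FermatCurve

namespace FermatCurve

lemma rho_pow_three : ρ3 ^ 3 = 1 := by
  rw [ρ3, ← Complex.exp_nat_mul, Complex.exp_eq_one_iff]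
  exact ⟨1, by push_cast; ring⟩

lemma rho_sq : ρ3 ^ 2 = -1 - ρ3 := by
  have h1 : ρ3 ≠ 1 := by
    intro h
    rw [ρ3, Complex.exp_eq_one_iff] at h
    obtain ⟨n, hn⟩ := h
    have h2 : (1 / 3 : ℂ) = n := by
      have := Complex.two_pi_I_ne_zero
      apply mul_right_cancel₀ this
      rw [← hn]
      ring
    have h3 : (1 : ℂ) = 3 * n := by rw [← h2]; norm_num
    have h4 : (1 : ℤ) = 3 * n := by exact_mod_cast h3
    omega
  have h2 : (ρ3 - 1) * (ρ3 ^ 2 + ρ3 + 1) = 0 := by linear_combination rho_pow_three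
  rcases mul_eq_zero.mp h2 with h | h
  · exact absurd (sub_eq_zero.mp h) h1
  · linear_combination h

lemma rho_ne_zero : ρ3 ≠ 0 := by
  intro h
  have := rho_pow_three
  rw [h] at this
  norm_num at this

lemma sqrt_ne_zero : ρ3 - ρ3 ^ 2 ≠ 0 := by
  intro h
  have h1 : (ρ3 - ρ3 ^ 2) ^ 2 = -3 := by
    linear_combination (ρ3 ^ 2 - 3 * ρ3 + 3) * rho_sq
  rw [h] at h1
  norm_num at h1

/-- A solution of the Fermat flow which uniformizes the Fermat cubic by `ℂ/Λ`, where `Λ` has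
complex multiplication by `ρ`. -/
structure IsFermatUnif (k : ℂ) (x y : ℂ → ℂ) (N : Set ℂ) (Λ : AddSubgroup ℂ) : Prop extends
    IsFermatFlow k x y N where
  mem_iff : ∀ u ∈ N, y u = 1 ↔ u ∈ Λ
  neg_mem_iff : ∀ u ∈ N, -u ∈ N ↔ y u ≠ 0
  neg_of_notMem : ∀ u, u ∉ N → -u ∈ N
  x_per : ∀ u, ∀ l ∈ Λ, x (u + l) = x u
  y_per : ∀ u, ∀ l ∈ Λ, y (u + l) = y u
  N_per : ∀ u, ∀ l ∈ Λ, (u + l ∈ N ↔ u ∈ N)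
  surj : ∀ X Y : ℂ, X ^ 3 + Y ^ 3 = 1 → ∃ u ∈ N, x u = X ∧ y u = Y
  x_rho : ∀ u, x (ρ3 * u) = ρ3 * x u
  y_rho : ∀ u, y (ρ3 * u) = y u
  N_rho : ∀ u, (ρ3 * u ∈ N ↔ u ∈ N)

namespace IsFermatUnif

variable {k : ℂ} {x y : ℂ → ℂ} {N : Set ℂ} {Λ : AddSubgroup ℂ} (F : IsFermatUnif k x y N Λ)
include F

lemma neg_y {u : ℂ} (hu : u ∈ N) (hu' : -u ∈ N) : y u * y (-u) = 1 := by
  have := F.I1 hu hu' (by simpa using F.zero_mem)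
  rw [add_neg_cancel, F.x0, F.y0] at this
  linear_combination -this

lemma neg_x {u : ℂ} (hu : u ∈ N) (hu' : -u ∈ N) : x (-u) * y u = -x u := by
  have := F.I2 hu hu' (by simpa using F.zero_mem)
  rw [add_neg_cancel, F.x0, F.y0] at this
  linear_combination this

lemma exists_generic : ∃ e ∈ N, x e ≠ 0 ∧ y e ≠ 0 := by
  obtain ⟨c, hc⟩ := IsAlgClosed.exists_pow_nat_eq (1 / 2 : ℂ) (n := 3) (by norm_num)
  have hc0 : c ≠ 0 := by
    rintro rfl
    norm_num at hc
  obtain ⟨e, he, h1, h2⟩ := F.surj c c (by rw [hc]; norm_num)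
  exact ⟨e, he, by rwa [h1], by rwa [h2]⟩

lemma sub_mem_of_ne {u v : ℂ} (hu : u ∈ N) (hv : v ∈ N) (hx : x u = x v) (hy : y u = y v)
    (h0 : y v ≠ 0) : u - v ∈ Λ := by
  have hv' : -v ∈ N := (F.neg_mem_iff v hv).mpr h0
  have e1 := F.neg_y hv hv'
  have e2 := F.neg_x hv hv'
  have e3 := F.curve v hv
  have e1' : y (-v) = 1 / y v := by rw [eq_div_iff h0, ← e1]; ring
  have e2' : x (-v) = - x v / y v := by rw [eq_div_iff h0, ← e2]
  by_cases hc : 1 + x v ^ 3 = 0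
  · have hy3 : y v ^ 3 = 2 := by linear_combination e3 - hc
    have hD : y u + x u ^ 2 * x (-v) * y (-v) ≠ 0 := by
      rw [hx, hy, e1', e2']
      have : y v + x v ^ 2 * (-x v / y v) * (1 / y v) = 3 / y v ^ 2 := by
        field_simp
        linear_combination hy3 - hc
      rw [this]
      exact div_ne_zero (by norm_num) (pow_ne_zero _ h0)
    have hN := F.add_mem hv' hu hD
    have h2 := F.add_y hv' hu hN
    have h3 : y (-v + u) = 1 := by
      apply mul_right_cancel₀ hD
      rw [h2, hx, hy, e1', e2']
      field_simp
      ring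
    have := (F.mem_iff _ hN).mp h3
    rwa [neg_add_eq_sub] at this
  · have hD : y (-v) + x (-v) ^ 2 * x u * y u ≠ 0 := by
      rw [hx, hy, e1', e2']
      have : 1 / y v + (-x v / y v) ^ 2 * x v * y v = (1 + x v ^ 3) / y v := by
        field_simp
      rw [this]
      exact div_ne_zero hc h0
    have hN := F.add_mem hu hv' hD
    have h2 := F.add_y hu hv' hN
    have h3 : y (u + -v) = 1 := by
      apply mul_right_cancel₀ hD
      rw [h2, hx, hy, e1', e2']
      field_simp
      ring
    have := (F.mem_iff _ hN).mp h3
    rwa [← sub_eq_add_neg] at this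

lemma sub_mem {u v : ℂ} (hu : u ∈ N) (hv : v ∈ N) (hx : x u = x v) (hy : y u = y v) :
    u - v ∈ Λ := by
  by_cases h0 : y v = 0
  · obtain ⟨e, he, hxe, hye⟩ := F.exists_generic
    have key : ∀ u ∈ N, y u = 0 → u + e ∈ N ∧ x (u + e) * y e = x u ∧
        y (u + e) * y e = -x u ^ 2 * x e := by
      intro u hu hy
      have hN := F.add_mem hu he (by rw [hy]; simpa using hye)
      have h1 := F.add_x hu he hN
      have h2 := F.add_y hu he hN
      rw [hy] at h1 h2
      exact ⟨hN, by linear_combination h1, by linear_combination h2⟩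
    obtain ⟨a1, a2, a3⟩ := key u hu (by rw [hy, h0])
    obtain ⟨b1, b2, b3⟩ := key v hv h0
    have := F.sub_mem_of_ne a1 b1 (mul_right_cancel₀ hye (by rw [a2, b2, hx]))
      (mul_right_cancel₀ hye (by rw [a3, b3, hx])) ?_
    · simpa using this
    · intro h
      rw [h, zero_mul] at b3
      have h3 := F.curve v hv
      rw [h0] at h3
      have hxv : x v ≠ 0 := by
        intro h
        rw [h] at h3
        norm_num at h3
      have h4 : x v ^ 2 * x e = 0 := by linear_combination b3
      exact mul_ne_zero (pow_ne_zero 2 hxv) hxe h4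
  · exact F.sub_mem_of_ne hu hv hx hy h0

/-- Zeros of `y` are `3`-torsion points. -/
lemma three_mul_mem {v : ℂ} (hv : v ∈ N) (hy : y v = 0) : 3 * v ∈ Λ := by
  obtain ⟨e, he, hxe, hye⟩ := F.exists_generic
  have hc := F.curve v hv
  have hxv : x v ^ 3 = 1 := by rw [hy] at hc; linear_combination hc
  have hxv0 : x v ≠ 0 := by
    intro h
    rw [h] at hxv
    norm_num at hxv
  have key : ∀ w ∈ N, x w ≠ 0 → y w ≠ 0 → v + w ∈ N ∧ x (v + w) ≠ 0 ∧ y (v + w) ≠ 0 ∧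
      x (v + w) = x v / y w ∧ y (v + w) = -x v ^ 2 * x w / y w := by
    intro w hw hxw hyw
    have hN := F.add_mem hv hw (by rw [hy]; simpa using hyw)
    have h1 := F.add_x hv hw hN
    have h2 := F.add_y hv hw hN
    rw [hy] at h1 h2
    have h3 : x (v + w) = x v / y w := by
      rw [eq_div_iff hyw]
      linear_combination h1
    have h4 : y (v + w) = -x v ^ 2 * x w / y w := by
      rw [eq_div_iff hyw]
      linear_combination h2
    refine ⟨hN, ?_, ?_, h3, h4⟩
    · rw [h3]; positivity
    · rw [h4]
      exact div_ne_zero (mul_ne_zero (neg_ne_zero.mpr (pow_ne_zero _ hxv0)) hxw) hyw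
  obtain ⟨a1, a2, a3, a4, a5⟩ := key e he hxe hye
  obtain ⟨b1, b2, b3, b4, b5⟩ := key _ a1 a2 a3
  obtain ⟨c1, c2, c3, c4, c5⟩ := key _ b1 b2 b3
  have := F.sub_mem c1 he ?_ ?_
  · convert this using 1
    ring
  · rw [c4, b5, a4, a5]
    field_simp
  · rw [c5, b4, b5, a4, a5]
    field_simp

/-- Points killed by `1 - ρ` are zeros of `x`. -/
lemma x_eq_zero {u : ℂ} (h : (1 - ρ3) * u ∈ Λ) : x u = 0 := by
  have h1 := F.x_per (ρ3 * u) _ h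
  rw [show ρ3 * u + (1 - ρ3) * u = u by ring, F.x_rho] at h1
  have h2 : (ρ3 - 1) * x u = 0 := by linear_combination -h1
  rcases mul_eq_zero.mp h2 with h3 | h3
  · exfalso
    have := rho_sq
    have h4 : ρ3 = 1 := sub_eq_zero.mp h3
    rw [h4] at this
    norm_num at this
  · exact h3

lemma mem_of_x_eq_zero {u : ℂ} (hu : u ∈ N) (h : x u = 0) : (1 - ρ3) * u ∈ Λ := by
  have := F.sub_mem hu ((F.N_rho u).mpr hu) (by rw [F.x_rho, h, mul_zero]) (F.y_rho u).symm
  convert this using 1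
  ring

/-- Multiplication by `√-3`. -/
lemma mul_sqrtm3 {u : ℂ} (hu : u ∈ N) (hy : y u ≠ 0) (hN : (ρ3 - ρ3 ^ 2) * u ∈ N) :
    x ((ρ3 - ρ3 ^ 2) * u) * (1 + ρ3 ^ 2 * x u ^ 3) = (ρ3 - ρ3 ^ 2) * (x u * y u) ∧
    y ((ρ3 - ρ3 ^ 2) * u) * (1 + ρ3 ^ 2 * x u ^ 3) = 1 + ρ3 * x u ^ 3 := by
  have hu' : -u ∈ N := (F.neg_mem_iff u hu).mpr hy
  have e1 := F.neg_y hu hu'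
  have e2 := F.neg_x hu hu'
  have e1' : y (-u) = 1 / y u := by rw [eq_div_iff hy, ← e1]; ring
  have e2' : x (-u) = - x u / y u := by rw [eq_div_iff hy, ← e2]
  have m1 : ρ3 * u ∈ N := (F.N_rho u).mpr hu
  have m2 : ρ3 * (ρ3 * -u) ∈ N := (F.N_rho _).mpr ((F.N_rho _).mpr hu')
  have hs : ρ3 * u + ρ3 * (ρ3 * -u) = (ρ3 - ρ3 ^ 2) * u := by ring
  rw [← hs] at hN ⊢
  have h1 := F.add_x m1 m2 hN
  have h2 := F.add_y m1 m2 hN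
  simp only [F.x_rho, F.y_rho, e1', e2'] at h1 h2
  have r3 := rho_pow_three
  generalize x (ρ3 * u + ρ3 * (ρ3 * -u)) = X at h1 ⊢
  generalize y (ρ3 * u + ρ3 * (ρ3 * -u)) = Y at h2 ⊢
  generalize x u = a at *
  generalize y u = b at *
  constructor
  · have h3 : X * (1 + ρ3 ^ 5 * a ^ 3) = (ρ3 - ρ3 ^ 2) * (a * b) := by
      field_simp at h1
      linear_combination h1
    linear_combination h3 - X * ρ3 ^ 2 * a ^ 3 * r3
  · have h3 : Y * (1 + ρ3 ^ 5 * a ^ 3) = 1 + ρ3 ^ 4 * a ^ 3 := by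
      field_simp at h2
      linear_combination h2
    linear_combination h3 - Y * ρ3 ^ 2 * a ^ 3 * r3 + ρ3 * a ^ 3 * r3

lemma rho_mul_mem {l : ℂ} (hl : l ∈ Λ) : ρ3 * l ∈ Λ := by
  have h0 : l ∈ N := by
    have := (F.N_per 0 l hl).mpr F.zero_mem
    rwa [zero_add] at this
  have h1 : y l = 1 := (F.mem_iff l h0).mpr hl
  exact (F.mem_iff _ ((F.N_rho l).mpr h0)).mp (by rw [F.y_rho, h1])

/-- A `3`-torsion point not killed by `1 - ρ` is a pole or a zero of `y`. -/
lemma notMem_or_y_eq_zero {v : ℂ} (h3 : 3 * v ∈ Λ) (h : (1 - ρ3) * v ∉ Λ) : v ∉ N ∨ y v = 0 := by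
  by_contra! hcon
  obtain ⟨hv, hy⟩ := hcon
  have hx : x v ≠ 0 := fun hx => h (F.mem_of_x_eq_zero hv hx)
  have e : (1 - ρ3) * ((ρ3 - ρ3 ^ 2) * v) = -(ρ3 * (ρ3 * (3 * v))) := by
    linear_combination v * (ρ3 * rho_sq)
  have hw : (1 - ρ3) * ((ρ3 - ρ3 ^ 2) * v) ∈ Λ := by
    rw [e]
    exact Λ.neg_mem (F.rho_mul_mem (F.rho_mul_mem h3))
  by_cases hN : (ρ3 - ρ3 ^ 2) * v ∈ N
  · have h1 := (F.mul_sqrtm3 hv hy hN).1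
    rw [F.x_eq_zero hw, zero_mul] at h1
    exact mul_ne_zero sqrt_ne_zero (mul_ne_zero hx hy) h1.symm
  · have h1 := F.neg_of_notMem _ hN
    have h2 : y (-((ρ3 - ρ3 ^ 2) * v)) = 0 := by
      by_contra h2
      have := (F.neg_mem_iff _ h1).mpr h2
      rw [neg_neg] at this
      exact hN this
    have h3 : x (-((ρ3 - ρ3 ^ 2) * v)) = 0 := by
      apply F.x_eq_zero
      rw [mul_neg]
      exact Λ.neg_mem hw
    have := F.curve _ h1
    rw [h2, h3] at this
    norm_num at this

end IsFermatUnif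

end FermatCurve

namespace FermatCurve

lemma add_formulas {x y t s A B : ℂ} (h1 : x * t * A = y * s - B) (h2 : t * y * B = A * s - x) :
    A * (s + t ^ 2 * x * y) = x + y ^ 2 * t * s ∧ B * (s + t ^ 2 * x * y) = s ^ 2 * y - x ^ 2 * t := by
  constructor
  · linear_combination t * y * h1 - h2
  · linear_combination s * h1 + x * t * h2

/-- The two pairs of addition formulas are never both degenerate. -/
lemma denominators_ne_zero {x y t s A B : ℂ} (c1 : x ^ 3 + y ^ 3 = 1) (c2 : t ^ 3 + s ^ 3 = 1)
    (h1 : x * t * A = y * s - B) (h2 : t * y * B = A * s - x) (h2' : x * s * B = A * y - t)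
    (d1 : s + t ^ 2 * x * y = 0) (d2 : y + x ^ 2 * t * s = 0) : False := by
  have e1 := add_formulas h1 h2
  have e2 := add_formulas (x := t) (y := s) (t := x) (s := y) (by linear_combination h1) h2'
  rw [d1, mul_zero, mul_zero] at e1
  rw [d2, mul_zero, mul_zero] at e2
  obtain ⟨n1, n2⟩ := e1
  obtain ⟨n3, n4⟩ := e2
  have hy : y ≠ 0 := by
    rintro rfl
    have hx : x = 0 := by linear_combination -n1
    rw [hx] at c1
    norm_num at c1
  have hs : s ≠ 0 := by
    rintro rfl
    have ht : t = 0 := by linear_combination -n3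
    rw [ht] at c2
    norm_num at c2
  have a1 : x ^ 3 * t ^ 3 = 1 := by
    apply mul_right_cancel₀ hy
    linear_combination x ^ 2 * t * d1 - d2
  have hx : x ≠ 0 := by
    rintro rfl
    norm_num at a1
  have ht : t ≠ 0 := by
    rintro rfl
    norm_num at a1
  have a2 : y ^ 3 * s ^ 3 = 1 := by
    apply mul_right_cancel₀ hx
    linear_combination n1 - y ^ 2 * s * n3
  have a3 : s ^ 3 = -1 := by
    apply mul_left_cancel₀ (mul_ne_zero (pow_ne_zero 2 hx) ht)
    linear_combination n2 + s ^ 2 * d2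
  have a4 : y ^ 3 = -1 := by rw [a3] at a2; linear_combination -a2
  rw [a4] at c1
  rw [a3] at c2
  rw [show x ^ 3 = 2 by linear_combination c1, show t ^ 3 = 2 by linear_combination c2] at a1
  norm_num at a1

namespace IsFermatUnif

variable {k : ℂ} {x y : ℂ → ℂ} {N : Set ℂ} {Λ : AddSubgroup ℂ} (F : IsFermatUnif k x y N Λ)
include F

/-- A sequence of points on the Fermat cubic which satisfies the addition laws is the sequence of
multiples of a point. -/
lemma exists_multiples (ξ η : ℕ → ℂ) (h0 : ξ 0 = 0) (h1 : η 0 = 1)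
    (hc : ∀ j, ξ j ^ 3 + η j ^ 3 = 1)
    (hI1 : ∀ i j, ξ i * ξ j * ξ (i + j) = η i * η j - η (i + j))
    (hI2 : ∀ i j, ξ j * η i * η (i + j) = ξ (i + j) * η j - ξ i) :
    ∃ w : ℂ, ∀ j : ℕ, (j : ℂ) * w ∈ N ∧ x (j * w) = ξ j ∧ y (j * w) = η j := by
  obtain ⟨w, hw, hwx, hwy⟩ := F.surj _ _ (hc 1)
  refine ⟨w, fun j => ?_⟩
  induction j with
  | zero => simpa [F.x0, F.y0, h0, h1] using F.zero_mem
  | succ j ih =>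
    obtain ⟨a1, a2, a3⟩ := ih
    have e1 := add_formulas (hI1 j 1) (hI2 j 1)
    have hI2' := hI2 1 j
    rw [add_comm 1 j] at hI2'
    have e2 := add_formulas (x := ξ 1) (y := η 1) (t := ξ j) (s := η j)
      (by linear_combination hI1 j 1) hI2'
    have hcast : ((j + 1 : ℕ) : ℂ) * w = j * w + w := by push_cast; ring
    rw [hcast]
    by_cases hD : η 1 + ξ 1 ^ 2 * ξ j * η j = 0
    · have hD' : η j + ξ j ^ 2 * ξ 1 * η 1 ≠ 0 := fun h =>
        denominators_ne_zero (hc j) (hc 1) (hI1 j 1) (hI2 j 1) hI2' hD h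
      have hDx : y (j * w) + x (j * w) ^ 2 * x w * y w ≠ 0 := by
        rwa [a2, a3, hwx, hwy]
      have hN := F.add_mem hw a1 hDx
      refine ⟨by rwa [add_comm], ?_, ?_⟩
      · apply mul_right_cancel₀ hD'
        rw [e2.1, ← hwx, ← hwy, ← a2, ← a3, add_comm (_ * w), F.add_x hw a1 hN]
      · apply mul_right_cancel₀ hD'
        rw [e2.2, ← hwx, ← hwy, ← a2, ← a3, add_comm (_ * w), F.add_y hw a1 hN]
    · have hDx : y w + x w ^ 2 * x (j * w) * y (j * w) ≠ 0 := by
        rwa [a2, a3, hwx, hwy]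
      have hN := F.add_mem a1 hw hDx
      refine ⟨hN, ?_, ?_⟩
      · apply mul_right_cancel₀ hD
        rw [e1.1, ← hwx, ← hwy, ← a2, ← a3, F.add_x a1 hw hN]
      · apply mul_right_cancel₀ hD
        rw [e1.2, ← hwx, ← hwy, ← a2, ← a3, F.add_y a1 hw hN]

end IsFermatUnif

end FermatCurve

namespace FermatCurve

open Topology Filter
open scoped PeriodPair

/-- The `℘`-function takes every value. -/
lemma exists_weierstrassP_eq (L : PeriodPair) (c : ℂ) : ∃ u, u ∉ L.lattice ∧ ℘[L] u = c := by
  by_contra! hcon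
  classical
  set f : ℂ → ℂ := fun u => if u ∈ L.lattice then 0 else (℘[L] u - c)⁻¹ with hf
  have hper : ∀ u, ∀ l ∈ L.lattice, f (u + l) = f u := by
    intro u l hl
    simp only [hf, add_mem_lattice_iff u l hl, L.weierstrassP_add_coe u ⟨l, hl⟩]
  have hd1 : ∀ u, u ∉ L.lattice → DifferentiableAt ℂ f u := by
    intro u hu
    have h1 : f =ᶠ[𝓝 u] fun u => (℘[L] u - c)⁻¹ := by
      filter_upwards [IsFermatData.eventually_notMem hu] with w hw
      simp [hf, hw]
    refine DifferentiableAt.congr_of_eventuallyEq ?_ h1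
    exact ((L.analyticOnNhd_weierstrassP u hu).differentiableAt.sub_const c).inv
      (sub_ne_zero.mpr (hcon u hu))
  have hd0 : DifferentiableAt ℂ f 0 := by
    apply AnalyticAt.differentiableAt
    apply analyticAt_of_differentiable_on_punctured_nhds_of_continuousAt
    · filter_upwards [eventually_notMem_lattice L] with z hz using hd1 z hz
    · rw [continuousAt_iff_punctured_nhds]
      have h0 : f 0 = 0 := by simp [hf]
      rw [h0]
      have h1 : Tendsto (fun u => (℘[L] u - c)⁻¹) (𝓝[≠] 0) (𝓝 0) := by
        apply tendsto_inv₀_cobounded.comp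
        have h2 := tendsto_weierstrassP_cobounded L
        rw [← tendsto_norm_atTop_iff_cobounded]
        refine tendsto_atTop_mono (f := fun u => ‖℘[L] u‖ - ‖c‖) (fun u => norm_sub_norm_le _ _) ?_
        exact tendsto_atTop_add_const_right _ _ h2
      refine h1.congr' ?_
      filter_upwards [eventually_notMem_lattice L] with z hz
      simp [hf, hz]
  have hd : Differentiable ℂ f := by
    intro u
    by_cases hu : u ∈ L.lattice
    · have e : f = fun w => f (w + -u) := funext fun w => (hper w _ (neg_mem hu)).symm
      rw [e]
      have : DifferentiableAt ℂ f (u + -u) := by simpa using hd0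
      exact this.comp u (by fun_prop : DifferentiableAt ℂ (fun w => w + -u) u)
    · exact hd1 u hu
  have h2 := hd.apply_eq_apply_of_bounded (IsZLattice.isCompact_range_of_periodic L.lattice f
    hd.continuous (fun z w hw => hper z w hw)).isBounded 0 (L.ω₁ / 2)
  have h3 := L.ω₁_div_two_notMem_lattice
  simp only [hf, h3, if_false, zero_mem, if_true] at h2
  exact inv_ne_zero (sub_ne_zero.mpr (hcon _ h3)) h2.symm

/-- The discriminant of an equianharmonic lattice does not vanish. -/
lemma g3_ne_zero (L : PeriodPair) (h2 : L.g₂ = 0) : L.g₃ ≠ 0 := by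
  intro h3
  have hu := L.ω₁_div_two_notMem_lattice
  set u := L.ω₁ / 2 with hu_def
  have h1 : ℘'[L] u = 0 := by
    have e := L.derivWeierstrassP_add_coe (-u) ⟨L.ω₁, L.ω₁_mem_lattice⟩
    rw [show -u + ((⟨L.ω₁, L.ω₁_mem_lattice⟩ : L.lattice) : ℂ) = u by
      simp only [hu_def]; ring, L.derivWeierstrassP_neg] at e
    linear_combination e / 2
  have hs := sq_of_g2 h2 u hu
  have hP : ℘[L] u = 0 := by
    rw [h1, h3] at hs
    have : ℘[L] u ^ 3 = 0 := by linear_combination -hs / 4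
    exact pow_eq_zero_iff (by norm_num) |>.mp this
  have hA := L.analyticOnNhd_weierstrassP u hu
  have hA' := L.analyticOnNhd_derivWeierstrassP u hu
  have e1 := hA.analyticOrderAt_deriv_add_one
  simp only [hP, sub_zero, L.deriv_weierstrassP] at e1
  have e2 : analyticOrderAt (℘'[L] ^ 2) u = analyticOrderAt ((fun _ => (4:ℂ)) * ℘[L] ^ 3) u := by
    apply analyticOrderAt_congr
    filter_upwards [IsFermatData.eventually_notMem hu] with w hw
    have := sq_of_g2 h2 w hw
    rw [h3, sub_zero] at this
    simpa using this
  rw [analyticOrderAt_mul analyticAt_const (hA.pow 3), analyticOrderAt_pow hA',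
    analyticOrderAt_pow hA] at e2
  have e3 : analyticOrderAt (fun _ : ℂ => (4:ℂ)) u = 0 := by
    rw [analyticOrderAt_eq_zero]; right; norm_num
  rw [e3, ← e1, zero_add] at e2
  have hfin : analyticOrderAt ℘'[L] u ≠ ⊤ := by
    intro ht
    have ht' : analyticOrderAt ℘[L] u = ⊤ := by
      rw [← e1, ht]; rfl
    have hpre : IsPreconnected (L.latticeᶜ : Set ℂ) := by
      have hc : (L.lattice : Set ℂ).Countable := Set.countable_coe_iff.mp
        (inferInstanceAs (Countable L.lattice))
      exact (hc.isPathConnected_compl_of_one_lt_rank (by simp)).isConnected.isPreconnected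
    have h0 := L.analyticOnNhd_weierstrassP.eqOn_zero_of_preconnected_of_eventuallyEq_zero hpre hu
      (analyticOrderAt_eq_top.mp ht')
    obtain ⟨v, hv, hv1⟩ := exists_weierstrassP_eq L 1
    have := h0 hv
    rw [hv1] at this
    norm_num at this
  lift analyticOrderAt ℘'[L] u to ℕ using hfin with d
  have e4 : ((2 * d : ℕ) : ℕ∞) = ((3 * d + 3 : ℕ) : ℕ∞) := by simpa using e2
  have e5 : 2 * d = 3 * d + 3 := by exact_mod_cast e4
  omega

namespace IsFermatData

variable {L : PeriodPair} {h a : ℂ} (H : IsFermatData L h a)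
include H

lemma surj (X Y : ℂ) (hXY : X ^ 3 + Y ^ 3 = 1) : ∃ u ∈ fN L h, fx L h a u = X ∧ fy L h u = Y := by
  by_cases hY : Y = 1
  · have hX : X = 0 := by
      have : X ^ 3 = 0 := by rw [hY] at hXY; linear_combination hXY
      exact pow_eq_zero_iff (by norm_num) |>.mp this
    exact ⟨0, zero_mem_fN, by rw [fx_coe (zero_mem _), hX], by rw [fy_coe (zero_mem _), hY]⟩
  · have hY1 : 1 - Y ≠ 0 := sub_ne_zero.mpr (Ne.symm hY)
    have ha := H.a0
    have hh := H.h0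
    obtain ⟨u, hu, hP⟩ := exists_weierstrassP_eq L (2 * h * X / (a * (1 - Y)))
    have hs := H.sq u hu
    have h4 : (℘'[L] u - h * (1 + Y) / (1 - Y)) * (℘'[L] u + h * (1 + Y) / (1 - Y)) = 0 := by
      have : 4 * (2 * h * X / (a * (1 - Y))) ^ 3 - h ^ 2 / 3 = (h * (1 + Y) / (1 - Y)) ^ 2 := by
        rw [div_pow, mul_pow a, H.a3]
        field_simp
        linear_combination 96 * hXY
      rw [hP, this] at hs
      linear_combination hs
    have key : ∀ v, v ∉ L.lattice → ℘[L] v = 2 * h * X / (a * (1 - Y)) →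
        ℘'[L] v = h * (1 + Y) / (1 - Y) → ∃ u ∈ fN L h, fx L h a u = X ∧ fy L h u = Y := by
      intro v hv e1 e2
      have e3 : h + ℘'[L] v = 2 * h / (1 - Y) := by
        rw [e2]; field_simp; ring
      have e4 : h + ℘'[L] v ≠ 0 := by
        rw [e3]; exact div_ne_zero (mul_ne_zero two_ne_zero hh) hY1
      refine ⟨v, Or.inr e4, ?_, ?_⟩
      · rw [fx, e3, e1]; field_simp
      · rw [fy, if_neg hv, add_comm, e3, e2]; field_simp; ring
    rcases mul_eq_zero.mp h4 with h5 | h5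
    · exact key u hu hP (sub_eq_zero.mp h5)
    · refine key (-u) (fun hn => hu (by simpa using neg_mem hn)) ?_ ?_
      · rw [L.weierstrassP_neg, hP]
      · rw [L.derivWeierstrassP_neg]
        linear_combination -h5

lemma neg_of_notMem (u : ℂ) (hu : u ∉ fN L h) : -u ∈ fN L h := by
  have hL : u ∉ L.lattice := fun hh => hu (Or.inl hh)
  have h1 : h + ℘'[L] u = 0 := by simpa [fN, hL] using hu
  refine Or.inr ?_
  rw [L.derivWeierstrassP_neg, show ℘'[L] u = -h by linear_combination h1, neg_neg, ← two_mul]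
  exact mul_ne_zero two_ne_zero H.h0

lemma isFermatFlow : IsFermatFlow (-a / 2) (fx L h a) (fy L h) (fN L h) where
  isOpen := IsFermatData.isOpen_fN
  countable := H.countable_compl_fN
  zero_mem := zero_mem_fN
  x0 := fx_coe (zero_mem _)
  y0 := fy_coe (zero_mem _)
  curve := H.curve
  dx u hu := (H.hasDerivAt hu).1
  dy u hu := by
    convert (H.hasDerivAt hu).2 using 1
    ring
  isolated u hu := by
    filter_upwards [H.eventually_mem_fN_of_notMem hu] with w hw using Or.inr hw
  pole u hu := H.tendsto_norm_of_notMem hu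

lemma isFermatUnif (hρ : ∀ l, ρ3 * l ∈ L.lattice ↔ l ∈ L.lattice)
    (hP : ∀ u, ℘[L] (ρ3 * u) = ρ3 * ℘[L] u) (hP' : ∀ u, ℘'[L] (ρ3 * u) = ℘'[L] u) :
    IsFermatUnif (-a / 2) (fx L h a) (fy L h) (fN L h) L.lattice.toAddSubgroup where
  toIsFermatFlow := H.isFermatFlow
  mem_iff := H.eq_one_iff
  neg_mem_iff := IsFermatData.neg_mem_iff
  neg_of_notMem := H.neg_of_notMem
  x_per u l hl := fx_add_coe u l hl
  y_per u l hl := fy_add_coe u l hl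
  N_per u l hl := add_mem_fN_iff u l hl
  surj := H.surj
  x_rho u := by rw [fx, fx, hP, hP']; ring
  y_rho u := by
    unfold fy
    rw [hP']
    have := hρ u
    split_ifs <;> tauto
  N_rho u := by
    change ρ3 * u ∈ L.lattice ∨ _ ↔ u ∈ L.lattice ∨ _
    rw [hρ, hP']

end IsFermatData

/-- Rescaling the uniformizing variable. -/
lemma IsFermatUnif.scale {k : ℂ} {x y : ℂ → ℂ} {N : Set ℂ} {Λ Λ' : AddSubgroup ℂ}
    (F : IsFermatUnif k x y N Λ) (c : ℂ) (hc : c ≠ 0) (hΛ : ∀ u, u ∈ Λ' ↔ c * u ∈ Λ) :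
    IsFermatUnif (k * c) (fun u => x (c * u)) (fun u => y (c * u)) {u | c * u ∈ N} Λ' := by
  have hcont : Continuous fun u : ℂ => c * u := by fun_prop
  have hinj : Function.Injective fun u : ℂ => c * u := mul_right_injective₀ hc
  have hd : ∀ u, HasDerivAt (fun u : ℂ => c * u) c u := fun u => by
    simpa using (hasDerivAt_id u).const_mul c
  have ht : ∀ u, Tendsto (fun u : ℂ => c * u) (𝓝[≠] u) (𝓝[≠] (c * u)) := fun u =>
    (hcont.continuousAt.continuousWithinAt).tendsto_nhdsWithin (fun w hw h => hw (hinj h))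
  have hflow : IsFermatFlow (k * c) (fun u => x (c * u)) (fun u => y (c * u)) {u | c * u ∈ N} := by
    refine ⟨F.isOpen.preimage hcont, F.countable.preimage hinj, by simpa using F.zero_mem,
      by simpa using F.x0, by simpa using F.y0, fun u hu => F.curve _ hu, fun u hu => ?_,
      fun u hu => ?_, fun u hu => (ht u).eventually (F.isolated _ hu),
      fun u hu => (F.pole _ hu).comp (ht u)⟩
    · have := (F.dx _ hu).comp u (hd u)
      convert! this using 1
      ring
    · have := (F.dy _ hu).comp u (hd u)
      convert! this using 1
      ring
  refine ⟨hflow, fun u hu => (F.mem_iff _ hu).trans (hΛ u).symm, fun u hu => ?_, fun u hu => ?_,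
    fun u l hl => ?_, fun u l hl => ?_, fun u l hl => ?_, fun X Y h => ?_, fun u => ?_, fun u => ?_,
    fun u => ?_⟩
  · have := F.neg_mem_iff _ hu
    rwa [← mul_neg] at this
  · have := F.neg_of_notMem _ hu
    rwa [← mul_neg] at this
  · rw [mul_add, F.x_per _ _ ((hΛ l).mp hl)]
  · rw [mul_add, F.y_per _ _ ((hΛ l).mp hl)]
  · have := F.N_per (c * u) _ ((hΛ l).mp hl)
    rwa [← mul_add] at this
  · obtain ⟨u, hu, h1, h2⟩ := F.surj X Y h
    have e : c * (u / c) = u := by field_simp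
    exact ⟨u / c, by rwa [Set.mem_ofPred_eq, e], by rw [e, h1], by rw [e, h2]⟩
  · rw [mul_left_comm, F.x_rho]
  · rw [mul_left_comm, F.y_rho]
  · have := F.N_rho (c * u)
    rwa [mul_left_comm] at this

end FermatCurve

namespace FermatCurve

open Topology Filter
open scoped PeriodPair ComplexConjugate

lemma rho_re_im : ρ3.re = -1 / 2 ∧ ρ3.im = Real.sqrt 3 / 2 := by
  have h : ρ3 = Complex.exp ((2 * Real.pi / 3 : ℝ) * Complex.I) := by
    rw [ρ3]; congr 1; push_cast; ring
  have e : 2 * Real.pi / 3 = Real.pi - Real.pi / 3 := by ring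
  rw [h, Complex.exp_ofReal_mul_I_re, Complex.exp_ofReal_mul_I_im, e, Real.cos_pi_sub,
    Real.sin_pi_sub, Real.cos_pi_div_three, Real.sin_pi_div_three]
  norm_num

lemma conj_rho : conj ρ3 = -1 - ρ3 := by
  obtain ⟨h1, h2⟩ := rho_re_im
  apply Complex.ext
  · simp [h1]; norm_num
  · simp

lemma mem_O3_iff {u : ℂ} : u ∈ O3 ↔ ∃ m n : ℤ, u = m + n * ρ3 := by
  constructor
  · intro h
    induction h using Subring.closure_induction with
    | mem x hx => exact ⟨0, 1, by rw [Set.mem_singleton_iff.mp hx]; simp⟩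
    | zero => exact ⟨0, 0, by simp⟩
    | one => exact ⟨1, 0, by simp⟩
    | add x y _ _ h1 h2 =>
      obtain ⟨a, b, rfl⟩ := h1
      obtain ⟨c, d, rfl⟩ := h2
      exact ⟨a + c, b + d, by push_cast; ring⟩
    | neg x _ h1 =>
      obtain ⟨a, b, rfl⟩ := h1
      exact ⟨-a, -b, by push_cast; ring⟩
    | mul x y _ _ h1 h2 =>
      obtain ⟨a, b, rfl⟩ := h1
      obtain ⟨c, d, rfl⟩ := h2
      refine ⟨a * c - b * d, a * d + b * c - b * d, ?_⟩
      push_cast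
      linear_combination (b * d : ℂ) * rho_sq
  · rintro ⟨m, n, rfl⟩
    exact add_mem (intCast_mem _ _) (mul_mem (intCast_mem _ _) (Subring.subset_closure rfl))

lemma rho_mem : ρ3 ∈ O3 := Subring.subset_closure rfl

lemma conj_mem_O3 {u : ℂ} (h : u ∈ O3) : conj u ∈ O3 := by
  obtain ⟨m, n, rfl⟩ := mem_O3_iff.mp h
  refine mem_O3_iff.mpr ⟨m - n, -n, ?_⟩
  simp [conj_rho]
  ring

/-- The equianharmonic lattice with real period `ω`. -/
def eisPair (ω : ℝ) (hω : ω ≠ 0) : PeriodPair where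
  ω₁ := ω
  ω₂ := ω * ρ3
  indep := by
    obtain ⟨h1, h2⟩ := rho_re_im
    rw [LinearIndependent.pair_iff]
    intro s t hst
    have him := congrArg Complex.im hst
    have hre := congrArg Complex.re hst
    simp [h1, h2] at him hre
    have h3 : t = 0 := by tauto
    rw [h3] at hre
    simp at hre
    exact ⟨by tauto, h3⟩

variable {ω : ℝ} {hω : ω ≠ 0}

lemma mem_eisPair {u : ℂ} : u ∈ (eisPair ω hω).lattice ↔ ∃ l ∈ O3, u = ω * l := by
  rw [PeriodPair.mem_lattice]
  constructor
  · rintro ⟨m, n, h⟩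
    refine ⟨m + n * ρ3, mem_O3_iff.mpr ⟨m, n, rfl⟩, ?_⟩
    rw [← h]
    simp [eisPair]
    ring
  · rintro ⟨l, hl, rfl⟩
    obtain ⟨m, n, rfl⟩ := mem_O3_iff.mp hl
    refine ⟨m, n, ?_⟩
    simp [eisPair]
    ring

lemma mul_mem_eisPair {u : ℂ} : ω * u ∈ (eisPair ω hω).lattice ↔ u ∈ O3 := by
  rw [mem_eisPair]
  have h0 : (ω : ℂ) ≠ 0 := by exact_mod_cast hω
  constructor
  · rintro ⟨l, hl, h⟩
    rwa [mul_left_cancel₀ h0 h]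
  · intro h
    exact ⟨u, h, rfl⟩

lemma rho_mul_mem_eisPair (l : ℂ) : ρ3 * l ∈ (eisPair ω hω).lattice ↔ l ∈ (eisPair ω hω).lattice := by
  have key : ∀ l, l ∈ (eisPair ω hω).lattice → ρ3 * l ∈ (eisPair ω hω).lattice := by
    intro l hl
    obtain ⟨m, hm, rfl⟩ := mem_eisPair.mp hl
    exact mem_eisPair.mpr ⟨ρ3 * m, mul_mem rho_mem hm, by ring⟩
  refine ⟨fun h => ?_, key l⟩
  have := key _ (key _ h)
  rwa [show ρ3 * (ρ3 * (ρ3 * l)) = l by linear_combination l * rho_pow_three] at this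

lemma conj_mem_eisPair (l : ℂ) : conj l ∈ (eisPair ω hω).lattice ↔ l ∈ (eisPair ω hω).lattice := by
  have key : ∀ l, l ∈ (eisPair ω hω).lattice → conj l ∈ (eisPair ω hω).lattice := by
    intro l hl
    obtain ⟨m, hm, rfl⟩ := mem_eisPair.mp hl
    exact mem_eisPair.mpr ⟨conj m, conj_mem_O3 hm, by simp⟩
  refine ⟨fun h => ?_, key l⟩
  have := key _ h
  rwa [Complex.conj_conj] at this

/-- Multiplication by `ρ` on the lattice. -/
def rhoEquiv (ω : ℝ) (hω : ω ≠ 0) : (eisPair ω hω).lattice ≃ (eisPair ω hω).lattice :=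
  (Equiv.mulLeft₀ ρ3 rho_ne_zero).subtypeEquiv fun l => (rho_mul_mem_eisPair l).symm

/-- Complex conjugation on the lattice. -/
def conjEquiv (ω : ℝ) (hω : ω ≠ 0) : (eisPair ω hω).lattice ≃ (eisPair ω hω).lattice :=
  (Function.Involutive.toPerm _ Complex.conj_conj).subtypeEquiv fun l => (conj_mem_eisPair l).symm

lemma inv_rho_pow (l : ℂ) : ((ρ3 * l) ^ 2)⁻¹ = ρ3 * (l ^ 2)⁻¹ ∧ ((ρ3 * l) ^ 3)⁻¹ = (l ^ 3)⁻¹ := by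
  have h := rho_pow_three
  have h0 := rho_ne_zero
  have h2 : (ρ3 ^ 2)⁻¹ = ρ3 := by
    rw [inv_eq_iff_eq_inv]
    exact eq_inv_of_mul_eq_one_left (by linear_combination h)
  constructor
  · rw [mul_pow, mul_inv, h2]
  · rw [mul_pow, h, one_mul]

lemma weierstrassP_rho (u : ℂ) : ℘[eisPair ω hω] (ρ3 * u) = ρ3 * ℘[eisPair ω hω] u := by
  rw [PeriodPair.weierstrassP, PeriodPair.weierstrassP, ← tsum_mul_left,
    ← (rhoEquiv ω hω).tsum_eq]
  refine tsum_congr fun l => ?_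
  have e : (((rhoEquiv ω hω l : (eisPair ω hω).lattice)) : ℂ) = ρ3 * l := rfl
  rw [e, ← mul_sub, one_div, one_div, (inv_rho_pow _).1, (inv_rho_pow _).1]
  ring

lemma derivWeierstrassP_rho (u : ℂ) : ℘'[eisPair ω hω] (ρ3 * u) = ℘'[eisPair ω hω] u := by
  rw [PeriodPair.derivWeierstrassP, PeriodPair.derivWeierstrassP, ← (rhoEquiv ω hω).tsum_eq]
  congr 1
  refine tsum_congr fun l => ?_
  have e : (((rhoEquiv ω hω l : (eisPair ω hω).lattice)) : ℂ) = ρ3 * l := rfl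
  rw [e, ← mul_sub, div_eq_mul_inv, div_eq_mul_inv, (inv_rho_pow _).2]

lemma weierstrassP_conj (u : ℂ) : ℘[eisPair ω hω] (conj u) = conj (℘[eisPair ω hω] u) := by
  rw [PeriodPair.weierstrassP, PeriodPair.weierstrassP, Complex.conj_tsum,
    ← (conjEquiv ω hω).tsum_eq]
  refine tsum_congr fun l => ?_
  have e : (((conjEquiv ω hω l : (eisPair ω hω).lattice)) : ℂ) = conj (l : ℂ) := rfl
  rw [e]
  simp

lemma derivWeierstrassP_conj (u : ℂ) : ℘'[eisPair ω hω] (conj u) = conj (℘'[eisPair ω hω] u) := by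
  rw [PeriodPair.derivWeierstrassP, PeriodPair.derivWeierstrassP, map_neg, Complex.conj_tsum,
    ← (conjEquiv ω hω).tsum_eq]
  congr 1
  refine tsum_congr fun l => ?_
  have e : (((conjEquiv ω hω l : (eisPair ω hω).lattice)) : ℂ) = conj (l : ℂ) := rfl
  rw [e]
  simp [Complex.conj_ofNat]

lemma g2_eisPair : (eisPair ω hω).g₂ = 0 := by
  have h : (eisPair ω hω).G 4 = ρ3 ^ 2 * (eisPair ω hω).G 4 := by
    conv_lhs => rw [PeriodPair.G, ← (rhoEquiv ω hω).tsum_eq]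
    rw [PeriodPair.G, ← tsum_mul_left]
    refine tsum_congr fun l => ?_
    have e : (((rhoEquiv ω hω l : (eisPair ω hω).lattice)) : ℂ) = ρ3 * l := rfl
    have h1 := (inv_rho_pow (l : ℂ)).1
    rw [e, show (ρ3 * (l : ℂ)) ^ 4 = ((ρ3 * l) ^ 2) ^ 2 by ring, ← inv_pow, h1]
    rw [mul_pow, inv_pow]
    ring
  have h2 : (1 - ρ3) * ((1 + ρ3) * (eisPair ω hω).G 4) = 0 := by linear_combination h
  have h3 : 1 + ρ3 ≠ 0 := by
    intro h3
    have := rho_sq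
    rw [show ρ3 = -1 by linear_combination h3] at this
    norm_num at this
  have h4 : 1 - ρ3 ≠ 0 := by
    intro h3
    have := rho_sq
    rw [show ρ3 = 1 by linear_combination -h3] at this
    norm_num at this
  have : (eisPair ω hω).G 4 = 0 := by
    simpa [h3, h4] using h2
  rw [PeriodPair.g₂, this, mul_zero]

lemma wp3_eq (h : varpi1 ≠ 0) (u : ℂ) : wp3 u = ℘[eisPair varpi1 h] u := by
  have e : ∀ m, ((((eisPair varpi1 h).latticeEquivProd.symm m) : (eisPair varpi1 h).lattice) : ℂ)
      = ω3 m := by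
    intro m
    rw [PeriodPair.latticeEquiv_symm_apply, ω3]
    simp [eisPair]
    ring
  have hs := (eisPair varpi1 h).hasSum_weierstrassP u
  rw [← (eisPair varpi1 h).latticeEquivProd.symm.toEquiv.hasSum_iff] at hs
  rw [← hs.tsum_eq, wp3, hs.summable.tsum_eq_add_tsum_ite 0]
  congr 1
  · simp
  · refine tsum_congr fun m => ?_
    split_ifs
    · rfl
    · simp [e]

lemma wp3'_eq (h : varpi1 ≠ 0) (u : ℂ) : wp3' u = ℘'[eisPair varpi1 h] u := by
  have e : ∀ m, ((((eisPair varpi1 h).latticeEquivProd.symm m) : (eisPair varpi1 h).lattice) : ℂ)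
      = ω3 m := by
    intro m
    rw [PeriodPair.latticeEquiv_symm_apply, ω3]
    simp [eisPair]
    ring
  rw [PeriodPair.derivWeierstrassP, ← (eisPair varpi1 h).latticeEquivProd.symm.toEquiv.tsum_eq,
    wp3', ← tsum_neg]
  refine tsum_congr fun m => ?_
  have e' := e m
  simp only [LinearEquiv.coe_toEquiv, e']
  ring

end FermatCurve

namespace FermatCurve

open Topology Filter MeasureTheory
open scoped PeriodPair ComplexConjugate

lemma intervalIntegrable_varpi1 :
    IntervalIntegrable (fun x : ℝ => (1 - x ^ 3) ^ (-(2:ℝ)/3)) volume 0 1 := by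
  have h1 : IntervalIntegrable (fun x : ℝ => x ^ (-(2:ℝ)/3)) volume 0 1 :=
    intervalIntegral.intervalIntegrable_rpow' (by norm_num)
  have h2 : IntervalIntegrable (fun x : ℝ => (1 - x) ^ (-(2:ℝ)/3)) volume 0 1 := by
    have := h1.comp_sub_left 1
    simpa using this.symm
  refine h2.mono_fun' ?_ ?_
  · exact (Measurable.aestronglyMeasurable (by fun_prop))
  · rw [Set.uIoc_of_le zero_le_one]
    refine (ae_restrict_iff' measurableSet_Ioc).mpr (ae_of_all _ fun x hx => ?_)
    rcases hx.2.lt_or_eq with h | h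
    · have h3 : 0 < 1 - x := by linarith
      have h4 : x ^ 3 ≤ x := by
        have := pow_le_pow_of_le_one hx.1.le hx.2 (show 1 ≤ 3 by norm_num)
        simpa using this
      have h5 : 0 < 1 - x ^ 3 := by linarith
      simp only [Real.norm_eq_abs]
      rw [abs_of_nonneg (Real.rpow_nonneg h5.le _)]
      exact Real.rpow_le_rpow_of_nonpos h3 (by linarith) (by norm_num)
    · simp [h]

lemma varpi1_pos : 0 < varpi1 := by
  refine intervalIntegral.intervalIntegral_pos_of_pos_on intervalIntegrable_varpi1 ?_ zero_lt_one
  intro x hx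
  have : x ^ 3 < 1 := pow_lt_one₀ hx.1.le hx.2 (by norm_num)
  exact Real.rpow_pos_of_pos (by linarith) _

lemma third_torsion_real {ω : ℝ} {hω : ω ≠ 0} (hpos : 0 < ω) {t : ℝ} (h0 : 0 ≤ t) (h1 : t ≤ ω / 3)
    (h : (3 * (t : ℂ)) ∈ (eisPair ω hω).lattice) : t = 0 ∨ t = ω / 3 := by
  obtain ⟨l, hl, h⟩ := mem_eisPair.mp h
  obtain ⟨m, n, rfl⟩ := mem_O3_iff.mp hl
  obtain ⟨e1, e2⟩ := rho_re_im
  have him := congrArg Complex.im h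
  have hre := congrArg Complex.re h
  simp [e1, e2] at him hre
  have hn : n = 0 := by tauto
  rw [hn] at hre
  simp at hre
  have h2 : (0:ℝ) ≤ m := by
    by_contra hm
    push Not at hm
    nlinarith
  have h3 : (m:ℝ) ≤ 1 := by
    by_contra hm
    push Not at hm
    nlinarith
  have h4 : 0 ≤ m := by exact_mod_cast h2
  have h5 : m ≤ 1 := by exact_mod_cast h3
  interval_cases m
  · left
    simp at hre
    exact hre
  · right
    simp at hre
    linarith

lemma one_sub_rho_third_notMem {ω : ℝ} {hω : ω ≠ 0} :
    (1 - ρ3) * ((ω / 3 : ℝ) : ℂ) ∉ (eisPair ω hω).lattice := by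
  have e : (1 - ρ3) * ((ω / 3 : ℝ) : ℂ) = ω * ((1 - ρ3) / 3) := by push_cast; ring
  rw [e, mul_mem_eisPair]
  intro h
  obtain ⟨m, n, h⟩ := mem_O3_iff.mp h
  obtain ⟨e1, e2⟩ := rho_re_im
  have h1 : 1 - ρ3 = 3 * m + 3 * n * ρ3 := by linear_combination 3 * h
  have him := congrArg Complex.im h1
  simp [e1, e2] at him
  have h3 : Real.sqrt 3 ≠ 0 := by positivity
  have h4 : (-1 : ℝ) = 3 * n := by
    apply mul_right_cancel₀ h3
    linear_combination 2 * him
  have h5 : (-1 : ℤ) = 3 * n := by exact_mod_cast h4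
  omega

lemma varpi1_eq_of_flow {v κ : ℝ} (hv : 0 < v) {s c : ℝ → ℝ} (hs0 : s 0 = 0) (hsv : s v = 1)
    (hcurve : ∀ t ∈ Set.Icc 0 v, s t ^ 3 + c t ^ 3 = 1)
    (hds : ∀ t ∈ Set.Icc 0 v, HasDerivAt s (κ * c t ^ 2) t)
    (hc : ContinuousOn c (Set.Icc 0 v)) (hc0 : c 0 = 1) (hcne : ∀ t ∈ Set.Ico 0 v, c t ≠ 0) :
    varpi1 = κ * v := by
  have hcpos : ∀ t ∈ Set.Ico 0 v, 0 < c t := by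
    intro t ht
    by_contra! hneg
    have hsub : Set.Icc 0 t ⊆ Set.Icc 0 v := Set.Icc_subset_Icc_right ht.2.le
    obtain ⟨w, hw, hw0⟩ := intermediate_value_Icc' ht.1 (hc.mono hsub)
      (show (0:ℝ) ∈ Set.Icc (c t) (c 0) from ⟨hneg, by rw [hc0]; norm_num⟩)
    exact hcne w ⟨hw.1, hw.2.trans_lt ht.2⟩ hw0
  have hscont : ContinuousOn s (Set.Icc 0 v) := fun t ht => (hds t ht).continuousAt.continuousWithinAt
  have hκ : 0 < κ := by
    by_contra! hneg
    have := antitoneOn_of_deriv_nonpos (convex_Icc 0 v) hscont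
      (fun t ht => (hds t (interior_subset ht)).differentiableAt.differentiableWithinAt)
      (fun t ht => by
        rw [(hds t (interior_subset ht)).deriv]
        exact mul_nonpos_of_nonpos_of_nonneg hneg (sq_nonneg _))
    have h1 := this (Set.left_mem_Icc.mpr hv.le) (Set.right_mem_Icc.mpr hv.le) hv.le
    rw [hs0, hsv] at h1
    linarith
  have hmono : StrictMonoOn s (Set.Icc 0 v) := by
    refine strictMonoOn_of_deriv_pos (convex_Icc 0 v) hscont fun t ht => ?_
    rw [(hds t (interior_subset ht)).deriv]
    rw [interior_Icc] at ht
    have := hcpos t ⟨ht.1.le, ht.2⟩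
    positivity
  have himg : s '' Set.Icc 0 v ⊆ Set.Icc 0 1 := by
    rintro _ ⟨t, ht, rfl⟩
    constructor
    · rw [← hs0]
      exact hmono.monotoneOn (Set.left_mem_Icc.mpr hv.le) ht ht.1
    · rw [← hsv]
      exact hmono.monotoneOn ht (Set.right_mem_Icc.mpr hv.le) ht.2
  have hsub : Set.Ioo 0 v ⊆ Set.Icc 0 v := Set.Ioo_subset_Icc_self
  have hval : ∀ t ∈ Set.Ioo 0 v,
      ((fun x : ℝ => (1 - x ^ 3) ^ (-(2:ℝ)/3)) ∘ s) t * (κ * c t ^ 2) = κ := by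
    intro t ht
    have h1 := hcpos t ⟨ht.1.le, ht.2⟩
    have h2 : 1 - s t ^ 3 = c t ^ (3:ℝ) := by
      have := hcurve t (hsub ht)
      rw [show (3:ℝ) = (3:ℕ) by norm_num, Real.rpow_natCast]
      linarith
    have h3 : (c t ^ (3:ℝ)) ^ (-(2:ℝ)/3) = (c t ^ 2)⁻¹ := by
      rw [← Real.rpow_mul h1.le, show (3:ℝ) * (-(2:ℝ)/3) = -2 by norm_num, Real.rpow_neg h1.le]
      congr 1
      exact_mod_cast Real.rpow_natCast (c t) 2
    simp only [Function.comp, h2, h3]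
    field_simp
  have hae : ∀ᵐ t ∂(volume.restrict (Set.Icc 0 v)),
      ((fun x : ℝ => (1 - x ^ 3) ^ (-(2:ℝ)/3)) ∘ s) t * (κ * c t ^ 2) = κ := by
    rw [← restrict_Ioo_eq_restrict_Icc]
    exact (ae_restrict_iff' measurableSet_Ioo).mpr (ae_of_all _ hval)
  have key := intervalIntegral.integral_comp_mul_deriv''' (a := 0) (b := v) (f := s)
    (f' := fun t => κ * c t ^ 2) (g := fun x : ℝ => (1 - x ^ 3) ^ (-(2:ℝ)/3)) ?_ ?_ ?_ ?_ ?_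
  · rw [hs0, hsv] at key
    rw [varpi1, ← key, intervalIntegral.integral_of_le hv.le, ← integral_Icc_eq_integral_Ioc,
      integral_congr_ae hae]
    simp [hv.le]
    ring
  · rwa [Set.uIcc_of_le hv.le]
  · intro t ht
    rw [min_eq_left hv.le, max_eq_right hv.le] at ht
    exact (hds t (hsub ht)).hasDerivWithinAt
  · rw [min_eq_left hv.le, max_eq_right hv.le]
    rintro _ ⟨t, ht, rfl⟩
    have h1 := hcpos t ⟨ht.1.le, ht.2⟩
    have h2 := hcurve t (hsub ht)
    refine ContinuousAt.continuousWithinAt ?_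
    refine ContinuousAt.rpow_const (by fun_prop) (Or.inl ?_)
    have : 0 < c t ^ 3 := by positivity
    linarith
  · rw [Set.uIcc_of_le hv.le]
    refine IntegrableOn.mono_set ?_ himg
    rw [integrableOn_Icc_iff_integrableOn_Ioc]
    exact (intervalIntegrable_iff_integrableOn_Ioc_of_le zero_le_one).mp intervalIntegrable_varpi1
  · rw [Set.uIcc_of_le hv.le]
    exact (integrable_const κ).congr (hae.mono fun t ht => ht.symm)

end FermatCurve

namespace FermatCurve

open Topology Filter MeasureTheory
open scoped PeriodPair ComplexConjugate

lemma exists_real_cube_root (c : ℝ) : ∃ r : ℝ, r ^ 3 = c := by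
  rcases le_total 0 c with h | h
  · refine ⟨c ^ ((1:ℝ) / 3), ?_⟩
    rw [← Real.rpow_natCast, ← Real.rpow_mul h]
    norm_num
  · refine ⟨-((-c) ^ ((1:ℝ) / 3)), ?_⟩
    have h' : 0 ≤ -c := by linarith
    rw [Odd.neg_pow (by decide), ← Real.rpow_natCast, ← Real.rpow_mul h']
    norm_num

lemma fx_conj {ω : ℝ} {hω : ω ≠ 0} (h a : ℝ) (u : ℂ) :
    fx (eisPair ω hω) h a (conj u) = conj (fx (eisPair ω hω) h a u) := by
  rw [fx, fx, weierstrassP_conj, derivWeierstrassP_conj]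
  simp

lemma fy_conj {ω : ℝ} {hω : ω ≠ 0} (h : ℝ) (u : ℂ) :
    fy (eisPair ω hω) h (conj u) = conj (fy (eisPair ω hω) h u) := by
  unfold fy
  rw [derivWeierstrassP_conj]
  have := conj_mem_eisPair (ω := ω) (hω := hω) u
  split_ifs <;> first | tauto | simp

lemma isFermatUnif_eisPair {ω : ℝ} {hω : ω ≠ 0} {h a : ℂ} (H : IsFermatData (eisPair ω hω) h a) :
    IsFermatUnif (-a / 2) (fx (eisPair ω hω) h a) (fy (eisPair ω hω) h) (fN (eisPair ω hω) h)
      (eisPair ω hω).lattice.toAddSubgroup :=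
  H.isFermatUnif rho_mul_mem_eisPair weierstrassP_rho derivWeierstrassP_rho

/-- The value of `℘′` at a third of the real period. -/
lemma derivWeierstrassP_third {ω : ℝ} {hω : ω ≠ 0} :
    ℘'[eisPair ω hω] ((ω / 3 : ℝ) : ℂ) ^ 2 = 3 * (eisPair ω hω).g₃ := by
  obtain ⟨h0, hh0⟩ := IsAlgClosed.exists_pow_nat_eq (3 * (eisPair ω hω).g₃) (n := 2) (by norm_num)
  obtain ⟨a0, ha0⟩ := IsAlgClosed.exists_pow_nat_eq (24 * h0) (n := 3) (by norm_num)
  have hne : h0 ≠ 0 := by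
    rintro rfl
    have := g3_ne_zero _ (g2_eisPair (hω := hω))
    apply this
    linear_combination -hh0 / 3
  have H : IsFermatData (eisPair ω hω) h0 a0 := ⟨g2_eisPair, by linear_combination -hh0 / 3, ha0, hne⟩
  have F := isFermatUnif_eisPair H
  have h1 := F.notMem_or_y_eq_zero (v := ((ω / 3 : ℝ) : ℂ)) ?_ one_sub_rho_third_notMem
  · have hL : ((ω / 3 : ℝ) : ℂ) ∉ (eisPair ω hω).lattice := by
      intro h
      apply one_sub_rho_third_notMem (ω := ω) (hω := hω)
      rw [sub_mul, one_mul]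
      exact sub_mem h ((rho_mul_mem_eisPair _).mpr h)
    rcases h1 with h1 | h1
    · have h2 : h0 + ℘'[eisPair ω hω] ((ω / 3 : ℝ) : ℂ) = 0 := by
        by_contra h
        exact h1 (Or.inr h)
      rw [← hh0, show ℘'[eisPair ω hω] ((ω / 3 : ℝ) : ℂ) = -h0 by linear_combination h2]
      ring
    · rw [fy, if_neg hL, div_eq_zero_iff] at h1
      rcases h1 with h1 | h1
      · rw [← hh0, show ℘'[eisPair ω hω] ((ω / 3 : ℝ) : ℂ) = h0 by linear_combination h1]
      · rw [← hh0, show ℘'[eisPair ω hω] ((ω / 3 : ℝ) : ℂ) = -h0 by linear_combination h1]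
        ring
  · change 3 * ((ω / 3 : ℝ) : ℂ) ∈ (eisPair ω hω).lattice
    rw [mem_eisPair]
    exact ⟨1, one_mem _, by push_cast; ring⟩

/-- Normalization of the real period: `℘′² = 4℘³ - 27`. -/
lemma isFermatData_varpi1 : IsFermatData (eisPair varpi1 varpi1_pos.ne') 9 6 := by
  set L := eisPair varpi1 varpi1_pos.ne' with hLdef
  set v : ℝ := varpi1 / 3 with hv
  have hvpos : 0 < v := by have := varpi1_pos; positivity
  have hreal : conj (℘'[L] (v : ℂ)) = ℘'[L] (v : ℂ) := by
    rw [hLdef, ← derivWeierstrassP_conj, Complex.conj_ofReal]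
  obtain ⟨h, hr⟩ : ∃ h : ℝ, ℘'[L] (v : ℂ) = -(h : ℂ) := by
    obtain ⟨r, hr⟩ := Complex.conj_eq_iff_real.mp hreal
    exact ⟨-r, by rw [hr]; push_cast; ring⟩
  obtain ⟨a, ha⟩ := exists_real_cube_root (24 * h)
  have hsq : ℘'[L] (v : ℂ) ^ 2 = 3 * L.g₃ := derivWeierstrassP_third
  rw [hr] at hsq
  have hg3 := g3_ne_zero L g2_eisPair
  have hr0 : (h : ℂ) ≠ 0 := by
    intro hz
    rw [hz] at hsq
    apply hg3
    linear_combination -hsq / 3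
  have H : IsFermatData L (h : ℂ) (a : ℂ) := by
    refine ⟨g2_eisPair, ?_, ?_, ?_⟩
    · linear_combination -hsq / 3
    · exact_mod_cast ha
    · exact hr0
  have F := isFermatUnif_eisPair H
  rw [← hLdef] at F
  have hxr : ∀ t : ℝ, ((fx L (h : ℂ) a (-(t : ℂ))).re : ℂ) = fx L (h : ℂ) a (-(t : ℂ)) := by
    intro t
    apply Complex.conj_eq_iff_re.mp
    rw [hLdef, ← fx_conj, map_neg, Complex.conj_ofReal]
  have hyr : ∀ t : ℝ, ((fy L (h : ℂ) (-(t : ℂ))).re : ℂ) = fy L (h : ℂ) (-(t : ℂ)) := by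
    intro t
    apply Complex.conj_eq_iff_re.mp
    rw [hLdef, ← fy_conj, map_neg, Complex.conj_ofReal]
  have hthird : ∀ t ∈ Set.Icc 0 v, (3 * (t : ℂ)) ∈ L.lattice → t = 0 ∨ t = v := fun t ht h3 =>
    third_torsion_real varpi1_pos ht.1 ht.2 h3
  have hL : (v : ℂ) ∉ L.lattice := by
    intro hm
    apply one_sub_rho_third_notMem (ω := varpi1) (hω := varpi1_pos.ne')
    rw [sub_mul, one_mul]
    exact sub_mem hm ((rho_mul_mem_eisPair _).mpr hm)
  have hvN : (v : ℂ) ∉ fN L (h : ℂ) := by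
    rintro (hm | hm)
    · exact hL hm
    · apply hm
      rw [hr]
      ring
  have hvN' := F.neg_of_notMem _ hvN
  have hy0 : fy L (h : ℂ) (-(v : ℂ)) = 0 := by
    by_contra hne
    apply hvN
    have := (F.neg_mem_iff _ hvN').mpr hne
    rwa [neg_neg] at this
  have hN : ∀ t ∈ Set.Icc 0 v, (-(t : ℂ)) ∈ fN L (h : ℂ) := by
    intro t ht
    by_contra hcon
    have h1 := F.neg_of_notMem _ hcon
    have h2 : fy L (h : ℂ) (-(-(t : ℂ))) = 0 := by
      by_contra hne
      exact hcon (by simpa using (F.neg_mem_iff _ h1).mpr hne)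
    have h3 := F.three_mul_mem h1 h2
    rw [neg_neg] at h3
    rcases hthird t ht h3 with h0 | h0
    · rw [h0] at hcon
      exact hcon (by simpa using F.zero_mem)
    · rw [h0] at hcon
      exact hcon hvN'
  have hder : ∀ t : ℝ, HasDerivAt (fun t : ℝ => -(t : ℂ)) (-1) t := fun t =>
    (Complex.ofRealCLM.hasDerivAt (x := t)).neg
  have key := varpi1_eq_of_flow (v := v) (κ := a / 2) hvpos
    (s := fun t => (fx L (h : ℂ) a (-(t : ℂ))).re)
    (c := fun t => (fy L (h : ℂ) (-(t : ℂ))).re) ?_ ?_ ?_ ?_ ?_ ?_ ?_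
  · have ha6 : a = 6 := by
      have h1 := varpi1_pos
      have h2 : varpi1 * (a - 6) = 0 := by rw [hv] at key; linear_combination -6 * key
      have := (mul_eq_zero.mp h2).resolve_left h1.ne'
      linarith
    have hr9 : h = 9 := by rw [ha6] at ha; linarith
    rw [ha6, hr9] at H
    exact_mod_cast H
  · rw [Complex.ofReal_zero, neg_zero, F.x0, Complex.zero_re]
  · have h1 := F.curve _ hvN'
    rw [hy0, ← hxr v] at h1
    have h2 : (fx L (h : ℂ) a (-(v : ℂ))).re ^ 3 = 1 := by
      have : (((fx L (h : ℂ) a (-(v : ℂ))).re ^ 3 : ℝ) : ℂ) = 1 := by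
        rw [Complex.ofReal_pow]; linear_combination h1
      exact_mod_cast this
    have : Function.Injective fun x : ℝ => x ^ 3 := (Odd.strictMono_pow (by decide)).injective
    apply this
    simpa using h2
  · intro t ht
    have h1 := F.curve _ (hN t ht)
    rw [← hxr t, ← hyr t] at h1
    exact_mod_cast h1
  · intro t ht
    have h1 := (F.dx _ (hN t ht)).comp t (hder t)
    have h2 := Complex.reCLM.hasFDerivAt.comp_hasDerivAt t h1
    have h3 : Complex.reCLM (-(a : ℂ) / 2 * fy L (h : ℂ) (-(t : ℂ)) ^ 2 * -1) =
        a / 2 * (fy L (h : ℂ) (-(t : ℂ))).re ^ 2 := by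
      have h4 : -(a : ℂ) / 2 * fy L (h : ℂ) (-(t : ℂ)) ^ 2 * -1 =
          ((a / 2 * (fy L (h : ℂ) (-(t : ℂ))).re ^ 2 : ℝ) : ℂ) := by
        rw [← hyr t]
        push_cast
        rw [Complex.ofReal_re]
        ring
      rw [h4, Complex.reCLM_apply, Complex.ofReal_re]
    rw [h3] at h2
    exact h2
  · intro t ht
    have h1 := (F.dy _ (hN t ht)).continuousAt
    refine ContinuousAt.continuousWithinAt ?_
    exact Complex.continuous_re.continuousAt.comp (h1.comp (f := fun t : ℝ => -(t : ℂ)) (hder t).continuousAt)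
  · rw [Complex.ofReal_zero, neg_zero, F.y0, Complex.one_re]
  · intro t ht h0
    have ht' : t ∈ Set.Icc 0 v := ⟨ht.1, ht.2.le⟩
    have h1 : fy L (h : ℂ) (-(t : ℂ)) = 0 := by rw [← hyr, h0]; simp
    have h3 := F.three_mul_mem (hN t ht') h1
    rw [mul_neg] at h3
    rcases hthird t ht' (by simpa using neg_mem h3) with ht0 | ht0
    · rw [ht0, Complex.ofReal_zero, neg_zero, F.y0] at h1
      norm_num at h1
    · exact ht.2.ne ht0

end FermatCurve

namespace FermatCurve

open scoped PeriodPair ComplexConjugate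

/-- The `x`-coordinate `φ` of the uniformization of the Fermat cubic by `ℂ / ℤ[ρ]`. -/
def X3 (u : ℂ) : ℂ := fx (eisPair varpi1 varpi1_pos.ne') 9 6 (varpi1 * u)

/-- The `y`-coordinate of the uniformization of the Fermat cubic by `ℂ / ℤ[ρ]`. -/
def Y3 (u : ℂ) : ℂ := fy (eisPair varpi1 varpi1_pos.ne') 9 (varpi1 * u)

/-- The points of regularity of the uniformization of the Fermat cubic. -/
def N3 : Set ℂ := {u | varpi1 * u ∈ fN (eisPair varpi1 varpi1_pos.ne') 9}

lemma isFermatUnif3 : IsFermatUnif (-6 / 2 * varpi1) X3 Y3 N3 O3.toAddSubgroup :=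
  (isFermatUnif_eisPair isFermatData_varpi1).scale (varpi1 : ℂ)
    (by exact_mod_cast varpi1_pos.ne') fun _ => mul_mem_eisPair.symm

lemma phi3_eq (u : ℂ) : phi3 u = X3 u := by
  rw [phi3, X3, fx, wp3_eq varpi1_pos.ne', wp3'_eq varpi1_pos.ne']

lemma psi3_eq {u : ℂ} (hu : u ∉ O3) : psi3 u = -Y3 u := by
  have : (varpi1 : ℂ) * u ∉ (eisPair varpi1 varpi1_pos.ne').lattice := by
    rwa [mul_mem_eisPair]
  rw [psi3, Y3, fy, if_neg this, wp3'_eq varpi1_pos.ne', ← neg_div]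
  congr 1 <;> ring

lemma X3_conj (u : ℂ) : X3 (conj u) = conj (X3 u) := by
  have := fx_conj (ω := varpi1) (hω := varpi1_pos.ne') 9 6 (varpi1 * u)
  simpa [X3] using this

lemma Y3_conj (u : ℂ) : Y3 (conj u) = conj (Y3 u) := by
  have := fy_conj (ω := varpi1) (hω := varpi1_pos.ne') 9 (varpi1 * u)
  simpa [Y3] using this

end FermatCurve

namespace FermatCurve

/-- A homomorphic sequence of points on the Fermat cubic `x³ + y³ = 1` (with origin `(0, 1)`),
indexed by `ℤ/p`, on which multiplication by `ι` acts as multiplication by `ω` on `x`. -/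
structure FermatSeq {p : ℕ} (ι : ZMod p) (ω : ℂ) (x y : ZMod p → ℂ) : Prop where
  iota_sq : ι ^ 2 = -1 - ι
  omega_sq : ω ^ 2 = -1 - ω
  x0 : x 0 = 0
  y0 : y 0 = 1
  x_ne : ∀ a, a ≠ 0 → x a ≠ 0
  I1 : ∀ a b, x a * x b * x (a + b) = y a * y b - y (a + b)
  I2 : ∀ a b, x b * y a * y (a + b) = x (a + b) * y b - x a
  x_iota : ∀ a, x (ι * a) = ω * x a
  y_iota : ∀ a, y (ι * a) = y a

/-- The discrete Fourier transform on `ℤ/p`. -/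
def four {p : ℕ} [NeZero p] (e : AddChar (ZMod p) ℂ) (f : ZMod p → ℂ) (j : ZMod p) : ℂ :=
  ∑ r, e (r * j) * f r

section four

variable {p : ℕ} [NeZero p] (e : AddChar (ZMod p) ℂ)

lemma four_mul {f g h k A B : ZMod p → ℂ}
    (H : ∀ s d, f (s + d) * g s = A d * h s + B d * h (s + d) + if d = 0 then k s else 0)
    (i j : ZMod p) :
    four e f i * four e g j = (four e A i + four e B (-j)) * four e h (i + j) + four e k (i + j) := by
  have e1 : four e f i * four e g j =
      ∑ s, ∑ d, e ((s + d) * i + s * j) * (f (s + d) * g s) := by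
    rw [mul_comm, four, four, Finset.sum_mul_sum]
    refine Finset.sum_congr rfl fun s _ => ?_
    rw [← Equiv.sum_comp (Equiv.addLeft s)]
    refine Finset.sum_congr rfl fun d _ => ?_
    rw [Equiv.coe_addLeft, AddChar.map_add_eq_mul]
    ring
  have e2 : four e A i * four e h (i + j) =
      ∑ s, ∑ d, e ((s + d) * i + s * j) * (A d * h s) := by
    rw [mul_comm, four, four, Finset.sum_mul_sum]
    refine Finset.sum_congr rfl fun s _ => Finset.sum_congr rfl fun d _ => ?_
    rw [show (s + d) * i + s * j = d * i + s * (i + j) by ring, AddChar.map_add_eq_mul]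
    ring
  have e3 : four e B (-j) * four e h (i + j) =
      ∑ s, ∑ d, e ((s + d) * i + s * j) * (B d * h (s + d)) := by
    rw [Finset.sum_comm, four, four, Finset.sum_mul_sum]
    refine Finset.sum_congr rfl fun d _ => ?_
    rw [← Equiv.sum_comp (Equiv.addRight d)]
    refine Finset.sum_congr rfl fun s _ => ?_
    rw [Equiv.coe_addRight,
      show (s + d) * i + s * j = d * -j + (s + d) * (i + j) by ring, AddChar.map_add_eq_mul]
    ring
  have e4 : four e k (i + j) =
      ∑ s, ∑ d, e ((s + d) * i + s * j) * (if d = 0 then k s else 0) := by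
    refine Finset.sum_congr rfl fun s _ => ?_
    simp only [mul_ite, mul_zero, Finset.sum_ite_eq', Finset.mem_univ, if_true]
    rw [show (s + 0) * i + s * j = s * (i + j) by ring]
  rw [e1, add_mul, e2, e3, e4, ← Finset.sum_add_distrib, ← Finset.sum_add_distrib]
  refine Finset.sum_congr rfl fun s _ => ?_
  rw [← Finset.sum_add_distrib, ← Finset.sum_add_distrib]
  refine Finset.sum_congr rfl fun d _ => ?_
  rw [H]
  ring

lemma four_neg (f : ZMod p → ℂ) (j : ZMod p) : four e (fun d => f (-d)) j = four e f (-j) := by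
  rw [four, four, ← Equiv.sum_comp (Equiv.neg _)]
  refine Finset.sum_congr rfl fun d _ => ?_
  simp

lemma four_zero (f : ZMod p → ℂ) : four e f 0 = ∑ r, f r := by simp [four]

lemma four_zero_of_iota {ι : ZMod p} (hι : ι ^ 3 = 1) {μ : ℂ} (hμ : μ ≠ 1) {f : ZMod p → ℂ}
    (hf : ∀ a, f (ι * a) = μ * f a) : four e f 0 = 0 := by
  have hu : IsUnit ι := .of_mul_eq_one (ι ^ 2) (by rw [← hι]; ring)
  have e1 : ∑ r, f r = μ * ∑ r, f r := by
    conv_lhs => rw [← Equiv.sum_comp hu.unit.mulLeft]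
    rw [Finset.mul_sum]
    exact Finset.sum_congr rfl fun d _ => hf d
  rw [four_zero]
  have : (1 - μ) * ∑ r, f r = 0 := by linear_combination e1
  exact (mul_eq_zero.mp this).resolve_left (sub_ne_zero.mpr hμ.symm)

lemma four_iota {ι : ZMod p} (hι : ι ^ 3 = 1) {μ : ℂ} {f : ZMod p → ℂ}
    (hf : ∀ a, f (ι * a) = μ * f a) (j : ZMod p) : μ * four e f (ι * j) = four e f j := by
  have hu : IsUnit ι := .of_mul_eq_one (ι ^ 2) (by rw [← hι]; ring)
  rw [four, four]
  conv_rhs => rw [← Equiv.sum_comp hu.unit.mulLeft]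
  rw [Finset.mul_sum]
  refine Finset.sum_congr rfl fun d _ => ?_
  change _ = e (ι * d * j) * f (ι * d)
  rw [hf, show d * (ι * j) = ι * d * j by ring]
  ring

lemma sum_four (he : e.IsPrimitive) (f : ZMod p → ℂ) : ∑ j, four e f j = p * f 0 := by
  unfold four
  rw [Finset.sum_comm]
  have : ∀ r, ∑ j, e (r * j) * f r = if r = 0 then p * f r else 0 := by
    intro r
    have h := AddChar.sum_mulShift r he
    rw [ZMod.card] at h
    rw [← Finset.sum_mul]
    simp_rw [mul_comm r]
    rw [h]
    split_ifs <;> simp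
  simp_rw [this]
  simp

lemma four_inv (he : e.IsPrimitive) (f : ZMod p → ℂ) (a : ZMod p) :
    ∑ j, e (-(a * j)) * four e f j = p * f a := by
  have : ∀ j, e (-(a * j)) * four e f j = four e (fun r => f (r + a)) j := by
    intro j
    rw [four, four, Finset.mul_sum]
    rw [← Equiv.sum_comp (Equiv.addRight a)]
    refine Finset.sum_congr rfl fun r _ => ?_
    rw [Equiv.coe_addRight, ← mul_assoc, ← AddChar.map_add_eq_mul]
    congr 2
    ring
  simp_rw [this, sum_four e he, zero_add]

end four

namespace FermatSeq

variable {p : ℕ} {ι : ZMod p} {ω : ℂ} {x y : ZMod p → ℂ} (F : FermatSeq ι ω x y)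
include F

lemma iota_cube : ι ^ 3 = 1 := by linear_combination (ι - 1) * F.iota_sq

lemma omega_cube : ω ^ 3 = 1 := by linear_combination (ω - 1) * F.omega_sq

lemma omega_ne_one : ω ≠ 1 := by
  rintro h
  have := F.omega_sq
  rw [h] at this
  norm_num at this

lemma omega_sq_ne_one : ω ^ 2 ≠ 1 := by
  intro h
  apply F.omega_ne_one
  linear_combination F.omega_cube - ω * h

lemma y_mul_neg (a : ZMod p) : y a * y (-a) = 1 := by
  have := F.I1 a (-a)
  rw [add_neg_cancel, F.x0, F.y0] at this
  linear_combination -this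

lemma y_ne (a : ZMod p) : y a ≠ 0 := left_ne_zero_of_mul_eq_one (F.y_mul_neg a)

lemma y_neg (a : ZMod p) : y (-a) = (y a)⁻¹ := eq_inv_of_mul_eq_one_right (F.y_mul_neg a)

lemma x_neg_mul (a : ZMod p) : x (-a) * y a = -x a := by
  have := F.I2 (-a) a
  rw [neg_add_cancel, F.x0, F.y0] at this
  have h := F.y_mul_neg a
  linear_combination y a * this - x a * h

lemma x_neg (a : ZMod p) : x (-a) = -(x a / y a) := by
  rw [eq_comm, ← neg_div, div_eq_iff (F.y_ne a), F.x_neg_mul]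

lemma curve (a : ZMod p) : x a ^ 3 + y a ^ 3 = 1 := by
  have h := F.I1 a (ι * a)
  have h2 : a + ι * a = -(ι * (ι * a)) := by linear_combination a * F.iota_sq
  simp only [h2, F.x_neg, F.y_neg, F.y_iota, F.x_iota] at h
  have := F.y_ne a
  field_simp at h
  linear_combination -h - x a ^ 3 * F.omega_cube

lemma add_x (a b : ZMod p) : (1 - x a ^ 3 * x b ^ 3) * x (a + b) =
    x a * y b ^ 2 + x b * y a ^ 2 - x a ^ 2 * x b ^ 2 * y a * y b := by
  have e1 := (add_formulas (F.I1 a b) (F.I2 a b)).1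
  have h := F.I2 b a
  have h' := F.I1 b a
  rw [add_comm b a] at h h'
  have e2 := (add_formulas h' h).1
  apply mul_left_cancel₀ (pow_ne_zero 3 (F.y_ne b))
  have c1 := F.curve b
  linear_combination y b ^ 2 * e1 - x a * x b ^ 2 * y b ^ 2 * e2 - y b ^ 2 * x a * c1

end FermatSeq

end FermatCurve

namespace FermatCurve

namespace FermatSeq

variable {p : ℕ} {ι : ZMod p} {ω : ℂ} {x y : ZMod p → ℂ} (F : FermatSeq ι ω x y)
include F

lemma m_neg (d : ZMod p) : y (-d) / x (-d) = -(x d)⁻¹ := by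
  have := F.y_ne d
  rw [F.y_neg, F.x_neg]
  by_cases h : x d = 0
  · simp [h]
  · field_simp

lemma mul_x (s d : ZMod p) : x (s + d) * x s =
    y d / x d * y s + y (-d) / x (-d) * y (s + d) + if d = 0 then x s ^ 2 else 0 := by
  rw [F.m_neg]
  split_ifs with h
  · subst h
    simp [F.x0, sq]
  · have hx := F.x_ne d h
    have e1 := F.I1 (s + d) (-s)
    rw [show s + d + -s = d by ring, F.x_neg, F.y_neg] at e1
    have := F.y_ne s
    field_simp at e1 ⊢
    linear_combination -e1

lemma mul_y (s d : ZMod p) : y (s + d) * y s =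
    y (-d) / x (-d) * x s + y d / x d * x (s + d) + if d = 0 then y s ^ 2 else 0 := by
  rw [F.m_neg]
  split_ifs with h
  · subst h
    simp [F.x0, sq]
  · have hx := F.x_ne d h
    have e1 := F.I2 s d
    field_simp
    linear_combination e1

variable [Fact p.Prime] (e : AddChar (ZMod p) ℂ)

lemma four_x_zero : four e x 0 = 0 :=
  four_zero_of_iota e F.iota_cube F.omega_ne_one F.x_iota

lemma four_m_zero : four e (fun d => y d / x d) 0 = 0 := by
  refine four_zero_of_iota e F.iota_cube F.omega_sq_ne_one fun a => ?_
  rw [F.x_iota, F.y_iota]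
  have h := F.omega_cube
  have h0 : ω ≠ 0 := by rintro rfl; norm_num at h
  by_cases hx : x a = 0
  · simp [hx]
  · field_simp
    rw [h, mul_one]

lemma four_x_mul (i j : ZMod p) : four e x i * four e x j = four e y (i + j) *
    (four e (fun d => y d / x d) i + four e (fun d => y d / x d) j
      - four e (fun d => y d / x d) (i + j)) := by
  have key := four_mul e F.mul_x
  have e1 := key (i + j) 0
  have e2 := key i j
  simp only [four_neg e (fun d => y d / x d), neg_zero, neg_neg, F.four_x_zero, F.four_m_zero,
    add_zero, mul_zero] at e1 e2
  linear_combination e2 - e1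

lemma four_y_mul (i j : ZMod p) : four e y i * four e y j = four e y 0 * four e y (i + j) +
    four e x (i + j) * (four e (fun d => y d / x d) (-i) + four e (fun d => y d / x d) (-j)
      - four e (fun d => y d / x d) (-(i + j))) := by
  have key := four_mul e F.mul_y
  have e1 := key (i + j) 0
  have e2 := key i j
  simp only [four_neg e (fun d => y d / x d), neg_zero, F.four_m_zero, add_zero] at e1 e2
  linear_combination e2 - e1

lemma four_y_mul_neg (j : ZMod p) : four e y j * four e y (-j) = four e y 0 ^ 2 := by
  have := F.four_y_mul e j (-j)
  rw [add_neg_cancel, F.four_x_zero] at this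
  linear_combination this

lemma sum_y_sq : ∑ r, y r ^ 2 = (∑ r, y r) ^ 2 := by
  have key := four_mul 0 F.mul_y 0 0
  have h1 := F.four_x_zero 0
  rw [add_zero, h1, four_zero, four_zero] at key
  rw [sq, key, four_zero]
  ring

variable (hc : four e y 0 ≠ 0)
include hc

lemma four_y_ne (j : ZMod p) : four e y j ≠ 0 := fun h => by
  have := F.four_y_mul_neg e j
  rw [h, zero_mul] at this
  exact pow_ne_zero 2 hc this.symm

lemma four_cocycle (i j : ZMod p) :
    four e x i * four e x j / four e y (i + j) + four e x (i + j) * four e x (-j) / four e y i =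
      four e x j * four e x (-j) / four e y 0 := by
  have e1 := F.four_x_mul e i j
  have e2 := F.four_x_mul e (i + j) (-j)
  have e3 := F.four_x_mul e j (-j)
  rw [add_neg_cancel_right] at e2
  rw [add_neg_cancel, F.four_m_zero] at e3
  rw [e1, e2, e3, mul_div_cancel_left₀ _ (F.four_y_ne e hc _),
    mul_div_cancel_left₀ _ (F.four_y_ne e hc _), mul_div_cancel_left₀ _ (F.four_y_ne e hc _)]
  ring

omit hc in
lemma four_x_iota (j : ZMod p) : four e x (ι * j) = ω ^ 2 * four e x j := by
  have h := four_iota e F.iota_cube F.x_iota j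
  linear_combination ω ^ 2 * h - four e x (ι * j) * F.omega_cube

omit hc in
lemma four_y_iota (j : ZMod p) : four e y (ι * j) = four e y j := by
  have h := four_iota e F.iota_cube (f := y) (μ := 1) (by simpa using F.y_iota) j
  simpa using h

lemma four_x_neg (j : ZMod p) : four e y 0 * four e x (-j) = -(four e x j * four e y j) := by
  have e1 := F.four_cocycle e hc (ι * j) j
  have e2 := F.four_cocycle e hc (ι * (ι * j)) j
  rw [show ι * j + j = ι * (ι * -j) by linear_combination j * F.iota_sq] at e1
  rw [show ι * (ι * j) + j = ι * -j by linear_combination j * F.iota_sq] at e2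
  simp only [F.four_x_iota, F.four_y_iota] at e1 e2
  have h0 := F.four_y_mul_neg e j
  have h1 := F.four_y_ne e hc j
  have h2 := F.four_y_ne e hc (-j)
  generalize four e x j = a at *
  generalize four e y j = b at *
  generalize four e x (-j) = a' at *
  generalize four e y 0 = c at *
  have hd : four e y (-j) = c ^ 2 / b := by field_simp; linear_combination h0
  rw [hd] at e1 e2
  field_simp at e1 e2
  have h3 := F.omega_cube
  have h4 := F.omega_sq
  have h5 : (a * b + c * a') ^ 2 = 0 := by
    linear_combination -e1 - e2 + (a ^ 2 * b ^ 2 + c ^ 2 * a' ^ 2) * (h4 + ω * h3)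
  linear_combination pow_eq_zero_iff (two_ne_zero) |>.mp h5

lemma four_x_ne (he : e.IsPrimitive) (j : ZMod p) (hj : j ≠ 0) : four e x j ≠ 0 := by
  intro h
  set M := four e (fun d => y d / x d) with hM
  have h1 : ∀ i, M (i + j) = M i + M j := by
    intro i
    have e1 := F.four_x_mul e i j
    rw [h, mul_zero] at e1
    have := (mul_eq_zero.mp e1.symm).resolve_left (F.four_y_ne e hc _)
    linear_combination -this
  have h2 : ∀ n : ℕ, M (n * j) = n * M j := by
    intro n
    induction n with
    | zero => simpa [hM] using F.four_m_zero e
    | succ n ih =>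
      rw [Nat.cast_succ, add_mul, one_mul, h1, ih]
      push_cast
      ring
  have hp0 : (p : ℂ) ≠ 0 := by exact_mod_cast (Fact.out : p.Prime).ne_zero
  have h3 : M j = 0 := by
    have := h2 p
    rw [CharP.cast_eq_zero, zero_mul, hM, F.four_m_zero, ← hM] at this
    exact (mul_eq_zero.mp this.symm).resolve_left hp0
  have h4 : ∀ i, M i = 0 := by
    intro i
    have := h2 (i / j).val
    rwa [ZMod.natCast_zmod_val, div_mul_cancel₀ _ hj, h3, mul_zero] at this
  have h5 := four_inv e he (fun d => y d / x d) 1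
  rw [← hM] at h5
  simp only [h4, mul_zero, Finset.sum_const_zero] at h5
  have h6 := div_ne_zero (F.y_ne 1) (F.x_ne 1 one_ne_zero)
  exact mul_ne_zero hp0 h6 h5.symm

/-- The Fourier transform of a homomorphic sequence on the Fermat cubic is again one. -/
lemma dual (he : e.IsPrimitive) : FermatSeq ι (ω ^ 2) (fun j => -four e x j / four e y 0)
    (fun j => four e y (-j) / four e y 0) where
  iota_sq := F.iota_sq
  omega_sq := by linear_combination ω * F.omega_cube + F.omega_sq
  x0 := by rw [F.four_x_zero]; simp
  y0 := by rw [neg_zero, div_self hc]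
  x_ne j hj := div_ne_zero (neg_ne_zero.mpr (F.four_x_ne e hc he j hj)) hc
  I1 i j := by
    have e1 := F.four_x_mul e i j
    have e2 := F.four_y_mul e (-i) (-j)
    have e3 := F.four_x_neg e hc (i + j)
    simp only [neg_neg, neg_add_rev] at e2 e3 ⊢
    rw [add_comm (-j) (-i)] at *
    rw [add_comm j i] at e2
    field_simp
    generalize four e (fun d => y d / x d) i + four e (fun d => y d / x d) j
      - four e (fun d => y d / x d) (i + j) = B at *
    linear_combination (-four e x (i + j)) * e1 - four e y 0 * e2 - B * e3
  I2 i j := by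
    have e1 := F.four_cocycle e hc j i
    have e2 := F.four_x_neg e hc i
    rw [add_comm j i] at e1
    have hi : four e y i ≠ 0 := F.four_y_ne e hc i
    have hj : four e y j ≠ 0 := F.four_y_ne e hc j
    have hs : four e y (i + j) ≠ 0 := F.four_y_ne e hc (i + j)
    have e3 : four e y (-i) = four e y 0 ^ 2 / four e y i := by
      rw [eq_div_iff hi, mul_comm, F.four_y_mul_neg]
    have e4 : four e y (-j) = four e y 0 ^ 2 / four e y j := by
      rw [eq_div_iff hj, mul_comm, F.four_y_mul_neg]
    have e5 : four e y (-(i + j)) = four e y 0 ^ 2 / four e y (i + j) := by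
      rw [eq_div_iff hs, mul_comm, F.four_y_mul_neg]
    have e6 : four e x (-i) = -(four e x i * four e y i) / four e y 0 := by
      rw [eq_div_iff hc, mul_comm, e2]
    rw [e6] at e1
    rw [e3, e4, e5]
    by_cases h0 : i = 0
    · subst h0
      simp only [F.four_x_zero, zero_add]
      field_simp
      ring
    have h1 := F.four_x_ne e hc he i h0
    field_simp at e1 ⊢
    linear_combination -e1
  x_iota j := by
    rw [F.four_x_iota]
    ring
  y_iota j := by
    rw [← mul_neg, F.four_y_iota]

lemma four_m_add_neg (j : ZMod p) :
    four e (fun d => y d / x d) j + four e (fun d => y d / x d) (-j) =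
      four e x j * four e x (-j) / four e y 0 := by
  have e3 := F.four_x_mul e j (-j)
  rw [add_neg_cancel, F.four_m_zero] at e3
  rw [e3, mul_div_cancel_left₀ _ hc, sub_zero]

end FermatSeq

end FermatCurve

namespace FermatCurve

open scoped ComplexConjugate

lemma exists_norm_O3 {d : ℂ} (hd : d ∈ O3) : ∃ n : ℤ, d * conj d = n := by
  obtain ⟨a, b, rfl⟩ := mem_O3_iff.mp hd
  refine ⟨a ^ 2 - a * b + b ^ 2, ?_⟩
  simp only [map_add, map_mul, map_intCast, conj_rho]
  push_cast
  linear_combination (-(b : ℂ) ^ 2) * rho_sq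

lemma int_mem_O3 (n : ℤ) : (n : ℂ) ∈ O3 := intCast_mem _ n

/-- A prime element `π` of `ℤ[ρ]` of norm `p ≡ 1 (mod 3)`, with an integer `ι ≡ ρ (mod π)`. -/
structure EisPrime (p : ℕ) (π : ℂ) (ι : ℤ) : Prop where
  prime : p.Prime
  mod3 : p % 3 = 1
  mem : π ∈ O3
  norm : (p : ℂ) = π * conj π
  iota : ECong ρ3 ι π

lemma exists_eisPrime {p : ℕ} (hp : p.Prime) (hp3 : p % 3 = 1) {π : ℂ} (hπ : π ∈ O3)
    (hnorm : (p : ℂ) = π * conj π) : ∃ ι : ℤ, EisPrime p π ι := by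
  obtain ⟨a, b, hab⟩ := mem_O3_iff.mp hπ
  have h1 : (p : ℤ) = a ^ 2 - a * b + b ^ 2 := by
    have : (p : ℂ) = a ^ 2 - a * b + b ^ 2 := by
      rw [hnorm, hab]
      simp only [map_add, map_mul, map_intCast, conj_rho]
      linear_combination (-(b : ℂ) ^ 2) * rho_sq
    exact_mod_cast this
  have hpZ : Prime (p : ℤ) := Nat.prime_iff_prime_int.mp hp
  have hb : IsCoprime (p : ℤ) b := by
    rw [Prime.coprime_iff_not_dvd hpZ]
    intro hb
    have ha : (p : ℤ) ∣ a := by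
      apply hpZ.dvd_of_dvd_pow (n := 2)
      have : a ^ 2 = p + (a - b) * b := by rw [h1]; ring
      rw [this]
      exact dvd_add dvd_rfl (hb.mul_left _)
    obtain ⟨c, rfl⟩ := ha
    obtain ⟨d, rfl⟩ := hb
    have h2 : (p : ℤ) * (p * (c ^ 2 - c * d + d ^ 2)) = p * 1 := by linear_combination -h1
    have h3 := mul_left_cancel₀ hpZ.ne_zero h2
    exact hpZ.not_isUnit (.of_mul_eq_one _ h3)
  obtain ⟨u, v, huv⟩ := hb
  refine ⟨-(a * v), hp, hp3, hπ, hnorm, ?_⟩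
  refine ⟨u * conj π * ρ3 + v, add_mem (mul_mem (mul_mem (int_mem_O3 _) (conj_mem_O3 hπ)) rho_mem)
    (int_mem_O3 _), ?_⟩
  have h4 : (u : ℂ) * p + v * b = 1 := by exact_mod_cast huv
  rw [hnorm] at h4
  push_cast
  linear_combination (-ρ3) * h4 - v * hab

namespace EisPrime

variable {p : ℕ} {π : ℂ} {ι : ℤ} (E : EisPrime p π ι)
include E

lemma p_ne_zero : (p : ℂ) ≠ 0 := by exact_mod_cast E.prime.ne_zero

lemma ne_zero : π ≠ 0 := by
  rintro rfl
  exact E.p_ne_zero (by rw [E.norm, zero_mul])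

lemma dvd_of_cong {r : ℤ} (h : ∃ d ∈ O3, (r : ℂ) = π * d) : (p : ℤ) ∣ r := by
  obtain ⟨d, hd, h⟩ := h
  obtain ⟨n, hn⟩ := exists_norm_O3 hd
  have h2 : (r : ℂ) ^ 2 = p * n := by
    have := congrArg conj h
    rw [map_mul, map_intCast] at this
    rw [E.norm, ← hn, sq]
    nth_rw 2 [this]
    rw [h]
    ring
  have h3 : r ^ 2 = p * n := by exact_mod_cast h2
  exact (Nat.prime_iff_prime_int.mp E.prime).dvd_of_dvd_pow (n := 2) ⟨n, h3⟩

lemma cong_iff {r s : ℤ} : ECong r s π ↔ (r : ZMod p) = s := by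
  rw [ZMod.intCast_eq_intCast_iff_dvd_sub]
  constructor
  · rintro ⟨d, hd, h⟩
    exact E.dvd_of_cong ⟨-d, neg_mem hd, by push_cast; linear_combination -h⟩
  · rintro ⟨n, hn⟩
    refine ⟨-(n * conj π), neg_mem (mul_mem (int_mem_O3 _) (conj_mem_O3 E.mem)), ?_⟩
    have : (s : ℂ) - r = p * n := by exact_mod_cast hn
    rw [E.norm] at this
    linear_combination -this

lemma conj_pi : EisPrime p (conj π) (ι ^ 2) where
  prime := E.prime
  mod3 := E.mod3
  mem := conj_mem_O3 E.mem
  norm := by rw [Complex.conj_conj, mul_comm, E.norm]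
  iota := by
    obtain ⟨d, hd, h⟩ := E.iota
    have h2 := congrArg conj h
    rw [map_sub, map_mul, map_intCast, conj_rho] at h2
    refine ⟨conj d * (-1 - ρ3 + ι), mul_mem (conj_mem_O3 hd)
      (add_mem (sub_mem (neg_mem (one_mem _)) rho_mem) (int_mem_O3 _)), ?_⟩
    push_cast
    linear_combination (-1 - ρ3 + ι) * h2 - rho_sq

lemma exists_int_cong {ν : ℂ} (hν : ν ∈ O3) : ∃ r : ℤ, ECong ν r π := by
  obtain ⟨a, b, rfl⟩ := mem_O3_iff.mp hν
  obtain ⟨d, hd, h⟩ := E.iota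
  refine ⟨a + b * ι, b * d, mul_mem (int_mem_O3 _) hd, ?_⟩
  push_cast
  linear_combination (b : ℂ) * h

lemma iota_sq : (ι : ZMod p) ^ 2 = -1 - ι := by
  obtain ⟨d, hd, h⟩ := E.iota
  have : ((ι ^ 2 : ℤ) : ZMod p) = ((-1 - ι : ℤ) : ZMod p) := by
    rw [← E.cong_iff]
    refine ⟨-(d * (ρ3 + ι + 1)), neg_mem (mul_mem hd (add_mem (add_mem rho_mem (int_mem_O3 _))
      (one_mem _))), ?_⟩
    push_cast
    linear_combination -(ρ3 + ι + 1) * h + rho_sq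
  exact_mod_cast this

lemma coprime_iff {r : ℤ} : ECoprime r π ↔ (r : ZMod p) ≠ 0 := by
  constructor
  · rintro ⟨u, hu, v, hv, h⟩ h0
    rw [show (0 : ZMod p) = ((0 : ℤ) : ZMod p) by simp, ← E.cong_iff] at h0
    obtain ⟨d, hd, h1⟩ := h0
    have h2 : ((1 : ℤ) : ZMod p) = ((0 : ℤ) : ZMod p) := by
      rw [← E.cong_iff]
      refine ⟨u * d + v, add_mem (mul_mem hu hd) hv, ?_⟩
      push_cast at h1 ⊢
      linear_combination u * h1 - h
    have := (ZMod.intCast_zmod_eq_zero_iff_dvd 1 p).mp (by simpa using h2)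
    exact (Nat.prime_iff_prime_int.mp E.prime).not_isUnit (isUnit_of_dvd_one this)
  · intro h
    have : IsCoprime (p : ℤ) r := by
      rw [Prime.coprime_iff_not_dvd (Nat.prime_iff_prime_int.mp E.prime)]
      rwa [← ZMod.intCast_zmod_eq_zero_iff_dvd]
    obtain ⟨u, v, huv⟩ := this
    have h4 : (u : ℂ) * p + v * r = 1 := by exact_mod_cast huv
    rw [E.norm] at h4
    exact ⟨v, int_mem_O3 _, u * conj π, mul_mem (int_mem_O3 _) (conj_mem_O3 E.mem),
      by linear_combination h4⟩

lemma pi_mul_mem {w : ℂ} (h1 : (ι - ρ3) * w ∈ O3) (h2 : p * w ∈ O3) : π * w ∈ O3 := by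
  obtain ⟨a, b, hab⟩ := mem_O3_iff.mp E.mem
  obtain ⟨d, hd, h⟩ := E.iota
  obtain ⟨n, hn⟩ : (p : ℤ) ∣ a + b * ι := by
    refine E.dvd_of_cong ⟨1 - b * d, sub_mem (one_mem _) (mul_mem (int_mem_O3 _) hd), ?_⟩
    push_cast
    linear_combination -hab - (b : ℂ) * h
  have hn' : (a : ℂ) + b * ι = p * n := by exact_mod_cast hn
  have : π * w = n * (p * w) - b * ((ι - ρ3) * w) := by
    rw [hab]
    linear_combination w * hn'
  rw [this]
  exact sub_mem (mul_mem (int_mem_O3 _) h2) (mul_mem (int_mem_O3 _) h1)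

end EisPrime

end FermatCurve

namespace FermatCurve

open scoped ComplexConjugate

/-- The `x`-coordinates of the `π`-torsion points of the Fermat cubic. -/
def tx (π : ℂ) {p : ℕ} (r : ZMod p) : ℂ := X3 ((r.val : ℂ) / π)

/-- The `y`-coordinates of the `π`-torsion points of the Fermat cubic. -/
def ty (π : ℂ) {p : ℕ} (r : ZMod p) : ℂ := Y3 ((r.val : ℂ) / π)

lemma tx_conj {p : ℕ} (π : ℂ) (a : ZMod p) : tx (conj π) a = conj (tx π a) := by
  rw [tx, tx, ← X3_conj, map_div₀, map_natCast]

lemma ty_conj {p : ℕ} (π : ℂ) (a : ZMod p) : ty (conj π) a = conj (ty π a) := by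
  rw [ty, ty, ← Y3_conj, map_div₀, map_natCast]

lemma add_div_cast (r s : ℤ) (π : ℂ) : ((r + s : ℤ) : ℂ) / π = r / π + s / π := by
  push_cast
  ring

lemma X3_add {u l : ℂ} (hl : l ∈ O3) : X3 (u + l) = X3 u := isFermatUnif3.x_per u l hl

lemma Y3_add {u l : ℂ} (hl : l ∈ O3) : Y3 (u + l) = Y3 u := isFermatUnif3.y_per u l hl

namespace EisPrime

variable {p : ℕ} {π : ℂ} {ι : ℤ} (E : EisPrime p π ι)
include E

lemma X3_of_cong {ν μ : ℂ} (h : ECong ν μ π) : X3 (ν / π) = X3 (μ / π) := by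
  obtain ⟨d, hd, h⟩ := h
  rw [← X3_add (u := μ / π) hd]
  congr 1
  have := E.ne_zero
  field_simp
  linear_combination h

lemma Y3_of_cong {ν μ : ℂ} (h : ECong ν μ π) : Y3 (ν / π) = Y3 (μ / π) := by
  obtain ⟨d, hd, h⟩ := h
  rw [← Y3_add (u := μ / π) hd]
  congr 1
  have := E.ne_zero
  field_simp
  linear_combination h

lemma cong_val (r : ℤ) : ECong r (((r : ZMod p).val : ℂ)) π := by
  have := Fact.mk E.prime
  have : ECong r (((r : ZMod p).val : ℤ) : ℂ) π := by
    rw [E.cong_iff]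
    simp
  exact_mod_cast this

lemma tx_int (r : ℤ) : tx π (r : ZMod p) = X3 (r / π) := (E.X3_of_cong (E.cong_val r)).symm

lemma ty_int (r : ℤ) : ty π (r : ZMod p) = Y3 (r / π) := (E.Y3_of_cong (E.cong_val r)).symm

lemma tx_of_cong {ν : ℂ} {r : ℤ} (h : ECong ν r π) : X3 (ν / π) = tx π (r : ZMod p) := by
  rw [E.tx_int, E.X3_of_cong h]

lemma ty_of_cong {ν : ℂ} {r : ℤ} (h : ECong ν r π) : Y3 (ν / π) = ty π (r : ZMod p) := by
  rw [E.ty_int, E.Y3_of_cong h]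

lemma div_mem_iff {r : ℤ} : (r : ℂ) / π ∈ O3 ↔ (r : ZMod p) = 0 := by
  rw [show (0 : ZMod p) = ((0 : ℤ) : ZMod p) by simp, ← E.cong_iff]
  have := E.ne_zero
  constructor
  · intro h
    exact ⟨_, h, by push_cast; field_simp; ring⟩
  · rintro ⟨d, hd, h⟩
    convert hd using 1
    field_simp
    push_cast at h
    linear_combination h

lemma p_mul_mem (r : ℤ) : (p : ℂ) * (r / π) ∈ O3 := by
  have := E.ne_zero
  convert mul_mem (conj_mem_O3 E.mem) (int_mem_O3 r) using 1
  rw [E.norm]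
  field_simp

lemma mem_of_three_mul {u : ℂ} (h : (p : ℂ) * u ∈ O3) (h3 : 3 * u ∈ O3) : u ∈ O3 := by
  obtain ⟨k, hk⟩ : ∃ k : ℤ, (p : ℤ) = 3 * k + 1 := ⟨(p / 3 : ℕ), by have := E.mod3; omega⟩
  have hk' : (p : ℂ) = 3 * k + 1 := by exact_mod_cast hk
  have : u = p * u - k * (3 * u) := by rw [hk']; ring
  rw [this]
  exact sub_mem h (mul_mem (int_mem_O3 k) h3)

lemma div_mem_N3 (r : ℤ) : (r : ℂ) / π ∈ N3 := by
  by_contra h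
  have hN := isFermatUnif3.neg_of_notMem _ h
  have hy : Y3 (-((r : ℂ) / π)) = 0 := by
    by_contra hy
    exact h (by simpa using (isFermatUnif3.neg_mem_iff _ hN).mpr hy)
  have h3 : 3 * (-((r : ℂ) / π)) ∈ O3 := isFermatUnif3.three_mul_mem hN hy
  have h4 : -((r : ℂ) / π) ∈ O3 :=
    E.mem_of_three_mul (by rw [mul_neg]; exact neg_mem (E.p_mul_mem r)) h3
  have h5 : (r : ℂ) / π ∈ O3 := by simpa using neg_mem h4
  refine h ?_
  have := (isFermatUnif3.N_per 0 _ h5).mpr isFermatUnif3.zero_mem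
  rwa [zero_add] at this

lemma Y3_div_ne_zero (r : ℤ) : Y3 ((r : ℂ) / π) ≠ 0 := by
  refine (isFermatUnif3.neg_mem_iff _ (E.div_mem_N3 r)).mp ?_
  have := E.div_mem_N3 (-r)
  push_cast at this
  rwa [neg_div] at this

lemma seq : FermatSeq (ι : ZMod p) ρ3 (tx π) (ty π) where
  iota_sq := E.iota_sq
  omega_sq := rho_sq
  x0 := by
    have := E.tx_int 0
    simp only [Int.cast_zero, zero_div] at this
    rw [this, isFermatUnif3.x0]
  y0 := by
    have := E.ty_int 0
    simp only [Int.cast_zero, zero_div] at this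
    rw [this, isFermatUnif3.y0]
  x_ne a ha := by
    obtain ⟨r, rfl⟩ := ZMod.intCast_surjective a
    rw [E.tx_int]
    intro h
    have h1 : (1 - ρ3) * ((r : ℂ) / π) ∈ O3 := isFermatUnif3.mem_of_x_eq_zero (E.div_mem_N3 r) h
    refine ha (E.div_mem_iff.mp (E.mem_of_three_mul (E.p_mul_mem r) ?_))
    have h2 := mul_mem (sub_mem (one_mem O3) (mul_mem rho_mem rho_mem)) h1
    convert h2 using 1
    linear_combination ((r : ℂ) / π) * (2 - ρ3) * rho_sq
  I1 a b := by
    obtain ⟨r, rfl⟩ := ZMod.intCast_surjective a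
    obtain ⟨s, rfl⟩ := ZMod.intCast_surjective b
    rw [← Int.cast_add, E.tx_int, E.tx_int, E.tx_int, E.ty_int, E.ty_int, E.ty_int, add_div_cast]
    exact isFermatUnif3.I1 (E.div_mem_N3 r) (E.div_mem_N3 s)
      (by rw [← add_div_cast]; exact E.div_mem_N3 _)
  I2 a b := by
    obtain ⟨r, rfl⟩ := ZMod.intCast_surjective a
    obtain ⟨s, rfl⟩ := ZMod.intCast_surjective b
    rw [← Int.cast_add, E.tx_int, E.tx_int, E.tx_int, E.ty_int, E.ty_int, E.ty_int, add_div_cast]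
    exact isFermatUnif3.I2 (E.div_mem_N3 r) (E.div_mem_N3 s)
      (by rw [← add_div_cast]; exact E.div_mem_N3 _)
  x_iota a := by
    obtain ⟨r, rfl⟩ := ZMod.intCast_surjective a
    rw [← Int.cast_mul, E.tx_int r, ← isFermatUnif3.x_rho, ← mul_div_assoc]
    refine (E.tx_of_cong ?_).symm
    obtain ⟨d, hd, h⟩ := E.iota
    exact ⟨d * r, mul_mem hd (int_mem_O3 r), by push_cast; linear_combination (r : ℂ) * h⟩
  y_iota a := by
    obtain ⟨r, rfl⟩ := ZMod.intCast_surjective a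
    rw [← Int.cast_mul, E.ty_int r, ← isFermatUnif3.y_rho, ← mul_div_assoc]
    refine (E.ty_of_cong ?_).symm
    obtain ⟨d, hd, h⟩ := E.iota
    exact ⟨d * r, mul_mem hd (int_mem_O3 r), by push_cast; linear_combination (r : ℂ) * h⟩

/-- Multiplication by `√-3` on the `π`-torsion. -/
lemma mul_q (a : ZMod p) :
    tx π (((ι : ZMod p) - (ι : ZMod p) ^ 2) * a) * (1 + ρ3 ^ 2 * tx π a ^ 3) = (ρ3 - ρ3 ^ 2) * (tx π a * ty π a) ∧
    ty π (((ι : ZMod p) - (ι : ZMod p) ^ 2) * a) * (1 + ρ3 ^ 2 * tx π a ^ 3) = 1 + ρ3 * tx π a ^ 3 := by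
  obtain ⟨r, rfl⟩ := ZMod.intCast_surjective a
  obtain ⟨d, hd, h⟩ := E.iota
  have hc : ECong ((ρ3 - ρ3 ^ 2) * r) (((ι - ι ^ 2) * r : ℤ) : ℂ) π := by
    refine ⟨d * (1 - ρ3 - ι) * r, mul_mem (mul_mem hd (sub_mem (sub_mem (one_mem _) rho_mem)
      (int_mem_O3 _))) (int_mem_O3 _), ?_⟩
    push_cast
    linear_combination (r : ℂ) * (1 - ρ3 - ι) * h
  have e1 := E.tx_of_cong hc
  have e2 := E.ty_of_cong hc
  push_cast at e1 e2
  rw [← e1, ← e2, E.tx_int, E.ty_int, mul_div_assoc]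
  refine isFermatUnif3.mul_sqrtm3 (E.div_mem_N3 r) (E.Y3_div_ne_zero r) ?_
  have h1 := (isFermatUnif3.N_per _ _ (show d * (1 - ρ3 - ι) * r ∈ O3 from mul_mem (mul_mem hd
    (sub_mem (sub_mem (one_mem _) rho_mem) (int_mem_O3 _))) (int_mem_O3 _))).mpr
    (E.div_mem_N3 ((ι - ι ^ 2) * r))
  convert h1 using 1
  have := E.ne_zero
  field_simp
  push_cast
  linear_combination (r : ℂ) * (1 - ρ3 - ι) * h

lemma tx_ty_inj {a b : ZMod p} (hx : tx π a = tx π b) (hy : ty π a = ty π b) : a = b := by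
  obtain ⟨r, rfl⟩ := ZMod.intCast_surjective a
  obtain ⟨s, rfl⟩ := ZMod.intCast_surjective b
  rw [E.tx_int, E.tx_int] at hx
  rw [E.ty_int, E.ty_int] at hy
  have h : (r : ℂ) / π - s / π ∈ O3 :=
    isFermatUnif3.sub_mem (E.div_mem_N3 r) (E.div_mem_N3 s) hx hy
  have h2 : ((r - s : ℤ) : ℂ) / π ∈ O3 := by
    convert h using 1
    push_cast
    ring
  have := E.div_mem_iff.mp h2
  push_cast at this
  exact sub_eq_zero.mp this

/-- Every homomorphic sequence is a dilate of the standard one. -/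
lemma exists_dilate {ξ η : ZMod p → ℂ} (F : FermatSeq (ι : ZMod p) ρ3 ξ η) :
    ∃ r : ZMod p, ∀ j, ξ j = tx π (j * r) ∧ η j = ty π (j * r) := by
  obtain ⟨w, hw⟩ := isFermatUnif3.exists_multiples (fun j => ξ j) (fun j => η j)
    (by simpa using F.x0) (by simpa using F.y0) (fun j => F.curve j)
    (fun i j => by push_cast; exact F.I1 i j) (fun i j => by push_cast; exact F.I2 i j)
  have := Fact.mk E.prime
  have hp : (p : ℂ) * w ∈ O3 := by
    obtain ⟨h1, h2, h3⟩ := hw p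
    exact (isFermatUnif3.mem_iff _ h1).mp (by rw [h3]; simpa using F.y0)
  have hι : (ι - ρ3) * w ∈ O3 := by
    obtain ⟨a1, a2, a3⟩ := hw (ι : ZMod p).val
    obtain ⟨b1, b2, b3⟩ := hw 1
    have hb := (isFermatUnif3.N_rho _).mpr b1
    have hm : (((ι : ZMod p).val : ℂ)) * w - ρ3 * ((1 : ℕ) * w) ∈ O3 := by
      refine isFermatUnif3.sub_mem a1 hb ?_ ?_
      · rw [a2, isFermatUnif3.x_rho, b2]
        simpa using F.x_iota 1
      · rw [a3, isFermatUnif3.y_rho, b3]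
        simpa using F.y_iota 1
    obtain ⟨k, hk⟩ : (p : ℤ) ∣ ι - (ι : ZMod p).val := by
      rw [← ZMod.intCast_zmod_eq_zero_iff_dvd]
      simp
    have hk' : (ι : ℂ) - ((ι : ZMod p).val : ℂ) = p * k := by exact_mod_cast hk
    have := add_mem hm (mul_mem (int_mem_O3 k) hp)
    convert this using 1
    push_cast
    linear_combination w * hk'
  obtain ⟨r, hr⟩ := E.exists_int_cong (E.pi_mul_mem hι hp)
  refine ⟨r, fun j => ?_⟩
  obtain ⟨s, rfl⟩ := ZMod.natCast_zmod_surjective j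
  obtain ⟨-, h2, h3⟩ := hw s
  have hc : ECong (s * (π * w)) ((s * r : ℤ) : ℂ) π := by
    obtain ⟨d, hd, h⟩ := hr
    exact ⟨s * d, mul_mem (natCast_mem _ s) hd, by push_cast; linear_combination (s : ℂ) * h⟩
  have e1 := E.tx_of_cong hc
  have e2 := E.ty_of_cong hc
  have e3 : (s : ℂ) * (π * w) / π = s * w := by
    have := E.ne_zero
    field_simp
  rw [e3] at e1 e2
  push_cast at e1 e2
  rw [← e1, ← e2, h2, h3]
  exact ⟨rfl, rfl⟩

end EisPrime

end FermatCurve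

namespace FermatCurve

open scoped ComplexConjugate

section residue

variable (V : ValuationSubring ℂ)

/-- The residue of an element of a valuation ring (and `0` outside the ring). -/
def res (x : ℂ) : IsLocalRing.ResidueField V :=
  open Classical in if h : x ∈ V then IsLocalRing.residue V ⟨x, h⟩ else 0

variable {V}

lemma res_of_mem {x : ℂ} (hx : x ∈ V) : res V x = IsLocalRing.residue V ⟨x, hx⟩ := dif_pos hx

lemma res_add {x y : ℂ} (hx : x ∈ V) (hy : y ∈ V) : res V (x + y) = res V x + res V y := by
  rw [res_of_mem hx, res_of_mem hy, res_of_mem (add_mem hx hy), ← map_add]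
  rfl

lemma res_mul {x y : ℂ} (hx : x ∈ V) (hy : y ∈ V) : res V (x * y) = res V x * res V y := by
  rw [res_of_mem hx, res_of_mem hy, res_of_mem (mul_mem hx hy), ← map_mul]
  rfl

lemma res_neg {x : ℂ} (hx : x ∈ V) : res V (-x) = -res V x := by
  rw [res_of_mem hx, res_of_mem (neg_mem hx), ← map_neg]
  rfl

lemma res_sub {x y : ℂ} (hx : x ∈ V) (hy : y ∈ V) : res V (x - y) = res V x - res V y := by
  rw [sub_eq_add_neg, res_add hx (neg_mem hy), res_neg hy, sub_eq_add_neg]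

lemma res_one : res V 1 = 1 := by
  rw [res_of_mem (one_mem V)]
  exact map_one _

lemma res_zero : res V 0 = 0 := by
  rw [res_of_mem (zero_mem V)]
  exact map_zero _

lemma res_pow {x : ℂ} (hx : x ∈ V) (n : ℕ) : res V (x ^ n) = res V x ^ n := by
  rw [res_of_mem hx, res_of_mem (pow_mem hx n), ← map_pow]
  rfl

lemma res_natCast (n : ℕ) : res V (n : ℂ) = n := by
  rw [res_of_mem (natCast_mem V n), ← map_natCast (IsLocalRing.residue V)]
  rfl

lemma res_intCast (n : ℤ) : res V (n : ℂ) = n := by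
  rw [res_of_mem (intCast_mem V n), ← map_intCast (IsLocalRing.residue V)]
  rfl

lemma res_sum {ι : Type*} (s : Finset ι) {f : ι → ℂ} (hf : ∀ i ∈ s, f i ∈ V) :
    res V (∑ i ∈ s, f i) = ∑ i ∈ s, res V (f i) := by
  classical
  induction s using Finset.induction_on with
  | empty => simp [res_zero]
  | insert a s ha ih =>
    rw [Finset.sum_insert ha, Finset.sum_insert ha, res_add (hf a (by simp)) (sum_mem fun i hi =>
      hf i (by simp [hi])), ih fun i hi => hf i (by simp [hi])]

lemma res_prod {ι : Type*} (s : Finset ι) {f : ι → ℂ} (hf : ∀ i ∈ s, f i ∈ V) :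
    res V (∏ i ∈ s, f i) = ∏ i ∈ s, res V (f i) := by
  classical
  induction s using Finset.induction_on with
  | empty => simp [res_one]
  | insert a s ha ih =>
    rw [Finset.prod_insert ha, Finset.prod_insert ha, res_mul (hf a (by simp)) (prod_mem fun i hi =>
      hf i (by simp [hi])), ih fun i hi => hf i (by simp [hi])]

lemma mem_iff_val {x : ℂ} : x ∈ V ↔ V.valuation x ≤ 1 := (V.valuation_le_one_iff x).symm

lemma res_eq_zero_iff {x : ℂ} (hx : x ∈ V) : res V x = 0 ↔ V.valuation x < 1 := by
  rw [res_of_mem hx, IsLocalRing.residue_eq_zero_iff]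
  exact V.valuation_lt_one_iff ⟨x, hx⟩

lemma res_ne_zero_iff {x : ℂ} (hx : x ∈ V) : res V x ≠ 0 ↔ V.valuation x = 1 := by
  rw [Ne, res_eq_zero_iff hx, not_lt]
  exact ⟨fun h => le_antisymm (mem_iff_val.mp hx) h, fun h => h.ge⟩

lemma mem_of_lt {x : ℂ} (hx : V.valuation x < 1) : x ∈ V := mem_iff_val.mpr hx.le

lemma inv_mem_of_res {x : ℂ} (hx : x ∈ V) (h : res V x ≠ 0) : x⁻¹ ∈ V := by
  rw [mem_iff_val, map_inv₀, (res_ne_zero_iff hx).mp h, inv_one]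

lemma res_inv {x : ℂ} (hx : x ∈ V) (h : res V x ≠ 0) : res V x⁻¹ = (res V x)⁻¹ := by
  have h0 : x ≠ 0 := by
    rintro rfl
    exact h res_zero
  refine eq_inv_of_mul_eq_one_left ?_
  rw [← res_mul (inv_mem_of_res hx h) hx, inv_mul_cancel₀ h0, res_one]

lemma mem_of_pow_mem {x : ℂ} {n : ℕ} (hn : n ≠ 0) (h : x ^ n ∈ V) : x ∈ V := by
  rw [mem_iff_val, map_pow] at h
  exact mem_iff_val.mpr ((pow_le_one_iff hn).mp h)

lemma O3_le {x : ℂ} (hx : x ∈ O3) : x ∈ V := by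
  have h : ρ3 ∈ V := mem_of_pow_mem three_ne_zero (by rw [rho_pow_three]; exact one_mem V)
  obtain ⟨a, b, rfl⟩ := mem_O3_iff.mp hx
  exact add_mem (intCast_mem V a) (mul_mem (intCast_mem V b) h)

lemma res_rho_sq : res V ρ3 ^ 2 = -1 - res V ρ3 := by
  rw [← res_pow (O3_le rho_mem), rho_sq, res_sub (neg_mem (one_mem V)) (O3_le rho_mem),
    res_neg (one_mem V), res_one]

/-- An ideal of `ℤ[ρ]` generated by a non-unit is dominated by a valuation ring. -/
lemma exists_valuation {z : ℂ} (hz : z ∈ O3) (h : ∀ w ∈ O3, z * w ≠ 1) :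
    ∃ V : ValuationSubring ℂ, V.valuation z < 1 := by
  obtain ⟨V, -, hV⟩ := Ideal.image_subset_nonunits_valuationSubring
    (Ideal.span {(⟨z, hz⟩ : O3)}) (by
      rw [Ne, Ideal.span_singleton_eq_top]
      intro hu
      obtain ⟨w, hw⟩ := hu.exists_right_inv
      exact h w w.2 (by simpa using congrArg Subtype.val hw))
  refine ⟨V, ?_⟩
  have := hV ⟨⟨z, hz⟩, Ideal.subset_span rfl, rfl⟩
  exact this

lemma isIntegral_of_forall_mem {x : ℂ} (h : ∀ V : ValuationSubring ℂ, x ∈ V) : IsIntegral ℤ x := by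
  have h1 : x ∈ (integralClosure (Subring.closure (∅ : Set ℂ)) ℂ).toSubring := by
    rw [← iInf_valuationSubring_superset, Subring.mem_iInf]
    exact fun V => h V.1
  have h2 : IsIntegral (Subring.closure (∅ : Set ℂ)) x := h1
  have : Algebra.IsIntegral ℤ (Subring.closure (∅ : Set ℂ)) := by
    refine ⟨fun y => ?_⟩
    obtain ⟨n, hn⟩ : ∃ n : ℤ, (n : Subring.closure (∅ : Set ℂ)) = y := by
      have h3 : ∀ z ∈ Subring.closure (∅ : Set ℂ), z ∈ (⊥ : Subring ℂ) := by
        rw [Subring.closure_empty]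
        exact fun z hz => hz
      obtain ⟨n, hn⟩ := Subring.mem_bot.mp (h3 y y.2)
      exact ⟨n, Subtype.ext (by simpa using hn)⟩
    rw [← hn]
    exact isIntegral_algebraMap (x := n)
  exact isIntegral_trans (R := ℤ) x h2

end residue

end FermatCurve

namespace FermatCurve

open scoped ComplexConjugate

namespace EisPrime

variable {p : ℕ} {π : ℂ} {ι : ℤ} (E : EisPrime p π ι)
include E

lemma q_sq : ((ι : ZMod p) - (ι : ZMod p) ^ 2) ^ 2 = -3 := by
  have h := E.iota_sq
  have h3 : (ι : ZMod p) ^ 3 = 1 := by linear_combination ((ι : ZMod p) - 1) * h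
  linear_combination (1 : ZMod p) * h + (ι - 2) * h3

lemma three_ne_zero' : (3 : ZMod p) ≠ 0 := by
  intro h
  have h1 : ((3 : ℕ) : ZMod p) = 0 := by exact_mod_cast h
  rw [ZMod.natCast_eq_zero_iff] at h1
  have h2 := (Nat.prime_dvd_prime_iff_eq E.prime Nat.prime_three).mp h1
  have := E.mod3
  omega

lemma q_ne_zero : (ι : ZMod p) - (ι : ZMod p) ^ 2 ≠ 0 := by
  intro h
  have h1 := E.q_sq
  rw [h] at h1
  exact E.three_ne_zero' (by linear_combination h1)

lemma q_pow : ((ι : ZMod p) - (ι : ZMod p) ^ 2) ^ (p - 1) = 1 := by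
  have := Fact.mk E.prime
  exact ZMod.pow_card_sub_one_eq_one E.q_ne_zero

lemma one_le_sub : 1 ≤ p - 1 := by have := E.prime.two_le; omega

variable (V : ValuationSubring ℂ)

lemma res_y_of_lt {a : ZMod p} (h : V.valuation (tx π a) < 1) : V.valuation (ty π a) = 1 := by
  have hx := mem_of_lt h
  have hy : ty π a ∈ V := by
    refine mem_of_pow_mem (three_ne_zero) (n := 3) ?_
    rw [show ty π a ^ 3 = 1 - tx π a ^ 3 by linear_combination E.seq.curve a]
    exact sub_mem (one_mem V) (pow_mem hx 3)
  rw [← res_ne_zero_iff hy]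
  intro h0
  have := congrArg (res V) (E.seq.curve a)
  rw [res_add (pow_mem hx 3) (pow_mem hy 3), res_pow hx, res_pow hy, h0, (res_eq_zero_iff hx).mpr h,
    res_one] at this
  norm_num at this

lemma val_q_of_lt {a : ZMod p} (h : V.valuation (tx π a) < 1) :
    V.valuation (tx π (((ι : ZMod p) - (ι : ZMod p) ^ 2) * a)) =
      V.valuation (ρ3 - ρ3 ^ 2) * V.valuation (tx π a) := by
  have hx := mem_of_lt h
  have hρ := pow_mem (O3_le (V := V) rho_mem) 2
  have h1 : V.valuation (1 + ρ3 ^ 2 * tx π a ^ 3) = 1 := by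
    rw [← res_ne_zero_iff (add_mem (one_mem V) (mul_mem hρ (pow_mem hx 3))),
      res_add (one_mem V) (mul_mem hρ (pow_mem hx 3)), res_mul hρ (pow_mem hx 3), res_pow hx,
      (res_eq_zero_iff hx).mpr h, res_one]
    simp
  have := congrArg V.valuation (E.mul_q a).1
  rwa [map_mul, h1, mul_one, map_mul, map_mul, E.res_y_of_lt V h, mul_one] at this

omit E in
lemma sqrt_le : V.valuation (ρ3 - ρ3 ^ 2) ≤ 1 :=
  mem_iff_val.mp (O3_le (sub_mem rho_mem (pow_mem rho_mem 2)))

lemma tx_mem (a : ZMod p) : tx π a ∈ V := by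
  by_contra h
  have key : ∀ k : ℕ, V.valuation (tx π (((ι : ZMod p) - (ι : ZMod p) ^ 2) ^ (k + 1) * a)) < 1 := by
    intro k
    induction k with
    | zero =>
      rw [mem_iff_val, not_le] at h
      set X := V.valuation (tx π a)
      have hX3 : 1 < X ^ 3 := one_lt_pow₀ h three_ne_zero
      have hρ : V.valuation ρ3 = 1 := by
        have : V.valuation ρ3 ^ 3 = 1 := by rw [← map_pow, rho_pow_three, map_one]
        exact (pow_left_inj₀ zero_le zero_le three_ne_zero).mp (by rw [this, one_pow])
      have h1 : V.valuation (1 + ρ3 ^ 2 * tx π a ^ 3) = X ^ 3 := by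
        rw [add_comm, Valuation.map_add_eq_of_lt_left]
        · simp [hρ, X]
        · simpa [hρ] using hX3
      have hy : V.valuation (ty π a) ^ 3 = X ^ 3 := by
        rw [← map_pow, show ty π a ^ 3 = -(tx π a ^ 3) + 1 by linear_combination E.seq.curve a,
          Valuation.map_add_eq_of_lt_left]
        · simp [X]
        · simpa using hX3
      have hy : V.valuation (ty π a) = X := (pow_left_inj₀ zero_le zero_le three_ne_zero).mp hy
      have := congrArg V.valuation (E.mul_q a).1
      rw [map_mul, h1, map_mul, map_mul, hy] at this
      rw [zero_add, pow_one]
      by_contra hc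
      rw [not_lt] at hc
      have h2 : X ^ 3 ≤ X * X := by
        calc X ^ 3 ≤ V.valuation (tx π (((ι : ZMod p) - (ι : ZMod p) ^ 2) * a)) * X ^ 3 :=
              le_mul_of_one_le_left zero_le hc
          _ = V.valuation (ρ3 - ρ3 ^ 2) * (X * X) := this
          _ ≤ X * X := mul_le_of_le_one_left zero_le (sqrt_le V)
      have h3 : X * X < X ^ 3 := by
        rw [show X ^ 3 = X * X * X by rw [pow_succ, sq]]
        have : 0 < X * X := mul_pos (zero_lt_one.trans h) (zero_lt_one.trans h)
        exact lt_mul_of_one_lt_right this h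
      exact absurd h2 h3.not_ge
    | succ k ih =>
      rw [pow_succ', mul_assoc, E.val_q_of_lt V ih]
      exact lt_of_le_of_lt (mul_le_of_le_one_left zero_le (sqrt_le V)) ih
  have h1 := key (p - 1 - 1)
  rw [Nat.sub_add_cancel E.one_le_sub, E.q_pow, one_mul] at h1
  exact h (mem_of_lt h1)

lemma ty_mem (a : ZMod p) : ty π a ∈ V := by
  refine mem_of_pow_mem (three_ne_zero) (n := 3) ?_
  rw [show ty π a ^ 3 = 1 - tx π a ^ 3 by linear_combination E.seq.curve a]
  exact sub_mem (one_mem V) (pow_mem (E.tx_mem V a) 3)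

lemma val_ty (a : ZMod p) : V.valuation (ty π a) = 1 := by
  refine le_antisymm (mem_iff_val.mp (E.ty_mem V a)) ?_
  have h := congrArg V.valuation (E.seq.y_mul_neg a)
  rw [map_mul, map_one] at h
  calc (1 : _) = _ := h.symm
    _ ≤ V.valuation (ty π a) := mul_le_of_le_one_right zero_le (mem_iff_val.mp (E.ty_mem V (-a)))

lemma res_curve (a : ZMod p) : res V (tx π a) ^ 3 + res V (ty π a) ^ 3 = 1 := by
  rw [← res_pow (E.tx_mem V a), ← res_pow (E.ty_mem V a), ← res_add (pow_mem (E.tx_mem V a) 3)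
    (pow_mem (E.ty_mem V a) 3), E.seq.curve, res_one]

variable {V}

omit E in
lemma sqrt_lt (h3 : V.valuation 3 < 1) : V.valuation (ρ3 - ρ3 ^ 2) < 1 := by
  have : V.valuation (ρ3 - ρ3 ^ 2) ^ 2 < 1 := by
    rw [← map_pow, show (ρ3 - ρ3 ^ 2) ^ 2 = -3 by
      linear_combination rho_sq + (ρ3 - 2) * rho_pow_three, Valuation.map_neg]
    exact h3
  exact (pow_lt_one_iff two_ne_zero).mp this

lemma val_tx_of_three (h3 : V.valuation 3 < 1) {a : ZMod p} (ha : a ≠ 0) :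
    V.valuation (tx π a) = 1 := by
  refine le_antisymm (mem_iff_val.mp (E.tx_mem V a)) (not_lt.mp fun h => ?_)
  have key : ∀ k : ℕ, V.valuation (tx π (((ι : ZMod p) - (ι : ZMod p) ^ 2) ^ k * a)) =
      V.valuation (ρ3 - ρ3 ^ 2) ^ k * V.valuation (tx π a) := by
    intro k
    induction k with
    | zero => simp
    | succ k ih =>
      rw [pow_succ', mul_assoc, E.val_q_of_lt V, ih, ← mul_assoc, ← pow_succ']
      rw [ih]
      exact lt_of_le_of_lt (mul_le_of_le_one_left zero_le (pow_le_one₀ zero_le (sqrt_le V))) h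
  have h1 := key (p - 1)
  rw [E.q_pow, one_mul] at h1
  have h2 : V.valuation (ρ3 - ρ3 ^ 2) ^ (p - 1) < 1 :=
    pow_lt_one₀ zero_le (sqrt_lt h3) (by have := E.one_le_sub; omega)
  have h4 : 0 < V.valuation (tx π a) := (Valuation.pos_iff _).mpr (E.seq.x_ne a ha)
  have := mul_lt_of_lt_one_left h4 h2
  exact absurd h1 this.ne'

omit E in
lemma res_three (h3 : V.valuation 3 < 1) : (3 : IsLocalRing.ResidueField V) = 0 := by
  have := res_natCast (V := V) 3
  push_cast at this
  rw [← this, res_eq_zero_iff (mem_of_lt h3)]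
  exact h3

omit E in
lemma res_rho_of_three (h3 : V.valuation 3 < 1) : res V ρ3 = 1 := by
  have h := res_three h3
  have h1 := res_rho_sq (V := V)
  have : (res V ρ3 - 1) ^ 2 = 0 := by linear_combination h1 - res V ρ3 * h
  exact sub_eq_zero.mp (pow_eq_zero_iff two_ne_zero |>.mp this)

lemma res_tx_of_three (h3 : V.valuation 3 < 1) {a : ZMod p} (ha : a ≠ 0) :
    res V (tx π a) = -1 := by
  have h := res_three h3
  have hx := E.tx_mem V a
  have := Fact.mk E.prime
  have hρ := pow_mem (O3_le (V := V) rho_mem) 2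
  have hm := add_mem (one_mem V) (mul_mem hρ (pow_mem hx 3))
  have h1 : res V (1 + ρ3 ^ 2 * tx π a ^ 3) = 0 := by
    rw [res_eq_zero_iff hm]
    have := congrArg V.valuation (E.mul_q a).1
    rw [map_mul, E.val_tx_of_three h3 (mul_ne_zero E.q_ne_zero ha), one_mul, map_mul, map_mul,
      E.val_tx_of_three h3 ha, E.val_ty V, mul_one, mul_one] at this
    rw [this]
    exact sqrt_lt h3
  rw [res_add (one_mem V) (mul_mem hρ (pow_mem hx 3)), res_mul hρ (pow_mem hx 3), res_pow hx,
    res_pow (O3_le rho_mem), res_one, res_rho_of_three h3] at h1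
  have : (res V (tx π a) + 1) ^ 3 = 0 := by
    linear_combination h1 + (res V (tx π a) ^ 2 + res V (tx π a)) * h
  exact eq_neg_of_add_eq_zero_left (pow_eq_zero_iff three_ne_zero |>.mp this)

lemma res_ty_of_three (h3 : V.valuation 3 < 1) {a : ZMod p} (ha : a ≠ 0) :
    res V (ty π a) = -1 := by
  have h := res_three h3
  have h1 := E.res_curve V a
  rw [E.res_tx_of_three h3 ha] at h1
  have : (res V (ty π a) + 1) ^ 3 = 0 := by
    linear_combination h1 + (res V (ty π a) ^ 2 + res V (ty π a) + 1) * h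
  exact eq_neg_of_add_eq_zero_left (pow_eq_zero_iff three_ne_zero |>.mp this)

lemma isIntegral_tx (a : ZMod p) : IsIntegral ℤ (tx π a) :=
  isIntegral_of_forall_mem fun V => E.tx_mem V a

lemma isIntegral_ty (a : ZMod p) : IsIntegral ℤ (ty π a) :=
  isIntegral_of_forall_mem fun V => E.ty_mem V a

end EisPrime

end FermatCurve

namespace FermatCurve

open scoped ComplexConjugate

/-- A set of representatives of the orbits of multiplication by the cube root of unity `ι` on the
non-zero elements of `ℤ/p`. -/
structure ThirdSet {p : ℕ} (ι : ZMod p) (T : Finset (ZMod p)) : Prop where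
  ne : ∀ s ∈ T, s ≠ 0
  cover : ∀ r, r ≠ 0 → ∃ s ∈ T, r = s ∨ r = ι * s ∨ r = ι ^ 2 * s
  disj : ∀ s ∈ T, ∀ s' ∈ T, s' ≠ ι * s ∧ s' ≠ ι ^ 2 * s

namespace ThirdSet

variable {p : ℕ} [Fact p.Prime] {ι : ZMod p} {T : Finset (ZMod p)} (hT : ThirdSet ι T)
  (hι : ι ^ 3 = 1)
include hT hι

lemma sq : ThirdSet (ι ^ 2) T where
  ne := hT.ne
  cover r hr := by
    obtain ⟨s, hs, h⟩ := hT.cover r hr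
    refine ⟨s, hs, ?_⟩
    rw [show (ι ^ 2) ^ 2 = ι by linear_combination ι * hι]
    tauto
  disj s hs s' hs' := by
    rw [show (ι ^ 2) ^ 2 = ι by linear_combination ι * hι]
    exact (hT.disj s hs s' hs').symm

@[to_additive]
lemma prod_erase {M : Type*} [CommMonoid M] (f : ZMod p → M) :
    ∏ r ∈ Finset.univ.erase 0, f r = ∏ s ∈ T, f s * f (ι * s) * f (ι ^ 2 * s) := by
  classical
  have hι0 : ι ≠ 0 := by rintro rfl; simp at hι
  have h1 : Function.Injective (fun s : ZMod p => ι * s) := mul_right_injective₀ hι0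
  have h2 : Function.Injective (fun s : ZMod p => ι ^ 2 * s) :=
    mul_right_injective₀ (pow_ne_zero 2 hι0)
  have hd1 : Disjoint T (T.image fun s => ι * s) := by
    rw [Finset.disjoint_left]
    intro s hs h
    obtain ⟨s', hs', rfl⟩ := Finset.mem_image.mp h
    exact (hT.disj s' hs' _ hs).1 rfl
  have hd2 : Disjoint (T ∪ T.image fun s => ι * s) (T.image fun s => ι ^ 2 * s) := by
    rw [Finset.disjoint_left]
    intro s hs h
    obtain ⟨s', hs', rfl⟩ := Finset.mem_image.mp h
    rcases Finset.mem_union.mp hs with hs | hs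
    · exact (hT.disj s' hs' _ hs).2 rfl
    · obtain ⟨s'', hs'', h3⟩ := Finset.mem_image.mp hs
      refine (hT.disj s' hs' _ hs'').1 (mul_left_cancel₀ hι0 ?_)
      rw [h3]
      ring
  have hU : (Finset.univ.erase 0 : Finset (ZMod p)) =
      (T ∪ T.image fun s => ι * s) ∪ T.image fun s => ι ^ 2 * s := by
    ext r
    simp only [Finset.mem_erase, Finset.mem_univ, and_true, Finset.mem_union, Finset.mem_image]
    constructor
    · intro hr
      obtain ⟨s, hs, h | h | h⟩ := hT.cover r hr
      · exact Or.inl (Or.inl (h ▸ hs))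
      · exact Or.inl (Or.inr ⟨s, hs, h.symm⟩)
      · exact Or.inr ⟨s, hs, h.symm⟩
    · rintro ((h | ⟨s, hs, rfl⟩) | ⟨s, hs, rfl⟩)
      · exact hT.ne r h
      · exact mul_ne_zero hι0 (hT.ne s hs)
      · exact mul_ne_zero (pow_ne_zero 2 hι0) (hT.ne s hs)
  rw [hU, Finset.prod_union hd2, Finset.prod_union hd1, Finset.prod_image h1.injOn,
    Finset.prod_image h2.injOn, Finset.prod_mul_distrib, Finset.prod_mul_distrib]

lemma card : T.card * 3 + 1 = p := by
  have h := hT.sum_erase hι (fun _ => (1 : ℕ))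
  rw [Finset.sum_const, Finset.card_erase_of_mem (Finset.mem_univ _), Finset.card_univ, ZMod.card,
    Finset.sum_const] at h
  have := (Fact.out : p.Prime).one_le
  simp only [smul_eq_mul] at h
  omega

lemma eq_card : T.card = (p - 1) / 3 := by
  have := hT.card hι
  omega

lemma sum_eq_of_invariant {f : ZMod p → ℂ} (hf : ∀ a, f (ι * a) = f a) :
    ∑ r, f r = f 0 + 3 * ∑ s ∈ T, f s := by
  rw [← Finset.add_sum_erase _ _ (Finset.mem_univ (0 : ZMod p)), hT.sum_erase hι, Finset.mul_sum]
  congr 1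
  refine Finset.sum_congr rfl fun s _ => ?_
  have h2 : ι ^ 2 * s = ι * (ι * s) := by ring
  simp only [h2, hf]
  ring

end ThirdSet

namespace EisPrime

variable {p : ℕ} {π : ℂ} {ι : ℤ} (E : EisPrime p π ι)

/-- Reduction modulo `π` of Eisenstein integers. -/
def red (E : EisPrime p π ι) (ν : ℂ) : ZMod p :=
  open Classical in if h : ν ∈ O3 then ((E.exists_int_cong h).choose : ZMod p) else 0

include E

omit E in
lemma _root_.FermatCurve.ECong.symm {a b c : ℂ} (h : ECong a b c) : ECong b a c := by
  obtain ⟨d, hd, h⟩ := h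
  exact ⟨-d, neg_mem hd, by linear_combination -h⟩

omit E in
lemma _root_.FermatCurve.ECong.trans {a b c d : ℂ} (h : ECong a b d) (h' : ECong b c d) :
    ECong a c d := by
  obtain ⟨e, he, h⟩ := h
  obtain ⟨e', he', h'⟩ := h'
  exact ⟨e + e', add_mem he he', by linear_combination h + h'⟩

lemma red_eq {ν : ℂ} {r : ℤ} (h : ECong ν r π) (hν : ν ∈ O3) : E.red ν = r := by
  rw [red, dif_pos hν, ← E.cong_iff]
  exact ECong.trans (ECong.symm (E.exists_int_cong hν).choose_spec) h

lemma cong_iff_red {ν μ : ℂ} (hν : ν ∈ O3) (hμ : μ ∈ O3) : ECong ν μ π ↔ E.red ν = E.red μ := by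
  obtain ⟨r, hr⟩ := E.exists_int_cong hν
  obtain ⟨s, hs⟩ := E.exists_int_cong hμ
  rw [E.red_eq hr hν, E.red_eq hs hμ, ← E.cong_iff]
  exact ⟨fun h => ECong.trans (ECong.trans (ECong.symm hr) h) hs,
    fun h => ECong.trans (ECong.trans hr h) (ECong.symm hs)⟩

lemma red_int (r : ℤ) : E.red r = r := E.red_eq ⟨0, zero_mem _, by simp⟩ (int_mem_O3 r)

lemma red_one : E.red 1 = 1 := by simpa using E.red_int 1

lemma red_rho : E.red ρ3 = ι := E.red_eq E.iota rho_mem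

lemma red_mul {ν μ : ℂ} (hν : ν ∈ O3) (hμ : μ ∈ O3) : E.red (ν * μ) = E.red ν * E.red μ := by
  obtain ⟨r, hr⟩ := E.exists_int_cong hν
  obtain ⟨s, hs⟩ := E.exists_int_cong hμ
  rw [E.red_eq hr hν, E.red_eq hs hμ, ← Int.cast_mul]
  refine E.red_eq ?_ (mul_mem hν hμ)
  obtain ⟨e, he, h⟩ := hr
  obtain ⟨e', he', h'⟩ := hs
  refine ⟨e * μ + r * e', add_mem (mul_mem he hμ) (mul_mem (int_mem_O3 r) he'), ?_⟩
  push_cast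
  linear_combination μ * h + r * h'

lemma red_add {ν μ : ℂ} (hν : ν ∈ O3) (hμ : μ ∈ O3) : E.red (ν + μ) = E.red ν + E.red μ := by
  obtain ⟨r, hr⟩ := E.exists_int_cong hν
  obtain ⟨s, hs⟩ := E.exists_int_cong hμ
  rw [E.red_eq hr hν, E.red_eq hs hμ, ← Int.cast_add]
  refine E.red_eq ?_ (add_mem hν hμ)
  obtain ⟨e, he, h⟩ := hr
  obtain ⟨e', he', h'⟩ := hs
  refine ⟨e + e', add_mem he he', ?_⟩
  push_cast
  linear_combination h + h'

lemma red_neg {ν : ℂ} (hν : ν ∈ O3) : E.red (-ν) = -E.red ν := by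
  have := E.red_mul (int_mem_O3 (-1)) hν
  rw [E.red_int] at this
  simpa using this

lemma red_pow {ν : ℂ} (hν : ν ∈ O3) (n : ℕ) : E.red (ν ^ n) = E.red ν ^ n := by
  induction n with
  | zero => simpa using E.red_one
  | succ n ih => rw [pow_succ, E.red_mul (pow_mem hν n) hν, ih, pow_succ]

lemma red_prod {S : Finset ℂ} (hS : ∀ ν ∈ S, ν ∈ O3) : E.red (∏ ν ∈ S, ν) = ∏ ν ∈ S, E.red ν := by
  classical
  induction S using Finset.induction_on with
  | empty => simpa using E.red_one
  | insert a S ha ih =>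
    have h' : ∀ ν ∈ S, ν ∈ O3 := fun ν h => hS ν (Finset.mem_insert_of_mem h)
    rw [Finset.prod_insert ha, Finset.prod_insert ha,
      E.red_mul (hS a (Finset.mem_insert_self _ _)) (prod_mem h'), ih h']

lemma coprime_iff_red {ν : ℂ} (hν : ν ∈ O3) : ECoprime ν π ↔ E.red ν ≠ 0 := by
  obtain ⟨r, hr⟩ := E.exists_int_cong hν
  rw [E.red_eq hr hν, ← E.coprime_iff]
  obtain ⟨d, hd, h⟩ := hr
  constructor
  · rintro ⟨u, hu, v, hv, e⟩
    exact ⟨u, hu, u * d + v, add_mem (mul_mem hu hd) hv, by linear_combination e - u * h⟩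
  · rintro ⟨u, hu, v, hv, e⟩
    exact ⟨u, hu, -u * d + v, add_mem (mul_mem (neg_mem hu) hd) hv, by
      linear_combination e + u * h⟩

lemma iota_cube : (ι : ZMod p) ^ 3 = 1 := E.seq.iota_cube

lemma X3_red {ν : ℂ} (hν : ν ∈ O3) : X3 (ν / π) = tx π (E.red ν) := by
  obtain ⟨r, hr⟩ := E.exists_int_cong hν
  rw [E.red_eq hr hν, E.tx_of_cong hr]

lemma exists_thirdSet {S : Finset ℂ} (hS : IsThirdSet π S) :
    ∃ T : Finset (ZMod p), ThirdSet (ι : ZMod p) T ∧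
      ∏ ν ∈ S, phi3 (ν / π) = ∏ s ∈ T, tx π s ∧ E.red (∏ ν ∈ S, ν) = ∏ s ∈ T, s := by
  classical
  obtain ⟨h1, h2, h3⟩ := hS
  have hinj : Set.InjOn E.red S := by
    intro ν hν μ hμ h
    refine (h3 ν hν μ hμ 1 (by simp) 1 (by simp) ?_).1
    rw [one_mul, one_mul, E.cong_iff_red (h1 ν hν).1 (h1 μ hμ).1, h]
  have hρ1 : (1 : ℂ) ≠ ρ3 := E.seq.omega_ne_one.symm
  have hρ2 : (1 : ℂ) ≠ ρ3 ^ 2 := E.seq.omega_sq_ne_one.symm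
  refine ⟨S.image E.red, ⟨?_, ?_, ?_⟩, ?_, ?_⟩
  · intro s hs
    obtain ⟨ν, hν, rfl⟩ := Finset.mem_image.mp hs
    exact (E.coprime_iff_red (h1 ν hν).1).mp (h1 ν hν).2
  · intro r hr
    obtain ⟨r, rfl⟩ := ZMod.intCast_surjective r
    obtain ⟨ν, hν, ε, hε, hc⟩ := h2 r (int_mem_O3 r) (E.coprime_iff.mpr hr)
    refine ⟨E.red ν, Finset.mem_image_of_mem _ hν, ?_⟩
    have hε' : ε ∈ O3 := by
      rcases hε with rfl | rfl | rfl
      · exact one_mem _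
      · exact rho_mem
      · exact pow_mem rho_mem 2
    rw [E.cong_iff_red (int_mem_O3 r) (mul_mem hε' (h1 ν hν).1), E.red_mul hε' (h1 ν hν).1,
      E.red_int] at hc
    rw [hc]
    rcases hε with rfl | rfl | rfl
    · left; rw [E.red_one, one_mul]
    · right; left; rw [E.red_rho]
    · right; right; rw [E.red_pow rho_mem, E.red_rho]
  · intro s hs s' hs'
    obtain ⟨ν, hν, rfl⟩ := Finset.mem_image.mp hs
    obtain ⟨μ, hμ, rfl⟩ := Finset.mem_image.mp hs'
    constructor
    · intro h
      refine hρ1 (h3 μ hμ ν hν 1 (by simp) ρ3 (by simp) ?_).2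
      rw [E.cong_iff_red (mul_mem (one_mem _) (h1 μ hμ).1) (mul_mem rho_mem (h1 ν hν).1),
        E.red_mul rho_mem (h1 ν hν).1, one_mul, E.red_rho, h]
    · intro h
      refine hρ2 (h3 μ hμ ν hν 1 (by simp) (ρ3 ^ 2) (by simp) ?_).2
      rw [E.cong_iff_red (mul_mem (one_mem _) (h1 μ hμ).1) (mul_mem (pow_mem rho_mem 2)
        (h1 ν hν).1), E.red_mul (pow_mem rho_mem 2) (h1 ν hν).1, one_mul, E.red_pow rho_mem,
        E.red_rho, h]
  · rw [Finset.prod_image hinj]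
    exact Finset.prod_congr rfl fun ν hν => by rw [phi3_eq, E.X3_red (h1 ν hν).1]
  · rw [Finset.prod_image hinj, E.red_prod fun ν hν => (h1 ν hν).1]

lemma exists_mulChar {χ : ℂ → ℂ} (hχ : IsCubicChar π p χ) : ∃ X : MulChar (ZMod p) ℂ,
    (∀ r : ℤ, χ r = X r) ∧ (∀ a, a ≠ 0 → X a ^ 3 = 1) ∧
    ∀ a, a ≠ 0 → E.red (X a) = a ^ ((p - 1) / 3) := by
  have := Fact.mk E.prime
  have hred : ∀ r : ℤ, χ r = χ (((r : ZMod p).val : ℕ) : ℂ) := fun r =>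
    hχ.resChar.periodic _ (int_mem_O3 r) _ (natCast_mem _ _) (E.cong_val r)
  let X : MulChar (ZMod p) ℂ :=
    { toFun := fun a => χ ((a.val : ℕ) : ℂ)
      map_one' := by
        have := hred 1
        rw [Int.cast_one, hχ.resChar.map_one] at this
        simpa using this.symm
      map_mul' := by
        intro a b
        obtain ⟨r, rfl⟩ := ZMod.intCast_surjective a
        obtain ⟨s, rfl⟩ := ZMod.intCast_surjective b
        rw [← Int.cast_mul, ← hred, ← hred, ← hred, Int.cast_mul,
          hχ.resChar.map_mul _ (int_mem_O3 r) _ (int_mem_O3 s)]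
      map_nonunit' := by
        intro a ha
        obtain ⟨r, rfl⟩ := ZMod.intCast_surjective a
        rw [← hred]
        refine hχ.resChar.vanish _ (int_mem_O3 r) ?_
        rw [E.coprime_iff]
        intro h
        exact ha (isUnit_iff_ne_zero.mpr h) }
  have hX : ∀ r : ℤ, χ r = X r := hred
  have h3 : ∀ a : ZMod p, a ≠ 0 → X a ^ 3 = 1 := by
    intro a ha
    obtain ⟨r, rfl⟩ := ZMod.intCast_surjective a
    rw [← hX]
    exact hχ.cube _ (int_mem_O3 r) (E.coprime_iff.mpr ha)
  refine ⟨X, hX, h3, ?_⟩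
  intro a ha
  have hO : X a ∈ O3 := by
    have : (X a - 1) * ((X a - ρ3) * (X a - ρ3 ^ 2)) = 0 := by
      linear_combination h3 a ha + (X a - X a ^ 2) * rho_sq + (X a - 1) * rho_pow_three
    rcases mul_eq_zero.mp this with h | h
    · rw [sub_eq_zero.mp h]; exact one_mem _
    · rcases mul_eq_zero.mp h with h | h
      · rw [sub_eq_zero.mp h]; exact rho_mem
      · rw [sub_eq_zero.mp h]; exact pow_mem rho_mem 2
  obtain ⟨r, rfl⟩ := ZMod.intCast_surjective a
  have h := hχ.euler _ (int_mem_O3 r) (E.coprime_iff.mpr ha)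
  rw [hX, E.cong_iff_red hO (pow_mem (int_mem_O3 r) _), E.red_pow (int_mem_O3 r), E.red_int] at h
  exact h

end EisPrime

/-- Sums over the integers `1, …, p - 1` as sums over `ℤ/p`. -/
lemma sum_Icc_eq {p : ℕ} [Fact p.Prime] {f : ZMod p → ℂ} (h0 : f 0 = 0) :
    ∑ r ∈ Finset.Icc 1 (p - 1), f (r : ZMod p) = ∑ a, f a := by
  have hp := (Fact.out : p.Prime).two_le
  rw [← Finset.add_sum_erase _ _ (Finset.mem_univ (0 : ZMod p)), h0, zero_add]
  refine Finset.sum_bij' (fun r _ => (r : ZMod p)) (fun a _ => a.val) ?_ ?_ ?_ ?_ ?_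
  · intro r hr
    rw [Finset.mem_Icc] at hr
    simp only [Finset.mem_erase, Finset.mem_univ, and_true]
    rw [Ne, ZMod.natCast_eq_zero_iff]
    intro h
    have := Nat.le_of_dvd (by omega) h
    omega
  · intro a ha
    simp only [Finset.mem_erase, Finset.mem_univ, and_true] at ha
    have h1 := ZMod.val_lt a
    have h2 : a.val ≠ 0 := by rwa [Ne, ZMod.val_eq_zero]
    rw [Finset.mem_Icc]
    omega
  · intro r hr
    rw [Finset.mem_Icc] at hr
    exact ZMod.val_natCast_of_lt (by omega)
  · intro a _
    simp
  · intro r _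
    rfl

end FermatCurve

namespace FermatCurve

open scoped ComplexConjugate

lemma exists_valuation_three : ∃ V : ValuationSubring ℂ, V.valuation 3 < 1 := by
  refine exists_valuation (by simpa only [Int.cast_ofNat] using int_mem_O3 3) fun w hw h => ?_
  obtain ⟨n, hn⟩ := exists_norm_O3 hw
  have h1 := congrArg conj h
  rw [map_mul, map_one, map_ofNat] at h1
  have h2 : (9 : ℂ) * n = 1 := by
    rw [← hn]
    linear_combination 3 * conj w * h + h1
  have h3 : (9 : ℤ) * n = 1 := by exact_mod_cast h2
  omega

namespace EisPrime

variable {p : ℕ} [Fact p.Prime] {π : ℂ} {ι : ℤ} (E : EisPrime p π ι)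

/-- The sum of the `y`-coordinates of the `π`-torsion points. -/
def ysum (_ : EisPrime p π ι) : ℂ := ∑ r : ZMod p, ty π r

include E

omit [Fact p.Prime] in
lemma res_p_of_three {V : ValuationSubring ℂ} (h3 : V.valuation 3 < 1) :
    (p : IsLocalRing.ResidueField V) = 1 := by
  have h : p = 3 * (p / 3) + 1 := by have := E.mod3; omega
  rw [h]
  push_cast
  rw [res_three h3]
  ring

lemma res_ysum_of_three {V : ValuationSubring ℂ} (h3 : V.valuation 3 < 1) :
    res V E.ysum = 1 := by
  rw [ysum, res_sum _ fun r _ => E.ty_mem V r,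
    ← Finset.add_sum_erase _ _ (Finset.mem_univ (0 : ZMod p)), E.seq.y0, res_one,
    Finset.sum_congr rfl fun r hr => E.res_ty_of_three h3 (Finset.ne_of_mem_erase hr),
    Finset.sum_const, Finset.card_erase_of_mem (Finset.mem_univ _), Finset.card_univ, ZMod.card,
    nsmul_eq_mul, Nat.cast_sub E.prime.one_le, E.res_p_of_three h3]
  simp

lemma ysum_ne_zero : E.ysum ≠ 0 := by
  obtain ⟨V, hV⟩ := exists_valuation_three
  intro h
  have := E.res_ysum_of_three hV
  rw [h, res_zero] at this
  exact zero_ne_one this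

lemma ysum_conj : E.conj_pi.ysum = conj E.ysum := by
  rw [ysum, ysum, map_sum]
  exact Finset.sum_congr rfl fun r _ => ty_conj π r

/-- The Fourier transform of the torsion sequence of `π` is the torsion sequence of `conj π`. -/
lemma exists_fourier : ∃ e : AddChar (ZMod p) ℂ, e.IsPrimitive ∧
    ∀ j, four e (tx π) j = -E.ysum * tx (conj π) j ∧
      four e (ty π) j = E.ysum * ty (conj π) (-j) ∧
      four e (fun d => ty π d / tx π d) j + four e (fun d => ty π d / tx π d) (-j) =
        E.ysum * tx (conj π) j * tx (conj π) (-j) := by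
  have he := ZMod.isPrimitive_stdAddChar p
  have hc : four (ZMod.stdAddChar (N := p)) (ty π) 0 = E.ysum := four_zero _ _
  have hc0 : four (ZMod.stdAddChar (N := p)) (ty π) 0 ≠ 0 := by
    rw [hc]
    exact E.ysum_ne_zero
  have D := E.seq.dual _ hc0 he
  have D' : FermatSeq ((ι ^ 2 : ℤ) : ZMod p) ρ3 _ _ :=
    { iota_sq := E.conj_pi.iota_sq
      omega_sq := rho_sq
      x0 := D.x0
      y0 := D.y0
      x_ne := D.x_ne
      I1 := D.I1
      I2 := D.I2
      x_iota := fun a => by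
        rw [Int.cast_pow, pow_two, mul_assoc, D.x_iota, D.x_iota]
        linear_combination (ρ3 * (-four (ZMod.stdAddChar (N := p)) (tx π) a /
          four (ZMod.stdAddChar (N := p)) (ty π) 0)) * rho_pow_three
      y_iota := fun a => by rw [Int.cast_pow, pow_two, mul_assoc, D.y_iota, D.y_iota] }
  obtain ⟨r, hr⟩ := E.conj_pi.exists_dilate D'
  rw [hc] at hr
  have hr0 : r ≠ 0 := by
    rintro rfl
    have := D.x_ne 1 one_ne_zero
    rw [hc, (hr 1).1, mul_zero, E.conj_pi.seq.x0] at this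
    exact this rfl
  have hsh : ∀ f j, four ((ZMod.stdAddChar (N := p)).mulShift r⁻¹) f j =
      four ZMod.stdAddChar f (j * r⁻¹) := by
    intro f j
    unfold four
    refine Finset.sum_congr rfl fun d _ => ?_
    rw [AddChar.mulShift_apply]
    congr 2
    ring
  have hc1 := E.ysum_ne_zero
  have hx : ∀ j, four (ZMod.stdAddChar (N := p)) (tx π) (j * r⁻¹) = -E.ysum * tx (conj π) j := by
    intro j
    have := (hr (j * r⁻¹)).1
    rw [inv_mul_cancel_right₀ hr0] at this
    rw [← this]
    field_simp
  have hy : ∀ j, four (ZMod.stdAddChar (N := p)) (ty π) (j * r⁻¹) =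
      E.ysum * ty (conj π) (-j) := by
    intro j
    have := (hr (-j * r⁻¹)).2
    rw [inv_mul_cancel_right₀ hr0, neg_mul, neg_neg] at this
    rw [← this]
    field_simp
  refine ⟨(ZMod.stdAddChar (N := p)).mulShift r⁻¹, ?_, fun j => ⟨?_, ?_, ?_⟩⟩
  · exact AddChar.IsPrimitive.of_ne_one (he (inv_ne_zero hr0))
  · rw [hsh, hx]
  · rw [hsh, hy]
  · rw [hsh, hsh, neg_mul]
    have := E.seq.four_m_add_neg _ hc0 (j * r⁻¹)
    refine this.trans ?_
    rw [hc, ← neg_mul, hx, hx]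
    field_simp

lemma ysum_mul_conj : E.ysum * conj E.ysum = p := by
  obtain ⟨e, he, h⟩ := E.exists_fourier
  have h1 := sum_four e he (ty π)
  rw [E.seq.y0, mul_one, Finset.sum_congr rfl fun j _ => (h j).2.1, ← Finset.mul_sum] at h1
  rw [← h1, ← E.ysum_conj, ysum, ysum]
  congr 1
  exact (Equiv.sum_comp (Equiv.neg (ZMod p)) (ty (conj π))).symm

end EisPrime

end FermatCurve

namespace FermatCurve

open scoped ComplexConjugate

/-- The field `ℚ(ρ)`. -/
def Kf : Subfield ℂ where
  carrier := {z | ∃ a b : ℚ, z = a + b * ρ3}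
  mul_mem' := by
    rintro _ _ ⟨a, b, rfl⟩ ⟨c, d, rfl⟩
    refine ⟨a * c - b * d, a * d + b * c - b * d, ?_⟩
    push_cast
    linear_combination (b * d : ℂ) * rho_sq
  one_mem' := ⟨1, 0, by simp⟩
  add_mem' := by
    rintro _ _ ⟨a, b, rfl⟩ ⟨c, d, rfl⟩
    exact ⟨a + c, b + d, by push_cast; ring⟩
  zero_mem' := ⟨0, 0, by simp⟩
  neg_mem' := by
    rintro _ ⟨a, b, rfl⟩
    exact ⟨-a, -b, by push_cast; ring⟩
  inv_mem' := by
    rintro _ ⟨a, b, rfl⟩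
    rcases eq_or_ne ((a : ℂ) + b * ρ3) 0 with h | h
    · exact ⟨0, 0, by simp [h]⟩
    · have hN : ((a : ℂ) + b * ρ3) * (a - b - b * ρ3) = ((a ^ 2 - a * b + b ^ 2 : ℚ) : ℂ) := by
        push_cast
        linear_combination (-b ^ 2 : ℂ) * rho_sq
      have hN0 : ((a ^ 2 - a * b + b ^ 2 : ℚ) : ℂ) ≠ 0 := by
        intro h0
        have h1 : a ^ 2 - a * b + b ^ 2 = 0 := by exact_mod_cast h0
        have hb : b = 0 := by
          have : b ^ 2 = 0 := by nlinarith [sq_nonneg (2 * a - b), sq_nonneg b]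
          exact pow_eq_zero_iff two_ne_zero |>.1 this
        subst hb
        have ha : a = 0 := by simpa using h1
        simp [ha] at h
      refine ⟨(a - b) / (a ^ 2 - a * b + b ^ 2), -b / (a ^ 2 - a * b + b ^ 2), ?_⟩
      refine inv_eq_of_mul_eq_one_right ?_
      have h2 : (((a - b) / (a ^ 2 - a * b + b ^ 2) : ℚ) : ℂ) +
          ((-b / (a ^ 2 - a * b + b ^ 2) : ℚ) : ℂ) * ρ3 =
          (a - b - b * ρ3) / ((a ^ 2 - a * b + b ^ 2 : ℚ) : ℂ) := by
        push_cast
        ring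
      rw [h2, mul_div_assoc', hN, div_self hN0]

lemma O3_le_Kf {z : ℂ} (hz : z ∈ O3) : z ∈ Kf := by
  obtain ⟨m, n, rfl⟩ := mem_O3_iff.1 hz
  exact ⟨m, n, by simp⟩

lemma rat_isInt {q : ℚ} (h : IsIntegral ℤ (q : ℂ)) : ∃ n : ℤ, q = n := by
  have h1 : IsIntegral ℤ q := by
    have : IsIntegral ℤ (algebraMap ℚ ℂ q) := by simpa using h
    exact (isIntegral_algebraMap_iff (algebraMap ℚ ℂ).injective).1 this
  obtain ⟨n, hn⟩ := IsIntegrallyClosed.isIntegral_iff.1 h1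
  exact ⟨n, by simpa using hn.symm⟩

lemma isIntegral_conj {z : ℂ} (h : IsIntegral ℤ z) : IsIntegral ℤ (conj z) :=
  h.map (starRingEnd ℂ).toIntAlgHom

lemma isIntegral_of_mem_O3 {z : ℂ} (h : z ∈ O3) : IsIntegral ℤ z :=
  isIntegral_of_forall_mem fun _ => O3_le h

lemma mem_O3_of_isIntegral {z : ℂ} (h : IsIntegral ℤ z) (hK : z ∈ Kf) : z ∈ O3 := by
  obtain ⟨a, b, rfl⟩ := hK
  have hc := isIntegral_conj h
  have hr : IsIntegral ℤ ρ3 := isIntegral_of_mem_O3 rho_mem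
  have e1 : conj ((a : ℂ) + b * ρ3) = a + b * (-1 - ρ3) := by
    rw [map_add, map_mul, conj_rho, map_ratCast, map_ratCast]
  obtain ⟨t1, h1⟩ := rat_isInt (q := 2 * a - b) (by
    have e : ((2 * a - b : ℚ) : ℂ) = (a + b * ρ3) + conj (a + b * ρ3) := by
      rw [e1]
      push_cast
      ring
    rw [e]
    exact h.add hc)
  obtain ⟨t2, h2⟩ := rat_isInt (q := - a - b) (by
    have e : ((-a - b : ℚ) : ℂ) = (a + b * ρ3) * ρ3 + conj ((a + b * ρ3) * ρ3) := by
      rw [map_mul, e1, conj_rho]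
      push_cast
      linear_combination (-2 * b : ℂ) * rho_sq
    rw [e]
    exact (h.mul hr).add (isIntegral_conj (h.mul hr)))
  obtain ⟨t3, h3⟩ := rat_isInt (q := a ^ 2 - a * b + b ^ 2) (by
    have e : ((a ^ 2 - a * b + b ^ 2 : ℚ) : ℂ) = (a + b * ρ3) * conj (a + b * ρ3) := by
      rw [e1]
      push_cast
      linear_combination (b ^ 2 : ℂ) * rho_sq
    rw [e]
    exact h.mul hc)
  have h4 : 3 * (t1 - t2) ^ 2 + 9 * ((t1 - t2) * t2 + t2 ^ 2) = 9 * t3 := by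
    have : (3 * (t1 - t2) ^ 2 + 9 * ((t1 - t2) * t2 + t2 ^ 2) : ℚ) = 9 * t3 := by
      rw [← h1, ← h2, ← h3]
      ring
    exact_mod_cast this
  have h5 : (3 : ℤ) ∣ (t1 - t2) ^ 2 := ⟨t3 - ((t1 - t2) * t2 + t2 ^ 2), by linarith⟩
  obtain ⟨m, hm⟩ := Int.prime_three.dvd_of_dvd_pow h5
  have ha : a = m := by
    have : (t1 - t2 : ℚ) = 3 * m := by exact_mod_cast hm
    linarith
  have hb : b = ((-t2 - m : ℤ) : ℚ) := by
    push_cast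
    linarith
  exact mem_O3_iff.2 ⟨m, -t2 - m, by rw [ha, hb]; push_cast; ring⟩

/-- The algebraic closure of `ℚ(ρ)` in `ℂ`. -/
abbrev Lf : IntermediateField Kf ℂ := algebraicClosure Kf ℂ

lemma mem_Lf {z : ℂ} (h : IsIntegral ℤ z) : z ∈ Lf :=
  mem_algebraicClosure_iff'.2 h.tower_top

lemma mem_Kf_of_fixed (w : Lf) (h : ∀ σ : Lf →ₐ[Kf] ℂ, σ w = w) : (w : ℂ) ∈ Kf := by
  have h1 := Algebra.IsAlgebraic.range_eval_eq_rootSet_minpoly (F := Kf) (K := Lf) ℂ w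
  have h2 : (minpoly Kf w).rootSet ℂ ⊆ {(w : ℂ)} := by
    rw [← h1]
    rintro _ ⟨σ, rfl⟩
    exact h σ
  have hw_int : IsIntegral Kf w := Algebra.IsIntegral.isIntegral w
  have h3 := Polynomial.card_rootSet_eq_natDegree (K := ℂ)
    (minpoly.irreducible hw_int).separable (IsAlgClosed.splits _)
  have h4 : (minpoly Kf w).natDegree ≤ 1 := by
    rw [← h3, ← Set.toFinset_card]
    refine (Finset.card_le_card (t := {(w : ℂ)}) fun x hx => ?_).trans
      (Finset.card_singleton _).le
    simpa using h2 (Set.mem_toFinset.1 hx)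
  have h5 := minpoly.natDegree_eq_one_iff.1 (le_antisymm h4 (minpoly.natDegree_pos hw_int))
  obtain ⟨k, hk⟩ := h5
  rw [← hk]
  exact k.2

namespace EisPrime

variable {p : ℕ} [Fact p.Prime] {π : ℂ} {ι : ℤ} (E : EisPrime p π ι)

/-- The torsion values `x(r/π)` as elements of `Lf`. -/
def Lx (r : ZMod p) : Lf := ⟨tx π r, mem_Lf (E.isIntegral_tx r)⟩

/-- The torsion values `y(r/π)` as elements of `Lf`. -/
def Ly (r : ZMod p) : Lf := ⟨ty π r, mem_Lf (E.isIntegral_ty r)⟩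

include E

omit [Fact p.Prime] in
@[simp] lemma coe_Lx (r : ZMod p) : ((E.Lx r : Lf) : ℂ) = tx π r := rfl

omit [Fact p.Prime] in
@[simp] lemma coe_Ly (r : ZMod p) : ((E.Ly r : Lf) : ℂ) = ty π r := rfl

lemma exists_galois (σ : Lf →ₐ[Kf] ℂ) :
    ∃ k : ZMod p, k ≠ 0 ∧ ∀ j, σ (E.Lx j) = tx π (k * j) ∧ σ (E.Ly j) = ty π (k * j) := by
  have hx0 : ∀ a, a ≠ 0 → σ (E.Lx a) ≠ 0 := by
    intro a ha h
    rw [map_eq_zero] at h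
    exact E.seq.x_ne a ha (by simpa using congrArg (Subtype.val) h)
  let R : Lf := algebraMap Kf Lf ⟨ρ3, O3_le_Kf rho_mem⟩
  have hR : σ R = ρ3 := σ.commutes _
  have hR' : (R : ℂ) = ρ3 := rfl
  have F : FermatSeq (ι : ZMod p) ρ3 (fun j => σ (E.Lx j)) (fun j => σ (E.Ly j)) :=
    { iota_sq := E.iota_sq
      omega_sq := rho_sq
      x0 := by
        have : E.Lx 0 = 0 := Subtype.ext (by simpa using E.seq.x0)
        simp [this]
      y0 := by
        have : E.Ly 0 = 1 := Subtype.ext (by simpa using E.seq.y0)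
        simp [this]
      x_ne := hx0
      I1 := fun a b => by
        have : E.Lx a * E.Lx b * E.Lx (a + b) = E.Ly a * E.Ly b - E.Ly (a + b) :=
          Subtype.ext (by simpa using E.seq.I1 a b)
        simpa using congrArg σ this
      I2 := fun a b => by
        have : E.Lx b * E.Ly a * E.Ly (a + b) = E.Lx (a + b) * E.Ly b - E.Lx a :=
          Subtype.ext (by simpa using E.seq.I2 a b)
        simpa using congrArg σ this
      x_iota := fun a => by
        have : E.Lx (ι * a) = R * E.Lx a := Subtype.ext (by simpa [hR'] using E.seq.x_iota a)
        simp only [this, map_mul, hR]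
      y_iota := fun a => by
        have : E.Ly (ι * a) = E.Ly a := Subtype.ext (by simpa using E.seq.y_iota a)
        simp only [this] }
  obtain ⟨k, hk⟩ := E.exists_dilate F
  refine ⟨k, ?_, fun j => by rw [mul_comm k]; exact hk j⟩
  rintro rfl
  refine hx0 1 one_ne_zero ?_
  rw [(hk 1).1, mul_zero, E.seq.x0]

lemma mem_Kf_of_fixed (w : Lf) (h : ∀ σ : Lf →ₐ[Kf] ℂ, ∀ k : ZMod p, k ≠ 0 →
    (∀ j, σ (E.Lx j) = tx π (k * j)) → (∀ j, σ (E.Ly j) = ty π (k * j)) → σ w = w) :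
    (w : ℂ) ∈ Kf :=
  FermatCurve.mem_Kf_of_fixed w fun σ => by
    obtain ⟨k, hk, hj⟩ := E.exists_galois σ
    exact h σ k hk (fun j => (hj j).1) fun j => (hj j).2

lemma isIntegral_ysum : IsIntegral ℤ E.ysum := IsIntegral.sum _ fun r _ => E.isIntegral_ty r

lemma ysum_mem_Kf : E.ysum ∈ Kf := by
  have h := E.mem_Kf_of_fixed (∑ r, E.Ly r) fun σ k hk _ hy => by
    rw [map_sum, Finset.sum_congr rfl fun j _ => hy j]
    push_cast
    simp only [coe_Ly]
    exact Equiv.sum_comp (Equiv.mulLeft₀ k hk) (ty π)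
  push_cast at h
  exact h

lemma ysum_mem_O3 : E.ysum ∈ O3 := mem_O3_of_isIntegral E.isIntegral_ysum E.ysum_mem_Kf

lemma ysum_cong_one {T : Finset (ZMod p)} (hT : ThirdSet (ι : ZMod p) T) :
    ECong E.ysum 1 3 := by
  have h1 : E.ysum = ty π 0 + 3 * ∑ s ∈ T, ty π s :=
    hT.sum_eq_of_invariant E.iota_cube fun a => E.seq.y_iota a
  rw [E.seq.y0] at h1
  refine ⟨∑ s ∈ T, ty π s, ?_, by rw [h1]; ring⟩
  refine mem_O3_of_isIntegral (IsIntegral.sum _ fun r _ => E.isIntegral_ty r) ?_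
  have h2 : ∑ s ∈ T, ty π s = (E.ysum - 1) / 3 := by
    rw [h1]
    ring
  rw [h2]
  refine Kf.div_mem (Kf.sub_mem E.ysum_mem_Kf Kf.one_mem) ?_
  exact_mod_cast natCast_mem Kf 3

omit [Fact p.Prime] E in
lemma _root_.FermatCurve.eq_one_of_norm {d : ℂ} (h : d * conj d = 1) (h3 : ECong d 1 3) : d = 1 := by
  obtain ⟨v, hv, hd⟩ := h3
  obtain ⟨n, hn⟩ := exists_norm_O3 hv
  have hd1 : ‖d‖ = 1 := by
    have := congrArg Norm.norm h
    rw [norm_mul, RCLike.norm_conj, norm_one] at this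
    nlinarith [norm_nonneg d]
  have h1 : ‖(3 : ℂ) * v‖ ≤ 2 := by
    rw [← hd]
    refine (norm_sub_le _ _).trans ?_
    rw [hd1, norm_one]
    norm_num
  have h2 : ‖v‖ * ‖v‖ = |(n : ℝ)| := by
    have := congrArg Norm.norm hn
    rwa [norm_mul, RCLike.norm_conj, norm_intCast] at this
  rw [norm_mul, norm_ofNat] at h1
  have h4 : |(n : ℝ)| < 1 := by nlinarith [norm_nonneg v]
  have h5 : |n| < 1 := by exact_mod_cast h4
  have h6 : n = 0 := Int.abs_lt_one_iff.1 h5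
  rw [h6] at h2
  have h7 : v = 0 := by simpa using h2
  rw [h7, mul_zero, sub_eq_zero] at hd
  exact hd

omit [Fact p.Prime] in
lemma eq_of_cong {c d : ℂ} (hd : d ∈ O3) (hc : c = π * d) (hcc : c * conj c = p)
    (h1 : ECong c 1 3) (h2 : ECong π 1 3) : c = π := by
  have hn : d * conj d = 1 := by
    have h0 := E.p_ne_zero
    rw [hc, map_mul, E.norm] at hcc
    rw [E.norm] at h0
    apply mul_left_cancel₀ h0
    linear_combination hcc
  obtain ⟨u, hu, hu'⟩ := h1
  obtain ⟨w, hw, hw'⟩ := h2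
  have : d = 1 := by
    refine eq_one_of_norm hn ⟨u - w * d, sub_mem hu (mul_mem hw hd), ?_⟩
    linear_combination hu' - d * hw' - hc
  rw [hc, this, mul_one]

lemma ysum_eq_or {T : Finset (ZMod p)} (hT : ThirdSet (ι : ZMod p) T) (h : ECong π 1 3) :
    E.ysum = π ∨ E.ysum = conj π := by
  have hO := E.ysum_mem_O3
  have hO' : conj E.ysum ∈ O3 := conj_mem_O3 hO
  have hc := E.ysum_mul_conj
  have h1 := E.ysum_cong_one hT
  have h0 : E.red E.ysum * E.red (conj E.ysum) = 0 := by
    rw [← E.red_mul hO hO', hc]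
    simpa using E.red_int p
  have hz : E.red 0 = 0 := by simpa using E.red_int 0
  rcases mul_eq_zero.1 h0 with h2 | h2
  · left
    rw [← hz, ← E.cong_iff_red hO (zero_mem _)] at h2
    obtain ⟨d, hd, hd'⟩ := h2
    exact E.eq_of_cong hd (by rw [← hd', sub_zero]) hc h1 h
  · right
    rw [← hz, ← E.cong_iff_red hO' (zero_mem _)] at h2
    obtain ⟨d, hd, hd'⟩ := h2
    have h3 : ECong (conj E.ysum) 1 3 := by
      obtain ⟨u, hu, hu'⟩ := h1
      refine ⟨conj u, conj_mem_O3 hu, ?_⟩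
      have := congrArg conj hu'
      simpa only [map_sub, map_mul, map_one, map_ofNat] using this
    have := E.eq_of_cong hd (by rw [← hd', sub_zero]) (by rw [conj_conj, mul_comm, hc]) h3 h
    exact (conj_conj _).symm.trans (congrArg conj this)

end EisPrime

end FermatCurve

namespace FermatCurve

open scoped ComplexConjugate Polynomial

lemma cube_eq_cube {u v : ℂ} (h : u ^ 3 = v ^ 3) : ∃ i : ℕ, u = ρ3 ^ i * v := by
  have h1 : (u - v) * ((u - ρ3 * v) * (u - ρ3 ^ 2 * v)) = 0 := by
    linear_combination h + (-u ^ 2 * v + u * v ^ 2) * rho_sq + (u * v ^ 2 - v ^ 3) * rho_pow_three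
  rcases mul_eq_zero.1 h1 with h2 | h2
  · exact ⟨0, by linear_combination h2⟩
  rcases mul_eq_zero.1 h2 with h2 | h2
  · exact ⟨1, by linear_combination h2⟩
  · exact ⟨2, by linear_combination h2⟩

/-- A rational function `1 + 3 ∑ wₛ / (1 - Xₛ T)` vanishing at all the `Xₛ`. -/
lemma partial_fractions {α : Type*} [DecidableEq α] {T : Finset α} {X w : α → ℂ}
    (hinj : Set.InjOn X T) (h1 : ∀ a ∈ T, ∀ b ∈ T, X a * X b ≠ 1)
    (hv : ∀ a ∈ T, 1 + 3 * ∑ s ∈ T, w s / (1 - X a * X s) = 0) :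
    1 + 3 * ∑ s ∈ T, w s = (∏ s ∈ T, X s) ^ 2 := by
  let L : α → ℂ[X] := fun s => 1 - Polynomial.C (X s) * Polynomial.X
  have hL : ∀ s, (L s).natDegree ≤ 1 := fun s => by
    refine (Polynomial.natDegree_sub_le _ _).trans ?_
    rw [Polynomial.natDegree_one]
    exact max_le zero_le_one ((Polynomial.natDegree_C_mul_le _ _).trans Polynomial.natDegree_X_le)
  have hprod : ∀ U : Finset α, (∏ s ∈ U, L s).natDegree ≤ U.card := fun U =>
    (Polynomial.natDegree_prod_le _ _).trans
      ((Finset.sum_le_sum fun s _ => hL s).trans (by simp))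
  let D : ℂ[X] := ∏ s ∈ T, L s +
    ∑ s ∈ T, Polynomial.C (3 * w s) * ∏ t ∈ T.erase s, L t -
    Polynomial.C (∏ s ∈ T, -X s) * ∏ s ∈ T, (Polynomial.X - Polynomial.C (X s))
  have hmid : ∀ m, T.card ≤ m →
      (∑ s ∈ T, Polynomial.C (3 * w s) * ∏ t ∈ T.erase s, L t).coeff m = 0 := by
    intro m hm
    rw [Polynomial.finsetSum_coeff]
    refine Finset.sum_eq_zero fun s hs => ?_
    rw [Polynomial.coeff_C_mul, Polynomial.coeff_eq_zero_of_natDegree_lt, mul_zero]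
    refine (hprod _).trans_lt (lt_of_lt_of_le ?_ hm)
    exact Finset.card_lt_card (Finset.erase_ssubset hs)
  have hmonic := Polynomial.monic_prod_X_sub_C X T
  have hdeg : (∏ s ∈ T, (Polynomial.X - Polynomial.C (X s))).natDegree = T.card :=
    Polynomial.natDegree_finsetProd_X_sub_C_eq_card T X
  have hD : D.degree < T.card := by
    rw [Polynomial.degree_lt_iff_coeff_zero]
    intro m hm
    rw [Polynomial.coeff_sub, Polynomial.coeff_add, hmid m hm, Polynomial.coeff_C_mul, add_zero]
    rcases hm.eq_or_lt with rfl | hm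
    · have e1 := Polynomial.coeff_prod_of_natDegree_le (s := T) L 1 fun s _ => hL s
      rw [mul_one] at e1
      rw [e1, ← hdeg, hmonic.coeff_natDegree, mul_one, sub_eq_zero]
      refine Finset.prod_congr rfl fun s _ => ?_
      simp [L, Polynomial.coeff_one]
    · rw [Polynomial.coeff_eq_zero_of_natDegree_lt ((hprod T).trans_lt hm),
        Polynomial.coeff_eq_zero_of_natDegree_lt (hdeg.trans_lt hm), mul_zero, sub_zero]
  have hD0 : D = 0 := by
    refine Polynomial.eq_zero_of_degree_lt_of_eval_index_eq_zero _ hinj hD fun a ha => ?_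
    have e2 : ∏ s ∈ T, (X a - X s) = 0 := Finset.prod_eq_zero ha (sub_self _)
    have e3 : ∀ s ∈ T, 3 * w s * ∏ t ∈ T.erase s, (1 - X t * X a) =
        (∏ t ∈ T, (1 - X t * X a)) * (3 * (w s / (1 - X a * X s))) := by
      intro s hs
      rw [← Finset.mul_prod_erase T _ hs]
      have : 1 - X a * X s ≠ 0 := sub_ne_zero.2 (h1 a ha s hs).symm
      rw [mul_comm (X a)] at this ⊢
      generalize ∏ t ∈ T.erase s, (1 - X t * X a) = P
      generalize 1 - X s * X a = d at this ⊢
      field_simp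
    simp only [D, L, Polynomial.eval_sub, Polynomial.eval_add, Polynomial.eval_mul,
      Polynomial.eval_prod, Polynomial.eval_finsetSum, Polynomial.eval_C, Polynomial.eval_X,
      Polynomial.eval_one, e2, mul_zero, sub_zero]
    rw [Finset.sum_congr rfl e3, ← Finset.mul_sum, ← Finset.mul_sum]
    linear_combination (∏ t ∈ T, (1 - X t * X a)) * hv a ha
  have h0 := congrArg (Polynomial.eval 0) hD0
  simp only [D, L, Polynomial.eval_sub, Polynomial.eval_add, Polynomial.eval_mul,
    Polynomial.eval_prod, Polynomial.eval_finsetSum, Polynomial.eval_C, Polynomial.eval_X,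
    Polynomial.eval_one, mul_zero, sub_zero, zero_sub, Finset.prod_const_one, mul_one,
    Polynomial.eval_zero, Finset.prod_neg] at h0
  rw [← Finset.mul_sum] at h0
  have h2 : ((-1 : ℂ) ^ T.card) ^ 2 = 1 := by rw [← pow_mul, mul_comm, pow_mul]; simp
  linear_combination h0 + (∏ s ∈ T, X s) ^ 2 * h2

namespace EisPrime

variable {p : ℕ} [Fact p.Prime] {π : ℂ} {ι : ℤ} (E : EisPrime p π ι)
include E

lemma tx_iota_pow (i : ℕ) (a : ZMod p) : tx π ((ι : ZMod p) ^ i * a) = ρ3 ^ i * tx π a := by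
  induction i with
  | zero => simp
  | succ i ih => rw [pow_succ', mul_assoc, E.seq.x_iota, ih]; ring

lemma ty_iota_pow (i : ℕ) (a : ZMod p) : ty π ((ι : ZMod p) ^ i * a) = ty π a := by
  induction i with
  | zero => simp
  | succ i ih => rw [pow_succ', mul_assoc, E.seq.y_iota, ih]

omit [Fact p.Prime] in
lemma one_add_ne_zero (a : ZMod p) : 1 + ρ3 ^ 2 * tx π a ^ 3 ≠ 0 := by
  intro h
  have h2 := (E.mul_q a).2
  rw [h, mul_zero] at h2
  have h3 : (ρ3 - ρ3 ^ 2) * tx π a ^ 3 = 0 := by linear_combination -h2 - h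
  have h4 : ρ3 - ρ3 ^ 2 ≠ 0 := by
    intro h5
    have : (3 : ℂ) = 0 := by
      linear_combination -(ρ3 - ρ3 ^ 2) * h5 + rho_sq + (ρ3 - 2) * rho_pow_three
    norm_num at this
  rcases mul_eq_zero.1 h3 with h5 | h5
  · exact h4 h5
  · rw [h5] at h
    norm_num at h

lemma orbit_of_cube_eq {a b : ZMod p} (h : tx π a ^ 3 = tx π b ^ 3) :
    ∃ i : ℕ, a = (ι : ZMod p) ^ i * b := by
  have ha := E.mul_q a
  have hb := E.mul_q b
  have h0 := E.one_add_ne_zero b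
  rw [h] at ha
  set q := (ι : ZMod p) - (ι : ZMod p) ^ 2 with hq
  have hy : ty π (q * a) = ty π (q * b) := mul_right_cancel₀ h0 (ha.2.trans hb.2.symm)
  have hx : tx π (q * a) ^ 3 = tx π (q * b) ^ 3 := by
    linear_combination E.seq.curve (q * a) - E.seq.curve (q * b) -
      (ty π (q * a) ^ 2 + ty π (q * a) * ty π (q * b) + ty π (q * b) ^ 2) * hy
  obtain ⟨i, hi⟩ := cube_eq_cube hx
  rw [← E.tx_iota_pow] at hi
  have h1 := E.tx_ty_inj hi (hy.trans (E.ty_iota_pow i _).symm)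
  exact ⟨i, mul_left_cancel₀ E.q_ne_zero (by rw [← hq, h1]; ring)⟩

lemma cube_mul_cube_ne_one (a b : ZMod p) : tx π a ^ 3 * tx π b ^ 3 ≠ 1 := by
  intro h
  have ha := (E.mul_q a).2
  have hb := (E.mul_q b).2
  have h0 := E.one_add_ne_zero b
  have hn := E.seq.y_mul_neg (((ι : ZMod p) - (ι : ZMod p) ^ 2) * a)
  have hny := E.seq.y_ne (-(((ι : ZMod p) - (ι : ZMod p) ^ 2) * a))
  set r := ((ι : ZMod p) - (ι : ZMod p) ^ 2) * b
  set u := ((ι : ZMod p) - (ι : ZMod p) ^ 2) * a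
  have hy : ty π r = ρ3 ^ 2 * ty π (-u) := by
    have e : ty π u * ty π r = ρ3 ^ 2 := by
      have e1 : (ty π u * ty π r - ρ3 ^ 2) * ((1 + ρ3 ^ 2 * tx π a ^ 3) * (1 + ρ3 ^ 2 * tx π b ^ 3))
          = 0 := by
        linear_combination (ty π r * (1 + ρ3 ^ 2 * tx π b ^ 3)) * ha + (1 + ρ3 * tx π a ^ 3) * hb +
          (ρ3 ^ 2 - ρ3 ^ 6) * h - (tx π a ^ 3 + tx π b ^ 3) * ρ3 * rho_pow_three -
          (1 + ρ3 ^ 3) * rho_pow_three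
      have := mul_eq_zero.1 e1
      have h3 := mul_ne_zero (E.one_add_ne_zero a) h0
      exact sub_eq_zero.1 (this.resolve_right h3)
    linear_combination ty π (-u) * e - ty π r * hn
  have hx : tx π r ^ 3 = tx π (-u) ^ 3 := by
    have c1 := E.seq.curve r
    have c2 := E.seq.curve (-u)
    rw [hy] at c1
    linear_combination c1 - c2 - ty π (-u) ^ 3 * (ρ3 ^ 3 + 1) * rho_pow_three
  obtain ⟨i, hi⟩ := E.orbit_of_cube_eq hx
  rw [hi, E.ty_iota_pow] at hy
  have h4 : (ρ3 ^ 2 - 1) * ty π (-u) = 0 := by linear_combination -hy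
  rcases mul_eq_zero.1 h4 with h5 | h5
  · exact E.seq.omega_sq_ne_one (by linear_combination h5)
  · exact hny h5

variable {T : Finset (ZMod p)} (hT : ThirdSet (ι : ZMod p) T)
include hT

omit hT in
lemma sum_orbit (a b : ZMod p) : (1 - tx π a ^ 3 * tx π b ^ 3) *
    (tx π (a + b) + tx π (a + (ι : ZMod p) * b) + tx π (a + (ι : ZMod p) ^ 2 * b)) =
      3 * tx π a * ty π b ^ 2 := by
  have h0 := E.seq.add_x a b
  have h1 := E.seq.add_x a (ι * b)
  have h2 := E.seq.add_x a ((ι : ZMod p) ^ 2 * b)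
  rw [E.seq.x_iota, E.seq.y_iota] at h1
  rw [E.tx_iota_pow, E.ty_iota_pow] at h2
  set A := tx π a
  set B := tx π b
  linear_combination h0 + h1 + h2 + (A ^ 3 * B ^ 3 * tx π (a + (ι : ZMod p) * b) +
    A ^ 3 * B ^ 3 * (ρ3 ^ 3 + 1) * tx π (a + (ι : ZMod p) ^ 2 * b) -
    A ^ 2 * B ^ 2 * ty π a * ty π b * ρ3) * rho_pow_three + (B * ty π a ^ 2 -
    A ^ 2 * B ^ 2 * ty π a * ty π b) * rho_sq

lemma rational_vanish {a : ZMod p} (ha : a ≠ 0) :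
    1 + 3 * ∑ s ∈ T, ty π s ^ 2 / (1 - tx π a ^ 3 * tx π s ^ 3) = 0 := by
  have hs : ∑ r : ZMod p, tx π (a + r) = 0 := by
    have h1 := E.seq.four_x_zero 0
    rw [four_zero] at h1
    exact (Equiv.sum_comp (Equiv.addLeft a) (tx π)).trans h1
  rw [← Finset.add_sum_erase _ _ (Finset.mem_univ (0 : ZMod p)), add_zero,
    hT.sum_erase E.iota_cube] at hs
  have hx := E.seq.x_ne a ha
  apply mul_left_cancel₀ hx
  rw [mul_zero, ← hs, mul_add, mul_one, Finset.mul_sum, Finset.mul_sum]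
  congr 1
  refine Finset.sum_congr rfl fun s _ => ?_
  have h1 := E.sum_orbit a s
  have h2 : 1 - tx π a ^ 3 * tx π s ^ 3 ≠ 0 := sub_ne_zero.2 (E.cube_mul_cube_ne_one a s).symm
  rw [← mul_right_inj' h2, h1]
  field_simp

lemma card_even : Even T.card := by
  have h := hT.card E.iota_cube
  have h2 := E.prime.eq_two_or_odd
  have h3 := E.mod3
  rw [Nat.even_iff]
  omega

lemma prod_cube_sq : (∏ s ∈ T, tx π s ^ 3) ^ 2 = E.ysum ^ 2 := by
  have h1 := partial_fractions (T := T) (X := fun s => tx π s ^ 3) (w := fun s => ty π s ^ 2)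
    (fun a ha b hb hab => ?_) (fun a _ b _ => E.cube_mul_cube_ne_one a b)
    fun a ha => E.rational_vanish hT (hT.ne a ha)
  · rw [← h1, ysum, ← E.seq.sum_y_sq, hT.sum_eq_of_invariant E.iota_cube fun a => by
      rw [E.seq.y_iota], E.seq.y0, one_pow]
  · obtain ⟨i, hi⟩ := E.orbit_of_cube_eq hab
    have hd := hT.disj b hb a ha
    have h3 := E.iota_cube
    have hi' : a = (ι : ZMod p) ^ (i % 3) * b := by
      rw [hi, ← Nat.div_add_mod i 3, pow_add, pow_mul, h3, one_pow, one_mul]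
      simp
    have hlt := Nat.mod_lt i (show 3 > 0 by norm_num)
    interval_cases i % 3
    · simpa using hi'
    · exact absurd (by simpa using hi') hd.1
    · exact absurd hi' hd.2

lemma prod_cube : ∏ s ∈ T, tx π s ^ 3 = E.ysum := by
  have h := E.prod_cube_sq hT
  rcases sq_eq_sq_iff_eq_or_eq_neg.1 h with h | h
  · exact h
  exfalso
  obtain ⟨V, h3⟩ := exists_valuation_three
  have h1 := congrArg (res V) h
  have hc : E.ysum ∈ V := O3_le E.ysum_mem_O3
  rw [res_prod _ fun s _ => pow_mem (E.tx_mem V s) 3, Finset.prod_congr rfl fun s hs => by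
    rw [res_pow (E.tx_mem V s), E.res_tx_of_three h3 (hT.ne s hs)], res_neg hc,
    E.res_ysum_of_three h3, Finset.prod_const, Odd.neg_one_pow (by decide),
    (E.card_even hT).neg_one_pow] at h1
  have h4 := res_three h3
  have : (1 : IsLocalRing.ResidueField V) = 0 := by linear_combination h4 - h1
  exact one_ne_zero this

end EisPrime

end FermatCurve

namespace FermatCurve

open scoped ComplexConjugate

namespace EisPrime

variable {p : ℕ} [Fact p.Prime] {π : ℂ} {ι : ℤ} (E : EisPrime p π ι)
include E

omit [Fact p.Prime] in
lemma exists_valuation_pi : ∃ V : ValuationSubring ℂ, V.valuation π < 1 := by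
  refine exists_valuation E.mem fun w hw h => ?_
  obtain ⟨n, hn⟩ := exists_norm_O3 hw
  have h1 := congrArg conj h
  rw [map_mul, map_one] at h1
  have h2 : (p : ℂ) * n = 1 := by
    rw [← hn, E.norm]
    linear_combination conj π * conj w * h + h1
  have h3 : (p : ℤ) * n = 1 := by exact_mod_cast h2
  have h4 : (p : ℤ) ∣ 1 := ⟨n, h3.symm⟩
  have := E.prime.one_lt
  have := Int.le_of_dvd one_pos h4
  omega

variable {V : ValuationSubring ℂ}

omit [Fact p.Prime] in
lemma val_p_of_pi (hV : V.valuation π < 1) : V.valuation (p : ℂ) < 1 := by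
  rw [E.norm, map_mul]
  exact mul_lt_one_of_lt_of_le hV (mem_iff_val.1 (O3_le (conj_mem_O3 E.mem)))

omit [Fact p.Prime] in
lemma res_p_of_pi (hV : V.valuation π < 1) : (p : IsLocalRing.ResidueField V) = 0 := by
  rw [← res_natCast, res_eq_zero_iff (natCast_mem V p)]
  exact E.val_p_of_pi hV

/-- The embedding of `ℤ/p` in the residue field of a valuation above `π`. -/
def toRes (hV : V.valuation π < 1) : ZMod p →+* IsLocalRing.ResidueField V :=
  letI := (CharP.charP_iff_prime_eq_zero (R := IsLocalRing.ResidueField V)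
    (Fact.out : p.Prime)).2 (E.res_p_of_pi hV)
  ZMod.castHom dvd_rfl _

lemma res_eq_toRes (hV : V.valuation π < 1) {ν : ℂ} (hν : ν ∈ O3) :
    res V ν = E.toRes hV (E.red ν) := by
  obtain ⟨r, d, hd, h⟩ := E.exists_int_cong hν
  rw [E.red_eq ⟨d, hd, h⟩ hν, map_intCast, sub_eq_iff_eq_add.1 h,
    res_add (mul_mem (O3_le E.mem) (O3_le hd)) (intCast_mem V r),
    res_mul (O3_le E.mem) (O3_le hd), (res_eq_zero_iff (O3_le E.mem)).2 hV, zero_mul, zero_add,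
    res_intCast]

lemma res_ty_of_lt {a : ZMod p} (h : V.valuation (tx π a) < 1) : res V (ty π a) = 1 := by
  set q := (ι : ZMod p) - (ι : ZMod p) ^ 2 with hq
  have key : ∀ k : ℕ, V.valuation (tx π (q ^ k * a)) < 1 := by
    intro k
    induction k with
    | zero => simpa using h
    | succ k ih =>
      rw [pow_succ', mul_assoc, hq, E.val_q_of_lt V (hq ▸ ih)]
      rw [mul_comm]
      exact mul_lt_one_of_lt_of_le (hq ▸ ih) (sqrt_le V)
  have h1 := key (p - 2)
  set b := q ^ (p - 2) * a with hb
  have hab : a = q * b := by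
    have := E.prime.two_le
    rw [hb, ← mul_assoc, ← pow_succ', show p - 2 + 1 = p - 1 by omega, E.q_pow, one_mul]
  have hx := E.tx_mem V b
  have hρ := O3_le (V := V) rho_mem
  have h2 := congrArg (res V) (E.mul_q b).2
  rw [← hq, ← hab] at h2
  rw [res_mul (E.ty_mem V a) (add_mem (one_mem V) (mul_mem (pow_mem hρ 2) (pow_mem hx 3))),
    res_add (one_mem V) (mul_mem (pow_mem hρ 2) (pow_mem hx 3)),
    res_add (one_mem V) (mul_mem hρ (pow_mem hx 3)), res_mul (pow_mem hρ 2) (pow_mem hx 3),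
    res_mul hρ (pow_mem hx 3), res_pow hx, (res_eq_zero_iff hx).2 h1, res_one] at h2
  simpa using h2

lemma exists_dilation {a : ZMod p} (h : V.valuation (tx π a) < 1) (k : ℕ) :
    ∃ w ∈ V, tx π ((k : ZMod p) * a) = tx π a * w ∧ res V w = k := by
  induction k with
  | zero => exact ⟨0, zero_mem V, by simp [E.seq.x0], by simp [res_zero]⟩
  | succ k ih =>
    obtain ⟨w, hw, h1, h2⟩ := ih
    have hx := E.tx_mem V a
    have hx0 : res V (tx π a) = 0 := (res_eq_zero_iff hx).2 h
    have hlt : V.valuation (tx π ((k : ZMod p) * a)) < 1 := by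
      rw [h1, map_mul]
      exact mul_lt_one_of_lt_of_le h (mem_iff_val.1 hw)
    have hxk := E.tx_mem V ((k : ZMod p) * a)
    have hya := E.ty_mem V a
    have hyk := E.ty_mem V ((k : ZMod p) * a)
    have hd : 1 - tx π ((k : ZMod p) * a) ^ 3 * tx π a ^ 3 ∈ V :=
      sub_mem (one_mem V) (mul_mem (pow_mem hxk 3) (pow_mem hx 3))
    have hdr : res V (1 - tx π ((k : ZMod p) * a) ^ 3 * tx π a ^ 3) = 1 := by
      rw [res_sub (one_mem V) (mul_mem (pow_mem hxk 3) (pow_mem hx 3)),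
        res_mul (pow_mem hxk 3) (pow_mem hx 3), res_pow hx, hx0, res_one]
      simp
    have hd1 : res V (1 - tx π ((k : ZMod p) * a) ^ 3 * tx π a ^ 3) ≠ 0 := by
      rw [hdr]
      exact one_ne_zero
    have hd0 : 1 - tx π ((k : ZMod p) * a) ^ 3 * tx π a ^ 3 ≠ 0 := by
      intro h0
      rw [h0, res_zero] at hd1
      exact hd1 rfl
    have m1 : w * ty π a ^ 2 ∈ V := mul_mem hw (pow_mem hya 2)
    have m2 : ty π ((k : ZMod p) * a) ^ 2 ∈ V := pow_mem hyk 2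
    have m3 : tx π ((k : ZMod p) * a) ^ 2 * ty π ((k : ZMod p) * a) * ty π a ∈ V :=
      mul_mem (mul_mem (pow_mem hxk 2) hyk) hya
    have hn : w * ty π a ^ 2 + ty π ((k : ZMod p) * a) ^ 2 -
        tx π a * (tx π ((k : ZMod p) * a) ^ 2 * ty π ((k : ZMod p) * a) * ty π a) ∈ V :=
      sub_mem (add_mem m1 m2) (mul_mem hx m3)
    refine ⟨(w * ty π a ^ 2 + ty π ((k : ZMod p) * a) ^ 2 -
        tx π a * (tx π ((k : ZMod p) * a) ^ 2 * ty π ((k : ZMod p) * a) * ty π a)) *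
        (1 - tx π ((k : ZMod p) * a) ^ 3 * tx π a ^ 3)⁻¹, mul_mem hn (inv_mem_of_res hd hd1), ?_, ?_⟩
    · have h3 := E.seq.add_x ((k : ZMod p) * a) a
      rw [Nat.cast_succ, add_mul, one_mul]
      apply mul_left_cancel₀ hd0
      rw [h3]
      field_simp
      linear_combination ty π a ^ 2 * h1
    · rw [res_mul hn (inv_mem_of_res hd hd1), res_inv hd hd1, hdr, res_sub (add_mem m1 m2)
        (mul_mem hx m3), res_add m1 m2, res_mul hw (pow_mem hya 2), res_mul hx m3, res_pow hya,
        res_pow hyk, hx0, E.res_ty_of_lt h, E.res_ty_of_lt hlt, h2]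
      push_cast
      ring

lemma val_of_dilation {a : ZMod p} (h : V.valuation (tx π a) < 1) (ha : a ≠ 0) (r : ZMod p) :
    V.valuation (tx π r) < 1 := by
  obtain ⟨w, hw, h1, -⟩ := E.exists_dilation h (r * a⁻¹).val
  rw [ZMod.natCast_rightInverse (r * a⁻¹), inv_mul_cancel_right₀ ha] at h1
  rw [h1, map_mul]
  exact mul_lt_one_of_lt_of_le h (mem_iff_val.1 hw)

variable {T : Finset (ZMod p)} (hT : ThirdSet (ι : ZMod p) T)
include hT

lemma exists_val_lt (hV : V.valuation E.ysum < 1) : ∃ a : ZMod p, a ≠ 0 ∧ V.valuation (tx π a) < 1 := by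
  rw [← E.prod_cube hT] at hV
  by_contra! h
  rw [map_prod] at hV
  refine absurd hV (not_lt.2 (le_of_eq ?_))
  refine (Finset.prod_eq_one fun s hs => ?_).symm
  rw [map_pow, le_antisymm (mem_iff_val.1 (E.tx_mem V s)) (h s (hT.ne s hs)), one_pow]

lemma ysum_eq (h : ECong π 1 3) : E.ysum = π := by
  rcases E.ysum_eq_or hT h with h1 | h1
  · exact h1
  exfalso
  obtain ⟨V, hV⟩ := E.conj_pi.exists_valuation_pi
  obtain ⟨a, ha, hlt⟩ := E.exists_val_lt hT (V := V) (h1 ▸ hV)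
  obtain ⟨w, hw, h2, h3⟩ := E.exists_dilation hlt (ι : ZMod p).val
  rw [ZMod.natCast_rightInverse (ι : ZMod p), E.seq.x_iota, mul_comm (tx π a)] at h2
  have h4 := mul_right_cancel₀ (E.seq.x_ne a ha) h2
  rw [← h4, E.conj_pi.res_eq_toRes hV rho_mem, E.conj_pi.red_rho, ← map_natCast (E.conj_pi.toRes hV),
    ZMod.natCast_rightInverse (ι : ZMod p)] at h3
  have h5 := (E.conj_pi.toRes hV).injective h3
  push_cast at h5
  exact E.q_ne_zero (by rw [h5]; ring)

end EisPrime

end FermatCurve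

namespace FermatCurve

open scoped ComplexConjugate

lemma mem_O3_of_cube {u : ℂ} (h : u ^ 3 = 1) : u ∈ O3 := by
  obtain ⟨i, rfl⟩ := cube_eq_cube (u := u) (v := 1) (by rw [h, one_pow])
  rw [mul_one]
  exact pow_mem rho_mem i

lemma mem_Kf_of_cube {u : ℂ} (h : u ^ 3 = 1) : u ∈ Kf := O3_le_Kf (mem_O3_of_cube h)

lemma mem_of_cube {V : ValuationSubring ℂ} {u : ℂ} (h : u ^ 3 = 1) : u ∈ V :=
  O3_le (mem_O3_of_cube h)

lemma conj_of_cube {u : ℂ} (h : u ^ 3 = 1) : conj u = u ^ 2 := by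
  obtain ⟨i, rfl⟩ := cube_eq_cube (u := u) (v := 1) (by rw [h, one_pow])
  rw [mul_one, map_pow, conj_rho, ← rho_sq, ← pow_mul, ← pow_mul, mul_comm]

lemma res_cube_of_three {V : ValuationSubring ℂ} (h3 : V.valuation 3 < 1) {u : ℂ}
    (h : u ^ 3 = 1) : res V u = 1 := by
  obtain ⟨i, rfl⟩ := cube_eq_cube (u := u) (v := 1) (by rw [h, one_pow])
  rw [mul_one, res_pow (O3_le rho_mem), EisPrime.res_rho_of_three h3, one_pow]

lemma eq_of_res_eq {V : ValuationSubring ℂ} (h3 : (3 : IsLocalRing.ResidueField V) ≠ 0) {u w : ℂ}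
    (hu : u ^ 3 = 1) (hw : w ^ 3 = 1) (h : res V u = res V w) : u = w := by
  have mu := mem_of_cube (V := V) hu
  have mw := mem_of_cube (V := V) hw
  by_contra hne
  have h1 : u ^ 2 + u * w + w ^ 2 = 0 := by
    have h2 : (u - w) * (u ^ 2 + u * w + w ^ 2) = 0 := by linear_combination hu - hw
    exact (mul_eq_zero.1 h2).resolve_left (sub_ne_zero.2 hne)
  have h2 := congrArg (res V) h1
  rw [res_add (add_mem (pow_mem mu 2) (mul_mem mu mw)) (pow_mem mw 2),
    res_add (pow_mem mu 2) (mul_mem mu mw), res_mul mu mw, res_pow mu, res_pow mw, h, res_zero] at h2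
  have h4 : (3 : IsLocalRing.ResidueField V) * res V w ^ 2 = 0 := by linear_combination h2
  have h5 := congrArg (res V) hw
  rw [res_pow mw, res_one] at h5
  rcases mul_eq_zero.1 h4 with h6 | h6
  · exact h3 h6
  · rw [pow_eq_zero_iff two_ne_zero] at h6
    rw [h6] at h5
    simp at h5

namespace EisPrime

/-- A multiplicative character of `ℤ/p` is the cubic residue character modulo `π`. -/
structure IsCubic {p : ℕ} {π : ℂ} {ι : ℤ} (E : EisPrime p π ι) (X : MulChar (ZMod p) ℂ) : Prop where
  cube : ∀ a, a ≠ 0 → X a ^ 3 = 1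
  red : ∀ a, a ≠ 0 → E.red (X a) = a ^ ((p - 1) / 3)

variable {p : ℕ} [Fact p.Prime] {π : ℂ} {ι : ℤ} (E : EisPrime p π ι)
include E

lemma three_ne_zero_res {V : ValuationSubring ℂ} (hV : V.valuation π < 1) :
    (3 : IsLocalRing.ResidueField V) ≠ 0 := by
  have h := (map_ne_zero (E.toRes hV)).2 E.three_ne_zero'
  rwa [map_ofNat] at h

lemma eq_of_red_eq {u w : ℂ} (hu : u ^ 3 = 1) (hw : w ^ 3 = 1) (h : E.red u = E.red w) : u = w := by
  obtain ⟨V, hV⟩ := E.exists_valuation_pi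
  refine eq_of_res_eq (E.three_ne_zero_res hV) hu hw ?_
  rw [E.res_eq_toRes hV (mem_O3_of_cube hu), E.res_eq_toRes hV (mem_O3_of_cube hw), h]

lemma dvd_of_red {ν : ℂ} (hν : ν ∈ O3) (h : E.red ν = 0) : ∃ d ∈ O3, ν = π * d := by
  have := (E.cong_iff_red hν (zero_mem O3)).2 (by simpa using h.trans (by simpa using (E.red_int 0).symm))
  simpa [ECong] using this

lemma dvd_of_val {V : ValuationSubring ℂ} (hV : V.valuation π < 1) {ν : ℂ} (hν : ν ∈ O3)
    (h : V.valuation ν < 1) : ∃ d ∈ O3, ν = π * d := by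
  refine E.dvd_of_red hν ?_
  rw [← res_eq_zero_iff (O3_le hν), E.res_eq_toRes hV hν, map_eq_zero] at h
  exact h

variable {T : Finset (ZMod p)} (hT : ThirdSet (ι : ZMod p) T)
include hT

lemma prod_erase_tx (k : ZMod p) :
    ∏ r ∈ Finset.univ.erase 0, tx π (k * r) = ∏ s ∈ T, tx π (k * s) ^ 3 := by
  rw [hT.prod_erase E.iota_cube]
  refine Finset.prod_congr rfl fun s _ => ?_
  rw [show k * ((ι : ZMod p) ^ 2 * s) = ι * (ι * (k * s)) by ring,
    show k * ((ι : ZMod p) * s) = ι * (k * s) by ring, E.seq.x_iota, E.seq.x_iota, E.seq.x_iota]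
  linear_combination tx π (k * s) ^ 3 * rho_pow_three

lemma val_tx_one (h1 : ECong π 1 3) {V : ValuationSubring ℂ} (hV : V.valuation π < 1) (r : ZMod p) :
    V.valuation (tx π r) < 1 := by
  obtain ⟨a, ha, h⟩ := E.exists_val_lt hT (V := V) (by rwa [E.ysum_eq hT h1])
  exact E.val_of_dilation h ha r

variable {X : MulChar (ZMod p) ℂ} (hX : E.IsCubic X)
include hX

lemma prod_dilate (h1 : ECong π 1 3) {k : ZMod p} (hk : k ≠ 0) :
    ∏ s ∈ T, tx π (k * s) = X k * ∏ s ∈ T, tx π s := by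
  obtain ⟨V, hV⟩ := E.exists_valuation_pi
  have hlt := E.val_tx_one hT h1 hV
  have hw : ∀ s ∈ T, ∃ w ∈ V, tx π (k * s) = tx π s * w ∧ res V w = E.toRes hV k := by
    intro s hs
    obtain ⟨w, hw, e1, e2⟩ := E.exists_dilation (hlt s) k.val
    rw [ZMod.natCast_rightInverse k] at e1
    refine ⟨w, hw, e1, ?_⟩
    rw [e2, ← map_natCast (E.toRes hV), ZMod.natCast_rightInverse k]
  choose! w hwV hw1 hw2 using hw
  rw [Finset.prod_congr rfl hw1, Finset.prod_mul_distrib, mul_comm]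
  congr 1
  have hP : ∏ s ∈ T, tx π s ≠ 0 := Finset.prod_ne_zero_iff.2 fun s hs => E.seq.x_ne s (hT.ne s hs)
  have hcube : ∏ s ∈ T, tx π (k * s) ^ 3 = ∏ s ∈ T, tx π s ^ 3 := by
    have h2 := E.prod_erase_tx hT 1
    simp only [one_mul] at h2
    rw [← E.prod_erase_tx hT k, ← h2]
    exact Finset.prod_bij (fun r _ => k * r)
      (fun r hr => Finset.mem_erase.2 ⟨mul_ne_zero hk (Finset.ne_of_mem_erase hr), Finset.mem_univ _⟩)
      (fun a _ b _ h => mul_left_cancel₀ hk h)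
      (fun b hb => ⟨k⁻¹ * b, Finset.mem_erase.2 ⟨mul_ne_zero (inv_ne_zero hk)
        (Finset.ne_of_mem_erase hb), Finset.mem_univ _⟩, mul_inv_cancel_left₀ hk b⟩)
      fun _ _ => rfl
  refine eq_of_res_eq (E.three_ne_zero_res hV) ?_ (hX.cube k hk) ?_
  · rw [Finset.prod_pow, Finset.prod_pow, Finset.prod_congr rfl hw1, Finset.prod_mul_distrib,
      mul_pow] at hcube
    exact mul_left_cancel₀ (pow_ne_zero 3 hP) (by rw [hcube, mul_one])
  · rw [res_prod _ hwV, Finset.prod_congr rfl hw2, Finset.prod_const, hT.eq_card E.iota_cube,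
      E.res_eq_toRes hV (mem_O3_of_cube (hX.cube k hk)), hX.red k hk, map_pow]

variable {f : ZMod p → ℂ} {γ : ℂ} (hγ : γ ^ 3 = 1)

omit hX in
include hγ in
lemma cube_root_cube (h1 : ECong π 1 3) : (γ⁻¹ * ∏ s ∈ T, tx π s) ^ 3 = π := by
  rw [mul_pow, inv_pow, hγ, inv_one, one_mul, ← Finset.prod_pow, E.prod_cube hT, E.ysum_eq hT h1]

omit E hT hX in
lemma sum_mul_dilate (X : MulChar (ZMod p) ℂ) (f : ZMod p → ℂ) {k : ZMod p} (hk : k ≠ 0) :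
    X k * ∑ r, X r * f (k * r) = ∑ r, X r * f r := by
  rw [Finset.mul_sum]
  refine Fintype.sum_bijective (fun r => k * r) (mulLeft_bijective₀ k hk) _ _ fun r => ?_
  rw [map_mul]
  ring

include hγ in
/-- The coefficient of an elliptic Gauss sum is an Eisenstein integer. -/
lemma exists_coeff (h1 : ECong π 1 3) (fL : ZMod p → Lf) (hfL : ∀ r, (fL r : ℂ) = f r)
    (hσ : ∀ (σ : Lf →ₐ[Kf] ℂ) (k : ZMod p), k ≠ 0 → (∀ j, σ (E.Lx j) = tx π (k * j)) →
      (∀ j, σ (E.Ly j) = ty π (k * j)) → ∀ j, σ (fL j) = f (k * j))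
    (hinv : ∀ a, X (ι * a) * f (ι * a) = X a * f a)
    (hval : ∀ (V : ValuationSubring ℂ) (a), a ≠ 0 → tx π a * f a ∈ V) :
    ∃ d ∈ O3, ∑ r, X r * f r = 3 * d * (γ⁻¹ * ∏ s ∈ T, tx π s) ^ 2 ∧
      ∑ s ∈ T, X s * f s = d * (γ⁻¹ * ∏ s ∈ T, tx π s) ^ 2 := by
  classical
  set P := γ⁻¹ * ∏ s ∈ T, tx π s with hP
  have hP3 : P ^ 3 = π := E.cube_root_cube hT hγ h1
  have hP0 : P ≠ 0 := by
    intro h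
    rw [h] at hP3
    exact E.ne_zero (by simpa using hP3.symm)
  have hγ' : γ⁻¹ ^ 3 = 1 := by rw [inv_pow, hγ, inv_one]
  have hsum : ∑ r, X r * f r = 3 * ∑ s ∈ T, X s * f s := by
    rw [hT.sum_eq_of_invariant E.iota_cube hinv, MulChar.map_zero, zero_mul, zero_add]
  have hmem : ∀ r, X r ∈ Kf := by
    intro r
    rcases eq_or_ne r 0 with rfl | hr
    · rw [MulChar.map_zero]
      exact zero_mem _
    · exact mem_Kf_of_cube (hX.cube r hr)
  set b := P * ∑ s ∈ T, X s * f s with hb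
  -- the product is an algebraic integer
  have hterm : ∀ s ∈ T, P * (X s * f s) =
      (γ⁻¹ * X s * (tx π s * f s)) * ∏ r ∈ T.erase s, tx π r := by
    intro s hs
    rw [hP, ← Finset.mul_prod_erase _ _ hs]
    ring
  have hV1 : ∀ V : ValuationSubring ℂ, ∀ s ∈ T, γ⁻¹ * X s * (tx π s * f s) ∈ V := fun V s hs =>
    mul_mem (mul_mem (mem_of_cube hγ') (mem_of_cube (hX.cube s (hT.ne s hs)))) (hval V s (hT.ne s hs))
  have hbint : IsIntegral ℤ b := isIntegral_of_forall_mem fun V => by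
    rw [hb, Finset.mul_sum]
    refine sum_mem fun s hs => ?_
    rw [hterm s hs]
    exact mul_mem (hV1 V s hs) (prod_mem fun r _ => E.tx_mem V r)
  have hbK : b ∈ Kf := by
    let w : Lf := (algebraMap Kf Lf ⟨γ⁻¹, mem_Kf_of_cube hγ'⟩ * ∏ s ∈ T, E.Lx s) *
      (algebraMap Kf Lf (3⁻¹) * ∑ r, algebraMap Kf Lf ⟨X r, hmem r⟩ * fL r)
    have hw : (w : ℂ) = b := by
      have e1 : (w : ℂ) = (γ⁻¹ * ∏ s ∈ T, tx π s) * (3⁻¹ * ∑ r, X r * f r) := by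
        change algebraMap Lf ℂ w = _
        simp only [w, map_mul, map_prod, map_sum, map_inv₀, map_ofNat, ← hfL]
        rfl
      rw [e1, hsum, hb, hP]
      ring
    rw [← hw]
    refine E.mem_Kf_of_fixed w fun σ k hk hx hy => ?_
    have e2 : σ w = (γ⁻¹ * ∏ s ∈ T, tx π (k * s)) * (3⁻¹ * ∑ r, X r * f (k * r)) := by
      simp only [w, map_mul, map_prod, map_sum, hx, hσ σ k hk hx hy, σ.commutes, map_inv₀, map_ofNat]
      rfl
    rw [e2, hw, E.prod_dilate hT hX h1 hk]
    have e3 := sum_mul_dilate X f hk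
    rw [hsum] at e3
    rw [hb, hP]
    linear_combination (3⁻¹ * γ⁻¹ * ∏ s ∈ T, tx π s) * e3
  have hbO := mem_O3_of_isIntegral hbint hbK
  obtain ⟨V, hV⟩ := E.exists_valuation_pi
  obtain ⟨d, hd, hbd⟩ := E.dvd_of_val hV hbO (by
    rw [hb, Finset.mul_sum]
    refine Valuation.map_sum_lt _ one_ne_zero fun s hs => ?_
    rw [hterm s hs, map_mul, mul_comm]
    refine mul_lt_one_of_lt_of_le ?_ (mem_iff_val.1 (hV1 V s hs))
    have hcard := hT.card E.iota_cube
    have h2 := Finset.card_erase_of_mem hs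
    have h3 := E.card_even hT
    have h4 := E.prime.two_le
    obtain ⟨m, hm⟩ := h3
    obtain ⟨r, hr⟩ := Finset.card_pos.1 (show 0 < (T.erase s).card by omega)
    rw [← Finset.mul_prod_erase _ _ hr, map_mul]
    exact mul_lt_one_of_lt_of_le (E.val_tx_one hT h1 hV r)
      (mem_iff_val.1 (prod_mem fun r _ => E.tx_mem V r)))
  have hfin : ∑ s ∈ T, X s * f s = d * P ^ 2 := by
    refine mul_left_cancel₀ hP0 ?_
    rw [← hb, hbd, ← hP3]
    ring
  exact ⟨d, hd, by rw [hsum, hfin]; ring, hfin⟩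

end EisPrime

end FermatCurve

namespace FermatCurve

open scoped ComplexConjugate Polynomial

lemma sum_eval_eq_zero {p : ℕ} [Fact p.Prime] {Q : (ZMod p)[X]} (h : Q.natDegree < p - 1) :
    ∑ r, Q.eval r = 0 := by
  simp_rw [Polynomial.eval_eq_sum_range]
  rw [Finset.sum_comm]
  refine Finset.sum_eq_zero fun i hi => ?_
  rw [← Finset.mul_sum, FiniteField.sum_pow_lt_card_sub_one, mul_zero]
  rw [ZMod.card]
  have := Finset.mem_range.1 hi
  omega

namespace EisPrime.IsCubic

variable {p : ℕ} [Fact p.Prime] {π : ℂ} {ι : ℤ} {E : EisPrime p π ι}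
variable {X : MulChar (ZMod p) ℂ} (hX : E.IsCubic X)
include hX

lemma pow_three : X ^ 3 = 1 := by
  ext a
  rw [MulChar.pow_apply_coe, hX.cube _ a.ne_zero, MulChar.one_apply_coe]

lemma inv_eq : X⁻¹ = X ^ 2 := by
  rw [inv_eq_iff_mul_eq_one, ← pow_succ', hX.pow_three]

lemma conj_apply (a : ZMod p) : conj (X a) = X⁻¹ a := by
  rcases eq_or_ne a 0 with rfl | ha
  · rw [MulChar.map_zero, MulChar.map_zero, map_zero]
  · rw [conj_of_cube (hX.cube a ha), hX.inv_eq, MulChar.pow_apply' _ two_ne_zero]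

lemma mem_O3 (a : ZMod p) : X a ∈ O3 := by
  rcases eq_or_ne a 0 with rfl | ha
  · rw [MulChar.map_zero]
    exact zero_mem _
  · exact mem_O3_of_cube (hX.cube a ha)

lemma map_neg_one : X (-1) = 1 := by
  have h1 := hX.cube (-1) (neg_ne_zero.2 one_ne_zero)
  have h2 : X (-1) * X (-1) = 1 := by rw [← map_mul, neg_one_mul, neg_neg, map_one]
  linear_combination h1 - X (-1) * h2

lemma map_neg (a : ZMod p) : X (-a) = X a := by
  rw [← neg_one_mul, map_mul, hX.map_neg_one, one_mul]

omit hX [Fact p.Prime] in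
lemma card_facts (E : EisPrime p π ι) : 0 < (p - 1) / 3 ∧ 3 * ((p - 1) / 3) = p - 1 := by
  have h3 := E.mod3
  have h2 := E.prime.two_le
  omega

lemma red_apply (a : ZMod p) : E.red (X a) = a ^ ((p - 1) / 3) := by
  rcases eq_or_ne a 0 with rfl | ha
  · rw [MulChar.map_zero, zero_pow (card_facts E).1.ne']
    simpa using E.red_int 0
  · exact hX.red a ha

lemma ne_one : X ≠ 1 := by
  intro h
  obtain ⟨h1, h2⟩ := card_facts E
  have h3 := FiniteField.sum_pow_lt_card_sub_one (ZMod p) ((p - 1) / 3) (by rw [ZMod.card]; omega)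
  have h4 : ∀ a : ZMod p, a ^ ((p - 1) / 3) = if a = 0 then 0 else 1 := by
    intro a
    split_ifs with ha
    · rw [ha, zero_pow h1.ne']
    · rw [← hX.red a ha, h, MulChar.one_apply (isUnit_iff_ne_zero.2 ha), E.red_one]
  simp only [h4] at h3
  rw [← Finset.add_sum_erase _ _ (Finset.mem_univ (0 : ZMod p)), if_pos rfl, zero_add,
    Finset.sum_congr rfl (g := fun _ => (1 : ZMod p)) (fun a ha => if_neg (Finset.ne_of_mem_erase ha)),
    Finset.sum_const, Finset.card_erase_of_mem (Finset.mem_univ _), Finset.card_univ, ZMod.card,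
    nsmul_eq_mul, mul_one, ZMod.natCast_eq_zero_iff] at h3
  have := Nat.le_of_dvd (by omega) h3
  omega

lemma sq_ne_one : X * X ≠ 1 := by
  intro h
  have h1 := hX.pow_three
  rw [pow_succ, sq, h, one_mul] at h1
  exact hX.ne_one h1

omit hX in
lemma red_sum (E : EisPrime p π ι) {α : Type*} (s : Finset α) {f : α → ℂ} (hf : ∀ i ∈ s, f i ∈ O3) :
    E.red (∑ i ∈ s, f i) = ∑ i ∈ s, E.red (f i) := by
  classical
  induction s using Finset.induction_on with
  | empty => simpa using E.red_int 0
  | insert a s ha ih =>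
    rw [Finset.sum_insert ha, Finset.sum_insert ha, E.red_add (hf _ (Finset.mem_insert_self _ _))
      (sum_mem fun i hi => hf i (Finset.mem_insert_of_mem hi)),
      ih fun i hi => hf i (Finset.mem_insert_of_mem hi)]

lemma conj_jacobiSum : conj (jacobiSum X X) = jacobiSum X⁻¹ X⁻¹ := by
  rw [jacobiSum, jacobiSum, map_sum]
  refine Finset.sum_congr rfl fun a _ => ?_
  rw [map_mul, hX.conj_apply, hX.conj_apply]

omit [Fact p.Prime] hX in
lemma _root_.FermatCurve.rho_isPrimitiveRoot : IsPrimitiveRoot ρ3 3 := by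
  have : Fact (Nat.Prime 3) := ⟨Nat.prime_three⟩
  have h : orderOf ρ3 = 3 := orderOf_eq_prime rho_pow_three fun h => by
    have h1 := rho_sq
    rw [h] at h1
    norm_num at h1
  rw [← h]
  exact IsPrimitiveRoot.orderOf ρ3

lemma jacobiSum_eq (h1 : ECong π 1 3) : jacobiSum X X = -π := by
  obtain ⟨hn0, hn⟩ := card_facts E
  have hO : jacobiSum X X ∈ O3 := sum_mem fun a _ => mul_mem (hX.mem_O3 a) (hX.mem_O3 _)
  have hred : E.red (jacobiSum X X) = 0 := by
    rw [jacobiSum, red_sum E _ fun a _ => mul_mem (hX.mem_O3 a) (hX.mem_O3 _)]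
    rw [← sum_eval_eq_zero (p := p)
      (Q := Polynomial.X ^ ((p - 1) / 3) * (1 - Polynomial.X) ^ ((p - 1) / 3)) ?_]
    · refine Finset.sum_congr rfl fun a _ => ?_
      rw [E.red_mul (hX.mem_O3 a) (hX.mem_O3 _), hX.red_apply, hX.red_apply]
      simp
    · have e1 : ((1 : (ZMod p)[X]) - Polynomial.X).natDegree ≤ 1 := by compute_degree
      have e2 := Polynomial.natDegree_mul_le (p := (Polynomial.X : (ZMod p)[X]) ^ ((p - 1) / 3))
        (q := (1 - Polynomial.X) ^ ((p - 1) / 3))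
      have e3 := Polynomial.natDegree_pow_le (p := (1 : (ZMod p)[X]) - Polynomial.X)
        (n := (p - 1) / 3)
      rw [Polynomial.natDegree_X_pow] at e2
      have e4 := Nat.mul_le_mul_left ((p - 1) / 3) e1
      omega
  obtain ⟨d, hd, hJ⟩ := E.dvd_of_red hO hred
  have hc : jacobiSum X X * jacobiSum X⁻¹ X⁻¹ = p := by
    rw [jacobiSum_mul_jacobiSum_inv _ hX.ne_one hX.ne_one hX.sq_ne_one, ZMod.card]
    rw [ZMod.ringChar_zmod_n, ringChar.eq_zero]
    exact E.prime.ne_zero.symm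
  rw [← hX.conj_jacobiSum, hJ, map_mul, E.norm] at hc
  have hdd : d * conj d = 1 := by
    refine mul_left_cancel₀ (a := (p : ℂ)) E.p_ne_zero ?_
    rw [E.norm]
    linear_combination hc
  obtain ⟨z, hz, hJz⟩ := exists_jacobiSum_eq_neg_one_add (F := ZMod p) (by norm_num) hX.pow_three
    hX.pow_three (by rw [ZMod.card, ← hn]; exact dvd_mul_right 3 _) rho_isPrimitiveRoot
  have hzO : z ∈ O3 := by
    have : Algebra.adjoin ℤ {ρ3} ≤ subalgebraOfSubring O3 :=
      Algebra.adjoin_le (Set.singleton_subset_iff.2 rho_mem)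
    exact this hz
  obtain ⟨u, hu, hπ⟩ := h1
  have h4 : -d = 1 := by
    refine eq_one_of_norm ?_ ⟨z * ρ3 + u * d,
      add_mem (mul_mem hzO rho_mem) (mul_mem hu hd), ?_⟩
    · rw [_root_.map_neg]
      linear_combination hdd
    · linear_combination d * hπ - hJz + hJ - z * rho_sq
  linear_combination hJ - π * h4

lemma gaussSum_cube (h1 : ECong π 1 3) {e : AddChar (ZMod p) ℂ} (he : e.IsPrimitive) :
    gaussSum X⁻¹ e ^ 3 = -π * conj π ^ 2 := by
  have hXi : X⁻¹ * X⁻¹ = X := by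
    rw [← mul_inv, inv_eq_iff_mul_eq_one, mul_assoc, ← sq, ← pow_succ', hX.pow_three]
  have h2 := jacobiSum_mul_nontrivial (χ := X⁻¹) (φ := X⁻¹) (by rw [hXi]; exact hX.ne_one) e
  have h3 := gaussSum_mul_gaussSum_eq_card hX.ne_one he
  have h4 := mul_gaussSum_inv_eq_gaussSum X⁻¹ e
  rw [ZMod.card] at h3
  rw [← hX.conj_apply, hX.map_neg_one, map_one, one_mul] at h4
  rw [hXi, ← hX.conj_jacobiSum, hX.jacobiSum_eq h1, _root_.map_neg] at h2
  rw [h4, E.norm] at h3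
  linear_combination -gaussSum X⁻¹ e * h2 - conj π * h3

end EisPrime.IsCubic

end FermatCurve

namespace FermatCurve

section smooth

variable {V : ValuationSubring ℂ} {t : ℂ}

/-- Sequences with values in `V` whose first `i` difference quotients with step `t` exist in `V`. -/
def IsSmooth (V : ValuationSubring ℂ) (t : ℂ) : ℕ → (ℕ → ℂ) → Prop
  | 0, f => ∀ r, f r ∈ V
  | i + 1, f => (∀ r, f r ∈ V) ∧ ∃ g, IsSmooth V t i g ∧ ∀ r, f (r + 1) = f r + t * g r

namespace IsSmooth

lemma mem {i : ℕ} {f : ℕ → ℂ} (h : IsSmooth V t i f) (r : ℕ) : f r ∈ V := by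
  cases i with
  | zero => exact h r
  | succ i => exact h.1 r

lemma of_succ {i : ℕ} {f : ℕ → ℂ} (h : IsSmooth V t (i + 1) f) : IsSmooth V t i f := by
  induction i generalizing f with
  | zero => exact h.1
  | succ i ih =>
    obtain ⟨h1, g, hg, h2⟩ := h
    exact ⟨h1, g, ih hg, h2⟩

lemma const {c : ℂ} (hc : c ∈ V) (i : ℕ) : IsSmooth V t i fun _ => c := by
  induction i generalizing c with
  | zero => exact fun _ => hc
  | succ i ih => exact ⟨fun _ => hc, fun _ => 0, ih (zero_mem V), fun _ => by ring⟩

lemma add {i : ℕ} {f g : ℕ → ℂ} (hf : IsSmooth V t i f) (hg : IsSmooth V t i g) :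
    IsSmooth V t i (f + g) := by
  induction i generalizing f g with
  | zero => exact fun r => add_mem (hf r) (hg r)
  | succ i ih =>
    obtain ⟨h1, f', hf', h2⟩ := hf
    obtain ⟨h3, g', hg', h4⟩ := hg
    refine ⟨fun r => add_mem (h1 r) (h3 r), f' + g', ih hf' hg', fun r => ?_⟩
    simp only [Pi.add_apply, h2, h4]
    ring

lemma mul (ht : t ∈ V) {i : ℕ} {f g : ℕ → ℂ} (hf : IsSmooth V t i f) (hg : IsSmooth V t i g) :
    IsSmooth V t i (f * g) := by
  induction i generalizing f g with
  | zero => exact fun r => mul_mem (hf r) (hg r)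
  | succ i ih =>
    have hf0 := hf.of_succ
    have hg0 := hg.of_succ
    obtain ⟨h1, f', hf', h2⟩ := hf
    obtain ⟨h3, g', hg', h4⟩ := hg
    refine ⟨fun r => mul_mem (h1 r) (h3 r), f' * g + f * g' + (fun _ => t) * (f' * g'),
      ((ih hf' hg0).add (ih hf0 hg')).add (ih (const ht i) (ih hf' hg')), fun r => ?_⟩
    simp only [Pi.add_apply, Pi.mul_apply, h2, h4]
    ring

lemma neg {i : ℕ} {f : ℕ → ℂ} (hf : IsSmooth V t i f) : IsSmooth V t i (-f) := by
  induction i generalizing f with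
  | zero => exact fun r => neg_mem (hf r)
  | succ i ih =>
    obtain ⟨h1, f', hf', h2⟩ := hf
    refine ⟨fun r => neg_mem (h1 r), -f', ih hf', fun r => ?_⟩
    simp only [Pi.neg_apply, h2]
    ring

lemma shift {i : ℕ} {f : ℕ → ℂ} (hf : IsSmooth V t i f) : IsSmooth V t i fun r => f (r + 1) := by
  induction i generalizing f with
  | zero => exact fun r => hf (r + 1)
  | succ i ih =>
    obtain ⟨h1, f', hf', h2⟩ := hf
    exact ⟨fun r => h1 (r + 1), _, ih hf', fun r => h2 (r + 1)⟩

lemma inv (ht : t ∈ V) {i : ℕ} {f : ℕ → ℂ} (hf : IsSmooth V t i f) (h0 : ∀ r, res V (f r) ≠ 0) :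
    IsSmooth V t i f⁻¹ := by
  induction i with
  | zero => exact fun r => inv_mem_of_res (hf r) (h0 r)
  | succ i ih =>
    have hi := ih hf.of_succ
    obtain ⟨h1, f', hf', h2⟩ := hf
    have hne : ∀ r, f r ≠ 0 := fun r h => h0 r (by rw [h, res_zero])
    refine ⟨fun r => inv_mem_of_res (h1 r) (h0 r), -(f' * (f⁻¹ * fun r => f⁻¹ (r + 1))),
      (hf'.mul ht (hi.mul ht hi.shift)).neg, fun r => ?_⟩
    have e1 := hne r
    have e2 := hne (r + 1)
    simp only [Pi.inv_apply, Pi.neg_apply, Pi.mul_apply]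
    field_simp
    linear_combination -h2 r

end IsSmooth

/-- The ring of sequences with difference quotients of all orders up to `i`. -/
def smoothRing (ht : t ∈ V) (i : ℕ) : Subring (ℕ → ℂ) where
  carrier := {f | IsSmooth V t i f}
  zero_mem' := IsSmooth.const (zero_mem V) i
  one_mem' := IsSmooth.const (one_mem V) i
  add_mem' := IsSmooth.add
  mul_mem' := IsSmooth.mul ht
  neg_mem' := IsSmooth.neg

/-- The ring of sequences with difference quotients of all orders. -/
def smooth (ht : t ∈ V) : Subring (ℕ → ℂ) := ⨅ i, smoothRing ht i

variable {ht : t ∈ V}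

lemma mem_smooth {f : ℕ → ℂ} : f ∈ smooth ht ↔ ∀ i, IsSmooth V t i f := Subring.mem_iInf

lemma const_mem_smooth {c : ℂ} (hc : c ∈ V) : (fun _ => c) ∈ smooth ht :=
  mem_smooth.2 (IsSmooth.const hc)

lemma inv_mem_smooth {f : ℕ → ℂ} (hf : f ∈ smooth ht) (h0 : ∀ r, res V (f r) ≠ 0) :
    f⁻¹ ∈ smooth ht :=
  mem_smooth.2 fun i => (mem_smooth.1 hf i).inv ht h0

lemma IsSmooth.fwdDiff_iter {i : ℕ} {f : ℕ → ℂ} (hf : IsSmooth V t i f) {k : ℕ} (hk : k ≤ i) :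
    ∃ a ∈ V, (fwdDiff 1)^[k] f 0 = t ^ k * a := by
  induction k generalizing i f with
  | zero => exact ⟨f 0, hf.mem 0, by simp⟩
  | succ k ih =>
    obtain ⟨i, rfl⟩ : ∃ i', i = i' + 1 := ⟨i - 1, by omega⟩
    obtain ⟨h1, g, hg, h2⟩ := hf
    obtain ⟨a, ha, h3⟩ := ih hg (by omega)
    refine ⟨a, ha, ?_⟩
    have h4 : fwdDiff 1 f = t • g := by
      ext r
      simp only [fwdDiff, h2, Pi.smul_apply, smul_eq_mul]
      ring
    rw [Function.iterate_succ_apply, h4, fwdDiff_iter_const_smul, Pi.smul_apply, h3, smul_eq_mul]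
    ring

lemma sum_range_choose_of_lt (p k : ℕ) :
    ∑ r ∈ Finset.range p, r.choose k = p.choose (k + 1) := by
  induction p with
  | zero => simp
  | succ p ih => rw [Finset.sum_range_succ, ih, Nat.choose_succ_succ, add_comm]

/-- The sum of a smooth sequence over a period is divisible by `t ^ (p - 1)`. -/
lemma exists_sum_eq {p : ℕ} (hp : p.Prime) {f : ℕ → ℂ} (hf : f ∈ smooth ht)
    (hpt : ∃ u ∈ V, (p : ℂ) = t ^ (p - 1) * u) :
    ∃ w ∈ V, ∑ r ∈ Finset.range p, f r = t ^ (p - 1) * w := by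
  obtain ⟨u, hu, hpu⟩ := hpt
  have h2 := hp.two_le
  have key : ∀ k, ∃ a ∈ V, (fwdDiff 1)^[k] f 0 = t ^ k * a := fun k =>
    (mem_smooth.1 hf k).fwdDiff_iter le_rfl
  choose a haV ha using key
  have h1 : ∀ r ∈ Finset.range p, f r = ∑ k ∈ Finset.range p, (r.choose k : ℂ) * (t ^ k * a k) := by
    intro r hr
    have h3 := shift_eq_sum_fwdDiff_iter 1 f r 0
    rw [smul_eq_mul, mul_one, zero_add] at h3
    rw [h3]
    have hr' := Finset.mem_range.1 hr
    refine (Finset.sum_congr rfl fun k _ => by rw [ha, nsmul_eq_mul]).trans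
      (Finset.sum_subset (Finset.range_subset_range.2 hr') fun k _ hk => ?_)
    rw [Nat.choose_eq_zero_of_lt (by simpa using hk), Nat.cast_zero, zero_mul]
  have h4 : ∀ k ∈ Finset.range p, ∃ w ∈ V,
      (p.choose (k + 1) : ℂ) * (t ^ k * a k) = t ^ (p - 1) * w := by
    intro k hk
    have hk' := Finset.mem_range.1 hk
    rcases eq_or_ne k (p - 1) with rfl | hne
    · refine ⟨a (p - 1), haV _, ?_⟩
      rw [Nat.sub_add_cancel hp.one_le, Nat.choose_self, Nat.cast_one, one_mul]
    · obtain ⟨c, hc⟩ := hp.dvd_choose_self (k := k + 1) (by omega) (by omega)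
      refine ⟨u * c * (t ^ k * a k), mul_mem (mul_mem hu (natCast_mem V c))
        (mul_mem (pow_mem ht k) (haV k)), ?_⟩
      rw [hc, Nat.cast_mul, hpu]
      ring
  choose! w hwV hw using h4
  refine ⟨∑ k ∈ Finset.range p, w k, sum_mem hwV, ?_⟩
  rw [Finset.sum_congr rfl h1, Finset.sum_comm, Finset.mul_sum]
  refine Finset.sum_congr rfl fun k hk => ?_
  rw [← hw k hk, ← Finset.sum_mul, ← sum_range_choose_of_lt]
  push_cast
  rfl

/-- `f'` is the derivative of the smooth sequence `f`, up to multiples of `t`. -/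
def HasSlope (ht : t ∈ V) (f f' : ℕ → ℂ) : Prop :=
  f ∈ smooth ht ∧ f' ∈ smooth ht ∧ ∃ h ∈ smooth ht, ∀ r, f (r + 1) = f r + t * (f' r + t * h r)

namespace HasSlope

lemma mul {f f' g g' : ℕ → ℂ} (hf : HasSlope ht f f') (hg : HasSlope ht g g') :
    HasSlope ht (f * g) (f' * g + f * g') := by
  obtain ⟨f0, f1, h, h0, hf⟩ := hf
  obtain ⟨g0, g1, k, k0, hg⟩ := hg
  have t0 : (fun _ => t) ∈ smooth ht := const_mem_smooth ht
  refine ⟨mul_mem f0 g0, add_mem (mul_mem f1 g0) (mul_mem f0 g1),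
    h * g + f * k + (f' + (fun _ => t) * h) * (g' + (fun _ => t) * k),
    add_mem (add_mem (mul_mem h0 g0) (mul_mem f0 k0)) (mul_mem (add_mem f1 (mul_mem t0 h0))
      (add_mem g1 (mul_mem t0 k0))), fun r => ?_⟩
  simp only [Pi.add_apply, Pi.mul_apply, hf, hg]
  ring

lemma one : HasSlope ht 1 0 :=
  ⟨one_mem _, zero_mem _, 0, zero_mem _, fun r => by simp⟩

lemma pow {f f' : ℕ → ℂ} (hf : HasSlope ht f f') (k : ℕ) :
    HasSlope ht (f ^ k) ((k : ℕ → ℂ) * f ^ (k - 1) * f') := by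
  induction k with
  | zero => simpa using one
  | succ k ih =>
    have h := ih.mul hf
    rw [pow_succ]
    convert h using 1
    rcases k with _ | k
    · simp
    · simp only [Nat.add_sub_cancel]
      push_cast
      ring

end HasSlope

end smooth

end FermatCurve

namespace FermatCurve

open scoped ComplexConjugate

section functional

variable {V : ValuationSubring ℂ} {t : ℂ} {ht : t ∈ V} {p : ℕ}

/-- The residue of the sum over a period, divided by `t ^ (p - 1)`. -/
def ell (V : ValuationSubring ℂ) (t : ℂ) (p : ℕ) (F : ℕ → ℂ) : IsLocalRing.ResidueField V :=
  res V ((∑ r ∈ Finset.range p, F r) / t ^ (p - 1))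

lemma ell_eq (ht0 : t ≠ 0) {F : ℕ → ℂ} {w : ℂ}
    (h : ∑ r ∈ Finset.range p, F r = t ^ (p - 1) * w) : ell V t p F = res V w := by
  rw [ell, h, mul_div_cancel_left₀ _ (pow_ne_zero _ ht0)]

variable (hp : p.Prime) (ht0 : t ≠ 0) (hpt : ∃ u ∈ V, (p : ℂ) = t ^ (p - 1) * u)
include hp ht0 hpt

lemma ell_add {F G : ℕ → ℂ} (hF : F ∈ smooth ht) (hG : G ∈ smooth ht) :
    ell V t p (F + G) = ell V t p F + ell V t p G := by
  obtain ⟨w, hw, h1⟩ := exists_sum_eq hp hF hpt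
  obtain ⟨v, hv, h2⟩ := exists_sum_eq hp hG hpt
  rw [ell_eq ht0 h1, ell_eq ht0 h2, ← res_add hw hv]
  refine ell_eq ht0 ?_
  simp only [Pi.add_apply]
  rw [Finset.sum_add_distrib, h1, h2, mul_add]

lemma ell_const_mul {F : ℕ → ℂ} (hF : F ∈ smooth ht) {c : ℂ} (hc : c ∈ V) :
    ell V t p ((fun _ => c) * F) = res V c * ell V t p F := by
  obtain ⟨w, hw, h1⟩ := exists_sum_eq hp hF hpt
  rw [ell_eq ht0 h1, ← res_mul hc hw]
  refine ell_eq ht0 ?_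
  simp only [Pi.mul_apply]
  rw [← Finset.mul_sum, h1]
  ring

lemma ell_slope (hvt : V.valuation t < 1) {F F' : ℕ → ℂ} (h : HasSlope ht F F') (hF : F p = F 0) :
    ell V t p F' = 0 := by
  obtain ⟨-, h1, k, h2, h3⟩ := h
  have h4 : F' = (fun r => F' r + t * k r) + (fun _ => -t) * k := by
    ext r
    simp
  have h5 : (fun r => F' r + t * k r) ∈ smooth ht := add_mem h1 (mul_mem (const_mem_smooth ht) h2)
  rw [h4, ell_add hp ht0 hpt h5 (mul_mem (const_mem_smooth (neg_mem ht)) h2),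
    ell_const_mul hp ht0 hpt h2 (neg_mem ht), res_neg ht, (res_eq_zero_iff ht).2 hvt, neg_zero,
    zero_mul, add_zero, ← res_zero]
  refine ell_eq ht0 ?_
  rw [mul_zero]
  refine (mul_eq_zero.1 ?_).resolve_left ht0
  rw [Finset.mul_sum, ← sub_eq_zero.2 hF, ← Finset.sum_range_sub]
  refine Finset.sum_congr rfl fun r _ => ?_
  rw [h3]
  ring

end functional

lemma FermatSeq.add_y {p : ℕ} {ι : ZMod p} {ω : ℂ} {x y : ZMod p → ℂ} (F : FermatSeq ι ω x y)
    (a b : ZMod p) : (1 - x a ^ 3 * x b ^ 3) * y (a + b) =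
      y a * y b - x a ^ 2 * x b * y b ^ 2 - x a * x b ^ 2 * y a ^ 2 := by
  linear_combination (1 - x a ^ 3 * x b ^ 3) * F.I1 a b - x a * x b * F.add_x a b

namespace EisPrime

variable {p : ℕ} [Fact p.Prime] {π : ℂ} {ι : ℤ} (E : EisPrime p π ι)
variable {V : ValuationSubring ℂ} (hV : V.valuation π < 1) (hx1 : V.valuation (tx π (1 : ZMod p)) < 1)

/-- The sequence `x(r/π)`. -/
def sx (p : ℕ) (π : ℂ) (r : ℕ) : ℂ := tx π (r : ZMod p)

/-- The sequence `y(r/π)`. -/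
def sy (p : ℕ) (π : ℂ) (r : ℕ) : ℂ := ty π (r : ZMod p)

include E hV hx1

lemma exists_kappa : ∃ κ ∈ V, ty π (1 : ZMod p) = 1 + tx π (1 : ZMod p) ^ 3 * κ := by
  have hy := E.ty_mem V 1
  have hm : 1 + ty π (1 : ZMod p) + ty π (1 : ZMod p) ^ 2 ∈ V :=
    add_mem (add_mem (one_mem V) hy) (pow_mem hy 2)
  have hr : res V (1 + ty π (1 : ZMod p) + ty π (1 : ZMod p) ^ 2) ≠ 0 := by
    rw [res_add (add_mem (one_mem V) hy) (pow_mem hy 2), res_add (one_mem V) hy, res_pow hy,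
      E.res_ty_of_lt hx1, res_one]
    have := E.three_ne_zero_res hV
    norm_num
    exact this
  have h0 : 1 + ty π (1 : ZMod p) + ty π (1 : ZMod p) ^ 2 ≠ 0 := fun h => hr (by rw [h, res_zero])
  refine ⟨-(1 + ty π (1 : ZMod p) + ty π (1 : ZMod p) ^ 2)⁻¹, neg_mem (inv_mem_of_res hm hr), ?_⟩
  field_simp
  linear_combination E.seq.curve 1

lemma exists_slopes (htV : tx π (1 : ZMod p) ∈ V) :
    HasSlope htV (sx p π) (sy p π ^ 2) ∧ HasSlope htV (sy p π) (-sx p π ^ 2) := by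
  obtain ⟨κ, hκ, hy1⟩ := E.exists_kappa hV hx1
  set t := tx π (1 : ZMod p) with ht
  set c := ty π (1 : ZMod p) with hc
  have hcV : c ∈ V := E.ty_mem V 1
  have hxV : ∀ r, sx p π r ∈ V := fun r => E.tx_mem V r
  have hyV : ∀ r, sy p π r ∈ V := fun r => E.ty_mem V r
  have hres : ∀ r, res V (1 - sx p π r ^ 3 * t ^ 3) = 1 := by
    intro r
    rw [res_sub (one_mem V) (mul_mem (pow_mem (hxV r) 3) (pow_mem htV 3)),
      res_mul (pow_mem (hxV r) 3) (pow_mem htV 3), res_pow htV, (res_eq_zero_iff htV).2 hx1, res_one]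
    simp
  have hres0 : ∀ r, res V (1 - sx p π r ^ 3 * t ^ 3) ≠ 0 := fun r => by
    rw [hres]; exact one_ne_zero
  have hD0 : ∀ r, 1 - sx p π r ^ 3 * t ^ 3 ≠ 0 := fun r h => hres0 r (by rw [h, res_zero])
  let C : ℂ → ℕ → ℂ := fun z _ => z
  let D : ℕ → ℂ := 1 - sx p π ^ 3 * C t ^ 3
  have hDr : ∀ r, D r = 1 - sx p π r ^ 3 * t ^ 3 := fun r => rfl
  let gx : ℕ → ℂ := (sx p π * C (t ^ 2 * κ * (c + 1)) + sy p π ^ 2 - sx p π ^ 2 * sy p π * C (t * c) +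
    sx p π ^ 4 * C (t ^ 2)) * D⁻¹
  let gy : ℕ → ℂ := (sy p π * C (t ^ 2 * κ) - sx p π ^ 2 * C (c ^ 2) - sx p π * sy p π ^ 2 * C t +
    sy p π * sx p π ^ 3 * C (t ^ 2)) * D⁻¹
  have hgx : ∀ r, sx p π (r + 1) = sx p π r + t * gx r := by
    intro r
    have h := E.seq.add_x (r : ZMod p) 1
    have h0 := hD0 r
    have e1 : sx p π (r + 1) = tx π ((r : ZMod p) + 1) := by simp [sx]
    rw [e1]
    refine mul_left_cancel₀ h0 ?_
    simp only [gx, Pi.mul_apply, Pi.add_apply, Pi.sub_apply, Pi.pow_apply, Pi.inv_apply, hDr, C]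
    rw [sx, h, ← ht, ← hc]
    have h0' : 1 - tx π (r : ZMod p) ^ 3 * t ^ 3 ≠ 0 := h0
    have hs : sy p π r = ty π (r : ZMod p) := rfl
    rw [hs]
    field_simp
    linear_combination tx π (r : ZMod p) * (c + 1) * hy1
  have hgy : ∀ r, sy p π (r + 1) = sy p π r + t * gy r := by
    intro r
    have h := E.seq.add_y (r : ZMod p) 1
    have h0 := hD0 r
    have e1 : sy p π (r + 1) = ty π ((r : ZMod p) + 1) := by simp [sy]
    rw [e1]
    refine mul_left_cancel₀ h0 ?_
    simp only [gy, Pi.mul_apply, Pi.add_apply, Pi.sub_apply, Pi.pow_apply, Pi.inv_apply, hDr, C]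
    rw [sx, h, ← ht, ← hc]
    have h0' : 1 - tx π (r : ZMod p) ^ 3 * t ^ 3 ≠ 0 := h0
    have hs : sy p π r = ty π (r : ZMod p) := rfl
    rw [hs]
    field_simp
    linear_combination ty π (r : ZMod p) * hy1
  have hsm : ∀ i, IsSmooth V t i (sx p π) ∧ IsSmooth V t i (sy p π) := by
    intro i
    induction i with
    | zero => exact ⟨hxV, hyV⟩
    | succ i ih =>
      have mx : sx p π ∈ smoothRing htV i := ih.1
      have my : sy p π ∈ smoothRing htV i := ih.2
      have mC : ∀ z ∈ V, C z ∈ smoothRing htV i := fun z hz => IsSmooth.const hz i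
      have mD0 : D ∈ smoothRing htV i :=
        sub_mem (one_mem _) (mul_mem (pow_mem mx 3) (pow_mem (mC t htV) 3))
      have mD : D⁻¹ ∈ smoothRing htV i := IsSmooth.inv htV mD0 hres0
      refine ⟨⟨hxV, gx, ?_, hgx⟩, ⟨hyV, gy, ?_, hgy⟩⟩
      · change gx ∈ smoothRing htV i
        refine mul_mem (add_mem (sub_mem (add_mem (mul_mem mx (mC _ ?_)) (pow_mem my 2))
          (mul_mem (mul_mem (pow_mem mx 2) my) (mC _ ?_))) (mul_mem (pow_mem mx 4) (mC _ ?_))) mD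
        · exact mul_mem (mul_mem (pow_mem htV 2) hκ) (add_mem hcV (one_mem V))
        · exact mul_mem htV hcV
        · exact pow_mem htV 2
      · change gy ∈ smoothRing htV i
        refine mul_mem (add_mem (sub_mem (sub_mem (mul_mem my (mC _ ?_)) (mul_mem (pow_mem mx 2)
          (mC _ ?_))) (mul_mem (mul_mem mx (pow_mem my 2)) (mC _ htV)))
          (mul_mem (mul_mem my (pow_mem mx 3)) (mC _ ?_))) mD
        · exact mul_mem (pow_mem htV 2) hκ
        · exact pow_mem hcV 2
        · exact pow_mem htV 2
  have mx : sx p π ∈ smooth htV := mem_smooth.2 fun i => (hsm i).1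
  have my : sy p π ∈ smooth htV := mem_smooth.2 fun i => (hsm i).2
  have mC : ∀ z ∈ V, C z ∈ smooth htV := fun z hz => const_mem_smooth hz
  have mD0 : D ∈ smooth htV := sub_mem (one_mem _) (mul_mem (pow_mem mx 3) (pow_mem (mC t htV) 3))
  have mD : D⁻¹ ∈ smooth htV := inv_mem_smooth mD0 hres0
  refine ⟨⟨mx, pow_mem my 2, (sx p π * C (t * κ * (c + 1)) - sx p π ^ 2 * sy p π * C c +
    sx p π ^ 4 * C t + sy p π ^ 2 * sx p π ^ 3 * C (t ^ 2)) * D⁻¹, ?_, fun r => ?_⟩,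
    ⟨my, neg_mem (pow_mem mx 2), (sy p π * C (t * κ) - sx p π ^ 2 * C (t ^ 2 * κ * (c + 1)) -
      sx p π * sy p π ^ 2 + sy p π * sx p π ^ 3 * C t - sx p π ^ 5 * C (t ^ 2)) * D⁻¹, ?_,
      fun r => ?_⟩⟩
  · exact mul_mem (add_mem (add_mem (sub_mem (mul_mem mx (mC _ (mul_mem (mul_mem htV hκ)
      (add_mem hcV (one_mem V))))) (mul_mem (mul_mem (pow_mem mx 2) my) (mC _ hcV)))
      (mul_mem (pow_mem mx 4) (mC _ htV))) (mul_mem (mul_mem (pow_mem my 2) (pow_mem mx 3))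
      (mC _ (pow_mem htV 2)))) mD
  · rw [hgx]
    have h0 := hD0 r
    simp only [gx, Pi.mul_apply, Pi.add_apply, Pi.sub_apply, Pi.pow_apply, Pi.inv_apply, hDr, C]
    field_simp
    ring
  · exact mul_mem (sub_mem (add_mem (sub_mem (sub_mem (mul_mem my (mC _ (mul_mem htV hκ)))
      (mul_mem (pow_mem mx 2) (mC _ (mul_mem (mul_mem (pow_mem htV 2) hκ)
      (add_mem hcV (one_mem V)))))) (mul_mem mx (pow_mem my 2)))
      (mul_mem (mul_mem my (pow_mem mx 3)) (mC _ htV)))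
      (mul_mem (pow_mem mx 5) (mC _ (pow_mem htV 2)))) mD
  · rw [hgy]
    have h0 := hD0 r
    simp only [gy, Pi.mul_apply, Pi.add_apply, Pi.sub_apply, Pi.pow_apply, Pi.inv_apply,
      Pi.neg_apply, hDr, C]
    have hi := mul_inv_cancel₀ h0
    linear_combination (-t * (1 - sx p π r ^ 3 * t ^ 3)⁻¹ * sx p π r ^ 2) * (c + 1) * hy1 -
      t * sx p π r ^ 2 * hi

end EisPrime

end FermatCurve

namespace FermatCurve

open scoped ComplexConjugate

namespace EisPrime

variable {p : ℕ} [Fact p.Prime] {π : ℂ} {ι : ℤ} (E : EisPrime p π ι)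
variable {V : ValuationSubring ℂ} (hV : V.valuation π < 1)

include E hV

lemma prod_res_eq {w : ℕ → ℂ} (hw : ∀ r, w r ∈ V) (h : ∀ r, res V (w r) = r) :
    res V (∏ k ∈ Finset.range (p - 1), w (k + 1)) = -1 := by
  rw [res_prod _ fun k _ => hw (k + 1), Finset.prod_congr rfl fun k _ => h (k + 1),
    ← Nat.cast_prod, Finset.prod_range_add_one_eq_factorial]
  have := congrArg (E.toRes hV) (ZMod.wilsons_lemma p)
  rwa [map_natCast, map_neg, map_one] at this

lemma res_root_of_unity {z : ℂ} (hz : z ^ p = 1) : z ∈ V ∧ res V z = 1 := by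
  have hp : p.Prime := Fact.out
  have hm : z ∈ V := mem_of_pow_mem hp.ne_zero (by rw [hz]; exact one_mem V)
  refine ⟨hm, ?_⟩
  have := (CharP.charP_iff_prime_eq_zero (R := IsLocalRing.ResidueField V) hp).2 (E.res_p_of_pi hV)
  have h : (res V z - 1) ^ p = 0 := by
    rw [sub_pow_char, ← res_pow hm, hz, res_one, one_pow, sub_self]
  exact sub_eq_zero.1 (pow_eq_zero_iff hp.ne_zero |>.1 h)

lemma res_conj_pi_ne_zero : res V (conj π) ≠ 0 := by
  rw [E.res_eq_toRes hV (conj_mem_O3 E.mem), Ne, map_eq_zero]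
  intro h
  obtain ⟨d, hd, h⟩ := E.dvd_of_red (conj_mem_O3 E.mem) h
  obtain ⟨d', hd', h'⟩ := E.conj_pi.iota
  have h2 : E.red ρ3 = E.red ((ι ^ 2 : ℤ) : ℂ) :=
    (E.cong_iff_red rho_mem (int_mem_O3 _)).1 ⟨d * d', mul_mem hd hd', by rw [h', h]; ring⟩
  rw [E.red_rho, E.red_int, Int.cast_pow] at h2
  exact E.q_ne_zero (sub_eq_zero.2 h2)

variable {T : Finset (ZMod p)} (hT : ThirdSet (ι : ZMod p) T) (h1 : ECong π 1 3)
include hT h1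

lemma val_t : V.valuation (tx π (1 : ZMod p)) < 1 := E.val_tx_one hT h1 hV 1

omit hV hT h1 in
lemma t_ne_zero : tx π (1 : ZMod p) ≠ 0 := E.seq.x_ne 1 one_ne_zero

lemma exists_sx (r : ℕ) : ∃ w ∈ V, sx p π r = tx π (1 : ZMod p) * w ∧ res V w = r := by
  obtain ⟨w, hw, h2, h3⟩ := E.exists_dilation (E.val_t hV hT h1) r
  rw [mul_one] at h2
  exact ⟨w, hw, h2, h3⟩

lemma exists_pi_eq : ∃ w ∈ V, π = tx π (1 : ZMod p) ^ (p - 1) * w ∧ res V w = -1 := by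
  have hp : p.Prime := Fact.out
  choose w hw h2 h3 using E.exists_sx hV hT h1
  refine ⟨_, prod_mem fun k (_ : k ∈ Finset.range (p - 1)) => hw (k + 1), ?_, E.prod_res_eq hV hw h3⟩
  have h4 := E.prod_erase_tx hT 1
  simp only [one_mul] at h4
  rw [E.prod_cube hT, E.ysum_eq hT h1] at h4
  nth_rw 1 [← h4]
  have h5 := Finset.prod_const (s := Finset.range (p - 1)) (tx π (1 : ZMod p))
  rw [Finset.card_range] at h5
  rw [← h5, ← Finset.prod_mul_distrib]
  symm
  refine Finset.prod_bij (fun k _ => ((k + 1 : ℕ) : ZMod p)) (fun k hk => ?_) (fun a ha b hb h => ?_)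
    (fun b hb => ?_) fun k _ => ?_
  · have := Finset.mem_range.1 hk
    rw [Finset.mem_erase, Ne, ZMod.natCast_eq_zero_iff]
    exact ⟨fun h => absurd (Nat.le_of_dvd k.succ_pos h) (by omega), Finset.mem_univ _⟩
  · have ha := Finset.mem_range.1 ha
    have hb := Finset.mem_range.1 hb
    rw [ZMod.natCast_eq_natCast_iff', Nat.mod_eq_of_lt (by omega), Nat.mod_eq_of_lt (by omega)] at h
    omega
  · have hb0 := Finset.ne_of_mem_erase hb
    have hlt := ZMod.val_lt b
    have hpos : b.val ≠ 0 := fun h => hb0 ((ZMod.val_eq_zero b).1 h)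
    refine ⟨b.val - 1, Finset.mem_range.2 (by omega), ?_⟩
    rw [Nat.sub_add_cancel (by omega), ZMod.natCast_rightInverse b]
  · rw [← h2, sx]

lemma exists_p_eq : ∃ u ∈ V, (p : ℂ) = tx π (1 : ZMod p) ^ (p - 1) * u ∧
    res V u = -res V (conj π) := by
  obtain ⟨w, hw, h2, h3⟩ := E.exists_pi_eq hV hT h1
  have hc : conj π ∈ V := O3_le (conj_mem_O3 E.mem)
  refine ⟨w * conj π, mul_mem hw hc, ?_, ?_⟩
  · rw [E.norm]
    nth_rw 1 [h2]
    ring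
  · rw [res_mul hw hc, h3]
    ring

/-- The leading coefficient `θ` of `ζ - 1`. -/
lemma exists_theta {e : AddChar (ZMod p) ℂ} (he : e.IsPrimitive) :
    ∃ θ : IsLocalRing.ResidueField V, θ ^ (p - 1) = res V (conj π) ∧
      ∀ j : ZMod p, ∃ c ∈ V, e j = 1 + tx π (1 : ZMod p) * c ∧ res V c = E.toRes hV j * θ := by
  have hp : p.Prime := Fact.out
  set t := tx π (1 : ZMod p)
  have ht0 : t ≠ 0 := E.t_ne_zero
  set ζ := e 1 with hζ
  have hpow : ∀ j : ℕ, e (j : ZMod p) = ζ ^ j := fun j => by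
    rw [hζ, ← AddChar.map_nsmul_eq_pow, nsmul_one]
  have hζp : ζ ^ p = 1 := by rw [← hpow, ZMod.natCast_self, AddChar.map_zero_eq_one]
  obtain ⟨hζV, hζ1⟩ := E.res_root_of_unity hV hζp
  have hζne : ζ ≠ 1 := by
    intro h
    refine he one_ne_zero (DFunLike.ext _ _ fun j => ?_)
    rw [AddChar.mulShift_apply, one_mul, AddChar.one_apply, ← ZMod.natCast_rightInverse j, hpow, h,
      one_pow]
  have hprim : IsPrimitiveRoot ζ (p - 1 + 1) := by
    rw [Nat.sub_add_cancel hp.one_le]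
    rw [← orderOf_eq_prime hζp hζne]
    exact IsPrimitiveRoot.orderOf ζ
  set s : ℕ → ℂ := fun k => ∑ i ∈ Finset.range k, ζ ^ i with hs
  have hsV : ∀ k, s k ∈ V := fun k => sum_mem fun i _ => pow_mem hζV i
  have hs1 : ∀ k, res V (s k) = k := by
    intro k
    rw [hs, res_sum _ fun i _ => pow_mem hζV i]
    simp [res_pow hζV, hζ1]
  have hsk : ∀ k, ζ ^ k = 1 + (ζ - 1) * s k := fun k => by
    rw [hs, mul_comm, geom_sum_mul]; ring
  obtain ⟨u, hu, h2, h3⟩ := E.exists_p_eq hV hT h1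
  have heven : Even (p - 1) := hp.even_sub_one (by
    rintro rfl
    have := E.mod3
    omega)
  have h4 := hprim.prod_one_sub_pow_eq_order
  have h5 : ∀ k ∈ Finset.range (p - 1), 1 - ζ ^ (k + 1) = -(ζ - 1) * s (k + 1) := fun k _ => by
    rw [hsk]; ring
  rw [Finset.prod_congr rfl h5, Finset.prod_mul_distrib, Finset.prod_const, Finset.card_range,
    heven.neg_pow] at h4
  have h6 : ((p - 1 : ℕ) : ℂ) + 1 = p := by
    rw [Nat.cast_sub hp.one_le]; push_cast; ring
  rw [h6] at h4
  have h7 := E.prod_res_eq hV hsV hs1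
  set P := ∏ k ∈ Finset.range (p - 1), s (k + 1) with hP
  have hPV : P ∈ V := prod_mem fun k _ => hsV _
  have hP0 : res V P ≠ 0 := by rw [h7]; exact neg_ne_zero.2 one_ne_zero
  have hPn : P ≠ 0 := fun h => hP0 (by rw [h, res_zero])
  obtain ⟨c, hc⟩ : ∃ c, ζ - 1 = t * c := ⟨(ζ - 1) / t, by field_simp⟩
  have h8 : c ^ (p - 1) = u * P⁻¹ := by
    rw [h2, hc, mul_pow] at h4
    have := mul_left_cancel₀ (pow_ne_zero (p - 1) ht0) ((mul_assoc _ _ _).symm.trans h4)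
    rw [← this]
    field_simp
  have hPi := inv_mem_of_res hPV hP0
  have hcV : c ∈ V := mem_of_pow_mem (n := p - 1) (by have := hp.two_le; omega)
    (by rw [h8]; exact mul_mem hu hPi)
  refine ⟨res V c, ?_, fun j => ⟨c * s j.val, mul_mem hcV (hsV _), ?_, ?_⟩⟩
  · rw [← res_pow hcV, h8, res_mul hu hPi, res_inv hPV hP0, h3, h7]
    norm_num
  · nth_rw 1 [← ZMod.natCast_rightInverse j]
    rw [hpow, hsk, hc]
    ring
  · rw [res_mul hcV (hsV _), hs1, mul_comm, ← map_natCast (E.toRes hV), ZMod.natCast_rightInverse j]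

end EisPrime

end FermatCurve

namespace FermatCurve

open scoped ComplexConjugate

lemma ell_eq_sum {V : ValuationSubring ℂ} {t : ℂ} {p : ℕ} (ht0 : t ≠ 0) {F g : ℕ → ℂ}
    (hg : ∀ r, g r ∈ V) (h : ∀ r, F r = t ^ (p - 1) * g r) :
    ell V t p F = ∑ r ∈ Finset.range p, res V (g r) := by
  rw [← res_sum _ fun r _ => hg r]
  refine ell_eq ht0 ?_
  rw [Finset.mul_sum]
  exact Finset.sum_congr rfl fun r _ => h r

namespace EisPrime

variable {p : ℕ} [Fact p.Prime] {π : ℂ} {ι : ℤ} (E : EisPrime p π ι)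
variable {V : ValuationSubring ℂ} (hV : V.valuation π < 1)
variable {T : Finset (ZMod p)} (hT : ThirdSet (ι : ZMod p) T) (h1 : ECong π 1 3)
variable {e : AddChar (ZMod p) ℂ} {θ : IsLocalRing.ResidueField V}
  (hθ : ∀ j : ZMod p, ∃ c ∈ V, e j = 1 + tx π (1 : ZMod p) * c ∧ res V c = E.toRes hV j * θ)

omit [Fact p.Prime] in
/-- The sequence `e(r j)`. -/
def sz (e : AddChar (ZMod p) ℂ) (j : ZMod p) (r : ℕ) : ℂ := e ((r : ZMod p) * j)

/-- The residue of `∑ e(r j) F(r)`, divided by `x(1/π) ^ (p - 1)`. -/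
def ellz (V : ValuationSubring ℂ) (π : ℂ) (e : AddChar (ZMod p) ℂ) (j : ZMod p) (F : ℕ → ℂ) :
    IsLocalRing.ResidueField V :=
  ell V (tx π (1 : ZMod p)) p (sz e j * F)

include E hV hT h1 hθ

lemma sz_mem (j : ZMod p) (r : ℕ) : sz e j r ∈ V ∧ res V (sz e j r) = 1 := by
  obtain ⟨c, hc, h2, -⟩ := hθ ((r : ZMod p) * j)
  have ht := E.val_t hV hT h1
  have htV := mem_of_lt ht
  rw [sz, h2]
  refine ⟨add_mem (one_mem V) (mul_mem htV hc), ?_⟩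
  rw [res_add (one_mem V) (mul_mem htV hc), res_mul htV hc, (res_eq_zero_iff htV).2 ht, res_one,
    zero_mul, add_zero]

lemma exists_slope_sz (htV : tx π (1 : ZMod p) ∈ V) (j : ZMod p) :
    ∃ c ∈ V, res V c = E.toRes hV j * θ ∧ HasSlope htV (sz e j) ((fun _ => c) * sz e j) := by
  obtain ⟨c, hc, h2, h3⟩ := hθ j
  have hs : ∀ r, sz e j (r + 1) = sz e j r + tx π (1 : ZMod p) * (c * sz e j r) := by
    intro r
    rw [sz, sz, Nat.cast_add, Nat.cast_one, add_mul, one_mul, AddChar.map_add_eq_mul, h2]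
    ring
  have hm : sz e j ∈ smooth htV := by
    refine mem_smooth.2 fun i => ?_
    induction i with
    | zero => exact fun r => (E.sz_mem hV hT h1 hθ j r).1
    | succ i ih =>
      exact ⟨fun r => (E.sz_mem hV hT h1 hθ j r).1, (fun _ => c) * sz e j,
        (IsSmooth.const hc i).mul htV ih, hs⟩
  refine ⟨c, hc, h3, hm, mul_mem (const_mem_smooth hc) hm, 0, zero_mem _, fun r => ?_⟩
  rw [hs]
  simp

lemma smooth_facts (htV : tx π (1 : ZMod p) ∈ V) :
    sx p π ∈ smooth htV ∧ sy p π ∈ smooth htV ∧ ∀ j, sz e j ∈ smooth htV :=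
  ⟨(E.exists_slopes hV (E.val_t hV hT h1) htV).1.1, (E.exists_slopes hV (E.val_t hV hT h1) htV).2.1,
    fun j => (E.exists_slope_sz hV hT h1 hθ htV j).choose_spec.2.2.1⟩

lemma ellz_lin (htV : tx π (1 : ZMod p) ∈ V) (j : ZMod p) {F G : ℕ → ℂ} (hF : F ∈ smooth htV)
    (hG : G ∈ smooth htV) {a b : ℂ} (ha : a ∈ V) (hb : b ∈ V) :
    ellz V π e j (fun r => a * F r + b * G r) =
      res V a * ellz V π e j F + res V b * ellz V π e j G := by
  have hp : p.Prime := Fact.out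
  obtain ⟨u, hu, hpt, -⟩ := E.exists_p_eq hV hT h1
  have hz := (E.smooth_facts hV hT h1 hθ htV).2.2 j
  have e1 : sz e j * (fun r => a * F r + b * G r) =
      (fun _ => a) * (sz e j * F) + (fun _ => b) * (sz e j * G) := by
    ext r
    simp only [Pi.mul_apply, Pi.add_apply]
    ring
  have ht0 := E.t_ne_zero
  rw [ellz, e1, ell_add hp ht0 ⟨u, hu, hpt⟩ (mul_mem (const_mem_smooth ha) (mul_mem hz hF))
    (mul_mem (const_mem_smooth hb) (mul_mem hz hG)),
    ell_const_mul hp ht0 ⟨u, hu, hpt⟩ (mul_mem hz hF) ha,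
    ell_const_mul hp ht0 ⟨u, hu, hpt⟩ (mul_mem hz hG) hb]
  rfl

lemma ellz_slope (htV : tx π (1 : ZMod p) ∈ V) (j : ZMod p) {F F' : ℕ → ℂ}
    (h : HasSlope htV F F') (hF : F p = F 0) :
    ellz V π e j F' = -(E.toRes hV j * θ) * ellz V π e j F := by
  have hp : p.Prime := Fact.out
  obtain ⟨u, hu, hpt, -⟩ := E.exists_p_eq hV hT h1
  obtain ⟨c, hc, h2, h3⟩ := E.exists_slope_sz hV hT h1 hθ htV j
  have ht0 := E.t_ne_zero
  have key := ell_slope hp ht0 ⟨u, hu, hpt⟩ (E.val_t hV hT h1) (h3.mul h) (by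
    simp [hF, sz])
  rw [mul_assoc, ell_add hp ht0 ⟨u, hu, hpt⟩ (mul_mem (const_mem_smooth hc) (mul_mem h3.1 h.1))
    (mul_mem h3.1 h.2.1), ell_const_mul hp ht0 ⟨u, hu, hpt⟩ (mul_mem h3.1 h.1) hc, h2] at key
  rw [ellz, ellz]
  linear_combination key

lemma ellz_slope_lin (htV : tx π (1 : ZMod p) ∈ V) (j : ZMod p) {F F' G H : ℕ → ℂ} {a b : ℤ}
    (h : HasSlope htV F F') (hF : F p = F 0) (hG : G ∈ smooth htV) (hH : H ∈ smooth htV)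
    (h' : ∀ r, F' r = a * G r + b * H r) :
    -(E.toRes hV j * θ) * ellz V π e j F = a * ellz V π e j G + b * ellz V π e j H := by
  rw [← E.ellz_slope hV hT h1 hθ htV j h hF, ← res_intCast, ← res_intCast,
    ← E.ellz_lin hV hT h1 hθ htV j hG hH (intCast_mem V a) (intCast_mem V b)]
  congr 1
  exact funext h'

lemma ellz_pow (j : ZMod p) (k : ℕ) :
    -(E.toRes hV j * θ) * ellz V π e j (sx p π ^ k) =
      k * ellz V π e j (sx p π ^ (k - 1) * sy p π ^ 2) := by
  have htV := mem_of_lt (E.val_t hV hT h1)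
  obtain ⟨hx, hy⟩ := E.exists_slopes hV (E.val_t hV hT h1) htV
  have h := E.ellz_slope_lin hV hT h1 hθ htV j (a := k) (b := 0) (hx.pow k)
    (by simp [sx]) (mul_mem (pow_mem hx.1 (k - 1)) (pow_mem hy.1 2)) (zero_mem _) (fun r => by
      simp [mul_assoc])
  rw [h]
  push_cast
  ring

lemma ellz_pow_mul_sq (j : ZMod p) (k : ℕ) :
    -(E.toRes hV j * θ) * ellz V π e j (sx p π ^ k * sy p π ^ 2) =
      k * ellz V π e j (sy p π * sx p π ^ (k - 1)) -
        (k + 2) * ellz V π e j (sy p π * sx p π ^ (k + 2)) := by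
  have htV := mem_of_lt (E.val_t hV hT h1)
  obtain ⟨hx, hy⟩ := E.exists_slopes hV (E.val_t hV hT h1) htV
  have h := E.ellz_slope_lin hV hT h1 hθ htV j (a := k) (b := -(k + 2)) ((hx.pow k).mul (hy.pow 2))
    (by simp [sx, sy]) (mul_mem hy.1 (pow_mem hx.1 (k - 1))) (mul_mem hy.1 (pow_mem hx.1 (k + 2)))
    (fun r => by
      have hc := E.seq.curve (r : ZMod p)
      change sx p π r ^ 3 + sy p π r ^ 3 = 1 at hc
      simp only [Pi.mul_apply, Pi.add_apply, Pi.pow_apply, Pi.neg_apply, Pi.natCast_apply]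
      push_cast
      rcases k with _ | k
      · simp only [Nat.cast_zero, pow_zero]
        ring
      · simp only [Nat.add_sub_cancel]
        push_cast
        linear_combination (k + 1) * sx p π r ^ k * sy p π r * hc)
  rw [h]
  push_cast
  ring

lemma ellz_mul_pow (j : ZMod p) (k : ℕ) :
    -(E.toRes hV j * θ) * ellz V π e j (sy p π * sx p π ^ k) =
      k * ellz V π e j (sx p π ^ (k - 1)) - (k + 1) * ellz V π e j (sx p π ^ (k + 2)) := by
  have htV := mem_of_lt (E.val_t hV hT h1)
  obtain ⟨hx, hy⟩ := E.exists_slopes hV (E.val_t hV hT h1) htV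
  have h := E.ellz_slope_lin hV hT h1 hθ htV j (a := k) (b := -(k + 1)) (hy.mul (hx.pow k))
    (by simp [sx, sy]) (pow_mem hx.1 (k - 1)) (pow_mem hx.1 (k + 2))
    (fun r => by
      have hc := E.seq.curve (r : ZMod p)
      change sx p π r ^ 3 + sy p π r ^ 3 = 1 at hc
      simp only [Pi.mul_apply, Pi.add_apply, Pi.pow_apply, Pi.neg_apply, Pi.natCast_apply]
      push_cast
      rcases k with _ | k
      · simp only [Nat.cast_zero, pow_zero]
        ring
      · simp only [Nat.add_sub_cancel]
        push_cast
        linear_combination (k + 1) * sx p π r ^ k * hc)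
  rw [h]
  push_cast
  ring

/-- The three-term recursion for the residues of `∑ e(r j) x(r/π) ^ (3 m + 1)`. -/
lemma ellz_recursion (j : ZMod p) (m : ℕ) :
    (3 * m + 1) * (3 * m) * (3 * m - 1) * ellz V π e j (sx p π ^ (3 * (m - 1) + 1)) -
      ((3 * m + 1) * (3 * m) ^ 2 + (3 * m + 1) * (3 * m + 2) ^ 2) *
        ellz V π e j (sx p π ^ (3 * m + 1)) +
      (3 * m + 1) * (3 * m + 2) * (3 * m + 3) * ellz V π e j (sx p π ^ (3 * (m + 1) + 1)) =
    -(E.toRes hV j * θ) ^ 3 * ellz V π e j (sx p π ^ (3 * m + 1)) := by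
  have e1 := E.ellz_pow hV hT h1 hθ j (3 * m + 1)
  have e2 := E.ellz_pow_mul_sq hV hT h1 hθ j (3 * m)
  have e3 := E.ellz_mul_pow hV hT h1 hθ j (3 * m + 2)
  have e4 := E.ellz_mul_pow hV hT h1 hθ j (3 * m - 1)
  rw [show 3 * m + 1 - 1 = 3 * m by omega] at e1
  rw [show 3 * m + 2 - 1 = 3 * m + 1 by omega, show 3 * m + 2 + 2 = 3 * (m + 1) + 1 by ring] at e3
  set J := E.toRes hV j * θ
  push_cast at e1 e2 e3
  rcases m with _ | m
  · simp only [Nat.cast_zero, mul_zero, zero_mul, zero_add] at e1 e2 e3 ⊢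
    linear_combination -J ^ 2 * e1 + J * e2 + 2 * e3
  · rw [show 3 * (m + 1) - 1 - 1 = 3 * m + 1 by omega, show 3 * (m + 1) - 1 + 2 = 3 * (m + 1) + 1
      by omega, show 3 * (m + 1) - 1 = 3 * m + 2 by omega] at e4
    rw [show 3 * (m + 1) - 1 = 3 * m + 2 by omega] at e2
    rw [show m + 1 - 1 = m by omega]
    push_cast at e1 e2 e3 e4 ⊢
    linear_combination -J ^ 2 * e1 + J * (3 * m + 4) * e2 - (3 * m + 4) * (3 * m + 3) * e4 +
      (3 * m + 4) * (3 * m + 5) * e3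

end EisPrime

end FermatCurve

namespace FermatCurve

open scoped ComplexConjugate

lemma sum_range_natCast {p : ℕ} [NeZero p] {M : Type*} [AddCommMonoid M] (f : ZMod p → M) :
    ∑ r ∈ Finset.range p, f r = ∑ a, f a := by
  refine Finset.sum_nbij' (fun r => (r : ZMod p)) ZMod.val (fun _ _ => Finset.mem_univ _)
    (fun a _ => Finset.mem_range.2 (ZMod.val_lt a)) (fun r hr => ?_)
    (fun a _ => ZMod.natCast_rightInverse a) fun _ _ => rfl
  exact ZMod.val_cast_of_lt (Finset.mem_range.1 hr)

namespace EisPrime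

variable {p : ℕ} [Fact p.Prime] {π : ℂ} {ι : ℤ} (E : EisPrime p π ι)
variable {V : ValuationSubring ℂ} (hV : V.valuation π < 1)
variable {T : Finset (ZMod p)} (hT : ThirdSet (ι : ZMod p) T) (h1 : ECong π 1 3)
variable {e : AddChar (ZMod p) ℂ} {θ : IsLocalRing.ResidueField V}
  (hθ : ∀ j : ZMod p, ∃ c ∈ V, e j = 1 + tx π (1 : ZMod p) * c ∧ res V c = E.toRes hV j * θ)

include E hV hT h1 hθ

lemma ellz_pow_prime (j : ZMod p) : ellz V π e j (sx p π ^ p) = 0 := by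
  have hp : p.Prime := Fact.out
  choose w hw h2 h3 using E.exists_sx hV hT h1
  have ht := E.val_t hV hT h1
  have htV := mem_of_lt ht
  have hz := E.sz_mem hV hT h1 hθ j
  rw [ellz, ell_eq_sum E.t_ne_zero (g := fun r => tx π (1 : ZMod p) * (sz e j r * w r ^ p))
    (fun r => mul_mem htV (mul_mem (hz r).1 (pow_mem (hw r) p)))]
  · refine Finset.sum_eq_zero fun r _ => ?_
    rw [res_mul htV (mul_mem (hz r).1 (pow_mem (hw r) p)), (res_eq_zero_iff htV).2 ht, zero_mul]
  · intro r
    rw [Pi.mul_apply, Pi.pow_apply, h2, mul_pow, ← pow_sub_one_mul hp.ne_zero (tx π (1 : ZMod p))]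
    ring

lemma ellz_pow_pred (j : ZMod p) : ellz V π e j (sx p π ^ (p - 1)) = -1 := by
  have hp : p.Prime := Fact.out
  choose w hw h2 h3 using E.exists_sx hV hT h1
  have hz := E.sz_mem hV hT h1 hθ j
  rw [ellz, ell_eq_sum E.t_ne_zero (g := fun r => sz e j r * w r ^ (p - 1))
    (fun r => mul_mem (hz r).1 (pow_mem (hw r) _))]
  · have h4 : ∀ r ∈ Finset.range p, res V (sz e j r * w r ^ (p - 1)) =
        E.toRes hV ((r : ZMod p) ^ (p - 1)) := fun r _ => by
      rw [res_mul (hz r).1 (pow_mem (hw r) _), (hz r).2, one_mul, res_pow (hw r), h3, map_pow,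
        map_natCast]
    rw [Finset.sum_congr rfl h4, ← map_sum, sum_range_natCast fun a : ZMod p => a ^ (p - 1)]
    simp only [ZMod.pow_card_sub_one]
    rw [Finset.sum_ite, Finset.sum_const_zero, add_zero, Finset.sum_const, Finset.filter_ne',
      Finset.card_erase_of_mem (Finset.mem_univ _), Finset.card_univ, ZMod.card, nsmul_one,
      map_natCast, Nat.cast_sub hp.one_le, E.res_p_of_pi hV]
    simp
  · intro r
    rw [Pi.mul_apply, Pi.pow_apply, h2]
    ring

lemma ellz_pow_mul_sq_eq (j : ZMod p) {k : ℕ} (hk : p ≤ k + 3) :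
    ellz V π e j (sx p π ^ k * sy p π ^ 2) = ellz V π e j (sx p π ^ k) := by
  have hp : p.Prime := Fact.out
  choose w hw h2 h3 using E.exists_sx hV hT h1
  have ht := E.val_t hV hT h1
  have htV := mem_of_lt ht
  obtain ⟨hx, hy, hsz⟩ := E.smooth_facts hV hT h1 hθ htV
  have hz := E.sz_mem hV hT h1 hθ j
  have hlt : ∀ r, V.valuation (tx π r) < 1 := E.val_tx_one hT h1 hV
  have hκ : ∀ r : ℕ, ∃ κ ∈ V, sy p π r ^ 2 - 1 = sx p π r ^ 3 * κ := by
    intro r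
    have hyV : sy p π r ∈ V := E.ty_mem V r
    have hc := E.seq.curve (r : ZMod p)
    change sx p π r ^ 3 + sy p π r ^ 3 = 1 at hc
    have hr : res V (sy p π r) = 1 := E.res_ty_of_lt (hlt r)
    have hm : 1 + sy p π r + sy p π r ^ 2 ∈ V := add_mem (add_mem (one_mem V) hyV) (pow_mem hyV 2)
    have hr' : res V (1 + sy p π r + sy p π r ^ 2) ≠ 0 := by
      rw [res_add (add_mem (one_mem V) hyV) (pow_mem hyV 2), res_add (one_mem V) hyV, res_pow hyV, hr,
        res_one]
      have := E.three_ne_zero_res hV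
      norm_num
      exact this
    have h0 : 1 + sy p π r + sy p π r ^ 2 ≠ 0 := fun h => hr' (by rw [h, res_zero])
    refine ⟨-(1 + sy p π r + sy p π r ^ 2)⁻¹ * (sy p π r + 1),
      mul_mem (neg_mem (inv_mem_of_res hm hr')) (add_mem hyV (one_mem V)), ?_⟩
    field_simp
    linear_combination (sy p π r + 1) * hc
  choose κ hκV hκ using hκ
  obtain ⟨d, hd⟩ : ∃ d, k + 3 = p + d := ⟨k + 3 - p, by omega⟩
  have h4 : ellz V π e j (fun r => 1 * (sx p π ^ k * sy p π ^ 2) r + (-1) * (sx p π ^ k) r) = 0 := by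
    have hg : ∀ r, tx π (1 : ZMod p) ^ d * (sz e j r * w r ^ (k + 3) * κ r) ∈ V := fun r =>
      mul_mem (pow_mem htV d) (mul_mem (mul_mem (hz r).1 (pow_mem (hw r) _)) (hκV r))
    rw [ellz, ell_eq_sum E.t_ne_zero (fun r => mul_mem htV (hg r))]
    · refine Finset.sum_eq_zero fun r _ => ?_
      rw [res_mul htV (hg r), (res_eq_zero_iff htV).2 ht, zero_mul]
    · intro r
      simp only [Pi.mul_apply, Pi.pow_apply]
      have h5 : 1 * (sx p π r ^ k * sy p π r ^ 2) + -1 * sx p π r ^ k = sx p π r ^ (k + 3) * κ r := by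
        linear_combination sx p π r ^ k * hκ r
      rw [h5, h2, mul_pow, hd, pow_add (tx π (1 : ZMod p)),
        ← pow_sub_one_mul hp.ne_zero (tx π (1 : ZMod p))]
      ring
  rw [E.ellz_lin hV hT h1 hθ htV j (mul_mem (pow_mem hx k) (pow_mem hy 2)) (pow_mem hx k)
    (one_mem V) (neg_mem (one_mem V)), res_neg (one_mem V), res_one] at h4
  linear_combination h4

/-- The last nonzero residue of the recursion. -/
lemma two_mul_ellz (j : ZMod p) :
    2 * ellz V π e j (sx p π ^ (p - 3)) = -(E.toRes hV j * θ) ^ 2 := by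
  have hp : p.Prime := Fact.out
  have h3 : 3 < p := by
    have h2 := hp.two_le
    have := E.mod3
    by_contra! h
    interval_cases p <;> omega
  have hp0 := E.res_p_of_pi hV
  have e1 := E.ellz_pow hV hT h1 hθ j (p - 1)
  have e2 := E.ellz_pow hV hT h1 hθ j (p - 2)
  rw [show p - 1 - 1 = p - 2 by omega, E.ellz_pow_mul_sq_eq hV hT h1 hθ j (by omega),
    E.ellz_pow_pred hV hT h1 hθ] at e1
  rw [show p - 2 - 1 = p - 3 by omega, E.ellz_pow_mul_sq_eq hV hT h1 hθ j (by omega)] at e2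
  rw [Nat.cast_sub (by omega), hp0] at e1 e2
  push_cast at e1 e2
  linear_combination e2 + (E.toRes hV j * θ) * e1

omit hθ in
lemma ellz_sx {j : ZMod p} (hf : four e (tx π) j = -E.ysum * tx (conj π) j) :
    ellz V π e j (sx p π ^ 1) = res V (tx (conj π) j) := by
  obtain ⟨w, hw, h2, h3⟩ := E.exists_pi_eq hV hT h1
  have hx : tx (conj π) j ∈ V := E.conj_pi.tx_mem V j
  rw [ellz, ell_eq (w := -w * tx (conj π) j) E.t_ne_zero, res_mul (neg_mem hw) hx, res_neg hw, h3,
    neg_neg, one_mul]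
  have h4 := sum_range_natCast fun a : ZMod p => e (a * j) * tx π a
  rw [four] at hf
  rw [hf, E.ysum_eq hT h1] at h4
  rw [pow_one]
  refine h4.trans ?_
  nth_rw 1 [h2]
  ring

end EisPrime

end FermatCurve

namespace FermatCurve

open scoped Polynomial Nat

section recursion

variable {k : Type*} [Field k] {n : ℕ} (t : Fin n → k)

lemma exists_monic_of_recursion {v : ℕ → Fin n → k}
    (h : ∀ m, m + 1 < n → ∃ β δ : k, ∀ j, v (m + 1) j = (t j + β) * v m j + δ * v (m - 1) j)
    (m : ℕ) (hm : m < n) :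
    ∃ P : k[X], P.Monic ∧ P.natDegree = m ∧ ∀ j, v m j = v 0 j * P.eval (t j) := by
  induction m using Nat.strong_induction_on with
  | _ m ih =>
    rcases m with _ | m
    · exact ⟨1, Polynomial.monic_one, Polynomial.natDegree_one, fun j => by simp⟩
    obtain ⟨β, δ, hr⟩ := h m hm
    obtain ⟨P, hP, hPd, hPe⟩ := ih m (by omega) (by omega)
    obtain ⟨Q, hQ, hQd, hQe⟩ := ih (m - 1) (by omega) (by omega)
    have hX : (Polynomial.X + Polynomial.C β).Monic := Polynomial.monic_X_add_C β
    have hXP := hX.mul hP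
    have hdeg : ((Polynomial.X + Polynomial.C β) * P).natDegree = m + 1 := by
      rw [hX.natDegree_mul hP, Polynomial.natDegree_X_add_C, hPd, add_comm]
    have hlt : (Polynomial.C δ * Q).degree < ((Polynomial.X + Polynomial.C β) * P).degree := by
      rw [Polynomial.degree_eq_natDegree hXP.ne_zero, hdeg]
      refine (Polynomial.degree_le_natDegree.trans (Nat.cast_le.2
        (Polynomial.natDegree_C_mul_le δ Q))).trans_lt ?_
      rw [hQd]
      exact_mod_cast (by omega : m - 1 < m + 1)
    refine ⟨(Polynomial.X + Polynomial.C β) * P + Polynomial.C δ * Q, hXP.add_of_left hlt, ?_,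
      fun j => ?_⟩
    · rw [Polynomial.natDegree_add_eq_left_of_degree_lt hlt, hdeg]
    · rw [hr, hPe, hQe]
      simp
      ring

lemma det_of_recursion {v : ℕ → Fin n → k}
    (h : ∀ m, m + 1 < n → ∃ β δ : k, ∀ j, v (m + 1) j = (t j + β) * v m j + δ * v (m - 1) j) :
    (Matrix.of fun j m : Fin n => v m j).det = (∏ j, v 0 j) * (Matrix.vandermonde t).det := by
  choose P hP hPd hPe using fun m : Fin n => exists_monic_of_recursion t h m m.2
  rw [Matrix.det_eval_matrixOfPolynomials_eq_det_vandermonde t P hPd hP, ← Matrix.det_mul_column]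
  congr 1
  ext j m
  simp [hPe m j]

/-- Comparison of the first and last terms of a three-term recursion. -/
lemma prod_sq_of_recursion (hn : (3 * n + 1 : k) = 0) (ht : Function.Injective t)
    {v : ℕ → Fin n → k} {b : ℕ → k}
    (h : ∀ m j, (3 * m + 1) * (3 * m) * (3 * m - 1) * v (m - 1) j - b m * v m j +
      (3 * m + 1) * (3 * m + 2) * (3 * m + 3) * v (m + 1) j = -t j * v m j)
    (hv : ∀ j, v n j = 0) :
    (∏ j, v 0 j) ^ 2 * (∏ m ∈ Finset.range n, ((3 * m + 1) * (3 * m + 2) : k)) ^ 2 =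
      (∏ j, 2 * v (n - 1) j) ^ 2 := by
  have hf : ∀ i : ℕ, ((i + 3)! : k) = (i + 1) * (i + 2) * (i + 3) * (i ! : k) := fun i => by
    rw [Nat.factorial_succ, Nat.factorial_succ, Nat.factorial_succ]
    push_cast
    ring
  have e1 := det_of_recursion t (v := fun m j => (-1) ^ m * (3 * m)! * v m j) (fun m _ => by
    rcases m with _ | m
    · refine ⟨-b 0, 0, fun j => ?_⟩
      have h2 := h 0 j
      rw [show 3 * (0 + 1) = 0 + 3 by rfl, hf]
      push_cast at h2 ⊢
      simp only [Nat.factorial_zero, Nat.cast_one]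
      linear_combination -h2
    · refine ⟨-b (m + 1), -((3 * (m + 1) + 1) * (3 * (m + 1)) * (3 * (m + 1) - 1) *
        ((3 * m + 1) * (3 * m + 2) * (3 * m + 3))), fun j => ?_⟩
      have h2 := h (m + 1) j
      rw [Nat.add_sub_cancel] at h2 ⊢
      rw [show 3 * (m + 1 + 1) = 3 * m + 3 + 3 by ring, show 3 * (m + 1) = 3 * m + 3 by ring, hf, hf]
      push_cast at h2 ⊢
      linear_combination -(-1) ^ (m + 1) * (3 * m + 1) * (3 * m + 2) * (3 * m + 3) *
        ((3 * m)! : k) * h2)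
  have e2 := det_of_recursion t (v := fun m j => (3 * m + 2)! * v (n - 1 - m) j) (fun m hm => by
    obtain ⟨K, hK⟩ : ∃ K, n = K + 1 + m := ⟨n - 1 - m, by omega⟩
    have hKk : (3 * K : k) = -(3 * m + 4) := by
      rw [hK] at hn
      push_cast at hn
      linear_combination hn
    have i1 : n - 1 - m = K := by omega
    have i2 : n - 1 - (m + 1) = K - 1 := by omega
    rcases m with _ | m
    · refine ⟨-b K, 0, fun j => ?_⟩
      have h2 := h K j
      rw [i1, i2, show 3 * (0 + 1) + 2 = 2 + 3 by rfl, hf]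
      rw [show K + 1 = n by omega, hv, hKk] at h2
      push_cast at h2 ⊢
      simp only [mul_zero, zero_add, Nat.factorial_two] at h2 ⊢
      push_cast at h2 ⊢
      linear_combination -2 * h2
    · refine ⟨-b K, (3 * K + 1) * (3 * K + 2) * (3 * K + 3) *
        ((3 * m + 3) * (3 * m + 4) * (3 * m + 5)), fun j => ?_⟩
      have h2 := h K j
      rw [i1, i2, Nat.add_sub_cancel, show n - 1 - m = K + 1 by omega,
        show 3 * (m + 1 + 1) + 2 = 3 * m + 2 + 3 + 3 by ring,
        show 3 * (m + 1) + 2 = 3 * m + 2 + 3 by ring, hf, hf]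
      rw [hKk] at h2 ⊢
      push_cast at h2 ⊢
      linear_combination -(3 * m + 3) * (3 * m + 4) * (3 * m + 5) * ((3 * m + 2)! : k) * h2)
  have hΔ : (Matrix.vandermonde t).det ≠ 0 := Matrix.det_vandermonde_ne_zero_iff.2 ht
  set D := (Matrix.of fun j m : Fin n => v m j).det with hD
  have d1 := Matrix.det_mul_row (fun m : Fin n => (-1) ^ (m : ℕ) * ((3 * (m : ℕ))! : k))
    (Matrix.of fun j m : Fin n => v m j)
  have d2 := Matrix.det_mul_row (fun m : Fin n => ((3 * (m : ℕ) + 2)! : k))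
    (Matrix.of fun j m : Fin n => v (n - 1 - m) j)
  have d3 := Matrix.det_permute' Fin.revPerm (Matrix.of fun j m : Fin n => v m j)
  have d4 : (Matrix.of fun j m : Fin n => v m j).submatrix id Fin.revPerm =
      Matrix.of fun j m : Fin n => v (n - 1 - m) j := by
    ext j m
    simp [Fin.val_rev, Nat.sub_sub, add_comm]
  rw [d4] at d3
  have hs : (((Equiv.Perm.sign (Fin.revPerm (n := n)) : ℤˣ) : ℤ) : k) ^ 2 = 1 := by
    rw [← Int.cast_pow, ← Units.val_pow_eq_pow_val, Int.units_sq, Units.val_one, Int.cast_one]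
  have e1' := e1.symm.trans d1
  have e2' := e2.symm.trans d2
  rw [d3] at e2'
  simp only [pow_zero, mul_zero, zero_add, Nat.factorial_zero, Nat.factorial_two, Nat.cast_one,
    one_mul, tsub_zero, Nat.cast_ofNat] at e1' e2'
  rw [Finset.prod_mul_distrib] at e1'
  have hS : (∏ m : Fin n, (-1 : k) ^ (m : ℕ)) ^ 2 = 1 := by
    rw [← Finset.prod_pow]
    refine Finset.prod_eq_one fun m _ => ?_
    rw [← pow_mul, mul_comm, pow_mul, neg_one_sq, one_pow]
  have hG : ∏ m : Fin n, ((3 * (m : ℕ) + 2)! : k) = (∏ m : Fin n, ((3 * (m : ℕ))! : k)) *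
      ∏ m ∈ Finset.range n, ((3 * m + 1) * (3 * m + 2) : k) := by
    rw [Finset.prod_range, ← Finset.prod_mul_distrib]
    refine Finset.prod_congr rfl fun m _ => ?_
    rw [Nat.factorial_succ, Nat.factorial_succ]
    push_cast
    ring
  rw [hG] at e2'
  refine mul_right_cancel₀ (pow_ne_zero 2 hΔ) ?_
  rw [← hD] at e1' e2'
  rw [mul_right_comm, ← mul_pow, e1', ← mul_pow _ (Matrix.vandermonde t).det, e2']
  linear_combination ((∏ m : Fin n, ((3 * (m : ℕ))! : k)) * D *
    ∏ m ∈ Finset.range n, ((3 * m + 1) * (3 * m + 2) : k)) ^ 2 * (hS - hs)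

end recursion

end FermatCurve

namespace FermatCurve

open scoped ComplexConjugate Nat

namespace EisPrime

variable {p : ℕ} [Fact p.Prime] {π : ℂ} {ι : ℤ} (E : EisPrime p π ι)
include E

lemma prod_mul_factorial :
    (∏ m ∈ Finset.range ((p - 1) / 3), ((3 * m + 1) * (3 * m + 2) : ZMod p)) *
      (3 ^ ((p - 1) / 3) * ((p - 1) / 3)!) = -1 := by
  have hp : p.Prime := Fact.out
  have h3 : 3 * ((p - 1) / 3) = p - 1 := by
    have := E.mod3
    omega
  rw [← ZMod.wilsons_lemma p, ← h3, Nat.mul_div_cancel_left _ three_pos]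
  generalize (p - 1) / 3 = n
  induction n with
  | zero => simp
  | succ n ih =>
    rw [Finset.prod_range_succ, show 3 * (n + 1) = 3 * n + 1 + 1 + 1 by ring, Nat.factorial_succ,
      Nat.factorial_succ, Nat.factorial_succ, Nat.factorial_succ]
    push_cast
    rw [← ih]
    ring

variable {T : Finset (ZMod p)} (hT : ThirdSet (ι : ZMod p) T)
include hT

lemma eq_of_cube_eq {s s' : ZMod p} (hs : s ∈ T) (hs' : s' ∈ T) (h : s ^ 3 = s' ^ 3) : s = s' := by
  have h0 : (s - s') * ((s - ι * s') * (s - ι ^ 2 * s')) = 0 := by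
    linear_combination h + (-s ^ 2 * s' + s * s' ^ 2 * ι - s' ^ 3 * (ι - 1)) * E.iota_sq
  obtain ⟨d1, d2⟩ := hT.disj s' hs' s hs
  rcases mul_eq_zero.1 h0 with h0 | h0
  · exact sub_eq_zero.1 h0
  rcases mul_eq_zero.1 h0 with h0 | h0
  · exact absurd (sub_eq_zero.1 h0) d1
  · exact absurd (sub_eq_zero.1 h0) d2

lemma prod_thirdSet_cube : (∏ s ∈ T, s) ^ 3 = -1 := by
  have h := hT.prod_erase E.iota_cube (fun r : ZMod p => r)
  have h2 := FiniteField.prod_univ_units_id_eq_neg_one (K := ZMod p)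
  have h3 : ∏ r ∈ Finset.univ.erase (0 : ZMod p), r = -1 := by
    rw [← Units.val_one, ← Units.val_neg, ← h2, Units.coe_prod]
    exact (Finset.prod_bij (s := Finset.univ) (fun (u : (ZMod p)ˣ) _ => (u : ZMod p)) (fun u _ => by simp)
      (fun _ _ _ _ h => Units.ext h)
      (fun r hr => ⟨Units.mk0 r (Finset.ne_of_mem_erase hr), Finset.mem_univ _, rfl⟩)
      (fun _ _ => rfl)).symm
  rw [h3] at h
  rw [h, ← Finset.prod_pow]
  exact Finset.prod_congr rfl fun s _ => by
    linear_combination (-s ^ 3) * E.iota_cube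

variable {V : ValuationSubring ℂ} (hV : V.valuation π < 1) (h1 : ECong π 1 3)
variable {e : AddChar (ZMod p) ℂ} {θ : IsLocalRing.ResidueField V}
  (hθ : ∀ j : ZMod p, ∃ c ∈ V, e j = 1 + tx π (1 : ZMod p) * c ∧ res V c = E.toRes hV j * θ)
include hV h1 hθ

lemma prod_ellz_sq (hθ0 : θ ≠ 0) {n : ℕ} (hn : 3 * n + 1 = p) (hn0 : 0 < n) {s : Fin n → ZMod p}
    (hs : ∀ i, s i ∈ T) (hinj : Function.Injective s) :
    (∏ i, ellz V π e (s i) (sx p π ^ 1)) ^ 2 *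
        (∏ m ∈ Finset.range n, ((3 * m + 1) * (3 * m + 2) : IsLocalRing.ResidueField V)) ^ 2 =
      (∏ i, -(E.toRes hV (s i) * θ) ^ 2) ^ 2 := by
  have hn' : (3 * n + 1 : IsLocalRing.ResidueField V) = 0 := by
    have := E.res_p_of_pi hV
    rw [← hn] at this
    exact_mod_cast this
  have ht : Function.Injective fun i => (E.toRes hV (s i) * θ) ^ 3 := by
    intro i j hij
    simp only [mul_pow] at hij
    have h4 := mul_right_cancel₀ (pow_ne_zero 3 hθ0) hij
    rw [← map_pow, ← map_pow] at h4
    exact hinj (E.eq_of_cube_eq hT (hs i) (hs j) ((E.toRes hV).injective h4))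
  have hv : ∀ i, ellz V π e (s i) (sx p π ^ (3 * n + 1)) = 0 := fun i => by
    rw [hn]
    exact E.ellz_pow_prime hV hT h1 hθ _
  have key := prod_sq_of_recursion (n := n) (fun i => (E.toRes hV (s i) * θ) ^ 3) hn' ht
    (v := fun m i => ellz V π e (s i) (sx p π ^ (3 * m + 1)))
    (b := fun m => (3 * m + 1) * (3 * m) ^ 2 + (3 * m + 1) * (3 * m + 2) ^ 2)
    (fun m i => E.ellz_recursion hV hT h1 hθ (s i) m) hv
  have e1 : ∀ i, 2 * ellz V π e (s i) (sx p π ^ (3 * (n - 1) + 1)) =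
      -(E.toRes hV (s i) * θ) ^ 2 := fun i => by
    rw [show 3 * (n - 1) + 1 = p - 3 by omega]
    exact E.two_mul_ellz hV hT h1 hθ _
  rw [Finset.prod_congr rfl fun i _ => e1 i] at key
  exact key

/-- The residue of the square of `∏ x(s/π̄)`. -/
lemma res_prod_conj_sq (hθ0 : θ ≠ 0) (hf : ∀ j, four e (tx π) j = -E.ysum * tx (conj π) j) :
    (∏ s ∈ T, res V (tx (conj π) s)) ^ 2 =
      E.toRes hV (∏ s ∈ T, s) ^ 4 * θ ^ (4 * ((p - 1) / 3)) *
        E.toRes hV (3 ^ ((p - 1) / 3) * ((p - 1) / 3)!) ^ 2 := by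
  have hp : p.Prime := Fact.out
  have h0 : 0 < (p - 1) / 3 := (EisPrime.IsCubic.card_facts E).1
  have h3 : 3 * ((p - 1) / 3) + 1 = p := by
    have := (EisPrime.IsCubic.card_facts E).2
    have := hp.two_le
    omega
  have e4 := congrArg (E.toRes hV) E.prod_mul_factorial
  have hT' := hT.eq_card E.iota_cube
  generalize (p - 1) / 3 = n at *
  obtain ⟨s, hs, hinj, hprod⟩ : ∃ s : Fin n → ZMod p, (∀ i, s i ∈ T) ∧ Function.Injective s ∧
      ∀ f : ZMod p → IsLocalRing.ResidueField V, ∏ i, f (s i) = ∏ s ∈ T, f s := by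
    refine ⟨fun i => (T.equivFinOfCardEq hT').symm i, fun i => Subtype.prop _,
      fun i j h => (T.equivFinOfCardEq hT').symm.injective (Subtype.ext h), fun f => ?_⟩
    rw [← Finset.prod_coe_sort T f]
    exact Equiv.prod_comp (T.equivFinOfCardEq hT').symm (fun s : T => f s)
  have key := E.prod_ellz_sq hT hV h1 hθ hθ0 h3 h0 hs hinj
  rw [Finset.prod_congr rfl fun i _ => E.ellz_sx hV hT h1 (hf (s i)),
    hprod fun s => res V (tx (conj π) s), hprod fun s => -(E.toRes hV s * θ) ^ 2] at key
  have e3 : (∏ s ∈ T, -(E.toRes hV s * θ) ^ 2) ^ 2 =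
      E.toRes hV (∏ s ∈ T, s) ^ 4 * θ ^ (4 * n) := by
    rw [map_prod, ← Finset.prod_pow, ← Finset.prod_pow, mul_comm 4 n, pow_mul,
      ← hT', ← Finset.prod_const, ← Finset.prod_pow, ← Finset.prod_mul_distrib]
    exact Finset.prod_congr rfl fun s _ => by ring
  rw [map_mul, map_neg, map_one, map_prod] at e4
  have e5 : ∏ m ∈ Finset.range n, E.toRes hV ((3 * m + 1) * (3 * m + 2)) =
      ∏ m ∈ Finset.range n, ((3 * m + 1) * (3 * m + 2) : IsLocalRing.ResidueField V) :=
    Finset.prod_congr rfl fun m _ => by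
      simp only [map_mul, map_add, map_ofNat, map_natCast, map_one]
  rw [e5] at e4
  rw [e3] at key
  rw [← key, mul_assoc, ← mul_pow, e4]
  ring

end EisPrime

end FermatCurve

namespace FermatCurve

open scoped ComplexConjugate Polynomial Nat

lemma sum_pow_mul_descPochhammer {p : ℕ} [Fact p.Prime] {n : ℕ} (hn : 3 * n = p - 1) (hn0 : 0 < n)
    {k : ℕ} (hk : k ≤ n) :
    ∑ a : ZMod p, (a ^ n) ^ 2 * (descPochhammer (ZMod p) k).eval a = if k = n then -1 else 0 := by
  have hdeg := descPochhammer_natDegree (ZMod p) k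
  have hmonic := monic_descPochhammer (ZMod p) k
  split_ifs with h
  · subst h
    have h1 : ∑ a : ZMod p, (a ^ k) ^ 2 * (descPochhammer (ZMod p) k - Polynomial.X ^ k).eval a = 0 := by
      have h2 : ((Polynomial.X ^ k) ^ 2 * (descPochhammer (ZMod p) k - Polynomial.X ^ k) :
          (ZMod p)[X]).natDegree < p - 1 := by
        refine Polynomial.natDegree_mul_le.trans_lt ?_
        have h3 : (descPochhammer (ZMod p) k - Polynomial.X ^ k).natDegree < k := by
          rcases eq_or_ne (descPochhammer (ZMod p) k - Polynomial.X ^ k) 0 with h | h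
          · simpa [h] using hn0
          refine (Polynomial.natDegree_lt_iff_degree_lt h).2 ?_
          have h4 : (descPochhammer (ZMod p) k).degree = k := by
            rw [Polynomial.degree_eq_natDegree hmonic.ne_zero, hdeg]
          refine (Polynomial.degree_sub_lt_left ?_ hmonic.ne_zero ?_).trans_eq h4
          · rw [h4, Polynomial.degree_X_pow]
          · rw [hmonic.leadingCoeff, Polynomial.leadingCoeff_X_pow]
        rw [← pow_mul, Polynomial.natDegree_X_pow]
        omega
      simpa using sum_eval_eq_zero h2
    have h2 : ∑ a : ZMod p, (a ^ k) ^ 2 * a ^ k = -1 := by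
      have : ∀ a : ZMod p, (a ^ k) ^ 2 * a ^ k = a ^ (p - 1) := fun a => by
        rw [← hn]
        ring
      simp only [this, ZMod.pow_card_sub_one]
      rw [Finset.sum_ite, Finset.sum_const_zero, add_zero, Finset.sum_const, Finset.filter_ne',
        Finset.card_erase_of_mem (Finset.mem_univ _), Finset.card_univ, ZMod.card, nsmul_one,
        Nat.cast_sub (Fact.out : p.Prime).one_le]
      simp
    simp only [Polynomial.eval_sub, Polynomial.eval_pow, Polynomial.eval_X, mul_sub,
      Finset.sum_sub_distrib] at h1
    rw [← h2]
    exact sub_eq_zero.1 h1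
  · have h2 : ((Polynomial.X ^ n) ^ 2 * descPochhammer (ZMod p) k : (ZMod p)[X]).natDegree < p - 1 := by
      refine Polynomial.natDegree_mul_le.trans_lt ?_
      rw [← pow_mul, Polynomial.natDegree_X_pow, hdeg]
      omega
    simpa using sum_eval_eq_zero h2

namespace EisPrime

variable {p : ℕ} [Fact p.Prime] {π : ℂ} {ι : ℤ} (E : EisPrime p π ι)
variable {X : MulChar (ZMod p) ℂ} (hX : E.IsCubic X)
include hX

lemma sum_choose_mem (k : ℕ) : ∑ a : ZMod p, X⁻¹ a * (a.val.choose k : ℂ) ∈ O3 := by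
  rw [hX.inv_eq]
  refine sum_mem fun a _ => mul_mem ?_ (by exact_mod_cast int_mem_O3 (a.val.choose k : ℤ))
  rw [MulChar.pow_apply' _ two_ne_zero]
  exact pow_mem (hX.mem_O3 a) 2

lemma red_sum_choose {k : ℕ} (hk : k ≤ (p - 1) / 3) :
    (k ! : ZMod p) * E.red (∑ a : ZMod p, X⁻¹ a * (a.val.choose k : ℂ)) =
      if k = (p - 1) / 3 then -1 else 0 := by
  rw [← sum_pow_mul_descPochhammer (EisPrime.IsCubic.card_facts E).2
    (EisPrime.IsCubic.card_facts E).1 hk]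
  have hi : ∀ m : ℕ, (m : ℂ) ∈ O3 := fun m => by exact_mod_cast int_mem_O3 (m : ℤ)
  have hx : ∀ a, X⁻¹ a ∈ O3 := fun a => by
    rw [hX.inv_eq, MulChar.pow_apply' _ two_ne_zero]
    exact pow_mem (hX.mem_O3 a) 2
  rw [EisPrime.IsCubic.red_sum E _ fun a _ => mul_mem (hx a) (hi _), Finset.mul_sum]
  refine Finset.sum_congr rfl fun a _ => ?_
  have h1 : E.red ((a.val.choose k : ℕ) : ℂ) = (a.val.choose k : ZMod p) := by
    simpa using E.red_int (a.val.choose k : ℤ)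
  have h2 := descPochhammer_eval_eq_descFactorial (ZMod p) a.val k
  rw [ZMod.natCast_zmod_val, Nat.descFactorial_eq_factorial_mul_choose] at h2
  rw [E.red_mul (hx a) (hi _), h1, h2, hX.inv_eq, MulChar.pow_apply' _ two_ne_zero,
    E.red_pow (hX.mem_O3 a), hX.red_apply]
  push_cast
  ring

variable {T : Finset (ZMod p)} (hT : ThirdSet (ι : ZMod p) T)
variable {V : ValuationSubring ℂ} (hV : V.valuation π < 1) (h1 : ECong π 1 3)
variable {e : AddChar (ZMod p) ℂ} {θ : IsLocalRing.ResidueField V}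
  (hθ : ∀ j : ZMod p, ∃ c ∈ V, e j = 1 + tx π (1 : ZMod p) * c ∧ res V c = E.toRes hV j * θ)
include hT hV h1 hθ

lemma exists_gaussSum : ∃ w ∈ V, gaussSum X⁻¹ e = tx π (1 : ZMod p) ^ ((p - 1) / 3) * w ∧
    E.toRes hV (((p - 1) / 3)! : ZMod p) * res V w = -θ ^ ((p - 1) / 3) := by
  have hp : p.Prime := Fact.out
  obtain ⟨h0, h3⟩ := EisPrime.IsCubic.card_facts E
  have hred := fun k => E.red_sum_choose hX (k := k)
  have hmem := E.sum_choose_mem hX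
  obtain ⟨c, hc, h4, h5⟩ := hθ 1
  rw [map_one, one_mul] at h5
  obtain ⟨u, hu, h6, -⟩ := E.exists_pi_eq hV hT h1
  have ht := E.val_t hV hT h1
  have htV := mem_of_lt ht
  have ht0 := (res_eq_zero_iff htV).2 ht
  set S : ℕ → ℂ := fun k => ∑ a : ZMod p, X⁻¹ a * (a.val.choose k : ℂ) with hS
  have hg : gaussSum X⁻¹ e = ∑ k ∈ Finset.range p, (tx π (1 : ZMod p) * c) ^ k * S k := by
    have he : ∀ a : ZMod p, e a =
        ∑ k ∈ Finset.range p, (tx π (1 : ZMod p) * c) ^ k * (a.val.choose k : ℂ) := fun a => by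
      have : e a = e 1 ^ a.val := by
        rw [← AddChar.map_nsmul_eq_pow, nsmul_one, ZMod.natCast_zmod_val]
      rw [this, h4, add_comm, add_pow]
      have hlt := ZMod.val_lt a
      refine (Finset.sum_subset (Finset.range_mono (by omega)) fun k _ hk => ?_).trans
        (Finset.sum_congr rfl fun k _ => by rw [one_pow, mul_one])
      rw [Nat.choose_eq_zero_of_lt (by simpa using hk)]
      simp
    simp only [gaussSum, he, hS, Finset.mul_sum]
    rw [Finset.sum_comm]
    exact Finset.sum_congr rfl fun k _ => Finset.sum_congr rfl fun a _ => by ring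
  generalize (p - 1) / 3 = n at *
  have hterm : ∀ k, ∃ w ∈ V, (tx π (1 : ZMod p) * c) ^ k * S k = tx π (1 : ZMod p) ^ n * w ∧
      E.toRes hV (n ! : ZMod p) * res V w = if k = n then -θ ^ n else 0 := by
    intro k
    have hSV : S k ∈ V := O3_le (hmem k)
    have hcV := pow_mem hc k
    rcases lt_trichotomy k n with hk | hk | hk
    · have h7 := hred k hk.le
      rw [if_neg hk.ne] at h7
      have h8 : (k ! : ZMod p) ≠ 0 := fun h => by
        rw [ZMod.natCast_eq_zero_iff, hp.dvd_factorial] at h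
        omega
      obtain ⟨d, hd, h9⟩ := E.dvd_of_red (hmem k) ((mul_eq_zero.1 h7).resolve_left h8)
      have hdV : d ∈ V := O3_le hd
      have m1 := mul_mem (mul_mem (mul_mem (pow_mem htV (k + (2 * n - 1))) hcV) hu) hdV
      refine ⟨tx π (1 : ZMod p) * (tx π (1 : ZMod p) ^ (k + (2 * n - 1)) * c ^ k * u * d),
        mul_mem htV m1, ?_, ?_⟩
      · rw [mul_pow]
        rw [show S k = π * d from h9]
        nth_rw 2 [h6]
        obtain ⟨j, rfl⟩ : ∃ j, n = j + 1 := ⟨n - 1, by omega⟩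
        rw [← h3, show 2 * (j + 1) - 1 = 2 * j + 1 by omega]
        ring
      · rw [if_neg hk.ne, res_mul htV m1, ht0, zero_mul, mul_zero]
    · subst hk
      refine ⟨c ^ k * S k, mul_mem hcV hSV, by ring, ?_⟩
      have h7 := congrArg (E.toRes hV) (hred k le_rfl)
      rw [if_pos rfl, map_mul, map_neg, map_one, ← E.res_eq_toRes hV (hmem k)] at h7
      rw [if_pos rfl, res_mul hcV hSV, res_pow hc, h5]
      linear_combination θ ^ k * h7
    · have m1 := mul_mem (pow_mem htV (k - n - 1)) (mul_mem hcV hSV)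
      refine ⟨tx π (1 : ZMod p) * (tx π (1 : ZMod p) ^ (k - n - 1) * (c ^ k * S k)),
        mul_mem htV m1, ?_, ?_⟩
      · obtain ⟨j, rfl⟩ : ∃ j, k = n + (j + 1) := ⟨k - n - 1, by omega⟩
        rw [show n + (j + 1) - n - 1 = j by omega]
        ring
      · rw [if_neg hk.ne', res_mul htV m1, ht0, zero_mul, mul_zero]
  choose w hw h7 h8 using hterm
  refine ⟨∑ k ∈ Finset.range p, w k, sum_mem fun k _ => hw k, ?_, ?_⟩
  · rw [hg, Finset.mul_sum]
    exact Finset.sum_congr rfl fun k _ => h7 k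
  · rw [res_sum _ fun k _ => hw k, Finset.mul_sum, Finset.sum_congr rfl fun k _ => h8 k,
      Finset.sum_ite_eq', if_pos (Finset.mem_range.2 (by omega))]

end EisPrime

end FermatCurve

namespace FermatCurve

open scoped ComplexConjugate Nat

lemma eq_of_cube_of_res_eq {V : ValuationSubring ℂ} (h3 : (3 : IsLocalRing.ResidueField V) ≠ 0)
    {u w : ℂ} (hu : u ∈ V) (h : u ^ 3 = w ^ 3) (hw : w ∈ V) (hw0 : res V w ≠ 0)
    (h2 : res V u = res V w) : u = w := by
  have w0 : w ≠ 0 := by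
    rintro rfl
    exact hw0 res_zero
  have h4 : (u * w⁻¹) ^ 3 = 1 := by
    rw [mul_pow, h, ← mul_pow, mul_inv_cancel₀ w0, one_pow]
  have h5 : u * w⁻¹ = 1 := by
    refine eq_of_res_eq h3 h4 (one_pow 3) ?_
    rw [res_mul hu (inv_mem_of_res hw hw0), res_inv hw hw0, h2, mul_inv_cancel₀ hw0, res_one]
  field_simp at h5
  exact h5

namespace EisPrime

variable {p : ℕ} [Fact p.Prime] {π : ℂ} {ι : ℤ} (E : EisPrime p π ι)
variable {X : MulChar (ZMod p) ℂ} (hX : E.IsCubic X)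
variable {T : Finset (ZMod p)} (hT : ThirdSet (ι : ZMod p) T) (h1 : ECong π 1 3)
variable {γ : ℂ} (hγ : γ ^ 3 = 1) (hγT : E.red γ = -∏ s ∈ T, s)
include E hT h1 hγ hγT

omit E h1 hγT [Fact p.Prime] hT in
lemma conj_cube_root (π : ℂ) (T : Finset (ZMod p)) :
    conj (γ⁻¹ * ∏ s ∈ T, tx π s) = γ * ∏ s ∈ T, tx (conj π) s := by
  have h0 : γ ≠ 0 := by
    rintro rfl
    norm_num at hγ
  have h2 : γ⁻¹ = γ ^ 2 := by
    field_simp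
    rw [hγ]
  rw [map_mul, map_inv₀, conj_of_cube hγ, map_prod, ← h2, inv_inv]
  exact congrArg _ (Finset.prod_congr rfl fun s _ => (tx_conj π s).symm)

lemma exists_cube_root_eq {V : ValuationSubring ℂ} (hV : V.valuation π < 1) :
    ∃ w ∈ V, γ⁻¹ * ∏ s ∈ T, tx π s = tx π (1 : ZMod p) ^ ((p - 1) / 3) * w ∧ res V w = -1 := by
  have h2 : ∀ s : ZMod p, ∃ w ∈ V, tx π s = tx π (1 : ZMod p) * w ∧ res V w = E.toRes hV s := by
    intro s
    obtain ⟨w, hw, h3, h4⟩ := E.exists_dilation (E.val_t hV hT h1) s.val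
    rw [mul_one, ZMod.natCast_zmod_val] at h3
    refine ⟨w, hw, h3, ?_⟩
    rw [h4, ← map_natCast (E.toRes hV), ZMod.natCast_zmod_val]
  choose w hw h3 h4 using h2
  have h0 : γ ≠ 0 := by
    rintro rfl
    norm_num at hγ
  have h5 : γ⁻¹ = γ ^ 2 := by
    field_simp
    rw [hγ]
  have hγV := mem_of_cube (V := V) hγ
  have hPV : ∏ s ∈ T, w s ∈ V := prod_mem fun s _ => hw s
  refine ⟨γ ^ 2 * ∏ s ∈ T, w s, mul_mem (pow_mem hγV 2) hPV, ?_, ?_⟩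
  · rw [Finset.prod_congr rfl fun s _ => h3 s, Finset.prod_mul_distrib, Finset.prod_const,
      hT.eq_card E.iota_cube, h5]
    ring
  · rw [res_mul (pow_mem hγV 2) hPV, res_pow hγV, E.res_eq_toRes hV (mem_O3_of_cube hγ), hγT,
      res_prod _ fun s _ => hw s, Finset.prod_congr rfl fun s _ => h4 s, ← map_prod]
    have h6 := congrArg (E.toRes hV) (E.prod_thirdSet_cube hT)
    rw [map_pow, map_neg, map_one] at h6
    rw [map_neg]
    linear_combination h6

include hX

/-- The cubic Gauss sum in terms of the canonical cubic root of `π`. -/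
theorem gaussSum_eq {e : AddChar (ZMod p) ℂ} (he : e.IsPrimitive)
    (hf : ∀ j, four e (tx π) j = -E.ysum * tx (conj π) j) :
    gaussSum X⁻¹ e =
      -X 3 * (γ⁻¹ * ∏ s ∈ T, tx π s) * conj (γ⁻¹ * ∏ s ∈ T, tx π s) ^ 2 := by
  have hp : p.Prime := Fact.out
  obtain ⟨V, hV⟩ := E.exists_valuation_pi
  obtain ⟨θ, hθC, hθ⟩ := E.exists_theta hV hT h1 he
  obtain ⟨h0, h3⟩ := EisPrime.IsCubic.card_facts E
  have hC0 := E.res_conj_pi_ne_zero hV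
  have hθ0 : θ ≠ 0 := by
    rintro rfl
    rw [zero_pow (by omega)] at hθC
    exact hC0 hθC.symm
  obtain ⟨w, hw, hgw, hw2⟩ := E.exists_gaussSum hX hT hV h1 hθ
  obtain ⟨v, hv, hPv, hv2⟩ := E.exists_cube_root_eq hT h1 hγ hγT hV
  have hconj := E.res_prod_conj_sq hT hV h1 hθ hθ0 hf
  have hg3 := hX.gaussSum_cube h1 he
  have hP3 := E.cube_root_cube hT hγ h1
  have hQ3 := congrArg conj hP3
  rw [map_pow] at hQ3
  have hX3 := hX.cube 3 E.three_ne_zero'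
  have hXr := E.res_eq_toRes hV (mem_O3_of_cube hX3)
  rw [hX.red 3 E.three_ne_zero', map_pow, map_ofNat (E.toRes hV)] at hXr
  have hN : (((p - 1) / 3)! : ZMod p) ≠ 0 := fun h => by
    rw [ZMod.natCast_eq_zero_iff, hp.dvd_factorial] at h
    have := hp.two_le
    omega
  rw [← h3] at hθC
  have ht0 : tx π (1 : ZMod p) ≠ 0 := E.t_ne_zero
  have hγV := mem_of_cube (V := V) hγ
  have hγr := E.res_eq_toRes hV (mem_O3_of_cube hγ)
  have hXV := mem_of_cube (V := V) hX3
  have hxV : ∏ s ∈ T, tx (conj π) s ∈ V := prod_mem fun s _ => E.conj_pi.tx_mem V s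
  have hxr := res_prod T fun s _ => E.conj_pi.tx_mem V s
  have hR := congrArg (E.toRes hV) (E.prod_thirdSet_cube hT)
  rw [map_pow, map_neg, map_one] at hR
  rw [hγT, map_neg] at hγr
  rw [map_mul, map_pow, map_ofNat (E.toRes hV)] at hconj
  rw [← hxr] at hconj
  have hPc := conj_cube_root hγ π T
  set P := γ⁻¹ * ∏ s ∈ T, tx π s with hP
  set R := E.toRes hV (∏ s ∈ T, s)
  set t := tx π (1 : ZMod p) with ht
  have hN' := (map_ne_zero (E.toRes hV)).2 hN
  set N := E.toRes hV (((p - 1) / 3)! : ZMod p)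
  generalize (p - 1) / 3 = n at *
  have hQV : conj P ∈ V := hPc ▸ mul_mem hγV hxV
  have hQ : res V (conj P) ^ 2 = θ ^ (4 * n) * (3 ^ n * N) ^ 2 := by
    rw [hPc, res_mul hγV hxV, mul_pow, hconj, hγr]
    linear_combination (θ ^ (4 * n) * (3 ^ n * N) ^ 2) * (R ^ 3 - 1) * hR
  have h3n : ((3 : IsLocalRing.ResidueField V) ^ n) ^ 3 = 1 := by
    rw [← hXr, ← res_pow hXV, hX3, res_one]
  have htn : t ^ n ≠ 0 := pow_ne_zero n ht0
  have hCV : conj π ∈ V := O3_le (conj_mem_O3 E.mem)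
  have e1 : w ^ 3 = -v ^ 3 * conj π ^ 2 := by
    refine mul_left_cancel₀ (pow_ne_zero 3 htn) ?_
    rw [← mul_pow, ← hgw, hg3, ← hP3, hPv]
    ring
  have e2 : res V w ^ 3 = θ ^ (6 * n) := by
    rw [← res_pow hw, e1, res_mul (neg_mem (pow_mem hv 3)) (pow_mem hCV 2), res_neg (pow_mem hv 3),
      res_pow hv, res_pow hCV, ← hθC, hv2]
    ring
  have e3 : N ^ 3 * θ ^ (3 * n) = -1 := by
    refine mul_right_cancel₀ (pow_ne_zero (3 * n) hθ0) ?_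
    have h4 := congrArg (· ^ 3) hw2
    simp only [mul_pow, e2] at h4
    linear_combination h4
  set k := -X 3 * v * conj P ^ 2 with hk
  have hkV : k ∈ V := mul_mem (mul_mem (neg_mem hXV) hv) (pow_mem hQV 2)
  have hkr : res V k = θ ^ (4 * n) * N ^ 2 := by
    rw [hk, res_mul (mul_mem (neg_mem hXV) hv) (pow_mem hQV 2), res_mul (neg_mem hXV) hv,
      res_neg hXV, res_pow hQV, hQ, hXr, hv2]
    linear_combination (θ ^ (4 * n) * N ^ 2) * h3n
  have hwk : w = k := by
    refine eq_of_cube_of_res_eq (E.three_ne_zero_res hV) hw ?_ hkV ?_ ?_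
    · rw [e1, hk, mul_pow, mul_pow, ← pow_mul, mul_comm 2 3, pow_mul, hQ3]
      linear_combination (v ^ 3 * conj π ^ 2) * hX3
    · rw [hkr]
      exact mul_ne_zero (pow_ne_zero _ hθ0) (pow_ne_zero _ hN')
    · refine mul_left_cancel₀ hN' ?_
      rw [hw2, hkr]
      linear_combination (-θ ^ n) * e3
  rw [hgw, hwk, hk]
  linear_combination (X 3 * conj P ^ 2) * hPv

end EisPrime

end FermatCurve

namespace FermatCurve

open scoped ComplexConjugate

lemma gaussSum_mul_sum {p : ℕ} [Fact p.Prime] {X : MulChar (ZMod p) ℂ} (hX : X⁻¹ ≠ 1)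
    (e : AddChar (ZMod p) ℂ) (f : ZMod p → ℂ) :
    gaussSum X⁻¹ e * ∑ r, X r * f r = ∑ j, X⁻¹ j * four e f j := by
  have h : ∀ r, ∑ j, X⁻¹ j * e (r * j) = gaussSum X⁻¹ e * X r := by
    intro r
    rcases eq_or_ne r 0 with rfl | hr
    · simp only [zero_mul, AddChar.map_zero_eq_one, mul_one, MulChar.map_zero, mul_zero]
      exact MulChar.sum_eq_zero_of_ne_one hX
    · have h2 := gaussSum_mulShift X⁻¹ e (Units.mk0 r hr)
      have h3 : X⁻¹ r * X r = 1 := by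
        rw [← MulChar.mul_apply, inv_mul_cancel, MulChar.one_apply (isUnit_iff_ne_zero.2 hr)]
      have h4 : gaussSum X⁻¹ (e.mulShift r) = ∑ j, X⁻¹ j * e (r * j) := by
        simp [gaussSum, AddChar.mulShift_apply]
      rw [← h4, ← h2, Units.val_mk0]
      linear_combination (-gaussSum X⁻¹ (e.mulShift r)) * h3
  simp only [four, Finset.mul_sum]
  rw [Finset.sum_comm]
  refine Finset.sum_congr rfl fun r _ => ?_
  have h5 := congrArg (· * f r) (h r)
  simp only [Finset.sum_mul] at h5
  rw [← mul_assoc, ← h5]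
  exact Finset.sum_congr rfl fun j _ => by ring

namespace EisPrime

variable {p : ℕ} [Fact p.Prime] {π : ℂ} {ι : ℤ} (E : EisPrime p π ι)
variable {X : MulChar (ZMod p) ℂ} (hX : E.IsCubic X)
variable {T : Finset (ZMod p)} (hT : ThirdSet (ι : ZMod p) T) (h1 : ECong π 1 3)
variable {γ : ℂ} (hγ : γ ^ 3 = 1) (hγT : E.red γ = -∏ s ∈ T, s)
variable {d : ℂ}
include E hX

lemma inv_ne_one : X⁻¹ ≠ 1 := fun h => hX.ne_one (inv_eq_one.1 h)

lemma conj_sum (f : ZMod p → ℂ) : conj (∑ r, X r * f r) = ∑ r, X⁻¹ r * conj (f r) := by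
  rw [map_sum]
  exact Finset.sum_congr rfl fun r _ => by rw [map_mul, hX.conj_apply]

lemma sum_neg (f : ZMod p → ℂ) : ∑ r, X⁻¹ r * f (-r) = ∑ r, X⁻¹ r * f r := by
  rw [← Equiv.sum_comp (Equiv.neg _)]
  refine Finset.sum_congr rfl fun r _ => ?_
  rw [Equiv.neg_apply, neg_neg, hX.inv_eq, MulChar.pow_apply' _ two_ne_zero,
    MulChar.pow_apply' _ two_ne_zero, hX.map_neg]

include hT h1 hγ hγT

lemma cancel {u v : ℂ} {e : AddChar (ZMod p) ℂ} (he : e.IsPrimitive)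
    (hf : ∀ j, four e (tx π) j = -E.ysum * tx (conj π) j) {f : ZMod p → ℂ}
    (hd : ∑ r, X r * f r = 3 * d * (γ⁻¹ * ∏ s ∈ T, tx π s) ^ 2)
    (h : gaussSum X⁻¹ e * (u * ∑ r, X r * f r) = -π * (v * conj (∑ r, X r * f r))) :
    X 3 * (u * d) = v * conj d := by
  rw [E.gaussSum_eq hX hT h1 hγ hγT he hf, hd] at h
  have hP3 := E.cube_root_cube hT hγ h1
  set P := γ⁻¹ * ∏ s ∈ T, tx π s
  have hP0 : P ≠ 0 := fun h => E.ne_zero (by rw [← hP3, h, zero_pow three_ne_zero])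
  have hc0 : conj P ≠ 0 := (map_ne_zero _).2 hP0
  have hc : conj (3 * d * P ^ 2) = 3 * conj d * conj P ^ 2 := by
    rw [_root_.map_mul, _root_.map_mul, _root_.map_pow, _root_.map_ofNat conj]
  rw [hc] at h
  have h0 : 3 * P ^ 3 * conj P ^ 2 ≠ 0 :=
    mul_ne_zero (mul_ne_zero three_ne_zero (pow_ne_zero 3 hP0)) (pow_ne_zero 2 hc0)
  refine mul_left_cancel₀ h0 ?_
  linear_combination -h - (3 * conj P ^ 2 * v * conj d) * hP3

lemma conj_coeff_x (hd : ∑ r, X r * tx π r = 3 * d * (γ⁻¹ * ∏ s ∈ T, tx π s) ^ 2) :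
    conj d = X 3 * d := by
  obtain ⟨e, he, hF⟩ := E.exists_fourier
  have h := E.cancel hX hT h1 hγ hγT he (fun j => (hF j).1) hd (u := 1) (v := 1) (by
    rw [one_mul, one_mul, gaussSum_mul_sum (E.inv_ne_one hX), E.conj_sum hX, Finset.mul_sum]
    refine Finset.sum_congr rfl fun j _ => ?_
    rw [(hF j).1, E.ysum_eq hT h1, tx_conj]
    ring)
  linear_combination -h

lemma conj_coeff_y (hd : ∑ r, X r * ty π r = 3 * d * (γ⁻¹ * ∏ s ∈ T, tx π s) ^ 2) :
    conj d = -(X 3 * d) := by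
  obtain ⟨e, he, hF⟩ := E.exists_fourier
  have h := E.cancel hX hT h1 hγ hγT he (fun j => (hF j).1) hd (u := 1) (v := -1) (by
    rw [one_mul, gaussSum_mul_sum (E.inv_ne_one hX), E.conj_sum hX,
      ← E.sum_neg hX (fun r => conj (ty π r)), Finset.mul_sum, Finset.mul_sum]
    refine Finset.sum_congr rfl fun j _ => ?_
    rw [(hF j).2.1, E.ysum_eq hT h1, ty_conj]
    ring)
  linear_combination h

omit hX hT h1 hγ hγT in
lemma dual_identity (j : ZMod p) (hj : j ≠ 0) :
    tx π j * tx π (-j) = (1 - ty π (((ι : ZMod p) - (ι : ZMod p) ^ 2) * j)) *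
      (tx π (((ι : ZMod p) - (ι : ZMod p) ^ 2) * j))⁻¹ := by
  have hx := E.seq.x_ne _ (mul_ne_zero E.q_ne_zero hj)
  have hy := E.seq.y_ne j
  have hx0 := E.seq.x_ne j hj
  obtain ⟨e1, e2⟩ := E.mul_q j
  rw [E.seq.x_neg, ← div_eq_mul_inv, eq_div_iff hx]
  have hq : (ρ3 - ρ3 ^ 2) ≠ 0 := by
    have h2 : (ρ3 - ρ3 ^ 2) ^ 2 = -3 := by
      linear_combination (ρ3 ^ 2 - 3 * ρ3 + 3) * rho_sq
    intro h
    rw [h] at h2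
    norm_num at h2
  have h3 : 1 + ρ3 ^ 2 * tx π j ^ 3 ≠ 0 := by
    intro h
    rw [h, mul_zero] at e1
    exact mul_ne_zero hq (mul_ne_zero hx0 hy) e1.symm
  refine mul_right_cancel₀ h3 ?_
  have h4 : tx π j * -(tx π j / ty π j) * (tx π j * ty π j) = -tx π j ^ 3 := by
    field_simp
  linear_combination (tx π j * -(tx π j / ty π j)) * e1 + e2 + (ρ3 - ρ3 ^ 2) * h4

omit hT h1 hγ hγT in
lemma apply_q : X ((ι : ZMod p) - (ι : ZMod p) ^ 2) = X 3 ^ 2 := by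
  have h2 := hX.cube _ E.q_ne_zero
  have h4 : X ((ι : ZMod p) - (ι : ZMod p) ^ 2) ^ 2 = X 3 := by
    rw [← map_pow, E.q_sq, hX.map_neg]
  rw [← h4]
  linear_combination (-X ((ι : ZMod p) - (ι : ZMod p) ^ 2)) * h2

omit hT h1 hγ hγT in
lemma sum_y_div_x : ∑ r, X r * (ty π r / tx π r) = -∑ r, X r * (tx π r)⁻¹ := by
  rw [← Finset.sum_neg_distrib, ← Equiv.sum_comp (Equiv.neg _)]
  refine Finset.sum_congr rfl fun r _ => ?_
  rw [Equiv.neg_apply, hX.map_neg]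
  rcases eq_or_ne r 0 with rfl | hr
  · rw [MulChar.map_zero, zero_mul, zero_mul, neg_zero]
  have h2 := E.seq.x_ne r hr
  have h4 := E.seq.y_mul_neg r
  have hy := E.seq.y_ne r
  rw [E.seq.x_neg]
  field_simp
  linear_combination (-X r) * h4

lemma conj_coeff_inv (hd : ∑ r, X r * (tx π r)⁻¹ = 3 * d * (γ⁻¹ * ∏ s ∈ T, tx π s) ^ 2) :
    d = X 3 * conj d := by
  obtain ⟨e, he, hF⟩ := E.exists_fourier
  have hX3 := hX.cube 3 E.three_ne_zero'
  have hq := E.conj_pi.q_ne_zero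
  have hXq : X (((ι ^ 2 : ℤ) : ZMod p) - ((ι ^ 2 : ℤ) : ZMod p) ^ 2) = X 3 ^ 2 := by
    rw [← E.apply_q hX, ← hX.map_neg]
    congr 1
    push_cast
    linear_combination (ι : ZMod p) * E.iota_cube
  have h := E.cancel hX hT h1 hγ hγT he (fun j => (hF j).1) hd (u := 2) (v := 2 * X 3 ^ 2) (by
    have hd1 := E.sum_y_div_x hX
    have hd2 := congrArg conj hd1
    rw [_root_.map_neg, E.conj_sum hX, E.conj_sum hX] at hd2
    have h3 : gaussSum X⁻¹ e * (2 * ∑ r, X r * (ty π r / tx π r)) =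
        π * ∑ j, X⁻¹ j * (tx (conj π) j * tx (conj π) (-j)) := by
      rw [mul_left_comm, gaussSum_mul_sum (E.inv_ne_one hX), two_mul]
      nth_rw 2 [← E.sum_neg hX]
      rw [← Finset.sum_add_distrib, Finset.mul_sum]
      refine Finset.sum_congr rfl fun j _ => ?_
      rw [← mul_add, (hF j).2.2, E.ysum_eq hT h1]
      ring
    have h4 : ∑ j, X⁻¹ j * (tx (conj π) j * tx (conj π) (-j)) =
        X 3 ^ 2 * ∑ j, X⁻¹ j * ((1 - ty (conj π) j) * (tx (conj π) j)⁻¹) := by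
      rw [← hXq, ← sum_mul_dilate X⁻¹ (fun j => (1 - ty (conj π) j) * (tx (conj π) j)⁻¹) hq,
        ← mul_assoc, ← MulChar.mul_apply, mul_inv_cancel,
        MulChar.one_apply (isUnit_iff_ne_zero.2 hq), one_mul]
      refine Finset.sum_congr rfl fun j _ => ?_
      rcases eq_or_ne j 0 with rfl | hj
      · rw [MulChar.map_zero, zero_mul, zero_mul]
      · rw [E.conj_pi.dual_identity j hj]
    have h5 : ∑ j, X⁻¹ j * ((1 - ty (conj π) j) * (tx (conj π) j)⁻¹) =
        2 * conj (∑ r, X r * (tx π r)⁻¹) := by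
      rw [E.conj_sum hX, two_mul]
      nth_rw 2 [← neg_neg (∑ r, X⁻¹ r * conj (tx π r)⁻¹)]
      rw [← hd2, ← sub_eq_add_neg, ← Finset.sum_sub_distrib]
      refine Finset.sum_congr rfl fun j _ => ?_
      rw [tx_conj, ty_conj, map_inv₀, map_div₀]
      ring
    rw [h4, h5, hd1] at h3
    linear_combination -h3)
  linear_combination (X 3 ^ 2 / 2) * h - (d - X 3 * conj d) * hX3

end EisPrime

end FermatCurve

namespace FermatCurve

open scoped ComplexConjugate

lemma one_add_two_rho_sq : (1 + 2 * ρ3) ^ 2 = -3 := by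
  linear_combination 4 * rho_sq

lemma one_add_two_rho_ne_zero : 1 + 2 * ρ3 ≠ 0 := fun h => by
  have := one_add_two_rho_sq
  rw [h] at this
  norm_num at this

lemma exists_int_of_conj_eq {z : ℂ} (hz : z ∈ O3) (h : conj z = z) : ∃ a : ℤ, z = a := by
  obtain ⟨m, n, rfl⟩ := mem_O3_iff.1 hz
  rw [map_add, map_mul, map_intCast, map_intCast, conj_rho] at h
  have h2 : (n : ℂ) * (1 + 2 * ρ3) = 0 := by linear_combination -h
  refine ⟨m, ?_⟩
  rw [(mul_eq_zero.1 h2).resolve_right one_add_two_rho_ne_zero]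
  ring

lemma exists_int_of_conj_eq_neg {z : ℂ} (hz : z ∈ O3) (h : conj z = -z) :
    ∃ a : ℤ, z = a * sqrtm3 := by
  obtain ⟨m, n, rfl⟩ := mem_O3_iff.1 hz
  rw [map_add, map_mul, map_intCast, map_intCast, conj_rho] at h
  have h2 : (m : ℂ) + n * ρ3 = m * (1 + 2 * ρ3) := by linear_combination -ρ3 * h
  have h4 : sqrtm3 ^ 2 = -3 := by
    rw [sqrtm3, mul_pow, Complex.I_sq, ← Complex.ofReal_pow, Real.sq_sqrt (by norm_num)]
    norm_num
  rw [← one_add_two_rho_sq] at h4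
  rw [h2]
  rcases sq_eq_sq_iff_eq_or_eq_neg.1 h4 with h5 | h5
  · exact ⟨m, by rw [h5]⟩
  · refine ⟨-m, ?_⟩
    rw [h5]
    push_cast
    ring

lemma three_dvd_of_res_eq_zero {V : ValuationSubring ℂ} (h3 : V.valuation 3 < 1) {b : ℤ}
    (h : (b : IsLocalRing.ResidueField V) = 0) : 3 ∣ b := by
  have h0 := EisPrime.res_three h3
  by_contra hb
  rcases (by omega : b % 3 = 1 ∨ b % 3 = 2) with hb | hb
  · obtain ⟨c, rfl⟩ : ∃ c, b = 3 * c + 1 := ⟨b / 3, by omega⟩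
    push_cast at h
    rw [h0] at h
    simp at h
  · obtain ⟨c, rfl⟩ : ∃ c, b = 3 * c - 1 := ⟨b / 3 + 1, by omega⟩
    push_cast at h
    rw [h0] at h
    simp at h

namespace EisPrime

variable {p : ℕ} [Fact p.Prime] {π : ℂ} {ι : ℤ} (E : EisPrime p π ι)
variable {X : MulChar (ZMod p) ℂ} (hX : E.IsCubic X)
variable {T : Finset (ZMod p)} (hT : ThirdSet (ι : ZMod p) T) (h1 : ECong π 1 3)
variable {γ : ℂ} (hγ : γ ^ 3 = 1) (hγT : E.red γ = -∏ s ∈ T, s)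
include E hX

lemma apply_iota : X ι = ρ3 ^ ((p - 1) / 3) := by
  have hι : (ι : ZMod p) ≠ 0 := fun h => by
    have := E.iota_cube
    rw [h] at this
    norm_num at this
  refine E.eq_of_red_eq (hX.cube _ hι) ?_ ?_
  · rw [← pow_mul, mul_comm, pow_mul, rho_pow_three, one_pow]
  · rw [hX.red _ hι, E.red_pow rho_mem, E.red_rho]

include hT hγ

lemma res_coeff_of_three {V : ValuationSubring ℂ} (h3 : V.valuation 3 < 1) {f : ZMod p → ℂ}
    (hf : ∀ a, a ≠ 0 → f a ∈ V ∧ res V (f a) = -1) {d : ℂ} (hd : d ∈ O3)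
    (h : ∑ s ∈ T, X s * f s = d * (γ⁻¹ * ∏ s ∈ T, tx π s) ^ 2) :
    res V d = -((p - 1) / 3 : ℕ) := by
  have hγ' : γ⁻¹ ^ 3 = 1 := by rw [inv_pow, hγ, inv_one]
  have hγV := mem_of_cube (V := V) hγ'
  have hxV : ∏ s ∈ T, tx π s ∈ V := prod_mem fun s _ => E.tx_mem V s
  have hP : res V (γ⁻¹ * ∏ s ∈ T, tx π s) = 1 := by
    rw [res_mul hγV hxV, res_cube_of_three h3 hγ', one_mul, res_prod T fun s _ => E.tx_mem V s,
      Finset.prod_congr rfl fun s hs => E.res_tx_of_three h3 (hT.ne s hs), Finset.prod_const,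
      (E.card_even hT).neg_one_pow]
  have hXV : ∀ s ∈ T, X s ∈ V := fun s hs => mem_of_cube (hX.cube s (hT.ne s hs))
  have h2 := congrArg (res V) h
  rw [res_mul (O3_le hd) (pow_mem (mul_mem hγV hxV) 2), res_pow (mul_mem hγV hxV), hP, one_pow,
    mul_one, res_sum T fun s hs => mul_mem (hXV s hs) (hf s (hT.ne s hs)).1] at h2
  rw [← h2, Finset.sum_congr rfl fun s hs => by
    rw [res_mul (hXV s hs) (hf s (hT.ne s hs)).1, (hf s (hT.ne s hs)).2,
      res_cube_of_three h3 (hX.cube s (hT.ne s hs)), one_mul]]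
  rw [Finset.sum_const, hT.eq_card E.iota_cube]
  simp

omit E hX hT hγ in
lemma res_int_of_three {V : ValuationSubring ℂ} (h3 : V.valuation 3 < 1) {u d : ℂ} {a : ℤ}
    (hu : u ^ 3 = 1) (hd : d ∈ O3) (h : d * u = a) : (a : IsLocalRing.ResidueField V) = res V d := by
  rw [← res_intCast, ← h, res_mul (O3_le hd) (mem_of_cube hu), res_cube_of_three h3 hu, mul_one]

include h1 hγT

/-- The elliptic Gauss sum of `φ` for `p ≡ 7 (mod 18)`. -/
theorem exists_coeff_x (hp : p % 18 = 7) : ∃ a : ℤ,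
    ∑ r, X r * tx π r = 3 * (X 3 * a) * (γ⁻¹ * ∏ s ∈ T, tx π s) ^ 2 ∧ (3 : ℤ) ∣ a - 1 := by
  have hX3 := hX.cube 3 E.three_ne_zero'
  obtain ⟨d, hd, hd1, hd2⟩ := E.exists_coeff (f := tx π) hT hX hγ h1 E.Lx (fun r => rfl)
    (fun σ k _ hx _ j => hx j) (fun a => by
      rw [map_mul, E.apply_iota hX, E.seq.x_iota]
      obtain ⟨m, hm⟩ : ∃ m, (p - 1) / 3 = 3 * m + 2 := ⟨(p - 1) / 9, by omega⟩
      rw [hm, pow_add, pow_mul, rho_pow_three, one_pow]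
      linear_combination (X a * tx π a) * rho_pow_three)
    (fun V a _ => mul_mem (E.tx_mem V a) (E.tx_mem V a))
  have hc := E.conj_coeff_x hX hT h1 hγ hγT hd1
  obtain ⟨a, ha⟩ := exists_int_of_conj_eq (z := d * X 3 ^ 2)
    (mul_mem hd (pow_mem (hX.mem_O3 3) 2)) (by
      rw [_root_.map_mul, _root_.map_pow, hc, conj_of_cube hX3]
      linear_combination (X 3 ^ 2 * d) * hX3)
  refine ⟨a, ?_, ?_⟩
  · rw [hd1, ← ha]
    linear_combination (-3 * d * (γ⁻¹ * ∏ s ∈ T, tx π s) ^ 2) * hX3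
  · obtain ⟨V, h3⟩ := exists_valuation_three
    have hr := res_int_of_three h3 (u := X 3 ^ 2)
      (by rw [← pow_mul, mul_comm, pow_mul, hX3, one_pow]) hd ha
    rw [E.res_coeff_of_three hX hT hγ h3
      (fun a ha => ⟨E.tx_mem V a, E.res_tx_of_three h3 ha⟩) hd hd2] at hr
    refine three_dvd_of_res_eq_zero h3 ?_
    obtain ⟨m, hm⟩ : ∃ m, (p - 1) / 3 = 3 * m + 2 := ⟨(p - 1) / 9, by omega⟩
    rw [hm] at hr
    push_cast at hr ⊢
    linear_combination hr - (m + 1) * res_three h3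

/-- The elliptic Gauss sum of `φ⁻¹` for `p ≡ 13 (mod 18)`. -/
theorem exists_coeff_inv (hp : p % 18 = 13) : ∃ a : ℤ,
    ∑ r, X r * (tx π r)⁻¹ = 3 * (conj (X 3) * a) * (γ⁻¹ * ∏ s ∈ T, tx π s) ^ 2 ∧
      (3 : ℤ) ∣ a + 1 := by
  have hX3 := hX.cube 3 E.three_ne_zero'
  have hx0 : ∀ a, a ≠ 0 → tx π a ≠ 0 := E.seq.x_ne
  obtain ⟨d, hd, hd1, hd2⟩ := E.exists_coeff (f := fun r => (tx π r)⁻¹) hT hX hγ h1 (fun r => (E.Lx r)⁻¹) (fun r => rfl)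
    (fun σ k _ hx _ j => by rw [map_inv₀, hx]) (fun a => by
      rw [map_mul, E.apply_iota hX, E.seq.x_iota]
      obtain ⟨m, hm⟩ : ∃ m, (p - 1) / 3 = 3 * m + 1 := ⟨(p - 1) / 9, by omega⟩
      rw [hm, pow_add, pow_mul, rho_pow_three, one_pow, mul_inv]
      linear_combination (X a * (tx π a)⁻¹) * mul_inv_cancel₀ rho_ne_zero)
    (fun V a ha => by
      rw [mul_inv_cancel₀ (hx0 a ha)]
      exact one_mem V)
  have hc := E.conj_coeff_inv hX hT h1 hγ hγT hd1
  obtain ⟨a, ha⟩ := exists_int_of_conj_eq (z := d * X 3)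
    (mul_mem hd (hX.mem_O3 3)) (by
      rw [_root_.map_mul, conj_of_cube hX3]
      linear_combination (-X 3) * hc)
  refine ⟨a, ?_, ?_⟩
  · rw [hd1, ← ha, conj_of_cube hX3]
    linear_combination (-3 * d * (γ⁻¹ * ∏ s ∈ T, tx π s) ^ 2) * hX3
  · obtain ⟨V, h3⟩ := exists_valuation_three
    have hr := res_int_of_three h3 (u := X 3) hX3 hd ha
    rw [E.res_coeff_of_three hX hT hγ h3 (fun a ha => by
      have h5 : res V (tx π a) ≠ 0 := by
        rw [E.res_tx_of_three h3 ha]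
        exact neg_ne_zero.2 one_ne_zero
      exact ⟨inv_mem_of_res (E.tx_mem V a) h5, by
        rw [res_inv (E.tx_mem V a) h5, E.res_tx_of_three h3 ha, inv_neg, inv_one]⟩) hd hd2] at hr
    refine three_dvd_of_res_eq_zero h3 ?_
    obtain ⟨m, hm⟩ : ∃ m, (p - 1) / 3 = 3 * m + 1 := ⟨(p - 1) / 9, by omega⟩
    rw [hm] at hr
    push_cast at hr ⊢
    linear_combination hr - m * res_three h3

/-- The elliptic Gauss sum of `ψ` for `p ≡ 1 (mod 18)`. -/
theorem exists_coeff_y (hp : p % 18 = 1) : ∃ a : ℤ,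
    ∑ r, X r * ty π r = 3 * (X 3 * a * sqrtm3) * (γ⁻¹ * ∏ s ∈ T, tx π s) ^ 2 := by
  have hX3 := hX.cube 3 E.three_ne_zero'
  obtain ⟨d, hd, hd1, hd2⟩ := E.exists_coeff (f := ty π) hT hX hγ h1 E.Ly (fun r => rfl)
    (fun σ k _ _ hy j => hy j) (fun a => by
      rw [map_mul, E.apply_iota hX, E.seq.y_iota]
      obtain ⟨m, hm⟩ : ∃ m, (p - 1) / 3 = 3 * m := ⟨(p - 1) / 9, by omega⟩
      rw [hm, pow_mul, rho_pow_three, one_pow, one_mul])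
    (fun V a _ => mul_mem (E.tx_mem V a) (E.ty_mem V a))
  have hc := E.conj_coeff_y hX hT h1 hγ hγT hd1
  obtain ⟨a, ha⟩ := exists_int_of_conj_eq_neg (z := d * X 3 ^ 2)
    (mul_mem hd (pow_mem (hX.mem_O3 3) 2)) (by
      rw [_root_.map_mul, _root_.map_pow, hc, conj_of_cube hX3]
      linear_combination (-X 3 ^ 2 * d) * hX3)
  refine ⟨a, ?_⟩
  rw [hd1, mul_assoc (X 3), ← ha]
  linear_combination (-3 * d * (γ⁻¹ * ∏ s ∈ T, tx π s) ^ 2) * hX3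

end EisPrime

end FermatCurve

namespace FermatCurve

namespace EisPrime

variable {p : ℕ} [Fact p.Prime] {π : ℂ} {ι : ℤ} (E : EisPrime p π ι)
include E

/-- The elliptic Gauss sum as a sum over `ℤ/p`. -/
lemma EGS3_eq {χ f : ℂ → ℂ} {X : MulChar (ZMod p) ℂ} (hX : ∀ r : ℤ, χ r = X r)
    {g : ZMod p → ℂ} (hf : ∀ r : ℤ, (r : ℂ) / π ∉ O3 → f (r / π) = g r) :
    EGS3 p χ f π = 1 / 3 * ∑ a, X a * g a := by
  rw [EGS3, ← sum_Icc_eq (f := fun a => X a * g a) (by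
    rw [MulChar.map_zero, zero_mul])]
  congr 1
  refine Finset.sum_congr rfl fun r hr => ?_
  have h1 := hX r
  have h2 := hf r (by
    rw [E.div_mem_iff, Int.cast_natCast, ZMod.natCast_eq_zero_iff]
    intro h
    have hp := (Fact.out : p.Prime).two_le
    rw [Finset.mem_Icc] at hr
    have := Nat.le_of_dvd (by omega) h
    omega)
  rw [Int.cast_natCast, Int.cast_natCast] at h1 h2
  rw [h1, h2]

end EisPrime

end FermatCurve

/-- **Theorem I.4.** Let `π ∈ ℤ[ρ]` be a primary prime with `p = π·π̄`. Then there
exists a rational integer `a_π` such that the coefficient `α_π = π̃⁻²·G_π(χ_π, f)`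
of the elliptic Gauss sum satisfies: `α_π = χ_π(3)·a_π` with `a_π ≡ 1 (mod 3)` if
`p ≡ 7 (mod 18)`; `α_π = χ̄_π(3)·a_π` with `a_π ≡ −1 (mod 3)` if `p ≡ 13 (mod 18)`;
and `α_π = χ_π(3)·a_π·√−3` if `p ≡ 1 (mod 18)`. -/
theorem stmt_3
    (p : ℕ) (hp : p.Prime) (hp3 : p % 3 = 1)
    (π : ℂ) (hπ : π ∈ O3) (hprimary : ECong π 1 3)
    (hnorm : (p : ℂ) = π * (starRingEnd ℂ) π)
    (χ : ℂ → ℂ) (hχ : IsCubicChar π p χ)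
    (S : Finset ℂ) (hS : IsThirdSet π S)
    (γ : ℂ) (hγ : IsGamma3 π S γ)
    (πt : ℂ) (hπt : πt = γ⁻¹ * ∏ ν ∈ S, phi3 (ν / π))
    (α₇ α₁₃ α₁ : ℂ)
    (hα₇ : α₇ = (πt ^ 2)⁻¹ * EGS3 p χ phi3 π)
    (hα₁₃ : α₁₃ = (πt ^ 2)⁻¹ * EGS3 p χ (fun u => (phi3 u)⁻¹) π)
    (hα₁ : α₁ = (πt ^ 2)⁻¹ * EGS3 p χ psi3 π) :
    (p % 18 = 7 → ∃ a : ℤ, α₇ = χ 3 * (a : ℂ) ∧ (3 : ℤ) ∣ (a - 1)) ∧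
    (p % 18 = 13 → ∃ a : ℤ, α₁₃ = (starRingEnd ℂ) (χ 3) * (a : ℂ) ∧ (3 : ℤ) ∣ (a + 1)) ∧
    (p % 18 = 1 → ∃ a : ℤ, α₁ = χ 3 * (a : ℂ) * sqrtm3) := by
  have := Fact.mk hp
  obtain ⟨ι, E⟩ := FermatCurve.exists_eisPrime hp hp3 hπ hnorm
  obtain ⟨X, hχX, hX1, hX2⟩ := E.exists_mulChar hχ
  have hX : E.IsCubic X := ⟨hX1, hX2⟩
  obtain ⟨T, hT, hprod, hred⟩ := E.exists_thirdSet hS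
  obtain ⟨hγ1, hγ2⟩ := hγ
  have hSO : ∏ ν ∈ S, ν ∈ O3 := prod_mem fun ν hν => (hS.1 ν hν).1
  have hγT : E.red γ = -∏ s ∈ T, s := by
    rw [← hred, ← E.red_neg hSO]
    exact (E.cong_iff_red (FermatCurve.mem_O3_of_cube hγ1) (neg_mem hSO)).1 hγ2
  have hχ3 : χ 3 = X 3 := by exact_mod_cast hχX 3
  rw [hprod] at hπt
  have hπt0 : πt ≠ 0 := fun h => E.ne_zero (by
    rw [← E.cube_root_cube hT hγ1 hprimary, ← hπt, h, zero_pow three_ne_zero])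
  rw [hα₇, hα₁₃, hα₁, hχ3,
    E.EGS3_eq hχX (g := FermatCurve.tx π) fun r _ => by rw [FermatCurve.phi3_eq, E.tx_int],
    E.EGS3_eq hχX (g := fun a => (FermatCurve.tx π a)⁻¹) fun r _ => by
      rw [FermatCurve.phi3_eq, E.tx_int],
    E.EGS3_eq hχX (g := fun a => -FermatCurve.ty π a) fun r hr => by
      rw [FermatCurve.psi3_eq hr, E.ty_int]]
  refine ⟨fun h => ?_, fun h => ?_, fun h => ?_⟩
  · obtain ⟨a, ha, ha3⟩ := E.exists_coeff_x hX hT hprimary hγ1 hγT h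
    refine ⟨a, ?_, ha3⟩
    rw [ha, ← hπt]
    field_simp
  · obtain ⟨a, ha, ha3⟩ := E.exists_coeff_inv hX hT hprimary hγ1 hγT h
    refine ⟨a, ?_, ha3⟩
    rw [ha, ← hπt]
    field_simp
  · obtain ⟨a, ha⟩ := E.exists_coeff_y hX hT hprimary hγ1 hγT h
    refine ⟨-a, ?_⟩
    rw [← hπt] at ha
    simp only [mul_neg, Finset.sum_neg_distrib]
    rw [ha]
    push_cast
    field_simp

end
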